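/- Let u be a very weak solution with integrability deficit δ. There exist constants c = c(data), δ₂ = δ₂(data) ∈ (δ₁,1) with 2 − q(1−δ₂) > 0, and θ₀ = θ₀(data) ∈ (0,δ₂) such that whenever G^π_{16ρ}(z₀) ⊂ Ω_T satisfies the (p,q)-intrinsic hypotheses and δ ∈ (δ₂,1): (i) Π^δ ≤ c (⨍_{G^π_{2ρ}(z₀)} H(z,|∇u|)^{θ₀} dz)^{δ/θ₀} + c ⨍_{G^π_{2ρ}(z₀)} H(z,|F|)^δ dz; and (ii) ∬_{G^π_{16ρ}(z₀)} H(z,|∇u|)^δ dz ≤ c Π^{δ−θ₀} ∬_{G^π_{2ρ}(z₀) ∩ Ψ(c^{−1}Π)} H(z,|∇u|)^{θ₀} dz + c ∬_{G^π_{2ρ}(z₀) ∩ Φ(c^{−1}Π)} H(z,|F|)^δ dz, where Ψ(Λ) = {z ∈ Ω_T : H(z,|∇u(z)|) > Λ} and Φ(Λ) = {z ∈ Ω_T : H(z,|F(z)|) > Λ}. -/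

import Mathlib

open MeasureTheory Set Metric Filter
open scoped ENNReal NNReal Topology BigOperators Classical

noncomputable section

namespace DoublePhase

/-- Spatial points: ℝⁿ. -/
abbrev Spc (n : ℕ) : Type := EuclideanSpace ℝ (Fin n)
/-- Space-time points `z = (x,t)`. -/
abbrev Pt (n : ℕ) : Type := Spc n × ℝ
/-- Values in ℝᴺ. -/
abbrev Vec (N : ℕ) : Type := Fin N → ℝ
/-- Matrices in ℝ^{N×n}. -/
abbrev Mat (N n : ℕ) : Type := Fin N → Fin n → ℝ

/-- Euclidean inner product on ℝᴺ. -/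
def vdot {N : ℕ} (v w : Vec N) : ℝ := ∑ i, v i * w i
/-- Euclidean norm on ℝᴺ. -/
def vnorm {N : ℕ} (v : Vec N) : ℝ := Real.sqrt (vdot v v)
/-- Euclidean inner product on ℝ^{N×n}. -/
def mdot {N n : ℕ} (A B : Mat N n) : ℝ := ∑ i, ∑ j, A i j * B i j
/-- Euclidean norm on ℝ^{N×n}. -/
def mnorm {N n : ℕ} (A : Mat N n) : ℝ := Real.sqrt (mdot A A)

/-- Parabolic cylinder `Q_{r,s}(z₀) = B_r(x₀) × (t₀−s, t₀+s)`. -/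
def Qrs {n : ℕ} (z₀ : Pt n) (r s : ℝ) : Set (Pt n) :=
  (Metric.ball z₀.1 r) ×ˢ (Set.Ioo (z₀.2 - s) (z₀.2 + s))

/-- Standard parabolic cylinder `Q_ρ(z₀) = B_ρ(x₀) × (t₀−ρ², t₀+ρ²)`. -/
def Qc {n : ℕ} (z₀ : Pt n) (ρ : ℝ) : Set (Pt n) := Qrs z₀ ρ (ρ ^ 2)

/-- The double-phase function `H(z,s) = s^p + a(z) s^q`. -/
def Hf {n : ℕ} (a : Pt n → ℝ) (p q : ℝ) (z : Pt n) (s : ℝ) : ℝ := s ^ p + a z * s ^ q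

/-- `p`-intrinsic cylinder `Q_ρ^λ(z₀) = B_ρ(x₀) × (t₀−λ^{2−p}ρ², t₀+λ^{2−p}ρ²)`. -/
def Qp {n : ℕ} (p : ℝ) (z₀ : Pt n) (lam ρ : ℝ) : Set (Pt n) :=
  Qrs z₀ ρ (lam ^ (2 - p) * ρ ^ 2)

/-- `(p,q)`-intrinsic cylinder `G_ρ^λ(z₀)`. -/
def Gpq {n : ℕ} (a : Pt n → ℝ) (p q : ℝ) (z₀ : Pt n) (lam ρ : ℝ) : Set (Pt n) :=
  Qrs z₀ ρ (lam ^ 2 / Hf a p q z₀ lam * ρ ^ 2)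

/-- The space-time domain `Ω_T = Ω × (0,T)`. -/
def cyl {n : ℕ} (Ω : Set (Spc n)) (T : ℝ) : Set (Pt n) := Ω ×ˢ Set.Ioo 0 T

/-- Spatial partial derivative `∂_{x_j} ψ` of a scalar test function. -/
def dxj {n : ℕ} (ψ : Pt n → ℝ) (j : Fin n) (z : Pt n) : ℝ :=
  fderiv ℝ ψ z (EuclideanSpace.single j 1, 0)

/-- Time derivative `∂_t φ` of a vector-valued test function. -/
def dtd {n N : ℕ} (φ : Pt n → Vec N) (z : Pt n) : Vec N :=
  fderiv ℝ φ z ((0 : Spc n), (1 : ℝ))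

/-- Spatial gradient `∇φ` of a vector-valued test function, as a matrix. -/
def gradm {n N : ℕ} (φ : Pt n → Vec N) (z : Pt n) : Mat N n :=
  fun i j => fderiv ℝ (fun w => φ w i) z (EuclideanSpace.single j 1, 0)

/-- The structural setting of the parabolic double-phase problem:
`data = (n, N, p, q, α, L₁, L₂, [a]_α)` together with the bounded domain `Ω`,
time `T`, the coefficient `a`, the vector field `𝒜` and the source `F`. -/
structure Setting (n N : ℕ) (p q α L₁ L₂ aH : ℝ) where
  Ω : Set (Spc n)
  T : ℝ
  a : Pt n → ℝ
  A : Pt n → Mat N n → Mat N n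
  F : Pt n → Mat N n
  hn : 2 ≤ n
  hN : 1 ≤ N
  hΩo : IsOpen Ω
  hΩb : Bornology.IsBounded Ω
  hΩne : Ω.Nonempty
  hT : 0 < T
  hα : α ∈ Set.Ioc (0 : ℝ) 1
  hp2 : 2 < p
  hpq : p < q
  hqub : q < p + 2 * α / ((n : ℝ) + 2)
  hL₁ : 0 < L₁
  hL₁₂ : L₁ ≤ L₂
  haH : 0 < aH
  ha0 : ∀ z, 0 ≤ a z
  haM : Measurable a
  haB : BddAbove (Set.range a)
  haHol : ∀ x ∈ Ω, ∀ y ∈ Ω, ∀ t ∈ Set.Ioo (0 : ℝ) T, ∀ s ∈ Set.Ioo (0 : ℝ) T,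
    |a (x, t) - a (y, s)| ≤ aH * max (‖x - y‖ ^ α) (|t - s| ^ (α / 2))
  hAM : Measurable (Function.uncurry A)
  hAcoer : ∀ᵐ z ∂(volume.restrict (cyl Ω T)), ∀ ξ : Mat N n,
    L₁ * (mnorm ξ ^ p + a z * mnorm ξ ^ q) ≤ mdot (A z ξ) ξ
  hAgrow : ∀ᵐ z ∂(volume.restrict (cyl Ω T)), ∀ ξ : Mat N n,
    mnorm (A z ξ) ≤ L₂ * (mnorm ξ ^ (p - 1) + a z * mnorm ξ ^ (q - 1))
  hFM : Measurable F
  hFint : IntegrableOn (fun z => Hf a p q z (mnorm (F z))) (cyl Ω T)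

variable {n N : ℕ} {p q α L₁ L₂ aH : ℝ}

/-- The right-hand side field `|F|^{p−2}F + a|F|^{q−2}F`. -/
def rhsF (S : Setting n N p q α L₁ L₂ aH) (z : Pt n) : Mat N n :=
  fun i j => mnorm (S.F z) ^ (p - 2) * S.F z i j + S.a z * mnorm (S.F z) ^ (q - 2) * S.F z i j

/-- Very weak solution with integrability deficit `δ`: `u ∈ L¹(0,T;W^{1,1})` with
weak spatial gradient `Du`, `H(·,|Du|)^δ` integrable, satisfying the weak formulation. -/
structure VeryWeakSolution (S : Setting n N p q α L₁ L₂ aH)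
    (u : Pt n → Vec N) (Du : Pt n → Mat N n) (δ : ℝ) : Prop where
  hδ : δ ∈ Set.Ioo (0 : ℝ) 1
  huM : Measurable u
  hDuM : Measurable Du
  huL1 : IntegrableOn (fun z => vnorm (u z)) (cyl S.Ω S.T)
  hDuL1 : IntegrableOn (fun z => mnorm (Du z)) (cyl S.Ω S.T)
  hgrad : ∀ (i : Fin N) (j : Fin n) (ψ : Pt n → ℝ),
    ContDiff ℝ (⊤ : ℕ∞) ψ → HasCompactSupport ψ → tsupport ψ ⊆ cyl S.Ω S.T →
    ∫ z in cyl S.Ω S.T, u z i * dxj ψ j z = - ∫ z in cyl S.Ω S.T, Du z i j * ψ z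
  henergy : IntegrableOn (fun z => Hf S.a p q z (mnorm (Du z)) ^ δ) (cyl S.Ω S.T)
  hweak : ∀ φ : Pt n → Vec N,
    ContDiff ℝ (⊤ : ℕ∞) φ → HasCompactSupport φ → tsupport φ ⊆ cyl S.Ω S.T →
    ∫ z in cyl S.Ω S.T, (-(vdot (u z) (dtd φ z)) + mdot (S.A z (Du z)) (gradm φ z))
      = ∫ z in cyl S.Ω S.T, mdot (rhsF S z) (gradm φ z)

/-- `H(z,|∇u|)`. -/
def HDu (S : Setting n N p q α L₁ L₂ aH) (Du : Pt n → Mat N n) (z : Pt n) : ℝ :=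
  Hf S.a p q z (mnorm (Du z))

/-- `H(z,|F|)`. -/
def HFf (S : Setting n N p q α L₁ L₂ aH) (z : Pt n) : ℝ :=
  Hf S.a p q z (mnorm (S.F z))

/-- Componentwise integral average `(u)_E` of a vector-valued function. -/
def vavg {n N : ℕ} (u : Pt n → Vec N) (E : Set (Pt n)) : Vec N := fun i => ⨍ z in E, u z i

/-- The `p`-intrinsic hypotheses \eqref{eq_pcase}-\eqref{eq_rho_decay}. -/
structure PHyp (S : Setting n N p q α L₁ L₂ aH) (Du : Pt n → Mat N n)
    (z₀ : Pt n) (π ρ δ : ℝ) : Prop where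
  hz₀ : z₀ ∈ cyl S.Ω S.T
  hπ : 1 < π
  hρ : ρ ∈ Set.Ioo (0 : ℝ) 1
  hcase : S.a z₀ * π ^ q ≤ π ^ p
  hsub : Qp p z₀ π (16 * ρ) ⊆ cyl S.Ω S.T
  hlow : π ^ (δ * p) ≤ ⨍ z in Qp p z₀ π ρ, (HDu S Du z + HFf S z) ^ δ
  hup : (⨍ z in Qp p z₀ π (16 * ρ), (HDu S Du z + HFf S z) ^ δ) ≤ π ^ (δ * p)
  hdecay : ρ ^ α ≤ π ^ (p - q)

/-- The `(p,q)`-intrinsic hypotheses \eqref{eq_pqcase}-\eqref{eq_pq4}. -/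
structure PQHyp (S : Setting n N p q α L₁ L₂ aH) (Du : Pt n → Mat N n)
    (z₀ : Pt n) (π ρ δ : ℝ) : Prop where
  hz₀ : z₀ ∈ cyl S.Ω S.T
  hπ : 1 < π
  hρ : ρ ∈ Set.Ioo (0 : ℝ) 1
  hcase : π ^ p < S.a z₀ * π ^ q
  hsub : Gpq S.a p q z₀ π (16 * ρ) ⊆ cyl S.Ω S.T
  hcomp : ∀ z ∈ Qc z₀ (10 * ρ), S.a z₀ / 2 ≤ S.a z ∧ S.a z ≤ 2 * S.a z₀
  hlow : Hf S.a p q z₀ π ^ δ ≤ ⨍ z in Gpq S.a p q z₀ π ρ, (HDu S Du z + HFf S z) ^ δ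
  hup : (⨍ z in Gpq S.a p q z₀ π (16 * ρ), (HDu S Du z + HFf S z) ^ δ) ≤ Hf S.a p q z₀ π ^ δ

/-- Strong maximal function over parabolic cylinders. -/
def strongMax {n : ℕ} (f : Pt n → ℝ) (z : Pt n) : ℝ :=
  sSup {m : ℝ | ∃ (w : Pt n) (r s : ℝ), 0 < r ∧ 0 < s ∧ z ∈ Qrs w r s ∧
    m = ⨍ y in Qrs w r s, |f y|}

/-- The function `g = (|∇u| + |u−u₀|/ρ + |F|) χ_{𝒬₂}`. -/
def gW (S : Setting n N p q α L₁ L₂ aH) (u : Pt n → Vec N) (Du : Pt n → Mat N n)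
    (Q2 : Set (Pt n)) (ρ : ℝ) (z : Pt n) : ℝ :=
  Q2.indicator (fun w => mnorm (Du w) + vnorm (u w - vavg u Q2) / ρ + mnorm (S.F w)) z

/-- Hölder extension of `a` to all of ℝ^{n+1}. -/
def aExt (S : Setting n N p q α L₁ L₂ aH) (Q2 : Set (Pt n)) (z : Pt n) : ℝ :=
  sInf {v : ℝ | ∃ w ∈ cyl S.Ω S.T,
    v = Q2.indicator S.a w + aH * (‖z.1 - w.1‖ ^ α + |z.2 - w.2| ^ (α / 2))}

/-- Hölder extension of `a` truncated between `inf_{𝒬₂} a` and `sup_{𝒬₂} a`. -/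
def aStar (S : Setting n N p q α L₁ L₂ aH) (Q2 : Set (Pt n)) (z : Pt n) : ℝ :=
  max (min (aExt S Q2 z) (sSup (S.a '' Q2))) (sInf (S.a '' Q2))

/-- The maximal weight `Υ(z) = (M(g^{q−1} + (a g^q)^{(q−1)/p})(z))^{p/(q−1)}`. -/
def Ups (S : Setting n N p q α L₁ L₂ aH) (u : Pt n → Vec N) (Du : Pt n → Mat N n)
    (Q2 : Set (Pt n)) (ρ : ℝ) (z : Pt n) : ℝ :=
  strongMax (fun w => gW S u Du Q2 ρ w ^ (q - 1)
      + (aStar S Q2 w * gW S u Du Q2 ρ w ^ q) ^ ((q - 1) / p)) z ^ (p / (q - 1))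

/-- `Υ̂(z) = max{Υ(z), θΠ}`. -/
def UpsHat (S : Setting n N p q α L₁ L₂ aH) (u : Pt n → Vec N) (Du : Pt n → Mat N n)
    (Q2 : Set (Pt n)) (ρ θ Pi' : ℝ) (z : Pt n) : ℝ :=
  max (Ups S u Du Q2 ρ z) (θ * Pi')

/-- `‖a‖_{L^∞(Ω_T)}`. -/
def supA (S : Setting n N p q α L₁ L₂ aH) : ℝ := sSup (S.a '' cyl S.Ω S.T)

/-- The constant `K = ((1+‖a‖_∞)/|B₁| ∬ Υ^μ)^{α/(n+2)}`. -/
def Kconst (S : Setting n N p q α L₁ L₂ aH) (u : Pt n → Vec N) (Du : Pt n → Mat N n)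
    (Q2 : Set (Pt n)) (ρ μ : ℝ) : ℝ :=
  (((1 + supA S) / (volume (Metric.ball (0 : Spc n) 1)).toReal)
      * ∫ z, Ups S u Du Q2 ρ z ^ μ) ^ (α / ((n : ℝ) + 2))

/-- Conditions \eqref{def_mu}-\eqref{def_mu_2} on `μ`. -/
def muCond (n : ℕ) (p q α μ : ℝ) : Prop :=
  max (1 - 2 / q + ((n : ℝ) + 2) * (q - p) / (q * α)) ((q - 1) / p) < μ ∧ μ < 1 ∧
    (1 / μ - 1) * (2 * (n : ℝ)) / (((n : ℝ) + 2) * q) + (n : ℝ) / ((n : ℝ) + 2) ≤ p / q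

/-- Condition \eqref{def_mfs} on `γ`. -/
def gammaCond (n : ℕ) (p q α μ γ : ℝ) : Prop :=
  0 < γ ∧ γ < 1 ∧ -(2 * α) / ((n : ℝ) + 2) + α * q * (1 - μ) / ((n : ℝ) + 2) < p - q - γ

/-- Condition \eqref{def_mfc} on the structural constant `c₀`. -/
def c0Cond (S : Setting n N p q α L₁ L₂ aH) (u : Pt n → Vec N) (Du : Pt n → Mat N n)
    (Q2 : Set (Pt n)) (ρ θ μ γ c₀ : ℝ) : Prop :=
  1 < c₀ ∧
    Kconst S u Du Q2 ρ μ * (θ * c₀ / (2 * (1 + supA S))) ^ (-(γ / p))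
      ≤ 1 / (800 * (1 + aH))

/-- The cylinder `𝒬` of \eqref{def_Qi}: `p`-intrinsic or `(p,q)`-intrinsic by phase. -/
def QorG (S : Setting n N p q α L₁ L₂ aH) (z₀ : Pt n) (π r : ℝ) : Set (Pt n) :=
  if S.a z₀ * π ^ q ≤ π ^ p then Qp p z₀ π r else Gpq S.a p q z₀ π r

/-- Half-length `σ` of the time interval of `𝒬`. -/
def sigmaOf (S : Setting n N p q α L₁ L₂ aH) (z₀ : Pt n) (π r : ℝ) : ℝ :=
  if S.a z₀ * π ^ q ≤ π ^ p then π ^ (2 - p) * r ^ 2 else π ^ 2 / Hf S.a p q z₀ π * r ^ 2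

/-- `Π_{z₀}` of \eqref{def_Pizo}. -/
def PiZ (S : Setting n N p q α L₁ L₂ aH) (z₀ : Pt n) (π : ℝ) : ℝ :=
  if S.a z₀ * π ^ q ≤ π ^ p then Hf S.a p q z₀ π else π ^ p

/-- Upper level set `Ψ(Λ)` of `H(z,|∇u|)`. -/
def PsiSet (S : Setting n N p q α L₁ L₂ aH) (Du : Pt n → Mat N n) (Λ : ℝ) : Set (Pt n) :=
  {z ∈ cyl S.Ω S.T | Λ < HDu S Du z}

/-- Upper level set `Φ(Λ)` of `H(z,|F|)`. -/
def PhiSet (S : Setting n N p q α L₁ L₂ aH) (Λ : ℝ) : Set (Pt n) :=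
  {z ∈ cyl S.Ω S.T | Λ < HFf S z}

/-- `Π > c₀` for the structural constant `c₀` of the paper. -/
def PiBig (S : Setting n N p q α L₁ L₂ aH) (u : Pt n → Vec N) (Du : Pt n → Mat N n)
    (z₀ : Pt n) (π ρ : ℝ) : Prop :=
  ∃ θ μ γ c₀ : ℝ, θ ∈ Set.Ioo (0 : ℝ) 1 ∧ muCond n p q α μ ∧ gammaCond n p q α μ γ ∧
    c0Cond S u Du (QorG S z₀ π (4 * ρ)) ρ θ μ γ c₀ ∧ c₀ < Hf S.a p q z₀ π

/-- `u ∈ C(0,T; L²(Ω,ℝᴺ))`. -/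
def ContL2 (S : Setting n N p q α L₁ L₂ aH) (u : Pt n → Vec N) : Prop :=
  (∀ t ∈ Set.Ioo (0 : ℝ) S.T, IntegrableOn (fun x => vnorm (u (x, t)) ^ 2) S.Ω) ∧
  ∀ t₁ ∈ Set.Ioo (0 : ℝ) S.T, ∀ ε > (0 : ℝ), ∃ η > (0 : ℝ), ∀ t₂ ∈ Set.Ioo (0 : ℝ) S.T,
    |t₂ - t₁| < η → ∫ x in S.Ω, vnorm (u (x, t₂) - u (x, t₁)) ^ 2 < ε

/-- The Vitali covering cylinder `U(w)`: `Q^{π_w}_{2ρ_w}(w)` or `G^{π_w}_{2ρ_w}(w)` by phase. -/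
def Uw (S : Setting n N p q α L₁ L₂ aH) (w : Pt n) (πw ρw : ℝ) : Set (Pt n) :=
  if S.a w * πw ^ q ≤ πw ^ p then Qp p w πw (2 * ρw) else Gpq S.a p q w πw (2 * ρw)

end DoublePhase

open DoublePhase

open ENNReal (ofReal)

namespace RH
variable {n : ℕ}

def pd (z w : Pt n) : ℝ := max ‖z.1 - w.1‖ (√|z.2 - w.2|)

lemma pd_nonneg (z w : Pt n) : 0 ≤ pd z w := le_max_of_le_left (norm_nonneg _)
lemma pd_self (z : Pt n) : pd z z = 0 := by simp [pd]
lemma pd_comm (z w : Pt n) : pd z w = pd w z := by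
  simp only [pd, norm_sub_rev z.1 w.1, abs_sub_comm z.2 w.2]
lemma pd_tri (z w y : Pt n) : pd z y ≤ pd z w + pd w y := by
  apply max_le
  · calc ‖z.1 - y.1‖ ≤ ‖z.1 - w.1‖ + ‖w.1 - y.1‖ := norm_sub_le_norm_sub_add_norm_sub _ _ _
      _ ≤ _ := add_le_add (le_max_left _ _) (le_max_left _ _)
  · have h1 : √|z.2 - w.2| ≤ pd z w := le_max_right _ _
    have h2 : √|w.2 - y.2| ≤ pd w y := le_max_right _ _
    apply Real.sqrt_le_iff.2
    refine ⟨add_nonneg (pd_nonneg _ _) (pd_nonneg _ _), ?_⟩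
    have e1 := Real.sq_sqrt (abs_nonneg (z.2 - w.2))
    have e2 := Real.sq_sqrt (abs_nonneg (w.2 - y.2))
    have := abs_sub_le z.2 w.2 y.2
    have p1 := Real.sqrt_nonneg |z.2 - w.2|
    have p2 := Real.sqrt_nonneg |w.2 - y.2|
    nlinarith [mul_nonneg p1 p2, mul_nonneg (pd_nonneg z w) (pd_nonneg w y), mul_self_le_mul_self p1 h1, mul_self_le_mul_self p2 h2]

lemma mem_Qc {z w : Pt n} {r : ℝ} : z ∈ Qc w r ↔ ‖z.1 - w.1‖ < r ∧ |z.2 - w.2| < r ^ 2 := by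
  simp only [Qc, Qrs, mem_prod, mem_ball, dist_eq_norm, mem_Ioo, abs_lt]
  constructor
  · rintro ⟨h, h1, h2⟩; exact ⟨h, by linarith, by linarith⟩
  · rintro ⟨h, h1, h2⟩; exact ⟨h, by linarith, by linarith⟩

lemma mem_Qc₉ {z w : Pt n} {r : ℝ} (hr : 0 < r) : z ∈ Qc w r ↔ pd z w < r := by
  rw [mem_Qc, pd, max_lt_iff, Real.sqrt_lt' hr]

lemma Qc_mono {w y : Pt n} {r s : ℝ} (hr : 0 < r) (h : pd w y + r ≤ s) : Qc w r ⊆ Qc y s := by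
  intro z hz
  rw [mem_Qc₉ hr] at hz
  rw [mem_Qc₉ (by linarith [pd_nonneg w y])]
  linarith [pd_tri z w y]

lemma isOpen_Qc (w : Pt n) (r : ℝ) : IsOpen (Qc w r) := isOpen_ball.prod isOpen_Ioo
lemma meas_Qc (w : Pt n) (r : ℝ) : MeasurableSet (Qc w r) := (isOpen_Qc w r).measurableSet

def Vn (n : ℕ) : ℝ := (volume (ball (0 : Spc n) 1)).toReal * 2

lemma Vn_pos (n : ℕ) : 0 < Vn n := by
  unfold Vn
  have : 0 < (volume (ball (0 : Spc n) 1)).toReal :=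
    ENNReal.toReal_pos (measure_ball_pos _ _ one_pos).ne' measure_ball_lt_top.ne
  positivity

lemma vol_Qrs (w : Pt n) {r s : ℝ} (hr : 0 < r) :
    volume (Qrs w r s) = ofReal (r ^ n * s * Vn n) := by
  rw [Qrs, Measure.volume_eq_prod, Measure.prod_prod, Measure.addHaar_ball_of_pos _ _ hr, Real.volume_Ioo]
  rw [show w.2 + s - (w.2 - s) = 2 * s by ring, finrank_euclideanSpace_fin, Vn]
  rw [← ENNReal.ofReal_toReal (measure_ball_lt_top (μ := volume) (x := (0 : Spc n)) (r := 1)).ne,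
    ← ENNReal.ofReal_mul (by positivity), ← ENNReal.ofReal_mul (by positivity),
    ENNReal.toReal_ofReal (by positivity)]
  congr 1; ring

lemma vol_Qc (w : Pt n) {r : ℝ} (hr : 0 < r) :
    volume (Qc w r) = ofReal (r ^ (n + 2) * Vn n) := by
  rw [Qc, vol_Qrs w hr]; congr 1; ring

lemma vitali (t : Set (Pt n × ℝ)) (R : ℝ) (ht : ∀ a ∈ t, 0 < a.2 ∧ a.2 ≤ R) :
    ∃ u ⊆ t, u.Countable ∧ u.PairwiseDisjoint (fun a ↦ Qc a.1 a.2) ∧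
      (⋃ a ∈ t, Qc a.1 a.2) ⊆ ⋃ b ∈ u, Qc b.1 (5 * b.2) := by
  have hself : ∀ a ∈ t, a.1 ∈ Qc a.1 a.2 := fun a ha ↦ by
    rw [mem_Qc₉ (ht a ha).1, pd_self]; exact (ht a ha).1
  obtain ⟨u, hut, hd, hc⟩ := Vitali.exists_disjoint_subfamily_covering_enlargement
    (fun a : Pt n × ℝ ↦ Qc a.1 a.2) t (fun a ↦ a.2) 2 one_lt_two (fun a ha ↦ (ht a ha).1.le) R
    (fun a ha ↦ (ht a ha).2) (fun a ha ↦ ⟨a.1, hself a ha⟩)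
  refine ⟨u, hut, hd.countable_of_isOpen (fun a _ ↦ isOpen_Qc _ _)
    (fun a ha ↦ ⟨a.1, hself a (hut ha)⟩), hd, ?_⟩
  intro z hz
  simp only [mem_iUnion, exists_prop] at hz ⊢
  obtain ⟨a, ha, hza⟩ := hz
  obtain ⟨b, hb, ⟨y, hya, hyb⟩, hab⟩ := hc a ha
  refine ⟨b, hb, ?_⟩
  have pa := (ht a ha).1
  have pb := (ht b (hut hb)).1
  rw [mem_Qc₉ pa] at hza hya
  rw [mem_Qc₉ pb] at hyb
  rw [mem_Qc₉ (by positivity)]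
  have := pd_tri z a.1 b.1
  have := pd_tri a.1 y b.1
  rw [pd_comm a.1 y] at this
  linarith

def Ob (g : Pt n → ℝ≥0∞) : Set (Pt n) :=
  ⋃ a ∈ {a : Pt n × ℝ | 0 < a.2 ∧ volume (Qc a.1 a.2) < ∫⁻ z in Qc a.1 a.2, g z}, Qc a.1 a.2

lemma isOpen_Ob (g : Pt n → ℝ≥0∞) : IsOpen (Ob g) :=
  isOpen_biUnion fun _ _ ↦ isOpen_Qc _ _

lemma not_Ob {g : Pt n → ℝ≥0∞} {z y : Pt n} (hz : z ∉ Ob g) {r : ℝ} (hr : 0 < r)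
    (hy : z ∈ Qc y r) : ∫⁻ z in Qc y r, g z ≤ volume (Qc y r) := by
  by_contra! h
  apply hz
  simp only [Ob, mem_iUnion, exists_prop]
  exact ⟨(y, r), ⟨hr, h⟩, hy⟩

lemma radius_bdd {M : ℝ≥0∞} (hM : M ≠ ∞) : ∃ R : ℝ, ∀ (a : Pt n) (r : ℝ), 0 < r →
    volume (Qc a r) ≤ M → r ≤ R := by
  refine ⟨max 1 (M.toReal / Vn n), fun a r hr h ↦ ?_⟩
  by_cases h1 : r ≤ 1
  · exact le_max_of_le_left h1
  · push Not at h1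
    apply le_max_of_le_right
    rw [vol_Qc a hr, ENNReal.ofReal_le_iff_le_toReal hM] at h
    rw [le_div_iff₀ (Vn_pos n)]
    refine le_trans (mul_le_mul_of_nonneg_right ?_ (Vn_pos n).le) h
    exact le_self_pow₀ h1.le (by omega)

lemma weak_type (g : Pt n → ℝ≥0∞) (hg : Measurable g) (hgi : ∫⁻ z, g z ≠ ∞) :
    volume (Ob g) ≤ ofReal (2 * 5 ^ (n + 2)) * ∫⁻ z in {z | 1 / 2 < g z}, g z := by
  set t := {a : Pt n × ℝ | 0 < a.2 ∧ volume (Qc a.1 a.2) < ∫⁻ z in Qc a.1 a.2, g z}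
  obtain ⟨R, hR⟩ := radius_bdd (n := n) hgi
  obtain ⟨u, hut, huc, hud, hcov⟩ := vitali t R fun a ha ↦
    ⟨ha.1, hR a.1 a.2 ha.1 (ha.2.le.trans (setLIntegral_le_lintegral _ _))⟩
  set A := {z | 1 / 2 < g z}
  have hA : MeasurableSet A := measurableSet_lt measurable_const hg
  have key : ∀ a ∈ t, volume (Qc a.1 a.2) ≤ 2 * ∫⁻ z in Qc a.1 a.2, A.indicator g z := by
    intro a ha
    have h1 : ∫⁻ z in Qc a.1 a.2, g z ≤ ∫⁻ z in Qc a.1 a.2, (A.indicator g z + 1 / 2) := by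
      apply lintegral_mono
      intro z
      by_cases hz : z ∈ A
      · simp [hz]
      · simp only [hz, not_false_eq_true, indicator_of_notMem, zero_add]
        simpa [A] using hz
    rw [lintegral_add_right _ measurable_const, lintegral_const, Measure.restrict_apply_univ] at h1
    have h2 := ha.2.le.trans h1
    have hf : volume (Qc a.1 a.2) ≠ ∞ := by rw [vol_Qc _ ha.1]; exact ENNReal.ofReal_ne_top
    generalize volume (Qc a.1 a.2) = v at *
    generalize (∫⁻ z in Qc a.1 a.2, A.indicator g z) = I at *
    by_cases hI : I = ∞
    · simp [hI]
    lift v to ℝ≥0 using hf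
    lift I to ℝ≥0 using hI
    have : (1 / 2 : ℝ≥0∞) = ((1 / 2 : ℝ≥0) : ℝ≥0∞) := by simp
    rw [this] at h2
    norm_cast at h2 ⊢
    have h3 : (v : ℝ) ≤ I + 1 / 2 * v := by exact_mod_cast h2
    have : (v : ℝ) ≤ 2 * I := by linarith
    exact_mod_cast this
  calc volume (Ob g) ≤ volume (⋃ b ∈ u, Qc b.1 (5 * b.2)) := measure_mono hcov
    _ ≤ ∑' b : u, volume (Qc b.1.1 (5 * b.1.2)) := measure_biUnion_le _ huc _
    _ ≤ ∑' b : u, ofReal (2 * 5 ^ (n + 2)) * ∫⁻ z in Qc b.1.1 b.1.2, A.indicator g z := by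
        apply ENNReal.tsum_le_tsum
        rintro ⟨b, hb⟩
        have hp := (hut hb).1
        have h1 := key b (hut hb)
        simp only
        have e : volume (Qc b.1 (5 * b.2)) = ofReal (5 ^ (n + 2)) * volume (Qc b.1 b.2) := by
          rw [vol_Qc _ (by positivity), vol_Qc _ hp, ← ENNReal.ofReal_mul (by positivity)]
          congr 1; ring
        rw [e, mul_comm (2 : ℝ), ENNReal.ofReal_mul (by positivity), mul_assoc]
        gcongr
        simpa using h1
    _ = ofReal (2 * 5 ^ (n + 2)) * ∑' b : u, ∫⁻ z in Qc b.1.1 b.1.2, A.indicator g z :=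
        ENNReal.tsum_mul_left
    _ = ofReal (2 * 5 ^ (n + 2)) * ∫⁻ z in ⋃ b ∈ u, Qc b.1 b.2, A.indicator g z := by
        rw [lintegral_biUnion huc (fun b _ ↦ meas_Qc _ _) hud]
    _ ≤ _ := by
        refine mul_le_mul_right ?_ _
        refine (setLIntegral_le_lintegral _ _).trans ?_
        rw [lintegral_indicator hA]

def dE (E : Set (Pt n)) (z : Pt n) : ℝ := ⨅ w : E, pd z w

lemma dE_bdd (E : Set (Pt n)) (z : Pt n) : BddBelow (range fun w : E ↦ pd z w) :=
  ⟨0, by rintro _ ⟨w, rfl⟩; exact pd_nonneg _ _⟩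

lemma dE_nonneg (E : Set (Pt n)) (z : Pt n) : 0 ≤ dE E z :=
  Real.iInf_nonneg fun _ ↦ pd_nonneg _ _

lemma dE_le {E : Set (Pt n)} {w : Pt n} (hw : w ∈ E) (z : Pt n) : dE E z ≤ pd z w :=
  ciInf_le (dE_bdd E z) ⟨w, hw⟩

lemma dE_lt {E : Set (Pt n)} (hE : E.Nonempty) {z : Pt n} {r : ℝ} (h : dE E z < r) :
    ∃ w ∈ E, pd z w < r := by
  haveI := hE.to_subtype
  obtain ⟨w, hw⟩ := exists_lt_of_ciInf_lt h
  exact ⟨w, w.2, hw⟩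

lemma dE_lip {E : Set (Pt n)} (hE : E.Nonempty) (z y : Pt n) : dE E z ≤ dE E y + pd z y := by
  apply le_of_forall_pos_le_add
  intro ε hε
  obtain ⟨w, hw, h⟩ := dE_lt hE (lt_add_of_pos_right (dE E y) hε)
  linarith [dE_le hw z, pd_tri z y w]

lemma dE_time {E : Set (Pt n)} (hE : E.Nonempty) (x : Spc n) (t s : ℝ) :
    dE E (x, t) ^ 2 ≤ dE E (x, s) ^ 2 + |t - s| := by
  apply le_of_forall_gt_imp_ge_of_dense
  intro a ha
  have h0 : 0 ≤ a - |t - s| := by nlinarith [sq_nonneg (dE E (x, s))]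
  have : dE E (x, s) < √(a - |t - s|) := Real.lt_sqrt_of_sq_lt (by linarith)
  obtain ⟨w, hw, h⟩ := dE_lt hE this
  have h1 := dE_le hw (x, t)
  have hp : pd (x, t) w ≤ √a := by
    rw [pd, max_lt_iff] at h
    apply max_le
    · exact h.1.le.trans (Real.sqrt_le_sqrt (by linarith [abs_nonneg (t - s)]))
    · apply Real.sqrt_le_sqrt
      have := (Real.sqrt_lt_sqrt_iff (abs_nonneg _)).1 h.2
      simp only at this ⊢
      linarith [abs_sub_le t s w.2]
  have := h1.trans hp
  have ha0 : 0 ≤ a := by linarith [abs_nonneg (t - s)]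
  calc dE E (x, t) ^ 2 ≤ √a ^ 2 := by gcongr; exact dE_nonneg _ _
    _ = a := Real.sq_sqrt ha0

lemma dE_zero {E : Set (Pt n)} {w : Pt n} (hw : w ∈ E) : dE E w = 0 :=
  le_antisymm ((dE_le hw w).trans (pd_self w).le) (dE_nonneg _ _)

lemma Qc_nhds (z : Pt n) {U : Set (Pt n)} (hU : U ∈ 𝓝 z) : ∃ r > 0, Qc z r ⊆ U := by
  obtain ⟨r, hr, h⟩ := Metric.mem_nhds_iff.1 hU
  refine ⟨min r 1, by positivity, fun y hy ↦ h ?_⟩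
  rw [mem_Qc] at hy
  have hm : (min r 1) ^ 2 ≤ min r 1 := by
    have : 0 < min r 1 := by positivity
    nlinarith [min_le_right r 1]
  rw [mem_ball, Prod.dist_eq, max_lt_iff, dist_eq_norm, Real.dist_eq]
  exact ⟨hy.1.trans_le (min_le_left _ _), (hy.2.trans_le hm).trans_le (min_le_left _ _)⟩

lemma dE_pos {E : Set (Pt n)} (hE : E.Nonempty) (hc : IsClosed E) {z : Pt n} (hz : z ∉ E) :
    0 < dE E z := by
  obtain ⟨r, hr, h⟩ := Qc_nhds z (hc.isOpen_compl.mem_nhds hz)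
  by_contra! hn
  obtain ⟨w, hw, h1⟩ := dE_lt hE (hn.trans_lt hr)
  rw [pd_comm, ← mem_Qc₉ hr] at h1
  exact h h1 hw

lemma Qc_dE {E : Set (Pt n)} (z : Pt n) {r : ℝ} (hr : 0 < r) (h : r ≤ dE E z) :
    Qc z r ⊆ Eᶜ := by
  intro y hy hyE
  rw [mem_Qc₉ hr, pd_comm] at hy
  linarith [dE_le hyE z]

lemma dE_bound {E : Set (Pt n)} (hE : E.Nonempty) (hc : IsClosed E) (hv : volume Eᶜ ≠ ∞) :
    ∃ R : ℝ, ∀ z, dE E z ≤ R := by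
  obtain ⟨R, hR⟩ := radius_bdd (n := n) hv
  refine ⟨max R 0, fun z ↦ ?_⟩
  by_cases hz : z ∈ E
  · rw [dE_zero hz]; exact le_max_right _ _
  · exact le_max_of_le_left (hR z _ (dE_pos hE hc hz)
      (measure_mono (Qc_dE z (dE_pos hE hc hz) le_rfl)))

lemma whit {E : Set (Pt n)} (hE : E.Nonempty) (hc : IsClosed E) (hv : volume Eᶜ ≠ ∞)
    (u : Pt n → ℝ≥0∞) (C : ℝ≥0∞)
    (hu : ∀ z ∉ E, ∫⁻ y in Qc z (dE E z / 2), u y ≤ C * volume (Qc z (dE E z))) :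
    ∫⁻ y in Eᶜ, u y ≤ C * ofReal (10 ^ (n + 2)) * volume Eᶜ := by
  obtain ⟨R, hR⟩ := dE_bound hE hc hv
  set t : Set (Pt n × ℝ) := {a | a.1 ∉ E ∧ a.2 = dE E a.1 / 10}
  obtain ⟨v, hvt, hvc, hvd, hcov⟩ := vitali t R fun a ha ↦ by
    have h1 := dE_pos hE hc ha.1
    have h2 := hR a.1
    rw [ha.2]; constructor <;> linarith
  have hsub : Eᶜ ⊆ ⋃ b ∈ v, Qc b.1 (5 * b.2) := by
    refine Subset.trans ?_ hcov
    intro z hz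
    simp only [mem_iUnion, exists_prop]
    have h1 := dE_pos hE hc hz
    refine ⟨(z, dE E z / 10), ⟨hz, rfl⟩, ?_⟩
    rw [mem_Qc₉ (by simp only; linarith), pd_self]; simp only; linarith
  calc ∫⁻ y in Eᶜ, u y ≤ ∫⁻ y in ⋃ b ∈ v, Qc b.1 (5 * b.2), u y := lintegral_mono_set hsub
    _ ≤ ∑' b : v, ∫⁻ y in Qc b.1.1 (5 * b.1.2), u y := by
        rw [biUnion_eq_iUnion]
        haveI := hvc.to_subtype
        exact lintegral_iUnion_le _ _
    _ ≤ ∑' b : v, C * ofReal (10 ^ (n + 2)) * volume (Qc b.1.1 b.1.2) := by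
        apply ENNReal.tsum_le_tsum
        rintro ⟨b, hb⟩
        obtain ⟨h1, h2⟩ := hvt hb
        have hp := dE_pos hE hc h1
        simp only
        rw [h2, show 5 * (dE E b.1 / 10) = dE E b.1 / 2 by ring]
        refine (hu _ h1).trans_eq ?_
        rw [mul_assoc]
        congr 1
        rw [vol_Qc _ hp, vol_Qc _ (by positivity), ← ENNReal.ofReal_mul (by positivity)]
        congr 1
        rw [div_pow]; field_simp
    _ = C * ofReal (10 ^ (n + 2)) * ∑' b : v, volume (Qc b.1.1 b.1.2) :=
        ENNReal.tsum_mul_left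
    _ = C * ofReal (10 ^ (n + 2)) * volume (⋃ b ∈ v, Qc b.1 b.2) := by
        rw [measure_biUnion hvc hvd (fun b _ ↦ meas_Qc _ _)]
    _ ≤ _ := by
        refine mul_le_mul_right (measure_mono ?_) _
        refine iUnion₂_subset fun b hb ↦ ?_
        obtain ⟨h1, h2⟩ := hvt hb
        have hp := dE_pos hE hc h1
        exact Qc_dE _ (by linarith) (by linarith)

def md (E : Set (Pt n)) (ε : ℝ) (z : Pt n) : ℝ := max ε (dE E z)

lemma md_lip {E : Set (Pt n)} (hE : E.Nonempty) {ε : ℝ} (hε : 0 < ε) (z y : Pt n) :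
    |md E ε z - md E ε y| ≤ ‖z.1 - y.1‖ + |z.2 - y.2| / md E ε z := by
  have hs : ∀ (x x₉ : Spc n) (t : ℝ), md E ε (x, t) ≤ md E ε (x₉, t) + ‖x - x₉‖ := by
    intro x x₉ t
    have := dE_lip hE (x, t) (x₉, t)
    have h2 : pd (x, t) (x₉, t) = ‖x - x₉‖ := by simp [pd]
    rw [h2] at this
    unfold md
    apply max_le
    · linarith [le_max_left ε (dE E (x₉, t)), norm_nonneg (x - x₉)]
    · linarith [le_max_right ε (dE E (x₉, t))]
  have hm : ∀ w, ε ≤ md E ε w := fun w ↦ le_max_left _ _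
  have ht : ∀ (x : Spc n) (t s : ℝ), md E ε (x, t) ^ 2 ≤ md E ε (x, s) ^ 2 + |t - s| := by
    intro x t s
    have h1 := dE_time hE x t s
    have h2 := dE_nonneg E (x, s)
    have h3 : dE E (x, s) ≤ md E ε (x, s) := le_max_right _ _
    have h4 := hm (x, s)
    have h5 := abs_nonneg (t - s)
    rcases max_cases ε (dE E (x, t)) with ⟨h, -⟩ | ⟨h, -⟩
    · rw [md, h]; nlinarith
    · rw [show md E ε (x, t) = dE E (x, t) from h]; nlinarith
  have h1 : |md E ε (z.1, z.2) - md E ε (z.1, y.2)| ≤ |z.2 - y.2| / md E ε z := by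
    have a1 := ht z.1 z.2 y.2
    have a2 := ht z.1 y.2 z.2
    rw [abs_sub_comm y.2] at a2
    have b1 := hm z
    have b2 := hm (z.1, y.2)
    have b3 : md E ε (z.1, z.2) = md E ε z := rfl
    rw [b3] at *
    rw [le_div_iff₀ (by linarith)]
    rcases abs_cases (md E ε z - md E ε (z.1, y.2)) with ⟨h, _⟩ | ⟨h, _⟩ <;> rw [h] <;> nlinarith
  have h2 : |md E ε (z.1, y.2) - md E ε (y.1, y.2)| ≤ ‖z.1 - y.1‖ := by
    have a1 := hs z.1 y.1 y.2
    have a2 := hs y.1 z.1 y.2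
    rw [norm_sub_rev] at a2
    rw [abs_le]; constructor <;> linarith
  have := abs_sub_le (md E ε z) (md E ε (z.1, y.2)) (md E ε y)
  have e1 : md E ε (z.1, z.2) = md E ε z := rfl
  have e2 : md E ε (y.1, y.2) = md E ε y := rfl
  rw [e1] at h1; rw [e2] at h2
  linarith

structure IsK (κ : Pt n → ℝ) : Prop where
  cd : ContDiff ℝ (⊤ : ℕ∞) κ
  sp : ∀ y, κ y ≠ 0 → ‖y‖ ≤ 1

def dts (κ : Pt n → ℝ) (z : Pt n) : ℝ := fderiv ℝ κ z ((0 : Spc n), (1 : ℝ))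
def mulX (κ : Pt n → ℝ) (j : Fin n) (y : Pt n) : ℝ := y.1 j * κ y
def mulT (κ : Pt n → ℝ) (y : Pt n) : ℝ := y.2 * κ y
def kR (κ : Pt n → ℝ) (y : Pt n) : ℝ := -∑ j, dxj (mulX κ j) j y
def kT (κ : Pt n → ℝ) (y : Pt n) : ℝ := - dts (mulT κ) y

def Dl (r τ : ℝ) (y : Pt n) : Pt n := (r⁻¹ • y.1, τ⁻¹ * y.2)
def kf (κ : Pt n → ℝ) (r τ : ℝ) (y : Pt n) : ℝ := (r ^ n * τ)⁻¹ * κ (Dl r τ y)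
def cv (κ : Pt n → ℝ) (r τ : ℝ) (w : Pt n → ℝ) (z : Pt n) : ℝ :=
  ∫ z₉, w z₉ * kf κ r τ (z - z₉)

lemma IsK.hcs {κ : Pt n → ℝ} (h : IsK κ) : HasCompactSupport κ :=
  HasCompactSupport.intro (isCompact_closedBall (0 : Pt n) 1) fun x hx ↦ by
    by_contra h1
    exact hx (by simpa using h.sp x h1)

lemma IsK.tsup {κ : Pt n → ℝ} (h : IsK κ) : tsupport κ ⊆ closedBall 0 1 :=
  closure_minimal (fun x hx ↦ by simpa using h.sp x hx) isClosed_closedBall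

lemma IsK.fd {κ : Pt n → ℝ} (h : IsK κ) (v : Pt n) : IsK (fun y ↦ fderiv ℝ κ y v) := by
  refine ⟨?_, fun y hy ↦ ?_⟩
  · exact (h.cd.fderiv_right (m := (⊤ : ℕ∞)) (by simp)).clm_apply contDiff_const
  · by_contra hn
    apply hy
    have : y ∉ tsupport κ := fun h1 ↦ hn (by simpa using h.tsup h1)
    have h2 := fderiv_of_notMem_tsupport (𝕜 := ℝ) this
    simp [h2]

lemma IsK.dx {κ : Pt n → ℝ} (h : IsK κ) (j : Fin n) : IsK (dxj κ j) := h.fd _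
lemma IsK.dt {κ : Pt n → ℝ} (h : IsK κ) : IsK (dts κ) := h.fd _

lemma contDiff_coord (j : Fin n) {m : WithTop ℕ∞} : ContDiff ℝ m (fun y : Pt n ↦ y.1 j) := by
  have : ContDiff ℝ m (fun y : Pt n ↦ (EuclideanSpace.proj (𝕜 := ℝ) j) y.1) := by fun_prop
  exact this

lemma IsK.mX {κ : Pt n → ℝ} (h : IsK κ) (j : Fin n) : IsK (mulX κ j) :=
  ⟨(contDiff_coord j).mul h.cd, fun y hy ↦ h.sp y (right_ne_zero_of_mul hy)⟩
lemma IsK.mT {κ : Pt n → ℝ} (h : IsK κ) : IsK (mulT κ) :=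
  ⟨contDiff_snd.mul h.cd, fun y hy ↦ h.sp y (right_ne_zero_of_mul hy)⟩
lemma IsK.kR {κ : Pt n → ℝ} (h : IsK κ) : IsK (kR κ) := by
  refine ⟨(ContDiff.sum fun j _ ↦ ((h.mX j).dx j).cd).neg, fun y hy ↦ ?_⟩
  by_contra hn
  apply hy
  unfold RH.kR
  rw [Finset.sum_eq_zero, neg_zero]
  intro j _
  by_contra h3
  exact hn (((h.mX j).dx j).sp y h3)
lemma IsK.kT {κ : Pt n → ℝ} (h : IsK κ) : IsK (kT κ) :=
  ⟨h.mT.dt.cd.neg, fun y hy ↦ h.mT.dt.sp y (by simpa [RH.kT] using hy)⟩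

lemma IsK.bdd {κ : Pt n → ℝ} (h : IsK κ) : ∃ C > 0, ∀ y, |κ y| ≤ C := by
  obtain ⟨C, hC⟩ := h.hcs.exists_bound_of_continuous h.cd.continuous
  exact ⟨max C 1, by positivity, fun y ↦ (hC y).trans (le_max_left _ _)⟩

lemma dxj_mulX {κ : Pt n → ℝ} (h : IsK κ) (j : Fin n) (y : Pt n) :
    dxj (mulX κ j) j y = κ y + y.1 j * dxj κ j y := by
  have h1 : HasFDerivAt (fun y : Pt n ↦ y.1 j)
      ((EuclideanSpace.proj (𝕜 := ℝ) j).comp (ContinuousLinearMap.fst ℝ (Spc n) ℝ)) y :=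
    ((EuclideanSpace.proj (𝕜 := ℝ) j).comp (ContinuousLinearMap.fst ℝ (Spc n) ℝ)).hasFDerivAt
  have h2 : HasFDerivAt κ (fderiv ℝ κ y) y :=
    (h.cd.differentiable (by simp)).differentiableAt.hasFDerivAt
  have := (h1.mul h2).fderiv
  unfold dxj mulX
  erw [this]
  simp
  ring

lemma dts_mulT {κ : Pt n → ℝ} (h : IsK κ) (y : Pt n) :
    dts (mulT κ) y = κ y + y.2 * dts κ y := by
  have h1 : HasFDerivAt (fun y : Pt n ↦ y.2)
      ((ContinuousLinearMap.snd ℝ (Spc n) ℝ)) y :=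
    ((ContinuousLinearMap.snd ℝ (Spc n) ℝ)).hasFDerivAt
  have h2 : HasFDerivAt κ (fderiv ℝ κ y) y :=
    (h.cd.differentiable (by simp)).differentiableAt.hasFDerivAt
  have := (h1.mul h2).fderiv
  unfold dts mulT
  erw [this]
  simp
  ring

lemma fd_expand (κ : Pt n → ℝ) (y v : Pt n) :
    fderiv ℝ κ y v = ∑ j, v.1 j * dxj κ j y + v.2 * dts κ y := by
  have h1 : v = (∑ j, v.1 j • ((EuclideanSpace.single j (1:ℝ), (0:ℝ)) : Pt n))
      + v.2 • ((0 : Spc n), (1:ℝ)) := by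
    ext j
    · simp [Prod.fst_sum, Finset.sum_apply, Pi.single_apply]
    · simp [Prod.snd_sum]
  conv_lhs => rw [h1]
  rw [map_add, map_sum, map_smul]
  simp only [map_smul, smul_eq_mul, dxj, dts]

def kA (κ : Pt n → ℝ) (P : ℝ × ℝ) (y : Pt n) : ℝ := kf κ P.1 P.2 y

lemma kA_cd {κ : Pt n → ℝ} (h : IsK κ) (s : Set (ℝ × ℝ)) (hs : ∀ P ∈ s, 0 < P.1 ∧ 0 < P.2)
    {m : ℕ∞} : ContDiffOn ℝ m (Function.HasUncurry.uncurry (kA κ)) (s ×ˢ (univ : Set (Pt n))) := by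
  have e : (Function.HasUncurry.uncurry (kA κ)) = fun q : (ℝ × ℝ) × Pt n ↦
    (q.1.1 ^ n * q.1.2)⁻¹ * κ (q.1.1⁻¹ • q.2.1, q.1.2⁻¹ * q.2.2) := rfl
  rw [e]
  have h1 : ContDiffOn ℝ m (fun q : (ℝ × ℝ) × Pt n ↦ q.1.1⁻¹) (s ×ˢ univ) :=
    ContDiffOn.inv (by fun_prop) fun q hq ↦ (hs _ hq.1).1.ne'
  have h2 : ContDiffOn ℝ m (fun q : (ℝ × ℝ) × Pt n ↦ q.1.2⁻¹) (s ×ˢ univ) :=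
    ContDiffOn.inv (by fun_prop) fun q hq ↦ (hs _ hq.1).2.ne'
  have h3 : ContDiffOn ℝ m (fun q : (ℝ × ℝ) × Pt n ↦ (q.1.1 ^ n * q.1.2)⁻¹) (s ×ˢ univ) :=
    ContDiffOn.inv (by fun_prop) fun q hq ↦ by
      have := hs _ hq.1
      have a := this.1
      have b := this.2
      positivity
  refine h3.mul ?_
  refine (h.cd.of_le (by exact_mod_cast le_top)).comp_contDiffOn ?_
  refine ContDiffOn.prodMk (h1.smul (by fun_prop)) (h2.mul (by fun_prop))

lemma kA_fd {κ : Pt n → ℝ} (h : IsK κ) {r τ : ℝ} (hr : 0 < r) (hτ : 0 < τ) (y : Pt n)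
    (v : (ℝ × ℝ) × Pt n) :
    fderiv ℝ (Function.HasUncurry.uncurry (kA κ)) ((r, τ), y) v =
      v.1.1 / r * kf (kR κ) r τ y + v.1.2 / τ * kf (kT κ) r τ y +
      ∑ j, v.2.1 j / r * kf (dxj κ j) r τ y + v.2.2 / τ * kf (dts κ) r τ y := by
  set q : ℝ → (ℝ × ℝ) × Pt n := fun σ ↦ ((r, τ), y) + σ • v
  have hq : HasDerivAt q v 0 := by
    have := ((hasDerivAt_id (0 : ℝ)).smul_const v).const_add ((r, τ), y)
    rw [one_smul] at this
    exact this
  have hq0 : q 0 = ((r, τ), y) := by simp [q]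
  have hd : HasFDerivAt (Function.HasUncurry.uncurry (kA κ))
      (fderiv ℝ (Function.HasUncurry.uncurry (kA κ)) ((r, τ), y)) (q 0) := by
    rw [hq0]
    have := kA_cd h {P : ℝ × ℝ | 0 < P.1 ∧ 0 < P.2} (fun P h ↦ h) (m := 1)
    refine ((this.differentiableOn (by simp)).differentiableAt ?_).hasFDerivAt
    refine (IsOpen.prod ?_ isOpen_univ).mem_nhds ⟨⟨hr, hτ⟩, trivial⟩
    exact (isOpen_lt continuous_const continuous_fst).inter
      (isOpen_lt continuous_const continuous_snd)
  have h1 := hd.comp_hasDerivAt (0 : ℝ) hq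
  have a1 : HasDerivAt (fun σ : ℝ ↦ r + σ * v.1.1) v.1.1 0 := by
    simpa using ((hasDerivAt_id (0 : ℝ)).mul_const v.1.1).const_add r
  have a2 : HasDerivAt (fun σ : ℝ ↦ τ + σ * v.1.2) v.1.2 0 := by
    simpa using ((hasDerivAt_id (0 : ℝ)).mul_const v.1.2).const_add τ
  have a3 : HasDerivAt (fun σ : ℝ ↦ y.1 + σ • v.2.1) v.2.1 0 := by
    simpa using ((hasDerivAt_id (0 : ℝ)).smul_const v.2.1).const_add y.1
  have a4 : HasDerivAt (fun σ : ℝ ↦ y.2 + σ * v.2.2) v.2.2 0 := by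
    simpa using ((hasDerivAt_id (0 : ℝ)).mul_const v.2.2).const_add y.2
  have b1 := (a1.inv (by simpa using hr.ne')).smul a3
  have b2 := (a2.inv (by simpa using hτ.ne')).mul a4
  have b3 := ((a1.pow n).mul a2).inv (by simp; exact ⟨fun h0 ↦ (hr.ne' h0).elim, hτ.ne'⟩)
  have hκ : HasFDerivAt κ (fderiv ℝ κ (Dl r τ y))
      ((r + 0 * v.1.1)⁻¹ • (y.1 + (0:ℝ) • v.2.1), (τ + 0 * v.1.2)⁻¹ * (y.2 + 0 * v.2.2)) := by
    have : ((r + 0 * v.1.1)⁻¹ • (y.1 + (0:ℝ) • v.2.1), (τ + 0 * v.1.2)⁻¹ * (y.2 + 0 * v.2.2))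
      = Dl r τ y := by simp [Dl]
    rw [this]
    exact (h.cd.differentiable (by simp)).differentiableAt.hasFDerivAt
  have b4 := HasFDerivAt.comp_hasDerivAt (0 : ℝ) (f := fun σ : ℝ ↦
      ((r + σ * v.1.1)⁻¹ • (y.1 + σ • v.2.1), (τ + σ * v.1.2)⁻¹ * (y.2 + σ * v.2.2)))
      hκ (b1.prodMk b2)
  have b5 := b3.mul b4
  have h2 := h1.unique b5
  rw [h2]
  rw [fd_expand]
  simp only [kf, kR, kT, Pi.mul_apply, Pi.pow_apply, Pi.inv_apply, Function.comp]
  simp only [dxj_mulX h, dts_mulT h, Finset.sum_add_distrib]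
  simp only [Dl, zero_mul, add_zero, zero_smul, Finset.sum_const, Finset.card_univ,
    Fintype.card_fin, nsmul_eq_mul, PiLp.add_apply, PiLp.smul_apply, smul_eq_mul, add_mul,
    Finset.sum_add_distrib]
  have s1 : ∀ D : Fin n → ℝ, ∑ j, v.2.1 j / r * ((r ^ n * τ)⁻¹ * D j)
      = (r ^ n * τ)⁻¹ * r⁻¹ * ∑ j, v.2.1 j * D j := by
    intro D; rw [Finset.mul_sum]; refine Finset.sum_congr rfl fun j _ ↦ ?_; ring
  have s2 : ∀ D : Fin n → ℝ, ∑ j, r⁻¹ * v.2.1 j * D j = r⁻¹ * ∑ j, v.2.1 j * D j := by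
    intro D; rw [Finset.mul_sum]; refine Finset.sum_congr rfl fun j _ ↦ ?_; ring
  have s3 : ∀ D : Fin n → ℝ, ∑ j, -v.1.1 / r ^ 2 * y.1 j * D j
      = -v.1.1 / r ^ 2 * ∑ j, y.1 j * D j := by
    intro D; rw [Finset.mul_sum]; refine Finset.sum_congr rfl fun j _ ↦ ?_; ring
  have s4 : ∀ D : Fin n → ℝ, ∑ j, r⁻¹ * y.1 j * D j = r⁻¹ * ∑ j, y.1 j * D j := by
    intro D; rw [Finset.mul_sum]; refine Finset.sum_congr rfl fun j _ ↦ ?_; ring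
  rw [s1, s2, s3, s4]
  have hn : (n : ℝ) * r ^ (n - 1) = n * r ^ n / r := by
    rw [eq_div_iff hr.ne']
    rcases n with _ | k
    · simp
    · simp [pow_succ]; ring
  rw [hn]
  generalize κ (r⁻¹ • y.1, τ⁻¹ * y.2) = K0
  generalize dts κ (r⁻¹ • y.1, τ⁻¹ * y.2) = K1
  generalize ∑ j, v.2.1 j * dxj κ j (r⁻¹ • y.1, τ⁻¹ * y.2) = K2
  generalize ∑ j, y.1 j * dxj κ j (r⁻¹ • y.1, τ⁻¹ * y.2) = K3
  have hr₉ : r ≠ 0 := hr.ne'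
  have hτ' : τ ≠ 0 := hτ.ne'
  have hrn : r ^ n ≠ 0 := pow_ne_zero n hr₉
  generalize r ^ n = R at *
  clear h2 b5 b4 b3 b2 b1 h1 hd s1 s2 s3 s4 hn hκ hq0 hq
  field_simp
  ring

def Cl (z : Pt n) (r τ : ℝ) : Set (Pt n) := {y | ‖z.1 - y.1‖ ≤ r ∧ |z.2 - y.2| ≤ τ}

lemma Cl_closed (z : Pt n) (r τ : ℝ) : IsClosed (Cl z r τ) :=
  IsClosed.inter (s₁ := {y : Pt n | ‖z.1 - y.1‖ ≤ r}) (s₂ := {y : Pt n | |z.2 - y.2| ≤ τ})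
    (isClosed_le (by fun_prop) continuous_const) (isClosed_le (by fun_prop) continuous_const)

lemma Cl_sub (z : Pt n) {r τ : ℝ} (hr : 0 < r) (hτ : 0 < τ) :
    Cl z r τ ⊆ Qrs z (2 * r) (2 * τ) := by
  rintro y ⟨h1, h2⟩
  rw [abs_le] at h2
  refine ⟨?_, ?_, ?_⟩
  · rw [mem_ball, dist_comm, dist_eq_norm]; linarith
  · linarith
  · linarith

lemma Cl_subQ (z : Pt n) {s : ℝ} (hs : 0 < s) : Cl z s (s ^ 2) ⊆ Qc z (2 * s) := by
  rintro y ⟨h1, h2⟩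
  rw [mem_Qc, norm_sub_rev, abs_sub_comm]
  constructor
  · linarith
  · nlinarith [abs_nonneg (z.2 - y.2)]

lemma Cl_vol (z : Pt n) {r τ : ℝ} (hr : 0 < r) (hτ : 0 < τ) :
    volume (Cl z r τ) ≤ ofReal (2 ^ (n + 1) * Vn n * (r ^ n * τ)) := by
  refine (measure_mono (Cl_sub z hr hτ)).trans ?_
  rw [vol_Qrs _ (by positivity)]
  apply ENNReal.ofReal_le_ofReal
  rw [mul_pow]; apply le_of_eq; ring

lemma Cl_compact (z : Pt n) (r τ : ℝ) : IsCompact (Cl z r τ) := by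
  refine Metric.isCompact_of_isClosed_isBounded (Cl_closed z r τ) ?_
  refine (Metric.isBounded_closedBall (x := z) (r := max r τ)).subset ?_
  rintro y ⟨h1, h2⟩
  rw [mem_closedBall, Prod.dist_eq, dist_comm, dist_eq_norm, Real.dist_eq, abs_sub_comm]
  exact max_le_max h1 h2

lemma kf_ne {κ : Pt n → ℝ} (h : IsK κ) {r τ : ℝ} (hr : 0 < r) (hτ : 0 < τ) {y : Pt n}
    (hy : kf κ r τ y ≠ 0) : ‖y.1‖ ≤ r ∧ |y.2| ≤ τ := by
  have := h.sp _ (right_ne_zero_of_mul hy)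
  rw [Prod.norm_def, max_le_iff] at this
  simp only [Dl, norm_smul, norm_mul, Real.norm_eq_abs, abs_inv, abs_of_pos hr, abs_of_pos hτ]
    at this
  constructor
  · have := this.1
    rwa [inv_mul_le_iff₀ hr, mul_one] at this
  · have := this.2
    rwa [inv_mul_le_iff₀ hτ, mul_one] at this

lemma kf_zero {κ : Pt n → ℝ} (h : IsK κ) {r τ : ℝ} (hr : 0 < r) (hτ : 0 < τ) {z z₉ : Pt n}
    (hy : z₉ ∉ Cl z r τ) : kf κ r τ (z - z₉) = 0 := by
  by_contra hn
  have h1 := kf_ne h hr hτ hn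
  rw [Prod.fst_sub, Prod.snd_sub] at h1
  exact hy h1

lemma kf_cont {κ : Pt n → ℝ} (h : IsK κ) (r τ : ℝ) : Continuous (kf κ r τ) := by
  unfold kf Dl
  have := h.cd.continuous
  fun_prop

lemma kf_bd {κ : Pt n → ℝ} {C : ℝ} (hC : ∀ y, |κ y| ≤ C) {r τ : ℝ} (hr : 0 < r) (hτ : 0 < τ)
    (y : Pt n) : |kf κ r τ y| ≤ C * (r ^ n * τ)⁻¹ := by
  unfold kf
  rw [abs_mul, abs_of_pos (by positivity), mul_comm]
  have := hC (Dl r τ y)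
  gcongr

lemma cv_int {κ : Pt n → ℝ} (h : IsK κ) {r τ : ℝ} (hr : 0 < r) (hτ : 0 < τ)
    {w : Pt n → ℝ} (hw : Integrable w) (z : Pt n) :
    Integrable (fun z₉ ↦ w z₉ * kf κ r τ (z - z₉)) := by
  obtain ⟨C, hC0, hC⟩ := h.bdd
  refine hw.mul_bdd (c := C * (r ^ n * τ)⁻¹) ?_ (ae_of_all _ fun y ↦ ?_)
  · exact ((kf_cont h r τ).comp (by fun_prop)).aestronglyMeasurable
  · exact kf_bd hC hr hτ _

lemma cv_bd {κ : Pt n → ℝ} (h : IsK κ) {C : ℝ} (hC : ∀ y, |κ y| ≤ C) {r τ : ℝ} (hr : 0 < r)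
    (hτ : 0 < τ) (w : Pt n → ℝ) (z : Pt n) :
    ‖cv κ r τ w z‖ₑ ≤ ofReal (C * (r ^ n * τ)⁻¹) * ∫⁻ y in Cl z r τ, ‖w y‖ₑ := by
  unfold cv
  refine (enorm_integral_le_lintegral_enorm _).trans ?_
  rw [← lintegral_const_mul' _ _ ENNReal.ofReal_ne_top,
    ← lintegral_indicator (Cl_closed z r τ).measurableSet]
  refine lintegral_mono fun y ↦ ?_
  by_cases hy : y ∈ Cl z r τ
  · rw [indicator_of_mem hy, enorm_mul, mul_comm]
    gcongr
    rw [← ofReal_norm]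
    exact ENNReal.ofReal_le_ofReal (kf_bd hC hr hτ _)
  · rw [kf_zero h hr hτ hy]; simp

lemma cv_eq_conv (κ : Pt n → ℝ) (w : Pt n → ℝ) (q : (ℝ × ℝ) × Pt n) :
    cv κ q.1.1 q.1.2 w q.2 = convolution w (kA κ q.1) (ContinuousLinearMap.mul ℝ ℝ) volume q.2 :=
  rfl

lemma param_box (R : ℝ) : IsOpen {P : ℝ × ℝ | (0 < P.1 ∧ P.1 < R) ∧ 0 < P.2 ∧ P.2 < R} := by
  refine IsOpen.inter (IsOpen.inter ?_ ?_) (IsOpen.inter ?_ ?_)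
  · exact isOpen_lt continuous_const continuous_fst
  · exact isOpen_lt continuous_fst continuous_const
  · exact isOpen_lt continuous_const continuous_snd
  · exact isOpen_lt continuous_snd continuous_const

lemma kA_supp {κ : Pt n → ℝ} (h : IsK κ) (R : ℝ) (P : ℝ × ℝ) (x : Pt n)
    (hP : P ∈ {P : ℝ × ℝ | (0 < P.1 ∧ P.1 < R) ∧ 0 < P.2 ∧ P.2 < R})
    (hx : x ∉ closedBall (0 : Pt n) R) : kA κ P x = 0 := by
  by_contra hn
  have := kf_ne h hP.1.1 hP.2.1 hn
  apply hx
  rw [mem_closedBall_zero_iff, Prod.norm_def]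
  exact max_le (this.1.trans hP.1.2.le) (this.2.trans hP.2.2.le)

lemma cv_cd {κ : Pt n → ℝ} (h : IsK κ) {w : Pt n → ℝ} (hw : Integrable w) {r τ : ℝ}
    (hr : 0 < r) (hτ : 0 < τ) (z : Pt n) :
    ContDiffAt ℝ (⊤ : ℕ∞) (fun q : (ℝ × ℝ) × Pt n ↦ cv κ q.1.1 q.1.2 w q.2) ((r, τ), z) := by
  set R := r + τ
  have := contDiffOn_convolution_right_with_param (n := (⊤ : ℕ∞)) (ContinuousLinearMap.mul ℝ ℝ)
    (μ := volume) (param_box R) (isCompact_closedBall (0 : Pt n) R) (kA_supp h R)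
    hw.locallyIntegrable (kA_cd h _ fun P hP ↦ ⟨hP.1.1, hP.2.1⟩)
  refine this.contDiffAt (((param_box R).prod isOpen_univ).mem_nhds ⟨⟨⟨hr, ?_⟩, hτ, ?_⟩, trivial⟩)
  · simp only [R]; linarith
  · simp only [R]; linarith

lemma cv_fd {κ : Pt n → ℝ} (h : IsK κ) {w : Pt n → ℝ} (hw : Integrable w) {r τ : ℝ}
    (hr : 0 < r) (hτ : 0 < τ) (z : Pt n) (v : (ℝ × ℝ) × Pt n) :
    fderiv ℝ (fun q : (ℝ × ℝ) × Pt n ↦ cv κ q.1.1 q.1.2 w q.2) ((r, τ), z) v =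
      v.1.1 / r * cv (kR κ) r τ w z + v.1.2 / τ * cv (kT κ) r τ w z +
      ∑ j, v.2.1 j / r * cv (dxj κ j) r τ w z + v.2.2 / τ * cv (dts κ) r τ w z := by
  set R := r + τ
  have hbox : ((r, τ) : ℝ × ℝ) ∈ {P : ℝ × ℝ | (0 < P.1 ∧ P.1 < R) ∧ 0 < P.2 ∧ P.2 < R} :=
    ⟨⟨hr, by simp only [R]; linarith⟩, hτ, by simp only [R]; linarith⟩
  have hk1 := kA_cd h _ (fun P hP ↦ ⟨hP.1.1, hP.2.1⟩ : ∀ P ∈ {P : ℝ × ℝ |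
    (0 < P.1 ∧ P.1 < R) ∧ 0 < P.2 ∧ P.2 < R}, 0 < P.1 ∧ 0 < P.2) (m := 1)
  have := hasFDerivAt_convolution_right_with_param (ContinuousLinearMap.mul ℝ ℝ)
    (μ := volume) (param_box R) (isCompact_closedBall (0 : Pt n) R) (kA_supp h R)
    hw.locallyIntegrable hk1 ((r, τ), z) hbox
  have e := this.fderiv
  have e2 : (fun q : (ℝ × ℝ) × Pt n ↦ cv κ q.1.1 q.1.2 w q.2) = fun q : (ℝ × ℝ) × Pt n ↦
    convolution w (kA κ q.1) (ContinuousLinearMap.mul ℝ ℝ) volume q.2 := rfl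
  rw [e2, e]
  simp only [convolution]
  have i1 := cv_int h.kR hr hτ hw z
  have i2 := cv_int h.kT hr hτ hw z
  have i3 := fun j ↦ cv_int (h.dx j) hr hτ hw z
  have i4 := cv_int h.dt hr hτ hw z
  have key : ∀ t, (((ContinuousLinearMap.mul ℝ ℝ).precompR ((ℝ × ℝ) × Pt n)) (w t)
      (fderiv ℝ (Function.HasUncurry.uncurry (kA κ)) ((r, τ), z - t))) v =
      v.1.1 / r * (w t * kf (kR κ) r τ (z - t)) + v.1.2 / τ * (w t * kf (kT κ) r τ (z - t)) +
      ∑ j, v.2.1 j / r * (w t * kf (dxj κ j) r τ (z - t)) +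
        v.2.2 / τ * (w t * kf (dts κ) r τ (z - t)) := by
    intro t
    have : (((ContinuousLinearMap.mul ℝ ℝ).precompR ((ℝ × ℝ) × Pt n)) (w t)
      (fderiv ℝ (Function.HasUncurry.uncurry (kA κ)) ((r, τ), z - t))) v =
      w t * fderiv ℝ (Function.HasUncurry.uncurry (kA κ)) ((r, τ), z - t) v := rfl
    rw [this, kA_fd h hr hτ]
    rw [mul_add, mul_add, mul_add, Finset.mul_sum]
    congr 1
    · congr 1
      · ring
      · exact Finset.sum_congr rfl fun j _ ↦ by ring
    · ring
  rw [ContinuousLinearMap.integral_apply]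
  · rw [integral_congr_ae (ae_of_all _ key)]
    have j1 := i1.const_mul (v.1.1 / r)
    have j2 := i2.const_mul (v.1.2 / τ)
    have j3 := integrable_finsetSum Finset.univ fun j _ ↦ (i3 j).const_mul (v.2.1 j / r)
    have j4 := i4.const_mul (v.2.2 / τ)
    set A1 := fun t ↦ v.1.1 / r * (w t * kf (kR κ) r τ (z - t))
    set A2 := fun t ↦ v.1.2 / τ * (w t * kf (kT κ) r τ (z - t))
    set A3 := fun t ↦ ∑ j, v.2.1 j / r * (w t * kf (dxj κ j) r τ (z - t)) with hA3
    set A4 := fun t ↦ v.2.2 / τ * (w t * kf (dts κ) r τ (z - t))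
    have k1 : Integrable (fun t ↦ A1 t + A2 t) := j1.add j2
    have k2 : Integrable (fun t ↦ A1 t + A2 t + A3 t) := k1.add j3
    rw [integral_add k2 j4, integral_add k1 j3, integral_add j1 j2, hA3,
      integral_finsetSum _ fun j _ ↦ (i3 j).const_mul (v.2.1 j / r)]
    simp only [A1, A2, A4, integral_const_mul]
    rfl
  · have hcf : Continuous fun x : Pt n ↦
        fderiv ℝ (Function.HasUncurry.uncurry (kA κ)) ((r, τ), x) := by
      have h2 := (hk1.continuousOn_fderiv_of_isOpen ((param_box R).prod isOpen_univ) le_rfl)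
      exact h2.comp_continuous (by fun_prop) fun x ↦ ⟨hbox, trivial⟩
    have hcs : HasCompactSupport fun x : Pt n ↦
        fderiv ℝ (Function.HasUncurry.uncurry (kA κ)) ((r, τ), x) := by
      refine HasCompactSupport.intro (isCompact_closedBall (0 : Pt n) R) fun x hx ↦ ?_
      refine ContinuousLinearMap.ext fun v ↦ ?_
      rw [kA_fd h hr hτ]
      have : ∀ κ : Pt n → ℝ, IsK κ → kf κ r τ x = 0 := fun κ hκ ↦ kA_supp hκ R (r, τ) x hbox hx
      rw [this _ h.kR, this _ h.kT, this _ h.dt]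
      simp [this _ (h.dx _)]
    exact (hcs.convolutionExists_right _ hw.locallyIntegrable hcf z)

structure WE (U : Set (Pt n)) (w : Pt n → ℝ) (G B : Fin n → Pt n → ℝ) (f : Pt n → ℝ) : Prop where
  iw : Integrable w
  iG : ∀ j, Integrable (G j)
  iB : ∀ j, Integrable (B j)
  jf : Integrable f
  hx : ∀ j (ψ : Pt n → ℝ), ContDiff ℝ (⊤ : ℕ∞) ψ → HasCompactSupport ψ → tsupport ψ ⊆ U →
    ∫ z, w z * dxj ψ j z = - ∫ z, G j z * ψ z
  ht : ∀ (ψ : Pt n → ℝ), ContDiff ℝ (⊤ : ℕ∞) ψ → HasCompactSupport ψ → tsupport ψ ⊆ U →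
    ∫ z, w z * dts ψ z = (∑ j, ∫ z, B j z * dxj ψ j z) - ∫ z, f z * ψ z

section
variable {κ : Pt n → ℝ} (h : IsK κ) {r τ : ℝ} (hr : 0 < r) (hτ : 0 < τ) (z : Pt n)
include h hr hτ

lemma ps_cd : ContDiff ℝ (⊤ : ℕ∞) (fun z₉ ↦ kf κ r τ (z - z₉)) := by
  unfold kf Dl
  refine contDiff_const.mul (h.cd.comp ?_)
  have : ContDiff ℝ (⊤ : ℕ∞) (fun z₉ : Pt n ↦ z - z₉) := contDiff_const.sub contDiff_id
  exact ((contDiff_fst.comp this).const_smul r⁻¹).prodMk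
    (contDiff_const.mul (contDiff_snd.comp this))

lemma ps_ts : tsupport (fun z₉ ↦ kf κ r τ (z - z₉)) ⊆ Cl z r τ := by
  refine closure_minimal (fun y hy ↦ ?_) (Cl_closed z r τ)
  by_contra hn
  exact hy (kf_zero h hr hτ hn)

lemma ps_cs : HasCompactSupport (fun z₉ ↦ kf κ r τ (z - z₉)) :=
  HasCompactSupport.intro (Cl_compact z r τ) fun y hy ↦ kf_zero h hr hτ hy

lemma ps_fd (y v : Pt n) : fderiv ℝ (fun z₉ ↦ kf κ r τ (z - z₉)) y v =
    -(∑ j, v.1 j / r * kf (dxj κ j) r τ (z - y) + v.2 / τ * kf (dts κ) r τ (z - y)) := by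
  have hd : HasFDerivAt (Function.HasUncurry.uncurry (kA κ))
      (fderiv ℝ (Function.HasUncurry.uncurry (kA κ)) ((r, τ), z - y)) ((r, τ), z - y) := by
    have := kA_cd h {P : ℝ × ℝ | 0 < P.1 ∧ 0 < P.2} (fun P h ↦ h) (m := 1)
    refine ((this.differentiableOn (by simp)).differentiableAt ?_).hasFDerivAt
    refine (IsOpen.prod ?_ isOpen_univ).mem_nhds ⟨⟨hr, hτ⟩, trivial⟩
    exact (isOpen_lt continuous_const continuous_fst).inter
      (isOpen_lt continuous_const continuous_snd)
  have h1 : HasFDerivAt (fun z₉ : Pt n ↦ (((r, τ), z - z₉) : (ℝ × ℝ) × Pt n))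
      ((0 : Pt n →L[ℝ] (ℝ × ℝ)).prod (-ContinuousLinearMap.id ℝ (Pt n))) y :=
    (hasFDerivAt_const _ _).prodMk ((hasFDerivAt_id y).const_sub z)
  have h2 := (HasFDerivAt.comp (f := fun z₉ : Pt n ↦ (((r, τ), z - z₉) : (ℝ × ℝ) × Pt n))
    y hd h1).fderiv
  have e : (Function.HasUncurry.uncurry (kA κ) ∘
      fun z₉ : Pt n ↦ (((r, τ), z - z₉) : (ℝ × ℝ) × Pt n)) =
    fun z₉ ↦ kf κ r τ (z - z₉) := rfl
  rw [e] at h2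
  rw [h2, ContinuousLinearMap.comp_apply, kA_fd h hr hτ]
  simp [neg_div]
  ring

lemma ps_dx (j : Fin n) (y : Pt n) : dxj (fun z₉ ↦ kf κ r τ (z - z₉)) j y =
    -(r⁻¹ * kf (dxj κ j) r τ (z - y)) := by
  unfold dxj
  rw [ps_fd h hr hτ]
  rw [Finset.sum_eq_single j]
  · simp; left; rfl
  · intro b _ hb
    simp [hb]
  · simp

lemma ps_dt (y : Pt n) : dts (fun z₉ ↦ kf κ r τ (z - z₉)) y =
    -(τ⁻¹ * kf (dts κ) r τ (z - y)) := by
  unfold dts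
  rw [ps_fd h hr hτ]
  simp; left; rfl

end

lemma WE.cvx {U : Set (Pt n)} {w f : Pt n → ℝ} {G B : Fin n → Pt n → ℝ} (W : WE U w G B f)
    {κ : Pt n → ℝ} (h : IsK κ) {r τ : ℝ} (hr : 0 < r) (hτ : 0 < τ) {z : Pt n}
    (hU : Cl z r τ ⊆ U) (j : Fin n) :
    r⁻¹ * cv (dxj κ j) r τ w z = cv κ r τ (G j) z := by
  have := W.hx j _ (ps_cd h hr hτ z) (ps_cs h hr hτ z) ((ps_ts h hr hτ z).trans hU)
  simp only [ps_dx h hr hτ] at this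
  unfold cv
  rw [← neg_inj, ← this, ← integral_const_mul, ← integral_neg]
  congr 1; ext y; ring

lemma WE.cvt {U : Set (Pt n)} {w f : Pt n → ℝ} {G B : Fin n → Pt n → ℝ} (W : WE U w G B f)
    {κ : Pt n → ℝ} (h : IsK κ) {r τ : ℝ} (hr : 0 < r) (hτ : 0 < τ) {z : Pt n}
    (hU : Cl z r τ ⊆ U) :
    τ⁻¹ * cv (dts κ) r τ w z = ∑ j, r⁻¹ * cv (dxj κ j) r τ (B j) z + cv κ r τ f z := by
  have := W.ht _ (ps_cd h hr hτ z) (ps_cs h hr hτ z) ((ps_ts h hr hτ z).trans hU)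
  simp only [ps_dx h hr hτ, ps_dt h hr hτ] at this
  unfold cv
  have e1 : ∫ z₉, w z₉ * -(τ⁻¹ * kf (dts κ) r τ (z - z₉)) =
      -(τ⁻¹ * ∫ z₉, w z₉ * kf (dts κ) r τ (z - z₉)) := by
    rw [← integral_const_mul, ← integral_neg]; congr 1; ext y; ring
  have e2 : ∀ j, ∫ z₉, B j z₉ * -(r⁻¹ * kf (dxj κ j) r τ (z - z₉)) =
      -(r⁻¹ * ∫ z₉, B j z₉ * kf (dxj κ j) r τ (z - z₉)) := by
    intro j
    rw [← integral_const_mul, ← integral_neg]; congr 1; ext y; ring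
  rw [e1, Finset.sum_congr rfl (fun j _ ↦ e2 j)] at this
  rw [Finset.sum_neg_distrib] at this
  linarith

lemma cv_sum {m : Type*} (s : Finset m) (κ : m → Pt n → ℝ) (h : ∀ i, IsK (κ i)) {r τ : ℝ}
    (hr : 0 < r) (hτ : 0 < τ) {w : Pt n → ℝ} (hw : Integrable w) (z : Pt n) :
    cv (fun y ↦ -∑ i ∈ s, κ i y) r τ w z = -∑ i ∈ s, cv (κ i) r τ w z := by
  unfold cv
  rw [← integral_finsetSum s fun i _ ↦ cv_int (h i) hr hτ hw z, ← integral_neg]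
  congr 1; ext y
  simp only [kf]
  rw [← Finset.mul_sum, ← Finset.mul_sum]; ring

lemma cv_kR {κ : Pt n → ℝ} (h : IsK κ) {r τ : ℝ}
    (hr : 0 < r) (hτ : 0 < τ) {w : Pt n → ℝ} (hw : Integrable w) (z : Pt n) :
    cv (kR κ) r τ w z = -∑ j, cv (dxj (mulX κ j) j) r τ w z :=
  cv_sum Finset.univ (fun j ↦ dxj (mulX κ j) j) (fun j ↦ (h.mX j).dx j) hr hτ hw z

lemma cv_kT (κ : Pt n → ℝ) (r τ : ℝ) (w : Pt n → ℝ) (z : Pt n) :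
    cv (kT κ) r τ w z = - cv (dts (mulT κ)) r τ w z := by
  unfold cv
  rw [← integral_neg]
  congr 1; ext y; simp only [kf, kT]; ring

lemma WE.cvR {U : Set (Pt n)} {w f : Pt n → ℝ} {G B : Fin n → Pt n → ℝ} (W : WE U w G B f)
    {κ : Pt n → ℝ} (h : IsK κ) {r τ : ℝ} (hr : 0 < r) (hτ : 0 < τ) {z : Pt n}
    (hU : Cl z r τ ⊆ U) :
    r⁻¹ * cv (kR κ) r τ w z = -∑ j, cv (mulX κ j) r τ (G j) z := by
  rw [cv_kR h hr hτ W.iw, mul_neg, Finset.mul_sum]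
  congr 1
  exact Finset.sum_congr rfl fun j _ ↦ W.cvx (h.mX j) hr hτ hU j

lemma WE.cvT {U : Set (Pt n)} {w f : Pt n → ℝ} {G B : Fin n → Pt n → ℝ} (W : WE U w G B f)
    {κ : Pt n → ℝ} (h : IsK κ) {r τ : ℝ} (hr : 0 < r) (hτ : 0 < τ) {z : Pt n}
    (hU : Cl z r τ ⊆ U) :
    τ⁻¹ * cv (kT κ) r τ w z =
      -(∑ j, r⁻¹ * cv (dxj (mulT κ) j) r τ (B j) z + cv (mulT κ) r τ f z) := by
  rw [cv_kT, mul_neg, W.cvt h.mT hr hτ hU]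

lemma cv_cont {κ : Pt n → ℝ} (h : IsK κ) {r τ : ℝ}
    (hr : 0 < r) (hτ : 0 < τ) {w : Pt n → ℝ} (hw : Integrable w) :
    Continuous (cv κ r τ w) := by
  rw [continuous_iff_continuousAt]
  intro z
  have := (cv_cd h hw hr hτ z).continuousAt
  exact ContinuousAt.comp (f := fun z : Pt n ↦ (((r, τ), z) : (ℝ × ℝ) × Pt n)) this
    (by fun_prop)

lemma avg_tonelli {u : Pt n → ℝ≥0∞} (hu : Measurable u) {r τ : ℝ} (hr : 0 < r) (hτ : 0 < τ)
    {A A₉ : Set (Pt n)} (hA : MeasurableSet A) (hA₉ : MeasurableSet A₉)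
    (hAA : ∀ z ∈ A, Cl z r τ ⊆ A₉) :
    ∫⁻ z in A, (ofReal ((r ^ n * τ)⁻¹) * ∫⁻ y in Cl z r τ, u y) ≤
      ofReal (2 ^ (n + 1) * Vn n) * ∫⁻ y in A₉, u y := by
  have hmS : MeasurableSet {q : Pt n × Pt n | q.2 ∈ Cl q.1 r τ} := by
    have : IsClosed ({q : Pt n × Pt n | ‖q.1.1 - q.2.1‖ ≤ r} ∩ {q | |q.1.2 - q.2.2| ≤ τ}) :=
      (isClosed_le (by fun_prop) continuous_const).inter
        (isClosed_le (by fun_prop) continuous_const)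
    exact this.measurableSet
  have hm : Measurable fun q : Pt n × Pt n ↦
      {q : Pt n × Pt n | q.2 ∈ Cl q.1 r τ}.indicator (fun q ↦ u q.2) q :=
    (hu.comp measurable_snd).indicator hmS
  rw [lintegral_const_mul' _ _ ENNReal.ofReal_ne_top]
  have e1 : ∀ z ∈ A, ∫⁻ y in Cl z r τ, u y = ∫⁻ y in A₉,
      {q : Pt n × Pt n | q.2 ∈ Cl q.1 r τ}.indicator (fun q ↦ u q.2) (z, y) := by
    intro z hz
    rw [← lintegral_indicator (Cl_closed z r τ).measurableSet, ← lintegral_indicator hA₉]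
    congr 1; ext y
    by_cases hy : y ∈ Cl z r τ
    · rw [indicator_of_mem hy, indicator_of_mem (hAA z hz hy), indicator_of_mem]
      exact hy
    · rw [indicator_of_notMem hy]
      by_cases hy₉ : y ∈ A₉
      · rw [indicator_of_mem hy₉, indicator_of_notMem]
        exact hy
      · rw [indicator_of_notMem hy₉]
  rw [setLIntegral_congr_fun hA e1, lintegral_lintegral_swap hm.aemeasurable]
  calc _ ≤ ofReal ((r ^ n * τ)⁻¹) *
        ∫⁻ y in A₉, ofReal (2 ^ (n + 1) * Vn n * (r ^ n * τ)) * u y := by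
        gcongr with y
        calc _ ≤ ∫⁻ x, {q : Pt n × Pt n | q.2 ∈ Cl q.1 r τ}.indicator (fun q ↦ u q.2) (x, y) :=
              setLIntegral_le_lintegral _ _
          _ = ∫⁻ x, (Cl y r τ).indicator (fun _ ↦ u y) x := by
              congr 1; ext x
              have : y ∈ Cl x r τ ↔ x ∈ Cl y r τ := by
                simp only [Cl, mem_setOf_eq, norm_sub_rev x.1 y.1, abs_sub_comm x.2 y.2]
              by_cases hy : x ∈ Cl y r τ
              · rw [indicator_of_mem hy, indicator_of_mem]
                exact this.2 hy
              · rw [indicator_of_notMem hy, indicator_of_notMem]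
                exact fun h ↦ hy (this.1 h)
          _ = u y * volume (Cl y r τ) := by
              rw [lintegral_indicator (Cl_closed y r τ).measurableSet, setLIntegral_const]
          _ ≤ _ := by rw [mul_comm]; gcongr; exact Cl_vol y hr hτ
    _ = _ := by
        rw [lintegral_const_mul' _ _ ENNReal.ofReal_ne_top, ← mul_assoc,
          ← ENNReal.ofReal_mul (by positivity)]
        congr 2
        have : r ^ n * τ ≠ 0 := by positivity
        field_simp

instance ptHaar : (volume : Measure (Pt n)).IsAddHaarMeasure := by
  rw [Measure.volume_eq_prod]; infer_instance

def Ts (z₀ : Pt n) (a b : ℝ) (z : Pt n) : Pt n := (z₀.1 + a • z.1, z₀.2 + b * z.2)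

lemma Ts_cd (z₀ : Pt n) (a b : ℝ) : ContDiff ℝ (⊤ : ℕ∞) (Ts z₀ a b) := by
  unfold Ts
  exact (contDiff_const.add (contDiff_fst.const_smul a)).prodMk
    (contDiff_const.add (contDiff_const.mul contDiff_snd))

def Tsi (z₀ : Pt n) (a b : ℝ) : Pt n → Pt n := Ts (-(a⁻¹ • z₀.1), -(b⁻¹ * z₀.2)) a⁻¹ b⁻¹

lemma Ts_Tsi (z₀ : Pt n) {a b : ℝ} (ha : 0 < a) (hb : 0 < b) (z : Pt n) :
    Ts z₀ a b (Tsi z₀ a b z) = z := by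
  have := ha.ne'; have := hb.ne'
  unfold Ts Tsi Ts
  refine Prod.ext ?_ ?_
  · simp [smul_smul, smul_add, mul_inv_cancel₀, ha.ne']
  · simp; field_simp; ring

lemma Tsi_Ts (z₀ : Pt n) {a b : ℝ} (ha : 0 < a) (hb : 0 < b) (z : Pt n) :
    Tsi z₀ a b (Ts z₀ a b z) = z := by
  have := ha.ne'; have := hb.ne'
  unfold Tsi Ts
  refine Prod.ext ?_ ?_
  · simp [smul_smul, smul_add, inv_mul_cancel₀, ha.ne']
  · simp; field_simp; ring

def TsH (z₀ : Pt n) {a b : ℝ} (ha : 0 < a) (hb : 0 < b) : Pt n ≃ₜ Pt n where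
  toFun := Ts z₀ a b
  invFun := Tsi z₀ a b
  left_inv := Tsi_Ts z₀ ha hb
  right_inv := Ts_Tsi z₀ ha hb
  continuous_toFun := (Ts_cd _ _ _).continuous
  continuous_invFun := (Ts_cd _ _ _).continuous

lemma Ts_me (z₀ : Pt n) {a b : ℝ} (ha : 0 < a) (hb : 0 < b) : MeasurableEmbedding (Ts z₀ a b) :=
  (TsH z₀ ha hb).measurableEmbedding

lemma Ts_map (z₀ : Pt n) {a b : ℝ} (ha : 0 < a) (hb : 0 < b) :
    Measure.map (Ts z₀ a b) volume = ofReal ((a ^ n * b)⁻¹) • volume := by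
  have e : Ts z₀ a b = (fun z ↦ z₀ + z) ∘ (Prod.map (fun x : Spc n ↦ a • x) (fun t : ℝ ↦ b * t)) := by
    ext z <;> simp [Ts]
  rw [e, ← Measure.map_map (by fun_prop) (by fun_prop), Measure.volume_eq_prod,
    ← Measure.map_prod_map _ _ (by fun_prop) (by fun_prop), Real.map_volume_mul_left hb.ne',
    Measure.map_addHaar_smul _ ha.ne', Measure.prod_smul_right, Measure.prod_smul_left,
    ← Measure.volume_eq_prod, Measure.map_smul, Measure.map_smul,
    (measurePreserving_add_left (volume : Measure (Pt n)) z₀).map_eq, smul_smul, ← ENNReal.ofReal_mul (by positivity), finrank_euclideanSpace_fin,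
    abs_of_pos (by positivity), abs_of_pos (by positivity), mul_comm, mul_inv]

lemma Ts_int (z₀ : Pt n) {a b : ℝ} (ha : 0 < a) (hb : 0 < b) (f : Pt n → ℝ) :
    ∫ z, f (Ts z₀ a b z) = (a ^ n * b)⁻¹ * ∫ z, f z := by
  rw [← (Ts_me z₀ ha hb).integral_map, Ts_map z₀ ha hb, integral_smul_measure,
    ENNReal.toReal_ofReal (by positivity), smul_eq_mul]

lemma Ts_lint (z₀ : Pt n) {a b : ℝ} (ha : 0 < a) (hb : 0 < b) (f : Pt n → ℝ≥0∞) :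
    ∫⁻ z, f (Ts z₀ a b z) = ofReal ((a ^ n * b)⁻¹) * ∫⁻ z, f z := by
  rw [← (Ts_me z₀ ha hb).lintegral_map, Ts_map z₀ ha hb, lintegral_smul_measure, smul_eq_mul]

lemma Ts_vol (z₀ : Pt n) {a b : ℝ} (ha : 0 < a) (hb : 0 < b) (s : Set (Pt n)) :
    volume (Ts z₀ a b ⁻¹' s) = ofReal ((a ^ n * b)⁻¹) * volume s := by
  rw [← (Ts_me z₀ ha hb).map_apply, Ts_map z₀ ha hb, Measure.smul_apply, smul_eq_mul]

lemma Ts_ae (z₀ : Pt n) {a b : ℝ} (ha : 0 < a) (hb : 0 < b) {P : Pt n → Prop}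
    (h : ∀ᵐ z, P z) : ∀ᵐ z, P (Ts z₀ a b z) := by
  rw [ae_iff] at h ⊢
  have := Ts_vol z₀ ha hb {z | ¬ P z}
  rw [h, mul_zero] at this
  exact this

lemma Ts_integrable (z₀ : Pt n) {a b : ℝ} (ha : 0 < a) (hb : 0 < b) {f : Pt n → ℝ}
    (hf : Integrable f) : Integrable (fun z ↦ f (Ts z₀ a b z)) := by
  have := (Ts_me z₀ ha hb).integrable_map_iff (μ := volume) (g := f)
  rw [Ts_map z₀ ha hb] at this
  exact this.1 (hf.smul_measure ENNReal.ofReal_ne_top)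

lemma kf_intg (κ : Pt n → ℝ) {r τ : ℝ} (hr : 0 < r) (hτ : 0 < τ) :
    ∫ y, kf κ r τ y = ∫ y, κ y := by
  have := Ts_int (0 : Pt n) (inv_pos.2 hr) (inv_pos.2 hτ) κ
  have e : ∀ y, kf κ r τ y = (r ^ n * τ)⁻¹ * κ (Ts 0 r⁻¹ τ⁻¹ y) := by
    intro y; simp [kf, Dl, Ts]
  simp only [e]
  rw [integral_const_mul, this, inv_pow, ← mul_inv, inv_inv, ← mul_assoc,
    inv_mul_cancel₀ (by positivity), one_mul]

lemma cv_sub₉ {κ : Pt n → ℝ} (r τ : ℝ) (w : Pt n → ℝ) (z : Pt n) :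
    cv κ r τ w z = ∫ y, w (z - y) * kf κ r τ y := by
  unfold cv
  rw [← integral_sub_left_eq_self _ _ z]
  simp

lemma cv_lin {κ : Pt n → ℝ} (h : IsK κ) {r τ : ℝ} (hr : 0 < r) (hτ : 0 < τ)
    {w w₉ : Pt n → ℝ} (hw : Integrable w) (hw₉ : Integrable w₉) (z : Pt n) :
    cv κ r τ (fun z ↦ w z - w₉ z) z = cv κ r τ w z - cv κ r τ w₉ z := by
  unfold cv
  rw [← integral_sub (cv_int h hr hτ hw z) (cv_int h hr hτ hw₉ z)]
  congr 1; ext y; ring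

lemma cv_L1 {κ : Pt n → ℝ} (h : IsK κ) {C : ℝ} (hC : ∀ y, |κ y| ≤ C) {r τ : ℝ}
    (hr : 0 < r) (hτ : 0 < τ) {w : Pt n → ℝ} (hw : Integrable w) :
    ∫⁻ z, ‖cv κ r τ w z‖ₑ ≤ ofReal (C * (2 ^ (n + 1) * Vn n)) * ∫⁻ z, ‖w z‖ₑ := by
  have hC0 : 0 ≤ C := (abs_nonneg _).trans (hC 0)
  obtain ⟨g, hg, hle⟩ : ∃ g : Pt n → ℝ≥0∞, Measurable g ∧ (fun z ↦ ‖w z‖ₑ) =ᵐ[volume] g :=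
    ⟨_, hw.1.enorm.measurable_mk, hw.1.enorm.ae_eq_mk⟩
  calc _ ≤ ∫⁻ z in univ, ofReal C * (ofReal ((r ^ n * τ)⁻¹) * ∫⁻ y in Cl z r τ, g y) := by
        rw [setLIntegral_univ]
        refine lintegral_mono fun z ↦ (cv_bd h hC hr hτ w z).trans ?_
        rw [ENNReal.ofReal_mul hC0, mul_assoc, lintegral_congr_ae (ae_restrict_of_ae hle)]
    _ ≤ ofReal C * (ofReal (2 ^ (n + 1) * Vn n) * ∫⁻ y in univ, g y) := by
        rw [lintegral_const_mul' _ _ ENNReal.ofReal_ne_top]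
        gcongr
        exact avg_tonelli hg hr hτ MeasurableSet.univ MeasurableSet.univ fun _ _ ↦ subset_univ _
    _ = _ := by
        rw [setLIntegral_univ, ← lintegral_congr_ae hle, ENNReal.ofReal_mul hC0, mul_assoc]

lemma cv_tend_cc {κ : Pt n → ℝ} (h : IsK κ) {φ : Pt n → ℝ} (hφ : Continuous φ)
    (hc : HasCompactSupport φ) {r τ : ℕ → ℝ} (hr : ∀ k, 0 < r k) (hτ : ∀ k, 0 < τ k)
    (hr0 : Tendsto r atTop (𝓝 0)) (hτ0 : Tendsto τ atTop (𝓝 0)) :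
    Tendsto (fun k ↦ ∫⁻ z, ‖cv κ (r k) (τ k) φ z - (∫ y, κ y) * φ z‖ₑ) atTop (𝓝 0) := by
  obtain ⟨C, hC, hCb⟩ := h.bdd
  have huc := hc.uniformContinuous_of_continuous hφ
  have hφi : Integrable φ := hφ.integrable_of_hasCompactSupport hc
  obtain ⟨R, hR, hRs⟩ : ∃ R > 0, ∀ z, R < ‖z‖ → φ z = 0 := by
    obtain ⟨R, hR⟩ := (isBounded_iff_forall_norm_le.1 hc.isCompact.isBounded)
    refine ⟨max R 1, by positivity, fun z hz ↦ ?_⟩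
    by_contra h
    exact absurd (hR z (subset_tsupport _ h)) (not_le.2 ((le_max_left _ _).trans_lt hz))
  set M := volume (closedBall (0 : Pt n) (R + 1)) with hM
  have hMf : M ≠ ∞ := measure_closedBall_lt_top.ne
  rw [ENNReal.tendsto_nhds_zero]
  intro ε hε

  set CC : ℝ := C * (2 ^ (n + 1) * Vn n) with hCC
  have hVp := Vn_pos n
  have hCCp : 0 < CC := by positivity
  obtain ⟨e, he, heε⟩ : ∃ e : ℝ, 0 < e ∧ ofReal (CC * e) * M ≤ ε := by
    have : Tendsto (fun e : ℝ ↦ ofReal (CC * e) * M) (𝓝[>] 0) (𝓝 0) := by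
      have h1 : Tendsto (fun e : ℝ ↦ ofReal (CC * e)) (𝓝[>] 0) (𝓝 (ofReal (CC * 0))) :=
        (ENNReal.continuous_ofReal.comp (continuous_const.mul continuous_id)).continuousWithinAt
      have := ENNReal.Tendsto.mul_const (b := M) h1 (Or.inr hMf)
      simpa using this
    obtain ⟨e, h1, h2⟩ := ((ENNReal.tendsto_nhds_zero.1 this ε hε).and self_mem_nhdsWithin).exists
    exact ⟨e, h2, h1⟩
  obtain ⟨d, hd, hdu⟩ := Metric.uniformContinuous_iff.1 huc e he
  have hev : ∀ᶠ k in atTop, r k < min d 1 ∧ τ k < min d 1 :=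
    ((hr0.eventually_lt_const (by positivity)).and (hτ0.eventually_lt_const (by positivity)))
  filter_upwards [hev] with k hk
  have hpt : ∀ z, ‖cv κ (r k) (τ k) φ z - (∫ y, κ y) * φ z‖ₑ ≤
      (closedBall (0 : Pt n) (R + 1)).indicator (fun _ ↦ ofReal (CC * e)) z := by
    intro z
    have e1 : cv κ (r k) (τ k) φ z - (∫ y, κ y) * φ z =
        cv κ (r k) (τ k) ((Cl z (r k) (τ k)).indicator fun y ↦ φ y - φ z) z := by
      rw [← kf_intg κ (hr k) (hτ k), ← integral_sub_left_eq_self _ _ z, ← integral_mul_const]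
      unfold cv
      rw [← integral_sub (cv_int h (hr k) (hτ k) hφi z)]
      · congr 1; ext y
        by_cases hy : y ∈ Cl z (r k) (τ k)
        · rw [indicator_of_mem hy]; ring
        · rw [kf_zero h (hr k) (hτ k) hy]; ring
      · have := cv_int h (hr k) (hτ k)
          ((integrable_indicator_iff (Cl_closed z (r k) (τ k)).measurableSet).2
            (integrableOn_const (C := (1:ℝ)) (Cl_compact z (r k) (τ k)).measure_lt_top.ne)) z
        refine (this.mul_const (φ z)).congr (ae_of_all _ fun y ↦ ?_)
        by_cases hy : y ∈ Cl z (r k) (τ k)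
        · simp [indicator_of_mem hy]
        · simp [kf_zero h (hr k) (hτ k) hy]
    have hcl : ∀ y ∈ Cl z (r k) (τ k), dist y z < min d 1 := by
      intro y hy
      rw [dist_comm, dist_eq_norm, Prod.norm_def, max_lt_iff]
      exact ⟨hy.1.trans_lt hk.1, hy.2.trans_lt hk.2⟩
    by_cases hz : z ∈ closedBall (0 : Pt n) (R + 1)
    · rw [indicator_of_mem hz, e1]
      refine (cv_bd h hCb (hr k) (hτ k) _ z).trans ?_
      calc _ ≤ ofReal (C * (r k ^ n * τ k)⁻¹) * ∫⁻ y in Cl z (r k) (τ k), ofReal e := by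
            refine mul_le_mul_right (setLIntegral_mono measurable_const fun y hy ↦ ?_) _
            rw [indicator_of_mem hy, ← ofReal_norm]
            apply ENNReal.ofReal_le_ofReal
            have := hdu ((hcl y hy).trans_le (min_le_left _ _))
            rw [dist_eq_norm] at this
            exact this.le
        _ ≤ ofReal (C * (r k ^ n * τ k)⁻¹) * (ofReal e *
              ofReal (2 ^ (n + 1) * Vn n * (r k ^ n * τ k))) := by
            rw [setLIntegral_const]; gcongr; exact Cl_vol z (hr k) (hτ k)
        _ = _ := by
            have h1 := hr k; have h2 := hτ k
            rw [← ENNReal.ofReal_mul he.le, ← ENNReal.ofReal_mul (by positivity)]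
            congr 1
            have : r k ^ n * τ k ≠ 0 := by positivity
            rw [hCC]; field_simp
    · rw [indicator_of_notMem hz, e1]
      have : (Cl z (r k) (τ k)).indicator (fun y ↦ φ y - φ z) = fun _ ↦ 0 := by
        ext y
        by_cases hy : y ∈ Cl z (r k) (τ k)
        · rw [indicator_of_mem hy]
          have h1 := (hcl y hy).trans_le (min_le_right d 1)
          rw [mem_closedBall, dist_zero_right, not_le] at hz
          have h2 : ‖z‖ ≤ ‖y‖ + dist y z := by
            rw [dist_comm, dist_eq_norm]; linarith [norm_sub_norm_le z y]
          rw [hRs z (by linarith), hRs y (by linarith), sub_zero]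
        · rw [indicator_of_notMem hy]
      rw [this]; simp [cv]
  calc _ ≤ ∫⁻ z, (closedBall (0 : Pt n) (R + 1)).indicator (fun _ ↦ ofReal (CC * e)) z :=
        lintegral_mono hpt
    _ = ofReal (CC * e) * M := by
        rw [lintegral_indicator measurableSet_closedBall, setLIntegral_const]
    _ ≤ ε := heε

lemma cv_tend {κ : Pt n → ℝ} (h : IsK κ) {w : Pt n → ℝ} (hw : Integrable w)
    {r τ : ℕ → ℝ} (hr : ∀ k, 0 < r k) (hτ : ∀ k, 0 < τ k)
    (hr0 : Tendsto r atTop (𝓝 0)) (hτ0 : Tendsto τ atTop (𝓝 0)) :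
    Tendsto (fun k ↦ ∫⁻ z, ‖cv κ (r k) (τ k) w z - (∫ y, κ y) * w z‖ₑ) atTop (𝓝 0) := by
  obtain ⟨C, hC, hCb⟩ := h.bdd
  set CC : ℝ := C * (2 ^ (n + 1) * Vn n) with hCC
  set m := ∫ y, κ y
  set L : ℝ≥0∞ := ofReal CC + ‖m‖ₑ with hL
  have hLf : L ≠ ∞ := by simp [hL]
  rw [ENNReal.tendsto_nhds_zero]
  intro ε hε
  obtain ⟨e, he, hee⟩ : ∃ e : ℝ, 0 < e ∧ L * ofReal e ≤ ε / 2 := by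
    have : Tendsto (fun e : ℝ ↦ L * ofReal e) (𝓝[>] 0) (𝓝 0) := by
      have h1 : Tendsto (fun e : ℝ ↦ ofReal e) (𝓝[>] 0) (𝓝 (ofReal 0)) :=
        (ENNReal.continuous_ofReal).continuousWithinAt
      have := ENNReal.Tendsto.const_mul (a := L) h1 (Or.inr hLf)
      simpa using this
    obtain ⟨e, h1, h2⟩ := ((ENNReal.tendsto_nhds_zero.1 this (ε / 2)
      (ENNReal.half_pos hε.ne')).and self_mem_nhdsWithin).exists
    exact ⟨e, h2, h1⟩
  obtain ⟨φ, hφc, hφe, hφ, hφi⟩ := hw.exists_hasCompactSupport_integral_sub_le he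
  have hd : ∫⁻ z, ‖w z - φ z‖ₑ ≤ ofReal e := by
    have := ofReal_integral_norm_eq_lintegral_enorm (hw.sub hφi)
    simp only [Pi.sub_apply] at this
    rw [← this]
    exact ENNReal.ofReal_le_ofReal hφe
  filter_upwards [ENNReal.tendsto_nhds_zero.1 (cv_tend_cc h hφ hφc hr hτ hr0 hτ0) (ε / 2)
    (ENNReal.half_pos hε.ne')] with k hk
  have hm1 : AEMeasurable (fun z ↦ ‖cv κ (r k) (τ k) (fun z ↦ w z - φ z) z‖ₑ) :=
    (cv_cont h (hr k) (hτ k) (hw.sub hφi)).aestronglyMeasurable.enorm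
  have hm2 : AEMeasurable (fun z ↦ ‖m‖ₑ * ‖w z - φ z‖ₑ) := (hw.sub hφi).1.enorm.const_mul _
  calc _ ≤ ∫⁻ z, (‖cv κ (r k) (τ k) (fun z ↦ w z - φ z) z‖ₑ + ‖m‖ₑ * ‖w z - φ z‖ₑ
        + ‖cv κ (r k) (τ k) φ z - m * φ z‖ₑ) := by
        refine lintegral_mono fun z ↦ ?_
        have : cv κ (r k) (τ k) w z - m * w z = cv κ (r k) (τ k) (fun z ↦ w z - φ z) z +
            (-(m * (w z - φ z))) + (cv κ (r k) (τ k) φ z - m * φ z) := by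
          rw [cv_lin h (hr k) (hτ k) hw hφi]; ring
        simp only
        rw [this]
        refine (enorm_add_le _ _).trans ?_
        gcongr
        refine (enorm_add_le _ _).trans ?_
        rw [enorm_neg, enorm_mul]
    _ ≤ ofReal CC * ofReal e + ‖m‖ₑ * ofReal e + ε / 2 := by
        have hm3 : AEMeasurable (fun z ↦ ‖cv κ (r k) (τ k) (fun z ↦ w z - φ z) z‖ₑ + ‖m‖ₑ * ‖w z - φ z‖ₑ) :=
          hm1.add hm2
        rw [lintegral_add_left' hm3, lintegral_add_left' hm1,
          lintegral_const_mul' _ _ (by simp)]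
        gcongr
        exact (cv_L1 h hCb (hr k) (hτ k) (hw.sub hφi)).trans (mul_le_mul_right hd _)
    _ ≤ ε := by
        rw [← add_mul]
        calc _ ≤ ε / 2 + ε / 2 := by gcongr
          _ = ε := ENNReal.add_halves ε

lemma sub_ae {f : ℕ → Pt n → ℝ} {F : Pt n → ℝ} (hf : ∀ k, AEStronglyMeasurable (f k))
    (hF : AEStronglyMeasurable F)
    (h : Tendsto (fun k ↦ ∫⁻ z, ‖f k z - F z‖ₑ) atTop (𝓝 0)) :
    ∃ ns : ℕ → ℕ, StrictMono ns ∧ ∀ᵐ z, Tendsto (fun k ↦ f (ns k) z) atTop (𝓝 (F z)) := by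
  have : TendstoInMeasure volume f atTop F := by
    refine tendstoInMeasure_of_tendsto_eLpNorm (p := 1) one_ne_zero hf hF ?_
    simpa [eLpNorm_one_eq_lintegral_enorm] using h
  obtain ⟨ns, h1, h2⟩ := this.exists_seq_tendsto_ae
  exact ⟨ns, h1, h2⟩

def bmp (n : ℕ) : ContDiffBump (0 : Pt n) := ⟨1 / 2, 1, by norm_num, by norm_num⟩

def KK (n : ℕ) : Pt n → ℝ := (bmp n).normed volume

lemma KK_isK : IsK (KK n) where
  cd := (bmp n).contDiff_normed
  sp := by
    intro y hy
    have : y ∈ Function.support ((bmp n).normed volume) := hy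
    rw [(bmp n).support_normed_eq] at this
    rw [mem_ball, dist_zero_right] at this
    exact this.le

lemma KK_int : ∫ y, KK n y = 1 := (bmp n).integral_normed

lemma KK_nonneg (y : Pt n) : 0 ≤ KK n y := (bmp n).nonneg_normed y

lemma dx_int {κ : Pt n → ℝ} (h : IsK κ) (j : Fin n) : ∫ y, dxj κ j y = 0 := by
  have := integral_mul_fderiv_eq_neg_fderiv_mul_of_integrable (𝕜 := ℝ) (μ := (volume : Measure (Pt n)))
    (f := fun _ ↦ (1 : ℝ)) (g := κ) (v := (EuclideanSpace.single j 1, 0)) (by simp)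
    (by simp only [one_mul]
        exact (h.dx j).cd.continuous.integrable_of_hasCompactSupport (h.dx j).hcs)
    (by simpa using (h.cd.continuous.integrable_of_hasCompactSupport h.hcs)) (by simp)
    (fun x _ ↦ h.cd.differentiable (by simp) x)
  simpa [dxj] using this

def Av (g : Pt n → ℝ≥0∞) (σ : ℝ) (y : Pt n) : ℝ≥0∞ :=
  ofReal ((σ ^ n * σ ^ 2)⁻¹) * ∫⁻ z in Cl y σ (σ ^ 2), g z

lemma Av_meas {g : Pt n → ℝ≥0∞} (hg : Measurable g) (σ : ℝ) : Measurable (Av g σ) := by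
  unfold Av
  refine Measurable.const_mul ?_ _
  have hmS : MeasurableSet {q : Pt n × Pt n | q.2 ∈ Cl q.1 σ (σ ^ 2)} := by
    have : IsClosed ({q : Pt n × Pt n | ‖q.1.1 - q.2.1‖ ≤ σ} ∩ {q | |q.1.2 - q.2.2| ≤ σ ^ 2}) :=
      (isClosed_le (by fun_prop) continuous_const).inter
        (isClosed_le (by fun_prop) continuous_const)
    exact this.measurableSet
  have hm : Measurable fun q : Pt n × Pt n ↦
      {q : Pt n × Pt n | q.2 ∈ Cl q.1 σ (σ ^ 2)}.indicator (fun q ↦ g q.2) q :=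
    (hg.comp measurable_snd).indicator hmS
  have := hm.lintegral_prod_right' (ν := volume)
  convert this using 2 with y
  rw [← lintegral_indicator (Cl_closed y σ (σ ^ 2)).measurableSet]
  rfl

lemma Av_fin {g : Pt n → ℝ≥0∞} (hgi : ∫⁻ z, g z ≠ ∞) (σ : ℝ) (y : Pt n) : Av g σ y ≠ ∞ :=
  ENNReal.mul_ne_top ENNReal.ofReal_ne_top
    (ne_top_of_le_ne_top hgi (setLIntegral_le_lintegral _ _))

lemma Av_mono (g : Pt n → ℝ≥0∞) {σ s : ℝ} (hs : 0 < s) (h1 : s / 2 ≤ σ) (h2 : σ ≤ s) (y : Pt n) :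
    Av g σ y ≤ ofReal (2 ^ (n + 2)) * Av g s y := by
  have hσ : 0 < σ := by linarith
  unfold Av
  rw [← mul_assoc, ← ENNReal.ofReal_mul (by positivity)]
  gcongr
  · rw [← pow_add, ← pow_add, inv_le_iff_one_le_mul₀ (by positivity), mul_assoc, mul_comm,
      mul_assoc]
    rw [inv_mul_eq_div, le_div_iff₀ (by positivity), one_mul, ← mul_pow]
    exact pow_le_pow_left₀ hs.le (by linarith) _
  · intro z hz
    exact ⟨hz.1.trans h2, hz.2.trans (pow_le_pow_left₀ hσ.le h2 2)⟩

lemma Av_E {g : Pt n → ℝ≥0∞} {e y : Pt n} {σ : ℝ} (hσ : 0 < σ) (he : e ∉ Ob g)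
    (h : pd y e ≤ 5 * σ) : Av g σ y ≤ ofReal (7 ^ (n + 2) * Vn n) := by
  have hV := Vn_pos n
  have h1 : Cl y σ (σ ^ 2) ⊆ Qc e (7 * σ) :=
    (Cl_subQ y hσ).trans (Qc_mono (by linarith) (by linarith))
  have h2 := not_Ob he (y := e) (r := 7 * σ) (by linarith)
    ((mem_Qc₉ (by linarith)).2 (by rw [pd_self]; linarith))
  rw [vol_Qc e (by linarith)] at h2
  unfold Av
  calc _ ≤ ofReal ((σ ^ n * σ ^ 2)⁻¹) * ofReal ((7 * σ) ^ (n + 2) * Vn n) := by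
        gcongr; exact (lintegral_mono_set h1).trans h2
    _ = _ := by
        rw [← ENNReal.ofReal_mul (by positivity)]; congr 1
        rw [mul_pow, pow_add σ]
        have : σ ^ n * σ ^ 2 ≠ 0 := by positivity
        field_simp

structure Dat (g : Pt n → ℝ≥0∞) (w : Pt n → ℝ) (G B : Fin n → Pt n → ℝ) (f : Pt n → ℝ) : Prop where
  W : WE univ w G B f
  bw : ∀ᵐ z, ‖w z‖ₑ ≤ g z
  bG : ∀ j, ∀ᵐ z, ‖G j z‖ₑ ≤ g z
  bB : ∀ j, ∀ᵐ z, ‖B j z‖ₑ ≤ g z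
  bf : ∀ᵐ z, ‖f z‖ₑ ≤ g z

lemma cvb {g : Pt n → ℝ≥0∞} (hgi : ∫⁻ z, g z ≠ ∞) {κ : Pt n → ℝ} (h : IsK κ) {C : ℝ}
    (hC : ∀ y, |κ y| ≤ C) {w : Pt n → ℝ} (hw : ∀ᵐ z, ‖w z‖ₑ ≤ g z) {σ : ℝ} (hσ : 0 < σ)
    (y : Pt n) : |cv κ σ (σ ^ 2) w y| ≤ C * (Av g σ y).toReal := by
  have hC0 : 0 ≤ C := (abs_nonneg _).trans (hC 0)
  have := cv_bd h hC hσ (pow_pos hσ 2) w y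
  have h2 : ‖cv κ σ (σ ^ 2) w y‖ₑ ≤ ofReal C * Av g σ y := by
    refine this.trans ?_
    rw [ENNReal.ofReal_mul hC0, mul_assoc, Av]
    exact mul_le_mul_right (mul_le_mul_right (lintegral_mono_ae (ae_restrict_of_ae hw)) _) _
  have h3 := ENNReal.toReal_mono (ENNReal.mul_ne_top ENNReal.ofReal_ne_top (Av_fin hgi σ y)) h2
  rw [ENNReal.toReal_mul, ENNReal.toReal_ofReal hC0, toReal_enorm, Real.norm_eq_abs] at h3
  exact h3

lemma exC (n : ℕ) : ∃ C : ℝ, 1 ≤ C ∧ (∀ y, |KK n y| ≤ C) ∧ (∀ j y, |dxj (KK n) j y| ≤ C) ∧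
    (∀ j y, |mulX (KK n) j y| ≤ C) ∧ (∀ j y, |dxj (mulT (KK n)) j y| ≤ C) ∧
    (∀ y, |mulT (KK n) y| ≤ C) ∧ (∀ y, |kR (KK n) y| ≤ C) ∧ (∀ y, |kT (KK n) y| ≤ C) ∧
    (∀ y, |dts (KK n) y| ≤ C) := by
  have h := KK_isK (n := n)
  obtain ⟨C1, p1, h1⟩ := h.bdd
  choose C2 p2 h2 using fun j ↦ (h.dx j).bdd
  choose C3 p3 h3 using fun j ↦ (h.mX j).bdd
  choose C4 p4 h4 using fun j ↦ (h.mT.dx j).bdd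
  obtain ⟨C5, p5, h5⟩ := h.mT.bdd
  obtain ⟨C6, p6, h6⟩ := h.kR.bdd
  obtain ⟨C7, p7, h7⟩ := h.kT.bdd
  obtain ⟨C8, p8, h8⟩ := h.dt.bdd
  have s2 : ∀ j, C2 j ≤ ∑ j, C2 j := fun j ↦
    Finset.single_le_sum (fun i _ ↦ (p2 i).le) (Finset.mem_univ j)
  have s3 : ∀ j, C3 j ≤ ∑ j, C3 j := fun j ↦
    Finset.single_le_sum (fun i _ ↦ (p3 i).le) (Finset.mem_univ j)
  have s4 : ∀ j, C4 j ≤ ∑ j, C4 j := fun j ↦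
    Finset.single_le_sum (fun i _ ↦ (p4 i).le) (Finset.mem_univ j)
  have q2 : 0 ≤ ∑ j, C2 j := Finset.sum_nonneg fun i _ ↦ (p2 i).le
  have q3 : 0 ≤ ∑ j, C3 j := Finset.sum_nonneg fun i _ ↦ (p3 i).le
  have q4 : 0 ≤ ∑ j, C4 j := Finset.sum_nonneg fun i _ ↦ (p4 i).le
  refine ⟨1 + C1 + (∑ j, C2 j) + (∑ j, C3 j) + (∑ j, C4 j) + C5 + C6 + C7 + C8, by linarith,
    fun y ↦ (h1 y).trans (by linarith), fun j y ↦ (h2 j y).trans (by linarith [s2 j]),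
    fun j y ↦ (h3 j y).trans (by linarith [s3 j]), fun j y ↦ (h4 j y).trans (by linarith [s4 j]),
    fun y ↦ (h5 y).trans (by linarith), fun y ↦ (h6 y).trans (by linarith),
    fun y ↦ (h7 y).trans (by linarith), fun y ↦ (h8 y).trans (by linarith)⟩

def Ss (w : Pt n → ℝ) (σ : ℝ) (y : Pt n) : ℝ :=
  σ⁻¹ * (cv (kR (KK n)) σ (σ ^ 2) w y + 2 * cv (kT (KK n)) σ (σ ^ 2) w y)

lemma sum_bd (x : Fin n → ℝ) (c : ℝ) (h : ∀ j, |x j| ≤ c) : |∑ j, x j| ≤ n * c := by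
  refine (Finset.abs_sum_le_sum_abs _ _).trans ((Finset.sum_le_sum fun j _ ↦ h j).trans ?_)
  simp

lemma exB (n : ℕ) : ∃ C : ℝ, 1 ≤ C ∧ ∀ (g : Pt n → ℝ≥0∞), ∫⁻ z, g z ≠ ∞ →
    ∀ w G B f, Dat g w G B f → ∀ σ > 0, ∀ y,
      |Ss w σ y| ≤ C * (Av g σ y).toReal ∧
      |(σ ^ 2)⁻¹ * cv (dts (KK n)) σ (σ ^ 2) w y| ≤ σ⁻¹ * (C * (Av g σ y).toReal) ∧
      (∀ j, |cv (KK n) σ (σ ^ 2) (G j) y| ≤ C * (Av g σ y).toReal) ∧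
      |cv (KK n) σ (σ ^ 2) w y| ≤ C * (Av g σ y).toReal := by
  obtain ⟨C, hC, c1, c2, c3, c4, c5, c6, c7, c8⟩ := exC n
  have h := KK_isK (n := n)
  refine ⟨(3 * n + 3) * C, by nlinarith [(Nat.cast_nonneg n : (0:ℝ) ≤ n)], ?_⟩
  intro g hgi w G B f D σ hσ y
  set a := (Av g σ y).toReal with ha
  have ha0 : 0 ≤ a := ENNReal.toReal_nonneg
  have hCa : 0 ≤ C * a := by positivity
  have hn0 : (0:ℝ) ≤ n := Nat.cast_nonneg n
  have hna : 0 ≤ n * (C * a) := by positivity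
  have σ2 : 0 < σ ^ 2 := by positivity
  have i0 : 0 < σ⁻¹ := by positivity
  refine ⟨?_, ?_, ?_, ?_⟩
  · by_cases h1 : σ ≤ 1
    · have e1 := D.W.cvR h hσ σ2 (subset_univ (Cl y σ (σ ^ 2)))
      have e2 := D.W.cvT h hσ σ2 (subset_univ (Cl y σ (σ ^ 2)))
      have e3 : Ss w σ y = -∑ j, cv (mulX (KK n) j) σ (σ ^ 2) (G j) y
          + 2 * (-(∑ j, cv (dxj (mulT (KK n)) j) σ (σ ^ 2) (B j) y
              + σ * cv (mulT (KK n)) σ (σ ^ 2) f y)) := by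
        rw [← Finset.mul_sum] at e2
        have e2₉ : σ⁻¹ * cv (kT (KK n)) σ (σ ^ 2) w y = σ * ((σ ^ 2)⁻¹ * cv (kT (KK n)) σ (σ ^ 2) w y) := by
          field_simp
        rw [Ss, mul_add, e1, mul_left_comm, e2₉, e2]
        field_simp
      have b1 := sum_bd _ _ fun j ↦ cvb hgi (h.mX j) (c3 j) (D.bG j) hσ y
      have b2 := sum_bd _ _ fun j ↦ cvb hgi (h.mT.dx j) (c4 j) (D.bB j) hσ y
      have b3 := cvb hgi h.mT c5 D.bf hσ y
      have b4 : |σ * cv (mulT (KK n)) σ (σ ^ 2) f y| ≤ C * a := by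
        rw [abs_mul, abs_of_pos hσ]; nlinarith [abs_nonneg (cv (mulT (KK n)) σ (σ ^ 2) f y)]
      rw [e3]
      rw [abs_le] at *
      constructor <;> nlinarith
    · have b1 := cvb hgi h.kR c6 D.bw hσ y
      have b2 := cvb hgi h.kT c7 D.bw hσ y
      have i1 : σ⁻¹ ≤ 1 := inv_le_one_of_one_le₀ (by linarith)
      rw [Ss, abs_mul, abs_of_pos i0]
      have : |cv (kR (KK n)) σ (σ ^ 2) w y + 2 * cv (kT (KK n)) σ (σ ^ 2) w y| ≤ 3 * (C * a) := by
        rw [abs_le] at *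
        constructor <;> nlinarith
      nlinarith [abs_nonneg (cv (kR (KK n)) σ (σ ^ 2) w y + 2 * cv (kT (KK n)) σ (σ ^ 2) w y)]
  · by_cases h1 : σ ≤ 1
    · rw [D.W.cvt h hσ σ2 (subset_univ _), ← Finset.mul_sum]
      have b1 := sum_bd _ _ fun j ↦ cvb hgi (h.dx j) (c2 j) (D.bB j) hσ y
      have b2 := cvb hgi h c1 D.bf hσ y
      have i1 : 1 ≤ σ⁻¹ := (one_le_inv₀ hσ).2 h1
      have e : σ⁻¹ * ∑ j, cv (dxj (KK n) j) σ (σ ^ 2) (B j) y + cv (KK n) σ (σ ^ 2) f y =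
          σ⁻¹ * (∑ j, cv (dxj (KK n) j) σ (σ ^ 2) (B j) y + σ * cv (KK n) σ (σ ^ 2) f y) := by
        field_simp
      rw [e, abs_mul, abs_of_pos i0]
      gcongr
      have b4 : |σ * cv (KK n) σ (σ ^ 2) f y| ≤ C * a := by
        rw [abs_mul, abs_of_pos hσ]; nlinarith [abs_nonneg (cv (KK n) σ (σ ^ 2) f y)]
      rw [abs_le] at *
      constructor <;> nlinarith
    · have b1 := cvb hgi h.dt c8 D.bw hσ y
      have i1 : σ⁻¹ ≤ 1 := inv_le_one_of_one_le₀ (by linarith)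
      have : (σ ^ 2)⁻¹ ≤ σ⁻¹ := by
        rw [pow_two, mul_inv]; nlinarith
      rw [abs_mul, abs_of_pos (by positivity)]
      gcongr
      nlinarith
  · intro j
    have b2 := cvb hgi h c1 (D.bG j) hσ y
    nlinarith
  · have b2 := cvb hgi h c1 D.bw hσ y
    nlinarith

lemma w1_fd {w : Pt n → ℝ} (hw : Integrable w) {m : Pt n → ℝ} (hm : ContDiff ℝ (⊤ : ℕ∞) m)
    (hp : ∀ z, 0 < m z) :
    ContDiff ℝ (⊤ : ℕ∞) (fun z ↦ cv (KK n) (m z) (m z ^ 2) w z) ∧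
    ∀ z v, fderiv ℝ (fun z ↦ cv (KK n) (m z) (m z ^ 2) w z) z v =
      fderiv ℝ m z v * Ss w (m z) z +
      ∑ j, v.1 j * ((m z)⁻¹ * cv (dxj (KK n) j) (m z) (m z ^ 2) w z) +
      v.2 * ((m z ^ 2)⁻¹ * cv (dts (KK n)) (m z) (m z ^ 2) w z) := by
  have h := KK_isK (n := n)
  have hP : ContDiff ℝ (⊤ : ℕ∞) (fun z : Pt n ↦ (((m z, m z ^ 2), z) : (ℝ × ℝ) × Pt n)) :=
    (hm.prodMk (hm.pow 2)).prodMk contDiff_id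
  constructor
  · rw [contDiff_iff_contDiffAt]
    intro z
    exact ContDiffAt.comp (f := fun z : Pt n ↦ (((m z, m z ^ 2), z) : (ℝ × ℝ) × Pt n)) z
      (cv_cd h hw (hp z) (pow_pos (hp z) 2) z) hP.contDiffAt
  · intro z v
    have hd := ((cv_cd h hw (hp z) (pow_pos (hp z) 2) z).differentiableAt (by simp)).hasFDerivAt
    have hmd : HasFDerivAt m (fderiv ℝ m z) z := (hm.differentiable (by simp) z).hasFDerivAt
    have h1 := ((hmd.prodMk (hmd.pow 2)).prodMk (hasFDerivAt_id z))
    have h2 := (HasFDerivAt.comp (f := fun z : Pt n ↦ (((m z, m z ^ 2), z) : (ℝ × ℝ) × Pt n))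
      z hd h1).fderiv
    have e : ((fun q : (ℝ × ℝ) × Pt n ↦ cv (KK n) q.1.1 q.1.2 w q.2) ∘
      fun z : Pt n ↦ (((m z, m z ^ 2), z) : (ℝ × ℝ) × Pt n)) =
      fun z ↦ cv (KK n) (m z) (m z ^ 2) w z := rfl
    rw [e] at h2
    rw [h2, ContinuousLinearMap.comp_apply, cv_fd h hw (hp z) (pow_pos (hp z) 2)]
    have := (hp z).ne'
    simp [Ss]
    field_simp

lemma W_deriv {w : Pt n → ℝ} (hw : Integrable w) {σ : ℝ} (hσ : 0 < σ) (y : Pt n) :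
    HasDerivAt (fun s ↦ cv (KK n) s (s ^ 2) w y) (Ss w σ y) σ := by
  have h := KK_isK (n := n)
  have hd := ((cv_cd h hw hσ (pow_pos hσ 2) y).differentiableAt (by simp)).hasFDerivAt
  have h1 : HasDerivAt (fun s : ℝ ↦ (((s, s ^ 2), y) : (ℝ × ℝ) × Pt n)) ((1, 2 * σ), 0) σ := by
    refine HasDerivAt.prodMk (HasDerivAt.prodMk (hasDerivAt_id σ) ?_) (hasDerivAt_const σ y)
    simpa using hasDerivAt_pow 2 σ
  have h2 := HasFDerivAt.comp_hasDerivAt (f := fun s : ℝ ↦ (((s, s ^ 2), y) : (ℝ × ℝ) × Pt n)) σ hd h1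
  rw [cv_fd h hw hσ (pow_pos hσ 2)] at h2
  refine h2.congr_deriv ?_
  simp [Ss]
  field_simp

lemma W_mvt {w : Pt n → ℝ} (hw : Integrable w) {s t M : ℝ} (hs : 0 < s) (hst : s ≤ t) (y : Pt n)
    (hM : ∀ σ ∈ Icc s t, |Ss w σ y| ≤ M) :
    |cv (KK n) t (t ^ 2) w y - cv (KK n) s (s ^ 2) w y| ≤ M * (t - s) := by
  have := (convex_Icc s t).norm_image_sub_le_of_norm_hasDerivWithin_le (C := M)
    (f := fun s ↦ cv (KK n) s (s ^ 2) w y) (f' := fun σ ↦ Ss w σ y)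
    (fun x hx ↦ (W_deriv hw (hs.trans_le hx.1) y).hasDerivWithinAt)
    (fun x hx ↦ hM x hx) (left_mem_Icc.2 hst) (right_mem_Icc.2 hst)
  simpa [abs_of_nonneg (sub_nonneg.2 hst)] using this

lemma md_cont {E : Set (Pt n)} (hE : E.Nonempty) {ε : ℝ} (hε : 0 < ε) : Continuous (md E ε) := by
  rw [continuous_iff_continuousAt]
  intro z
  rw [ContinuousAt, tendsto_iff_dist_tendsto_zero]
  have h1 : Tendsto (fun y : Pt n ↦ ‖z.1 - y.1‖ + |z.2 - y.2| / md E ε z) (𝓝 z) (𝓝 0) := by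
    have : Continuous (fun y : Pt n ↦ ‖z.1 - y.1‖ + |z.2 - y.2| / md E ε z) := by fun_prop
    simpa using this.tendsto z
  refine squeeze_zero (fun _ ↦ dist_nonneg) (fun y ↦ ?_) h1
  rw [dist_comm, Real.dist_eq]
  exact md_lip hE hε z y

lemma md_ge (E : Set (Pt n)) (ε : ℝ) (z : Pt n) : ε ≤ md E ε z := le_max_left _ _

lemma md_pd {E : Set (Pt n)} (hE : E.Nonempty) (ε : ℝ) (z y : Pt n) :
    |md E ε z - md E ε y| ≤ pd z y := by
  have h1 := dE_lip hE z y
  have h2 := dE_lip hE y z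
  rw [pd_comm y z] at h2
  refine (abs_max_sub_max_le_max _ _ _ _).trans ?_
  rw [sub_self, abs_zero, max_eq_right (abs_nonneg _), abs_le]
  constructor <;> linarith

lemma md_int {E : Set (Pt n)} (hE : E.Nonempty) (hc : IsClosed E) (hv : volume Eᶜ ≠ ∞)
    {ε : ℝ} (hε : 0 < ε) : Integrable (fun z ↦ md E ε z - ε) := by
  obtain ⟨R, hR⟩ := dE_bound hE hc hv
  have hs : (fun z ↦ md E ε z - ε) = Eᶜ.indicator (fun z ↦ md E ε z - ε) := by
    ext z
    by_cases hz : z ∈ E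
    · rw [indicator_of_notMem (by simpa using hz), md, dE_zero hz, max_eq_left hε.le, sub_self]
    · rw [indicator_of_mem hz]
  rw [hs, integrable_indicator_iff hc.isOpen_compl.measurableSet]
  refine Measure.integrableOn_of_bounded (M := max ε R + ε) hv
    ((md_cont hE hε).sub continuous_const).aestronglyMeasurable (ae_of_all _ fun z ↦ ?_)
  rw [Real.norm_eq_abs, abs_le]
  have : md E ε z ≤ max ε R := max_le_max le_rfl (hR z)
  have := md_ge E ε z
  constructor <;> linarith

lemma kf_one {r τ : ℝ} (hr : 0 < r) (hτ : 0 < τ) : ∫ y, kf (KK n) r τ y = 1 := by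
  rw [kf_intg _ hr hτ, KK_int]

lemma kf_integrable {κ : Pt n → ℝ} (h : IsK κ) {r τ : ℝ} (hr : 0 < r) (hτ : 0 < τ) :
    Integrable (kf κ r τ) :=
  by_contra fun hn ↦ by
    have := ps_cd h hr hτ (0 : Pt n)
    have h2 := this.continuous.integrable_of_hasCompactSupport (ps_cs h hr hτ 0) (μ := volume)
    exact hn (by simpa using h2.comp_neg)

lemma mt_spec {E : Set (Pt n)} (hE : E.Nonempty) (hc : IsClosed E) (hv : volume Eᶜ ≠ ∞)
    {ε : ℝ} (hε : 0 < ε) : ∃ m : Pt n → ℝ, ContDiff ℝ (⊤ : ℕ∞) m ∧ (∀ z, ε ≤ m z) ∧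
      (∀ z, 9 / 10 * md E ε z ≤ m z ∧ m z ≤ 11 / 10 * md E ε z) ∧ (∀ z ∈ E, m z = ε) ∧
      ∀ z v, |fderiv ℝ m z v| ≤ ‖v.1‖ + |v.2| * (2 / m z) := by
  have h := KK_isK (n := n)
  set r := ε / 10 with hr₉
  have hr : 0 < r := by positivity
  have hr2 : 0 < r ^ 2 := by positivity
  have hI := md_int hE hc hv hε
  set m : Pt n → ℝ := fun z ↦ ε + cv (KK n) r (r ^ 2) (fun z ↦ md E ε z - ε) z with hm
  have hkp : ∀ y, 0 ≤ kf (KK n) r (r ^ 2) y := fun y ↦ by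
    unfold kf; exact mul_nonneg (by positivity) (KK_nonneg _)
  have hki := kf_integrable h hr hr2
  have hints : ∀ z, Integrable (fun y ↦ (md E ε (z - y) - ε) * kf (KK n) r (r ^ 2) y) := by
    intro z
    have := (cv_int h hr hr2 hI z).comp_sub_left z
    simpa using this
  have hmz : ∀ z, m z = ε + ∫ y, (md E ε (z - y) - ε) * kf (KK n) r (r ^ 2) y := by
    intro z; simp only [hm]; rw [cv_sub₉]
  have hsup : ∀ z y, kf (KK n) r (r ^ 2) y ≠ 0 → pd (z - y) z ≤ r := by
    intro z y hy
    by_contra hn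
    apply hy
    have : z - (z - y) = y := by abel
    rw [← this]
    refine kf_zero h hr hr2 fun hcl ↦ hn ?_
    rw [pd_comm, pd]
    refine max_le hcl.1 (Real.sqrt_le_iff.2 ⟨hr.le, hcl.2⟩)
  have hd : ∀ z c, m z - c = ∫ y, (md E ε (z - y) - c) * kf (KK n) r (r ^ 2) y := by
    intro z c
    rw [hmz z]
    have : ∫ y, (md E ε (z - y) - c) * kf (KK n) r (r ^ 2) y =
        ∫ y, ((md E ε (z - y) - ε) * kf (KK n) r (r ^ 2) y + (ε - c) * kf (KK n) r (r ^ 2) y) := by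
      congr 1; ext y; ring
    rw [this, integral_add (hints z) (hki.const_mul _), integral_const_mul, kf_one hr hr2]
    ring
  have hclose : ∀ z, |m z - md E ε z| ≤ r := by
    intro z
    rw [hd z (md E ε z)]
    calc _ ≤ ∫ y, |(md E ε (z - y) - md E ε z) * kf (KK n) r (r ^ 2) y| := abs_integral_le_integral_abs
      _ ≤ ∫ y, r * kf (KK n) r (r ^ 2) y := by
          refine integral_mono_of_nonneg (ae_of_all _ fun _ ↦ abs_nonneg _) (hki.const_mul _)
            (ae_of_all _ fun y ↦ ?_)
          simp only
          rw [abs_mul, abs_of_nonneg (hkp y)]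
          by_cases hy : kf (KK n) r (r ^ 2) y = 0
          · rw [hy]; simp
          · exact mul_le_mul_of_nonneg_right ((md_pd hE ε _ _).trans (hsup z y hy)) (hkp y)
      _ = r := by rw [integral_const_mul, kf_one hr hr2, mul_one]
  have hcmp : ∀ z, 9 / 10 * md E ε z ≤ m z ∧ m z ≤ 11 / 10 * md E ε z := by
    intro z
    have h1 := abs_le.1 (hclose z)
    have h2 := md_ge E ε z
    constructor <;> linarith [h1.1, h1.2]
  have hge : ∀ z, ε ≤ m z := by
    intro z
    rw [hmz z]
    have : 0 ≤ ∫ y, (md E ε (z - y) - ε) * kf (KK n) r (r ^ 2) y :=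
      integral_nonneg fun y ↦ mul_nonneg (sub_nonneg.2 (md_ge _ _ _)) (hkp y)
    linarith
  have hcd : ContDiff ℝ (⊤ : ℕ∞) m := by
    refine contDiff_const.add (contDiff_iff_contDiffAt.2 fun z ↦ ?_)
    exact ContDiffAt.comp (f := fun z : Pt n ↦ (((r, r ^ 2), z) : (ℝ × ℝ) × Pt n)) z
      (cv_cd h hI hr hr2 z) (contDiff_const.prodMk contDiff_id).contDiffAt
  refine ⟨m, hcd, hge, hcmp, ?_, ?_⟩
  · intro z hz
    rw [hmz z]
    have : ∀ y, (md E ε (z - y) - ε) * kf (KK n) r (r ^ 2) y = 0 := by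
      intro y
      by_cases hy : kf (KK n) r (r ^ 2) y = 0
      · rw [hy, mul_zero]
      · have h1 := hsup z y hy
        have h2 := dE_lip hE (z - y) z
        rw [dE_zero hz] at h2
        rw [md, max_eq_left (by linarith), sub_self, zero_mul]
    simp [this]
  · intro z v
    have hmp : 0 < m z := hε.trans_le (hge z)
    have hl : HasDerivAt (fun t : ℝ ↦ m (z + t • v)) (fderiv ℝ m z v) 0 := by
      have h1 : HasFDerivAt m (fderiv ℝ m z) (z + (0 : ℝ) • v) := by
        simpa using (hcd.differentiable (by simp) z).hasFDerivAt
      have h2 : HasDerivAt (fun t : ℝ ↦ z + t • v) v 0 := by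
        simpa using ((hasDerivAt_id (0 : ℝ)).smul_const v).const_add z
      exact h1.comp_hasDerivAt (0 : ℝ) h2
    have hC0 : 0 ≤ ‖v.1‖ + |v.2| * (2 / m z) := by positivity
    refine hl.le_of_lip' hC0 (Eventually.of_forall fun t ↦ ?_)
    simp only [zero_smul, add_zero, sub_zero, Real.norm_eq_abs]
    have e : m (z + t • v) - m z = ∫ y, (md E ε (z + t • v - y) - md E ε (z - y)) * kf (KK n) r (r ^ 2) y := by
      rw [hmz, hmz, add_sub_add_left_eq_sub, ← integral_sub (hints _) (hints _)]
      congr 1; ext y; ring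
    rw [e]
    calc _ ≤ ∫ y, |(md E ε (z + t • v - y) - md E ε (z - y)) * kf (KK n) r (r ^ 2) y| :=
          abs_integral_le_integral_abs
      _ ≤ ∫ y, ((‖v.1‖ + |v.2| * (2 / m z)) * |t|) * kf (KK n) r (r ^ 2) y := by
          refine integral_mono_of_nonneg (ae_of_all _ fun _ ↦ abs_nonneg _) (hki.const_mul _)
            (ae_of_all _ fun y ↦ ?_)
          simp only
          rw [abs_mul, abs_of_nonneg (hkp y)]
          by_cases hy : kf (KK n) r (r ^ 2) y = 0
          · rw [hy]; simp
          · refine mul_le_mul_of_nonneg_right ?_ (hkp y)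
            have h1 := md_lip hE hε (z - y) (z + t • v - y)
            rw [abs_sub_comm] at h1
            refine h1.trans ?_
            have e1 : (z - y).1 - (z + t • v - y).1 = -(t • v.1) := by simp
            have e2 : (z - y).2 - (z + t • v - y).2 = -(t * v.2) := by simp
            rw [e1, e2, norm_neg, abs_neg, norm_smul, abs_mul, Real.norm_eq_abs]
            have h3 := abs_le.1 ((md_pd hE ε (z - y) z).trans (hsup z y hy))
            have h4 := md_ge E ε z
            have h5 : m z / 2 ≤ md E ε (z - y) := by linarith [h3.1, (hcmp z).2]
            have h6 : |t| * |v.2| / md E ε (z - y) ≤ |t| * |v.2| / (m z / 2) := by gcongr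
            calc _ ≤ |t| * ‖v.1‖ + |t| * |v.2| / (m z / 2) := by linarith
              _ = _ := by field_simp
      _ = _ := by rw [integral_const_mul, kf_one hr hr2, mul_one]

lemma tele {C : ℝ} (hC0 : 0 ≤ C) {g : Pt n → ℝ≥0∞} (hgi : ∫⁻ z, g z ≠ ∞) {w : Pt n → ℝ}
    (hw : Integrable w) (hS : ∀ σ > 0, ∀ y, |Ss w σ y| ≤ C * (Av g σ y).toReal) {s : ℝ}
    (hs : 0 < s) :
    ∀ᵐ y, ‖w y - cv (KK n) s (s ^ 2) w y‖ₑ ≤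
      ∑' k : ℕ, ofReal (C * 2 ^ (n + 2) * s * (1 / 2) ^ k) * Av g (s * (1 / 2) ^ k) y := by
  have h := KK_isK (n := n)
  have hσ : ∀ k : ℕ, 0 < s * (1 / 2) ^ k := fun k ↦ by positivity
  have t0 : Tendsto (fun k : ℕ ↦ s * (1 / 2 : ℝ) ^ k) atTop (𝓝 0) := by
    simpa using (tendsto_pow_atTop_nhds_zero_of_lt_one (by norm_num : (0:ℝ) ≤ 1 / 2)
      (by norm_num)).const_mul s
  have t1 : Tendsto (fun k : ℕ ↦ (s * (1 / 2 : ℝ) ^ k) ^ 2) atTop (𝓝 0) := by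
    simpa using t0.pow 2
  have hT := cv_tend h hw hσ (fun k ↦ pow_pos (hσ k) 2) t0 t1
  simp only [KK_int, one_mul] at hT
  obtain ⟨ns, hns, hae⟩ := sub_ae (fun k ↦ (cv_cont h (hσ k) (pow_pos (hσ k) 2)
    hw).aestronglyMeasurable) hw.1 hT
  filter_upwards [hae] with y hy
  set V : ℕ → ℝ := fun k ↦ cv (KK n) (s * (1 / 2) ^ k) ((s * (1 / 2) ^ k) ^ 2) w y with hV
  have hstep : ∀ k, ‖V (k + 1) - V k‖ₑ ≤
      ofReal (C * 2 ^ (n + 2) * s * (1 / 2) ^ k) * Av g (s * (1 / 2) ^ k) y := by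
    intro k
    have h2 : s * (1 / 2) ^ (k + 1) = (s * (1 / 2) ^ k) / 2 := by rw [pow_succ]; ring
    have hle : (s * (1 / 2) ^ k) / 2 ≤ s * (1 / 2) ^ k := by linarith [hσ k]
    have := W_mvt hw (half_pos (hσ k)) hle y (M := C * (2 ^ (n + 2) * (Av g (s * (1 / 2) ^ k) y).toReal))
      (fun σ hσ₉ ↦ (hS σ (by linarith [hσ₉.1, hσ k]) y).trans (by
        gcongr
        have h3 := ENNReal.toReal_mono (ENNReal.mul_ne_top ENNReal.ofReal_ne_top (Av_fin hgi _ _))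
          (Av_mono g (hσ k) hσ₉.1 hσ₉.2 y)
        rwa [ENNReal.toReal_mul, ENNReal.toReal_ofReal (by positivity)] at h3))
    simp only [hV]
    rw [h2, enorm_sub_rev, ← ofReal_norm, Real.norm_eq_abs, ← ENNReal.ofReal_toReal (Av_fin hgi (s * (1 / 2) ^ k) y),
      ← ENNReal.ofReal_mul (by positivity)]
    refine ENNReal.ofReal_le_ofReal (this.trans ?_)
    have h4 : (0:ℝ) ≤ (Av g (s * (1 / 2) ^ k) y).toReal := ENNReal.toReal_nonneg
    have h5 : 0 ≤ C * (2 ^ (n + 2) * (Av g (s * (1 / 2) ^ k) y).toReal) * (s * (1 / 2) ^ k) := by positivity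
    nlinarith
  have hpart : ∀ k, ‖V k - V 0‖ₑ ≤ ∑' k : ℕ,
      ofReal (C * 2 ^ (n + 2) * s * (1 / 2) ^ k) * Av g (s * (1 / 2) ^ k) y := by
    intro k
    refine le_trans ?_ (ENNReal.sum_le_tsum (Finset.range k))
    rw [← Finset.sum_range_sub]
    exact (enorm_sum_le _ _).trans (Finset.sum_le_sum fun i _ ↦ hstep i)
  have hV0 : V 0 = cv (KK n) s (s ^ 2) w y := by simp [hV]
  rw [← hV0]
  have : Tendsto (fun k ↦ ‖V (ns k) - V 0‖ₑ) atTop (𝓝 ‖w y - V 0‖ₑ) :=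
    (hy.sub_const _).enorm
  exact le_of_tendsto' this fun k ↦ hpart _

lemma ofReal_geom (a : ℝ) (ha : 0 ≤ a) :
    ∑' k : ℕ, ofReal (a * (1 / 2) ^ k) = ofReal (2 * a) := by
  rw [← ENNReal.ofReal_tsum_of_nonneg (fun k ↦ by positivity)
    ((summable_geometric_of_lt_one (by norm_num) (by norm_num)).mul_left a), tsum_mul_left,
    tsum_geometric_two, mul_comm]

structure MT (E : Set (Pt n)) (ε : ℝ) (m : Pt n → ℝ) : Prop where
  cd : ContDiff ℝ (⊤ : ℕ∞) m
  ge : ∀ z, ε ≤ m z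
  bd : ∀ z, 9 / 10 * md E ε z ≤ m z ∧ m z ≤ 11 / 10 * md E ε z
  eq : ∀ z ∈ E, m z = ε
  fd : ∀ z v, |fderiv ℝ m z v| ≤ ‖v.1‖ + |v.2| * (2 / m z)

lemma Ob_near {g : Pt n → ℝ≥0∞} (hE : ((Ob g)ᶜ).Nonempty) {z : Pt n} {r : ℝ}
    (h : dE (Ob g)ᶜ z < 5 * r) (hr : 0 < r) :
    (Av g r z) ≤ ofReal (7 ^ (n + 2) * Vn n) := by
  obtain ⟨e, he, h1⟩ := dE_lt hE h
  exact Av_E hr he h1.le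

lemma Ob_near₉ {g : Pt n → ℝ≥0∞} (hE : ((Ob g)ᶜ).Nonempty) {z : Pt n} {r : ℝ}
    (h : dE (Ob g)ᶜ z < 5 * r) (hr : 0 < r) :
    (Av g r z).toReal ≤ 7 ^ (n + 2) * Vn n := by
  have := Vn_pos n
  exact ENNReal.toReal_le_of_le_ofReal (by positivity) (Ob_near hE h hr)

lemma MT.near {E : Set (Pt n)} {ε : ℝ} {m : Pt n → ℝ} (hm : MT E ε m) (hε : 0 < ε) (z : Pt n) :
    dE E z < 5 * m z := by
  have h1 := (hm.bd z).1
  have h2 : dE E z ≤ md E ε z := le_max_right _ _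
  have h3 := md_ge E ε z
  linarith

lemma w1_bounds {C : ℝ} (hC1 : 1 ≤ C) {g : Pt n → ℝ≥0∞} (hgi : ∫⁻ z, g z ≠ ∞) {w : Pt n → ℝ}
    {G B : Fin n → Pt n → ℝ} {f : Pt n → ℝ} (D : Dat g w G B f)
    (hC : ∀ σ > 0, ∀ y, |Ss w σ y| ≤ C * (Av g σ y).toReal ∧
      |(σ ^ 2)⁻¹ * cv (dts (KK n)) σ (σ ^ 2) w y| ≤ σ⁻¹ * (C * (Av g σ y).toReal) ∧
      (∀ j, |cv (KK n) σ (σ ^ 2) (G j) y| ≤ C * (Av g σ y).toReal) ∧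
      |cv (KK n) σ (σ ^ 2) w y| ≤ C * (Av g σ y).toReal)
    (hE : ((Ob g)ᶜ).Nonempty) {ε : ℝ} (hε : 0 < ε) {m : Pt n → ℝ} (hm : MT (Ob g)ᶜ ε m)
    {K : ℝ} (hK : K = C * (7 ^ (n + 2) * Vn n)) {w1 : Pt n → ℝ}
    (hw1 : w1 = fun z ↦ cv (KK n) (m z) (m z ^ 2) w z) :
    ContDiff ℝ (⊤ : ℕ∞) w1 ∧ (∀ z, |w1 z| ≤ K) ∧ (∀ j z, |dxj w1 j z| ≤ 2 * K) ∧
    (∀ z, |dts w1 z| ≤ 3 * K * (m z)⁻¹) ∧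
    (∀ z ∈ (Ob g)ᶜ, ∀ j, dxj w1 j z = cv (KK n) ε (ε ^ 2) (G j) z) ∧
    (∀ z ∈ (Ob g)ᶜ, w1 z = cv (KK n) ε (ε ^ 2) w z) ∧
    (∀ z ∈ (Ob g)ᶜ, dts w1 z = (ε ^ 2)⁻¹ * cv (dts (KK n)) ε (ε ^ 2) w z) := by
  have h := KK_isK (n := n)
  have hp : ∀ z, 0 < m z := fun z ↦ hε.trans_le (hm.ge z)
  obtain ⟨hcd, hfd⟩ := w1_fd D.W.iw hm.cd hp
  have hA : ∀ z, C * (Av g (m z) z).toReal ≤ K := fun z ↦ by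
    rw [hK]; gcongr; exact Ob_near₉ hE (hm.near hε z) (hp z)
  have hx : ∀ z j, dxj w1 j z = fderiv ℝ m z (EuclideanSpace.single j 1, 0) * Ss w (m z) z +
      cv (KK n) (m z) (m z ^ 2) (G j) z := by
    intro z j
    rw [dxj, hw1, hfd, ← D.W.cvx h (hp z) (pow_pos (hp z) 2) (subset_univ _) j]
    simp [Pi.single_apply]
  have ht : ∀ z, dts w1 z = fderiv ℝ m z (0, 1) * Ss w (m z) z +
      (m z ^ 2)⁻¹ * cv (dts (KK n)) (m z) (m z ^ 2) w z := by
    intro z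
    rw [dts, hw1, hfd]; simp
  have hfz : ∀ z ∈ (Ob g)ᶜ, fderiv ℝ m z = 0 := fun z hz ↦
    IsLocalMin.fderiv_eq_zero (Filter.Eventually.of_forall fun y ↦ by
      simpa [hm.eq z hz] using hm.ge y)
  refine ⟨hw1 ▸ hcd, fun z ↦ ?_, fun j z ↦ ?_, fun z ↦ ?_, fun z hz j ↦ ?_, fun z hz ↦ ?_,
    fun z hz ↦ ?_⟩
  · rw [hw1]; exact ((hC _ (hp z) z).2.2.2).trans (hA z)
  · rw [hx]
    refine (abs_add_le _ _).trans ?_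
    have h1 := hm.fd z (EuclideanSpace.single j 1, 0)
    simp only [EuclideanSpace.norm_single, norm_one, abs_zero, zero_mul, add_zero] at h1
    have h2 := ((hC _ (hp z) z).1).trans (hA z)
    have h3 := ((hC _ (hp z) z).2.2.1 j).trans (hA z)
    rw [abs_mul]
    nlinarith [abs_nonneg (Ss w (m z) z), mul_le_mul h1 h2 (abs_nonneg _) zero_le_one]
  · rw [ht]
    refine (abs_add_le _ _).trans ?_
    have h1 := hm.fd z (0, 1)
    simp only [norm_zero, abs_one, one_mul, zero_add] at h1
    have h2 := ((hC _ (hp z) z).1).trans (hA z)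
    have h3 := ((hC _ (hp z) z).2.1)
    have h4 : (m z)⁻¹ * (C * (Av g (m z) z).toReal) ≤ (m z)⁻¹ * K :=
      mul_le_mul_of_nonneg_left (hA z) (inv_nonneg.2 (hp z).le)
    have h5 : 0 < 2 / m z := div_pos two_pos (hp z)
    rw [abs_mul]
    have h6 := mul_le_mul h1 h2 (abs_nonneg _) h5.le
    have h7 : 2 / m z * K = 2 * ((m z)⁻¹ * K) := by ring
    linarith [h6, h7]
  · rw [hx, hfz z hz, hm.eq z hz]; simp
  · rw [hw1]; simp only [hm.eq z hz]
  · rw [ht, hfz z hz, hm.eq z hz]; simp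

lemma w1_cs {E : Set (Pt n)} (hE : E.Nonempty) (hc : IsClosed E) (hv : volume Eᶜ ≠ ∞)
    {w : Pt n → ℝ} (hcs : HasCompactSupport w) {ε : ℝ} (hε : 0 < ε) {m : Pt n → ℝ}
    (hm : MT E ε m) : HasCompactSupport (fun z ↦ cv (KK n) (m z) (m z ^ 2) w z) := by
  have h := KK_isK (n := n)
  obtain ⟨R, hR⟩ := dE_bound hE hc hv
  have hp : ∀ z, 0 < m z := fun z ↦ hε.trans_le (hm.ge z)
  set R₉ := 11 / 10 * max ε R
  have hmR : ∀ z, m z ≤ R₉ := fun z ↦ (hm.bd z).2.trans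
    (mul_le_mul_of_nonneg_left (max_le_max le_rfl (hR z)) (by norm_num))
  obtain ⟨ρ, hρ⟩ := hcs.isBounded.exists_norm_le
  refine HasCompactSupport.intro (isCompact_closedBall (0 : Pt n) (ρ + R₉ + R₉ ^ 2)) fun z hz ↦ ?_
  refine integral_eq_zero_of_ae (Filter.Eventually.of_forall fun y ↦ ?_)
  simp only [Pi.zero_apply]
  by_cases hy : y ∈ Cl z (m z) (m z ^ 2)
  · rw [image_eq_zero_of_notMem_tsupport (f := w) (x := y), zero_mul]
    intro hy2
    apply hz
    have h1 := hρ y hy2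
    have h2 := hmR z
    have h3 : m z ^ 2 ≤ R₉ ^ 2 := by gcongr; exact (hp z).le
    have h4 : ‖z - y‖ ≤ R₉ + R₉ ^ 2 := by
      rw [Prod.norm_def]
      refine max_le (hy.1.trans ?_) (hy.2.trans ?_)
      · nlinarith [sq_nonneg R₉]
      · linarith [hp z]
    rw [mem_closedBall_zero_iff]
    have := norm_add_le (z - y) y
    rw [sub_add_cancel] at this
    linarith
  · rw [kf_zero h (hp z) (pow_pos (hp z) 2) hy, mul_zero]

lemma Ob_nb {g : Pt n → ℝ≥0∞} (hE : ((Ob g)ᶜ).Nonempty) {z : Pt n} {r d : ℝ} (hd : 0 < d)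
    (hr : 0 < r) (hdz : dE (Ob g)ᶜ z = d) (hrd : r ≤ 2 * d) :
    ∫⁻ y in Qc z r, g y ≤ ofReal (4 ^ (n + 2)) * volume (Qc z d) := by
  obtain ⟨e, he, h1⟩ := dE_lt hE (z := z) (r := 2 * d) (by linarith)
  have h2 := not_Ob he (y := e) (r := 4 * d) (by linarith)
    ((mem_Qc₉ (by linarith)).2 (by rw [pd_self]; linarith))
  refine (lintegral_mono_set (Qc_mono hr (by linarith))).trans (h2.trans ?_)
  rw [vol_Qc _ (by linarith), vol_Qc _ hd, ← ENNReal.ofReal_mul (by positivity)]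
  refine le_of_eq ?_
  congr 1; ring

lemma whit_g {g : Pt n → ℝ≥0∞} (hE : ((Ob g)ᶜ).Nonempty) (hv : volume (Ob g) ≠ ∞) :
    ∫⁻ z in Ob g, g z ≤ ofReal (4 ^ (n + 2)) * ofReal (10 ^ (n + 2)) *
      volume (Ob g) := by
  have hc : IsClosed (Ob g)ᶜ := (isOpen_Ob g).isClosed_compl
  have := whit hE hc (by rwa [compl_compl]) g (ofReal (4 ^ (n + 2))) (fun z hz ↦ by
    have hd := dE_pos hE hc hz
    exact Ob_nb hE hd (by linarith) rfl (by linarith))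
  rwa [compl_compl] at this

lemma whit_w {C : ℝ} (hC1 : 1 ≤ C) {g : Pt n → ℝ≥0∞} (hg : Measurable g) (hgi : ∫⁻ z, g z ≠ ∞)
    {w : Pt n → ℝ} (hw : Integrable w)
    (hC : ∀ σ > 0, ∀ y, |Ss w σ y| ≤ C * (Av g σ y).toReal)
    (hE : ((Ob g)ᶜ).Nonempty) (hv : volume (Ob g) ≠ ∞)
    {ε : ℝ} (hε : 0 < ε) {m : Pt n → ℝ} (hm : MT (Ob g)ᶜ ε m)
    {K : ℝ} (hK : K = C * (7 ^ (n + 2) * Vn n)) :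
    ∫⁻ z in Ob g, ‖w z - cv (KK n) (m z) (m z ^ 2) w z‖ₑ * ofReal (m z)⁻¹ ≤
      (ofReal (2 * (C * 2 ^ (n + 2))) * (ofReal (2 ^ (n + 1) * Vn n) *
        ofReal (4 ^ (n + 2))) + ofReal K) *
        ofReal (10 ^ (n + 2)) * volume (Ob g) := by
  have hV := Vn_pos n
  have hK0 : 0 ≤ K := by rw [hK]; positivity
  have hc : IsClosed (Ob g)ᶜ := (isOpen_Ob g).isClosed_compl
  have := whit hE hc (by rwa [compl_compl])
    (fun z ↦ ‖w z - cv (KK n) (m z) (m z ^ 2) w z‖ₑ * ofReal (m z)⁻¹)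
    (ofReal (2 * (C * 2 ^ (n + 2))) * (ofReal (2 ^ (n + 1) * Vn n) *
        ofReal (4 ^ (n + 2))) + ofReal K) (fun z hz ↦ by
    have hd := dE_pos hE hc hz
    obtain ⟨d, hdz⟩ : ∃ d, d = dE (Ob g)ᶜ z := ⟨_, rfl⟩
    rw [← hdz] at hd ⊢
    have hd2 : (0 : ℝ) < d / 2 := by linarith
    set s : ℝ := 2 / 5 * d with hsd
    have hs : 0 < s := by positivity
    have hpt : ∀ᵐ y ∂(volume.restrict (Qc z (d / 2))),
        ‖w y - cv (KK n) (m y) (m y ^ 2) w y‖ₑ * ofReal (m y)⁻¹ ≤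
        ofReal s⁻¹ * ‖w y - cv (KK n) s (s ^ 2) w y‖ₑ + ofReal K := by
      filter_upwards [ae_restrict_mem (meas_Qc z _)] with y hy
      have hy₉ := (mem_Qc₉ hd2).1 hy
      have l1 := dE_lip hE z y
      have l2 := dE_lip hE y z
      rw [pd_comm] at l1
      rw [← hdz] at l1 l2
      have hmy := (hm.bd y).1
      have l3 : dE (Ob g)ᶜ y ≤ md (Ob g)ᶜ ε y := le_max_right _ _
      have hsm : s ≤ m y := by rw [hsd]; linarith
      have hmp : 0 < m y := hs.trans_le hsm
      have h1 := W_mvt hw hs hsm y (M := K) (fun σ hσ ↦ by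
        refine (hC σ (hs.trans_le hσ.1) y).trans ?_
        rw [hK]; gcongr
        refine Ob_near₉ hE ?_ (hs.trans_le hσ.1)
        have := hσ.1
        rw [hsd] at this
        linarith)
      have h2 : |w y - cv (KK n) (m y) (m y ^ 2) w y| * (m y)⁻¹ ≤
          s⁻¹ * |w y - cv (KK n) s (s ^ 2) w y| + K := by
        have e1 : |w y - cv (KK n) (m y) (m y ^ 2) w y| ≤ |w y - cv (KK n) s (s ^ 2) w y| +
            K * m y := by
          have := abs_sub_le (w y) (cv (KK n) s (s ^ 2) w y) (cv (KK n) (m y) (m y ^ 2) w y)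
          rw [abs_sub_comm (cv (KK n) s (s ^ 2) w y)] at this
          nlinarith
        have e2 : (m y)⁻¹ ≤ s⁻¹ := inv_anti₀ hs hsm
        calc _ ≤ (|w y - cv (KK n) s (s ^ 2) w y| + K * m y) * (m y)⁻¹ := by gcongr
          _ = |w y - cv (KK n) s (s ^ 2) w y| * (m y)⁻¹ + K := by field_simp
          _ ≤ |w y - cv (KK n) s (s ^ 2) w y| * s⁻¹ + K := by gcongr
          _ = _ := by ring
      have h3 := ENNReal.ofReal_le_ofReal h2
      rwa [ENNReal.ofReal_add (by positivity) hK0, ENNReal.ofReal_mul (by positivity),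
        ENNReal.ofReal_mul (by positivity), ← Real.norm_eq_abs, ← Real.norm_eq_abs,
        ofReal_norm, ofReal_norm] at h3
    refine (lintegral_mono_ae hpt).trans ?_
    rw [lintegral_add_right _ measurable_const, setLIntegral_const, add_mul]
    have hsub : Qc z (d / 2) ⊆ Qc z d := Qc_mono hd2 (by rw [pd_self]; linarith)
    refine add_le_add ?_ (by gcongr)
    have hte := ae_restrict_of_ae (s := Qc z (d / 2))
      (tele (by linarith : 0 ≤ C) hgi hw hC hs)
    rw [lintegral_const_mul' _ _ ENNReal.ofReal_ne_top]
    have h4 : ∫⁻ y in Qc z (d / 2), ‖w y - cv (KK n) s (s ^ 2) w y‖ₑ ≤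
        ofReal (2 * (C * 2 ^ (n + 2) * s)) * (ofReal (2 ^ (n + 1) * Vn n) *
        (ofReal (4 ^ (n + 2)) * volume (Qc z d))) := by
      refine (lintegral_mono_ae hte).trans ?_
      rw [lintegral_tsum (fun k ↦ ((Av_meas hg _).const_mul _).aemeasurable)]
      rw [← ofReal_geom _ (by positivity), ← ENNReal.tsum_mul_right]
      refine ENNReal.tsum_le_tsum fun k ↦ ?_
      rw [lintegral_const_mul _ (Av_meas hg _)]
      refine mul_le_mul_right ?_ _
      set σ := s * (1 / 2) ^ k
      have hσ : 0 < σ := by positivity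
      have hσs : σ ≤ s := mul_le_of_le_one_right hs.le (pow_le_one₀ (by norm_num) (by norm_num))
      refine (avg_tonelli hg hσ (pow_pos hσ 2) (meas_Qc z _) (meas_Qc z (2 * d)) ?_).trans
        (mul_le_mul_right (Ob_nb hE hd (by linarith) hdz.symm le_rfl) _)
      intro y hy
      have := (mem_Qc₉ hd2).1 hy
      refine (Cl_subQ y hσ).trans (Qc_mono (by linarith) ?_)
      rw [hsd] at hσs
      linarith
    refine (mul_le_mul_right h4 _).trans (le_of_eq ?_)
    rw [← mul_assoc, ← ENNReal.ofReal_mul (by positivity)]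
    rw [show s⁻¹ * (2 * (C * 2 ^ (n + 2) * s)) = 2 * (C * 2 ^ (n + 2)) by field_simp]
    ring)
  rwa [compl_compl] at this

lemma Ob_E {g : Pt n → ℝ≥0∞} (hg : Measurable g) (hgi : ∫⁻ z, g z ≠ ∞) :
    volume (Ob g) ≠ ∞ ∧ ((Ob g)ᶜ).Nonempty := by
  have h1 : volume (Ob g) ≠ ∞ := ne_top_of_le_ne_top (ENNReal.mul_ne_top ENNReal.ofReal_ne_top
    (ne_top_of_le_ne_top hgi (setLIntegral_le_lintegral _ _))) (weak_type g hg hgi)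
  refine ⟨h1, ?_⟩
  by_contra h
  rw [not_nonempty_iff_eq_empty, compl_empty_iff] at h
  rw [h, Measure.volume_eq_prod, ← univ_prod_univ, Measure.prod_prod] at h1
  apply h1
  rw [Real.volume_univ, ENNReal.mul_top]
  exact (isOpen_univ.measure_pos _ ⟨0, mem_univ _⟩).ne'

lemma g_bd (n : ℕ) : ∃ K : ℝ, 0 ≤ K ∧ ∀ g : Pt n → ℝ≥0∞, Measurable g → ∫⁻ z, g z ≠ ∞ →
    ∀ᵐ z, z ∈ (Ob g)ᶜ → g z ≤ ofReal K := by
  have h := KK_isK (n := n)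
  obtain ⟨C, hC0, hC⟩ := h.bdd
  have hV := Vn_pos n
  refine ⟨C * (7 ^ (n + 2) * Vn n), by positivity, fun g hg hgi ↦ ?_⟩
  have hi : Integrable (fun z ↦ (g z).toReal) := integrable_toReal_of_lintegral_ne_top hg.aemeasurable hgi
  have hr : ∀ k : ℕ, (0 : ℝ) < (1 / 2) ^ k := fun k ↦ by positivity
  have hr0 : Tendsto (fun k : ℕ ↦ (1 / 2 : ℝ) ^ k) atTop (𝓝 0) :=
    tendsto_pow_atTop_nhds_zero_of_lt_one (by norm_num) (by norm_num)
  have ht := cv_tend h hi hr (fun k ↦ pow_pos (hr k) 2) hr0 (by simpa using hr0.pow 2)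
  simp only [KK_int, one_mul] at ht
  obtain ⟨ns, -, hns⟩ := sub_ae
    (fun k ↦ (cv_cont h (hr k) (pow_pos (hr k) 2) hi).aestronglyMeasurable) hi.1 ht
  filter_upwards [hns, ae_lt_top hg hgi] with z hz hfin hzE
  rw [← ENNReal.ofReal_toReal hfin.ne]
  refine ENNReal.ofReal_le_ofReal (le_of_tendsto hz (Eventually.of_forall fun k ↦ ?_))
  refine (le_abs_self _).trans ((cvb hgi h hC (Eventually.of_forall fun y ↦ ?_) (hr _) z).trans ?_)
  · rw [Real.enorm_eq_ofReal ENNReal.toReal_nonneg]; exact ENNReal.ofReal_toReal_le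
  · gcongr
    exact ENNReal.toReal_le_of_le_ofReal (by positivity)
      (Av_E (hr _) hzE (by rw [pd_self]; have := hr (ns k); positivity))

lemma enorm_le_of_abs {x c : ℝ} (h : |x| ≤ c) : ‖x‖ₑ ≤ ofReal c := by
  rw [← ofReal_norm]; exact ENNReal.ofReal_le_ofReal h

lemma core_eps {C Kg : ℝ} (hC1 : 1 ≤ C) (hKg : 0 ≤ Kg) {g : Pt n → ℝ≥0∞} (hg : Measurable g)
    (hgi : ∫⁻ z, g z ≠ ∞) {w : Pt n → ℝ}
    {G B : Fin n → Pt n → ℝ} {f : Pt n → ℝ} (D : Dat g w G B f) (hcs : HasCompactSupport w)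
    (hC : ∀ σ > 0, ∀ y, |Ss w σ y| ≤ C * (Av g σ y).toReal ∧
      |(σ ^ 2)⁻¹ * cv (dts (KK n)) σ (σ ^ 2) w y| ≤ σ⁻¹ * (C * (Av g σ y).toReal) ∧
      (∀ j, |cv (KK n) σ (σ ^ 2) (G j) y| ≤ C * (Av g σ y).toReal) ∧
      |cv (KK n) σ (σ ^ 2) w y| ≤ C * (Av g σ y).toReal)
    (hgK : ∀ᵐ z, z ∈ (Ob g)ᶜ → g z ≤ ofReal Kg)
    {K : ℝ} (hK : K = C * (7 ^ (n + 2) * Vn n)) {ε : ℝ} (hε : 0 < ε) :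
    ‖∫ z in (Ob g)ᶜ, ((∑ j, B j z * G j z) - f z * w z)‖ₑ ≤
      (ofReal (n * (2 * K) + K) * (ofReal (4 ^ (n + 2)) *
        ofReal (10 ^ (n + 2))) + ofReal (3 * K) *
        ((ofReal (2 * (C * 2 ^ (n + 2))) * (ofReal (2 ^ (n + 1) * Vn n) *
        ofReal (4 ^ (n + 2))) + ofReal K) *
        ofReal (10 ^ (n + 2)))) * volume (Ob g) +
      (ofReal Kg * ((∑ j, ∫⁻ z, ‖cv (KK n) ε (ε ^ 2) (G j) z - 1 * G j z‖ₑ) +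
        ∫⁻ z, ‖cv (KK n) ε (ε ^ 2) w z - 1 * w z‖ₑ) +
      ofReal (2 * (C * 2 ^ (n + 2)) * (7 ^ (n + 2) * Vn n)) *
        ((∑ j, ∫⁻ z, ‖cv (dxj (KK n) j) ε (ε ^ 2) (B j) z - 0 * B j z‖ₑ) +
          ofReal ε * ∫⁻ z, ‖cv (KK n) ε (ε ^ 2) f z‖ₑ)) := by
  have h := KK_isK (n := n)
  have hV := Vn_pos n
  have hK0 : 0 ≤ K := by rw [hK]; positivity
  have hε2 := pow_pos hε 2
  obtain ⟨hv, hE⟩ := Ob_E hg hgi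
  have hO : MeasurableSet (Ob g) := (isOpen_Ob g).measurableSet
  have hc : IsClosed (Ob g)ᶜ := (isOpen_Ob g).isClosed_compl
  obtain ⟨m, m1, m2, m3, m4, m5⟩ := mt_spec hE hc (by rwa [compl_compl]) hε
  have hm : MT (Ob g)ᶜ ε m := ⟨m1, m2, m3, m4, m5⟩
  obtain ⟨w1, hw1⟩ : ∃ w1, w1 = fun z ↦ cv (KK n) (m z) (m z ^ 2) w z := ⟨_, rfl⟩
  obtain ⟨hcd, b0, b1, b2, e1, e2, e3⟩ := w1_bounds hC1 hgi D hC hE hε hm hK hw1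
  have hcs1 : HasCompactSupport w1 := hw1 ▸ w1_cs hE hc (by rwa [compl_compl]) hcs hε hm
  have hcf := hcd.continuous_fderiv (by simp)
  have cx : ∀ j, Continuous (dxj w1 j) := fun j ↦ hcf.clm_apply continuous_const
  have ct : Continuous (dts w1) := hcf.clm_apply continuous_const
  have ctb : ∀ z, |dts w1 z| ≤ 3 * K * ε⁻¹ := fun z ↦ (b2 z).trans
    (mul_le_mul_of_nonneg_left (inv_anti₀ hε (hm.ge z)) (by positivity))
  have iBx : ∀ j, Integrable (fun z ↦ B j z * dxj w1 j z) := fun j ↦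
    (D.W.iB j).mul_bdd (c := 2 * K) (cx j).aestronglyMeasurable (Eventually.of_forall (b1 j))
  have ifw : Integrable (fun z ↦ f z * w1 z) :=
    D.W.jf.mul_bdd (c := K) hcd.continuous.aestronglyMeasurable (Eventually.of_forall b0)
  have iwt : Integrable (fun z ↦ w z * dts w1 z) :=
    D.W.iw.mul_bdd (c := 3 * K * ε⁻¹) ct.aestronglyMeasurable (Eventually.of_forall ctb)
  have iwwt : Integrable (fun z ↦ w1 z * dts w1 z) :=
    (hcd.continuous.mul ct).integrable_of_hasCompactSupport hcs1.mul_right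
  have iS : Integrable (fun z ↦ ∑ j, B j z * dxj w1 j z) := integrable_finsetSum _ fun j _ ↦ iBx j
  have iX1 : Integrable (fun z ↦ (∑ j, B j z * dxj w1 j z) - f z * w1 z) := iS.sub ifw
  have z1 : ∫ z, w1 z * dts w1 z = 0 := by
    have := integral_mul_fderiv_eq_neg_fderiv_mul_of_integrable (𝕜 := ℝ)
      (μ := (volume : Measure (Pt n))) (f := w1) (g := w1) (v := (0, 1))
      (by simpa only [dts, mul_comm] using iwwt) iwwt
      ((hcd.continuous.mul hcd.continuous).integrable_of_hasCompactSupport hcs1.mul_right)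
      (fun x _ ↦ hcd.differentiable (by simp) x) (fun x _ ↦ hcd.differentiable (by simp) x)
    have h2 : ∫ z, fderiv ℝ w1 z (0, 1) * w1 z = ∫ z, w1 z * fderiv ℝ w1 z (0, 1) := by
      simp only [mul_comm]
    rw [h2] at this
    change ∫ z, w1 z * fderiv ℝ w1 z (0, 1) = 0
    linarith
  have id1 : ∫ z, ((∑ j, B j z * dxj w1 j z) - f z * w1 z) = ∫ z, (w z - w1 z) * dts w1 z := by
    rw [integral_sub iS ifw, integral_finsetSum _ fun j _ ↦ iBx j, ← D.W.ht w1 hcd hcs1 (subset_univ _)]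
    simp only [sub_mul]
    rw [integral_sub iwt iwwt, z1, sub_zero]
  have iwd : Integrable (fun z ↦ (w z - w1 z) * dts w1 z) := by
    simp only [sub_mul]; exact iwt.sub iwwt

  have bE : ∀ (F : Pt n → ℝ), (∀ᵐ z, ‖F z‖ₑ ≤ g z) →
      ∀ᵐ z ∂(volume.restrict (Ob g)ᶜ), ‖F z‖ₑ ≤ ofReal Kg := by
    intro F hF
    filter_upwards [ae_restrict_of_ae hF, ae_restrict_of_ae hgK, ae_restrict_mem hO.compl] with z h1 h2 h3
    exact h1.trans (h2 h3)
  have bE₉ : ∀ (F : Pt n → ℝ), (∀ᵐ z, ‖F z‖ₑ ≤ g z) →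
      ∀ᵐ z ∂(volume.restrict (Ob g)ᶜ), ‖F z‖ ≤ Kg := by
    intro F hF
    filter_upwards [bE F hF] with z hz
    rwa [← ofReal_norm, ENNReal.ofReal_le_ofReal_iff hKg] at hz
  have iX : IntegrableOn (fun z ↦ (∑ j, B j z * G j z) - f z * w z) (Ob g)ᶜ := by
    refine Integrable.sub (integrable_finsetSum _ fun j _ ↦ ?_) ?_
    · exact (D.W.iG j).integrableOn.bdd_mul (D.W.iB j).1.restrict (bE₉ _ (D.bB j))
    · exact (D.W.iw).integrableOn.bdd_mul D.W.jf.1.restrict (bE₉ _ D.bf)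
  set X := fun z ↦ (∑ j, B j z * G j z) - f z * w z with hX
  set X1 := fun z ↦ (∑ j, B j z * dxj w1 j z) - f z * w1 z with hX1
  have key : ∫ z in (Ob g)ᶜ, X z = (∫ z in (Ob g)ᶜ, (X z - X1 z)) + (- ∫ z in Ob g, X1 z) +
      (∫ z in Ob g, (w z - w1 z) * dts w1 z) + ∫ z in (Ob g)ᶜ, (w z - w1 z) * dts w1 z := by
    rw [integral_sub iX iX1.integrableOn]
    have k1 := integral_add_compl hO iX1
    have k2 := integral_add_compl hO iwd
    linarith
  have E1 : ‖∫ z in (Ob g)ᶜ, (X z - X1 z)‖ₑ ≤ ofReal Kg *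
      ((∑ j, ∫⁻ z, ‖cv (KK n) ε (ε ^ 2) (G j) z - 1 * G j z‖ₑ) +
        ∫⁻ z, ‖cv (KK n) ε (ε ^ 2) w z - 1 * w z‖ₑ) := by
    have ms : ∀ F : Pt n → ℝ, Integrable F →
        AEMeasurable (fun z ↦ ‖cv (KK n) ε (ε ^ 2) F z - 1 * F z‖ₑ) := fun F hF ↦
      ((cv_cont h hε hε2 hF).aestronglyMeasurable.sub (hF.1.const_mul 1)).enorm
    refine (enorm_integral_le_lintegral_enorm _).trans ?_
    rw [← lintegral_finsetSum' _ (fun j _ ↦ ms _ (D.W.iG j)), ← lintegral_add_right' _ (ms _ D.W.iw),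
      ← lintegral_const_mul' _ _ ENNReal.ofReal_ne_top]
    refine le_trans (lintegral_mono_ae ?_) (setLIntegral_le_lintegral (Ob g)ᶜ _)
    have hB := (Filter.eventually_all (ι := Fin n)).2 fun j ↦ bE _ (D.bB j)
    filter_upwards [hB, bE _ D.bf, ae_restrict_mem hO.compl] with z h1 h2 h3
    have : X z - X1 z = (∑ j, B j z * -(cv (KK n) ε (ε ^ 2) (G j) z - 1 * G j z)) +
        f z * (cv (KK n) ε (ε ^ 2) w z - 1 * w z) := by
      simp only [hX, hX1, e1 z h3, e2 z h3]
      rw [show ∀ a b c d : ℝ, a - b - (c - d) = (a - c) + (d - b) by intros; ring,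
        ← Finset.sum_sub_distrib]
      congr 1
      · refine Finset.sum_congr rfl fun j _ ↦ ?_
        ring
      · ring
    rw [this]
    refine (enorm_add_le _ _).trans ?_
    rw [mul_add, Finset.mul_sum]
    refine add_le_add ((enorm_sum_le _ _).trans (Finset.sum_le_sum fun j _ ↦ ?_)) ?_
    · rw [enorm_mul, enorm_neg]; gcongr; exact h1 j
    · rw [enorm_mul]; gcongr
  have E2 : ‖- ∫ z in Ob g, X1 z‖ₑ ≤ ofReal (n * (2 * K) + K) *
      (ofReal (4 ^ (n + 2)) * ofReal (10 ^ (n + 2)) * volume (Ob g)) := by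
    rw [enorm_neg]
    refine (enorm_integral_le_lintegral_enorm _).trans (le_trans ?_ (mul_le_mul_right (whit_g hE hv) _))
    rw [← lintegral_const_mul' _ _ ENNReal.ofReal_ne_top]
    refine lintegral_mono_ae (ae_restrict_of_ae ?_)
    have hB := (Filter.eventually_all (ι := Fin n)).2 fun j ↦ D.bB j
    filter_upwards [hB, D.bf] with z h1 h2
    refine (enorm_sub_le).trans ?_
    rw [ENNReal.ofReal_add (by positivity) hK0, add_mul]
    refine add_le_add ((enorm_sum_le _ _).trans ?_) ?_
    · refine (Finset.sum_le_sum (g := fun _ ↦ g z * ofReal (2 * K)) fun j _ ↦ ?_).trans ?_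
      · rw [enorm_mul]; exact mul_le_mul' (h1 j) (enorm_le_of_abs (b1 j z))
      · rw [Finset.sum_const, ENNReal.ofReal_mul (p := (n : ℝ)) (by positivity)]
        simp only [Finset.card_univ, Fintype.card_fin, nsmul_eq_mul, ENNReal.ofReal_natCast]
        rw [mul_comm (g z), mul_assoc]
    · rw [enorm_mul, mul_comm]; exact mul_le_mul' (enorm_le_of_abs (b0 z)) h2
  have E3 : ‖∫ z in Ob g, (w z - w1 z) * dts w1 z‖ₑ ≤ ofReal (3 * K) *
        ((ofReal (2 * (C * 2 ^ (n + 2))) * (ofReal (2 ^ (n + 1) * Vn n) *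
        ofReal (4 ^ (n + 2))) + ofReal K) *
        ofReal (10 ^ (n + 2)) * volume (Ob g)) := by
    refine (enorm_integral_le_lintegral_enorm _).trans (le_trans ?_ (mul_le_mul_right
      (whit_w hC1 hg hgi D.W.iw (fun σ hσ y ↦ (hC σ hσ y).1) hE hv hε hm hK) _))
    rw [← lintegral_const_mul' _ _ ENNReal.ofReal_ne_top]
    refine lintegral_mono fun z ↦ ?_
    rw [enorm_mul, mul_left_comm, ← ENNReal.ofReal_mul (by positivity),
      show cv (KK n) (m z) (m z ^ 2) w z = w1 z by rw [hw1]]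
    exact mul_le_mul_right (enorm_le_of_abs (b2 z)) _
  have E4 : ‖∫ z in (Ob g)ᶜ, (w z - w1 z) * dts w1 z‖ₑ ≤
      ofReal (2 * (C * 2 ^ (n + 2)) * (7 ^ (n + 2) * Vn n)) *
        ((∑ j, ∫⁻ z, ‖cv (dxj (KK n) j) ε (ε ^ 2) (B j) z - 0 * B j z‖ₑ) +
          ofReal ε * ∫⁻ z, ‖cv (KK n) ε (ε ^ 2) f z‖ₑ) := by
    refine (enorm_integral_le_lintegral_enorm _).trans ?_
    have ms : ∀ j, AEMeasurable (fun z ↦ ‖cv (dxj (KK n) j) ε (ε ^ 2) (B j) z - 0 * B j z‖ₑ) :=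
      fun j ↦ ((cv_cont (h.dx j) hε hε2 (D.W.iB j)).aestronglyMeasurable.sub
        ((D.W.iB j).1.const_mul 0)).enorm
    rw [← lintegral_finsetSum' _ (fun j _ ↦ ms j), ← lintegral_const_mul' _ _ ENNReal.ofReal_ne_top,
      ← lintegral_add_left' (Finset.aemeasurable_fun_sum _ fun j _ ↦ ms j),
      ← lintegral_const_mul' _ _ ENNReal.ofReal_ne_top]
    refine le_trans (lintegral_mono_ae ?_) (setLIntegral_le_lintegral (Ob g)ᶜ _)
    filter_upwards [ae_restrict_of_ae (tele (by linarith : 0 ≤ C) hgi D.W.iw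
      (fun σ hσ y ↦ (hC σ hσ y).1) hε), ae_restrict_mem hO.compl] with z h1 h3
    have h4 : ‖w z - w1 z‖ₑ ≤ ofReal (2 * (C * 2 ^ (n + 2)) * (7 ^ (n + 2) * Vn n)) *
        ofReal ε := by
      rw [e2 z h3]
      refine h1.trans ?_
      refine (ENNReal.tsum_le_tsum (g := fun k : ℕ ↦ ofReal (C * 2 ^ (n + 2) * ε * (1 / 2) ^ k) *
        ofReal (7 ^ (n + 2) * Vn n)) fun k ↦ ?_).trans ?_
      · refine mul_le_mul_right (Av_E (by positivity) h3 ?_) _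
        rw [pd_self]; positivity
      · rw [ENNReal.tsum_mul_right, ofReal_geom _ (by positivity), ← ENNReal.ofReal_mul (by positivity),
          ← ENNReal.ofReal_mul (by positivity)]
        refine le_of_eq ?_
        congr 1; ring
    have h5 : dts w1 z = ε⁻¹ * ((∑ j, cv (dxj (KK n) j) ε (ε ^ 2) (B j) z) +
        ε * cv (KK n) ε (ε ^ 2) f z) := by
      rw [e3 z h3, D.W.cvt h hε hε2 (subset_univ _), mul_add, Finset.mul_sum]
      field_simp
    rw [enorm_mul, h5, enorm_mul]
    have h6 : ‖ε⁻¹‖ₑ = ofReal ε⁻¹ := by rw [Real.enorm_eq_ofReal (by positivity)]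
    have h7 : ofReal ε * ofReal ε⁻¹ = 1 := by
      rw [← ENNReal.ofReal_mul hε.le, mul_inv_cancel₀ hε.ne', ENNReal.ofReal_one]
    calc _ ≤ (ofReal (2 * (C * 2 ^ (n + 2)) * (7 ^ (n + 2) * Vn n)) *
          ofReal ε) * (ofReal ε⁻¹ * ‖(∑ j, cv (dxj (KK n) j) ε (ε ^ 2) (B j) z) +
        ε * cv (KK n) ε (ε ^ 2) f z‖ₑ) := by rw [h6]; gcongr
      _ = ofReal (2 * (C * 2 ^ (n + 2)) * (7 ^ (n + 2) * Vn n)) *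
          ((ofReal ε * ofReal ε⁻¹) * ‖(∑ j, cv (dxj (KK n) j) ε (ε ^ 2) (B j) z) +
        ε * cv (KK n) ε (ε ^ 2) f z‖ₑ) := by ring
      _ ≤ _ := by
        rw [h7, one_mul]
        refine mul_le_mul_right ((enorm_add_le _ _).trans ?_) _
        refine add_le_add ((enorm_sum_le _ _).trans (Finset.sum_le_sum fun j _ ↦ ?_)) ?_
        · simp
        · rw [enorm_mul, Real.enorm_eq_ofReal hε.le]
  rw [key]
  refine ((enorm_add_le _ _).trans (add_le_add ((enorm_add_le _ _).trans (add_le_add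
    ((enorm_add_le _ _).trans (add_le_add E1 E2)) E3)) E4)).trans (le_of_eq ?_)
  ring

theorem core (n : ℕ) : ∃ K : ℝ, 0 < K ∧ ∀ g : Pt n → ℝ≥0∞, Measurable g → ∫⁻ z, g z ≠ ∞ →
    (∀ᵐ z, z ∈ (Ob g)ᶜ → g z ≤ ofReal K) ∧
    ∀ w G B f, Dat g w G B f → HasCompactSupport w →
    ‖∫ z in (Ob g)ᶜ, ((∑ j, B j z * G j z) - f z * w z)‖ₑ ≤ ofReal K * volume (Ob g) := by
  have h := KK_isK (n := n)
  have hV := Vn_pos n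
  obtain ⟨C, hC1, hC⟩ := exB n
  obtain ⟨Kg, hKg, hgK⟩ := g_bd n
  obtain ⟨Cb, hCb, hCb₉⟩ := h.bdd
  obtain ⟨K, hK⟩ : ∃ K, K = C * (7 ^ (n + 2) * Vn n) := ⟨_, rfl⟩
  have hK0 : 0 ≤ K := by rw [hK]; positivity
  set L : ℝ≥0∞ := (ofReal (n * (2 * K) + K) * (ofReal (4 ^ (n + 2)) *
        ofReal (10 ^ (n + 2))) + ofReal (3 * K) *
        ((ofReal (2 * (C * 2 ^ (n + 2))) * (ofReal (2 ^ (n + 1) * Vn n) *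
        ofReal (4 ^ (n + 2))) + ofReal K) *
        ofReal (10 ^ (n + 2)))) with hL
  have hLf : L ≠ ∞ := by
    rw [hL]; finiteness
  refine ⟨L.toReal + Kg + 1, by positivity, fun g hg hgi ↦ ⟨?_, fun w G B f D hcs ↦ ?_⟩⟩
  · filter_upwards [hgK g hg hgi] with z hz hzE
    refine (hz hzE).trans (ENNReal.ofReal_le_ofReal ?_)
    linarith [ENNReal.toReal_nonneg (a := L)]
  have hr : ∀ k : ℕ, (0 : ℝ) < (1 / 2) ^ k := fun k ↦ by positivity
  have hr0 : Tendsto (fun k : ℕ ↦ (1 / 2 : ℝ) ^ k) atTop (𝓝 0) :=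
    tendsto_pow_atTop_nhds_zero_of_lt_one (by norm_num) (by norm_num)
  have hr2 := fun k ↦ pow_pos (hr k) 2
  have hr20 : Tendsto (fun k : ℕ ↦ ((1 / 2 : ℝ) ^ k) ^ 2) atTop (𝓝 0) := by simpa using hr0.pow 2
  have key := fun k ↦ core_eps hC1 hKg hg hgi D hcs (hC g hgi w G B f D) (hgK g hg hgi) hK (hr k)
  have t1 : ∀ j, Tendsto (fun k : ℕ ↦ ∫⁻ z, ‖cv (KK n) ((1/2) ^ k) (((1/2) ^ k) ^ 2) (G j) z - 1 * G j z‖ₑ)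
      atTop (𝓝 0) := fun j ↦ by
    have := cv_tend h (D.W.iG j) hr hr2 hr0 hr20
    rwa [KK_int] at this
  have t2 : Tendsto (fun k : ℕ ↦ ∫⁻ z, ‖cv (KK n) ((1/2) ^ k) (((1/2) ^ k) ^ 2) w z - 1 * w z‖ₑ)
      atTop (𝓝 0) := by
    have := cv_tend h D.W.iw hr hr2 hr0 hr20
    rwa [KK_int] at this
  have t3 : ∀ j, Tendsto (fun k : ℕ ↦ ∫⁻ z, ‖cv (dxj (KK n) j) ((1/2) ^ k) (((1/2) ^ k) ^ 2) (B j) z -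
      0 * B j z‖ₑ) atTop (𝓝 0) := fun j ↦ by
    have := cv_tend (h.dx j) (D.W.iB j) hr hr2 hr0 hr20
    rwa [dx_int h] at this
  have t4 : Tendsto (fun k : ℕ ↦ ofReal ((1/2) ^ k) * ∫⁻ z,
      ‖cv (KK n) ((1/2) ^ k) (((1/2) ^ k) ^ 2) f z‖ₑ) atTop (𝓝 0) := by
    have hb : ∀ k : ℕ, ofReal ((1/2) ^ k) * ∫⁻ z,
      ‖cv (KK n) ((1/2) ^ k) (((1/2) ^ k) ^ 2) f z‖ₑ ≤ ofReal ((1/2) ^ k) *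
      (ofReal (Cb * (2 ^ (n + 1) * Vn n)) * ∫⁻ z, ‖f z‖ₑ) := fun k ↦
      mul_le_mul_right (cv_L1 h hCb₉ (hr k) (hr2 k) D.W.jf) _
    refine tendsto_of_tendsto_of_tendsto_of_le_of_le tendsto_const_nhds ?_ (fun _ ↦ zero_le) hb
    have := ENNReal.Tendsto.mul_const (b := ofReal (Cb * (2 ^ (n + 1) * Vn n)) * ∫⁻ z, ‖f z‖ₑ)
      ((ENNReal.continuous_ofReal.tendsto 0).comp hr0)
      (Or.inr (ENNReal.mul_ne_top ENNReal.ofReal_ne_top D.W.jf.2.ne))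
    simpa using this
  have T := ((ENNReal.Tendsto.const_mul (a := ofReal Kg)
    ((tendsto_finsetSum (Finset.univ : Finset (Fin n)) fun j _ ↦ t1 j).add t2)
    (Or.inr ENNReal.ofReal_ne_top)).add (ENNReal.Tendsto.const_mul
      (a := ofReal (2 * (C * 2 ^ (n + 2)) * (7 ^ (n + 2) * Vn n)))
      ((tendsto_finsetSum (Finset.univ : Finset (Fin n)) fun j _ ↦ t3 j).add t4)
      (Or.inr ENNReal.ofReal_ne_top))).const_add (L * volume (Ob g))
  have := ge_of_tendsto' T key
  refine this.trans ?_
  simp only [Finset.sum_const_zero, add_zero, mul_zero]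
  refine mul_le_mul_left ?_ _
  refine ENNReal.le_ofReal_iff_toReal_le hLf (by positivity) |>.2 ?_
  linarith

lemma Ts_fd (z₀ : Pt n) (a b : ℝ) {ψ : Pt n → ℝ} (hψ : ContDiff ℝ (⊤ : ℕ∞) ψ) (y : Pt n)
    (v : Pt n) : fderiv ℝ (fun y ↦ ψ (Ts z₀ a b y)) y v = fderiv ℝ ψ (Ts z₀ a b y) (a • v.1, b * v.2) := by
  have h1 : HasFDerivAt (Ts z₀ a b) ((a • ContinuousLinearMap.fst ℝ (Spc n) ℝ).prod
      (b • ContinuousLinearMap.snd ℝ (Spc n) ℝ)) y := by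
    unfold Ts
    refine HasFDerivAt.prodMk ?_ ?_
    · exact ((ContinuousLinearMap.fst ℝ (Spc n) ℝ).hasFDerivAt.const_smul a).const_add _
    · exact ((ContinuousLinearMap.snd ℝ (Spc n) ℝ).hasFDerivAt.const_mul b).const_add _
  have h2 := ((hψ.differentiable (by simp)) (Ts z₀ a b y)).hasFDerivAt.comp y h1
  rw [show (fun y ↦ ψ (Ts z₀ a b y)) = ψ ∘ Ts z₀ a b from rfl, h2.fderiv]
  simp

lemma WE.scale {U : Set (Pt n)} {w f : Pt n → ℝ} {G B : Fin n → Pt n → ℝ} (W : WE U w G B f)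
    (z₀ : Pt n) {a b : ℝ} (ha : 0 < a) (hb : 0 < b) (μ : ℝ) :
    WE (Ts z₀ a b ⁻¹' U) (fun z ↦ μ * w (Ts z₀ a b z)) (fun j z ↦ μ * a * G j (Ts z₀ a b z))
      (fun j z ↦ μ * (b / a) * B j (Ts z₀ a b z)) (fun z ↦ μ * b * f (Ts z₀ a b z)) := by
  have tst : ∀ ψ : Pt n → ℝ, ContDiff ℝ (⊤ : ℕ∞) ψ → HasCompactSupport ψ →
      tsupport ψ ⊆ Ts z₀ a b ⁻¹' U → ∃ χ : Pt n → ℝ, ContDiff ℝ (⊤ : ℕ∞) χ ∧ HasCompactSupport χ ∧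
      tsupport χ ⊆ U ∧ (∀ y, ψ y = χ (Ts z₀ a b y)) ∧ (∀ j y, dxj ψ j y = a * dxj χ j (Ts z₀ a b y)) ∧
      ∀ y, dts ψ y = b * dts χ (Ts z₀ a b y) := by
    intro ψ h1 h2 h3
    have c1 : ContDiff ℝ (⊤ : ℕ∞) (fun y ↦ ψ (Tsi z₀ a b y)) := h1.comp (Ts_cd _ _ _)
    have e : ψ = fun y ↦ (fun y ↦ ψ (Tsi z₀ a b y)) (Ts z₀ a b y) := by
      ext y; simp [Tsi_Ts z₀ ha hb]
    refine ⟨fun y ↦ ψ (Tsi z₀ a b y), c1, ?_, ?_, ?_, ?_, ?_⟩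
    · exact h2.comp_homeomorph (TsH z₀ ha hb).symm
    · intro y hy
      have := (tsupport_comp_subset_preimage ψ (f := Tsi z₀ a b) (Ts_cd _ _ _).continuous) hy
      have := h3 this
      rwa [mem_preimage, Ts_Tsi z₀ ha hb] at this
    · intro y; simp [Tsi_Ts z₀ ha hb]
    · intro j y
      conv_lhs => rw [e]
      rw [dxj, Ts_fd _ _ _ c1, dxj]
      have : (a • (EuclideanSpace.single j 1 : Spc n), b * (0 : ℝ)) =
        a • ((EuclideanSpace.single j 1, 0) : Pt n) := by ext <;> simp
      dsimp only
      rw [this, map_smul, smul_eq_mul]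
    · intro y
      conv_lhs => rw [e]
      rw [dts, Ts_fd _ _ _ c1, dts]
      have : (a • (0 : Spc n), b * (1 : ℝ)) = b • ((0, 1) : Pt n) := by ext <;> simp
      dsimp only
      rw [this, map_smul, smul_eq_mul]
  have ch : ∀ (c : ℝ) (F χ : Pt n → ℝ), ∫ z, c * (F (Ts z₀ a b z) * χ (Ts z₀ a b z)) =
      c * ((a ^ n * b)⁻¹ * ∫ z, F z * χ z) := fun c F χ ↦ by
    rw [integral_const_mul, Ts_int z₀ ha hb (fun z ↦ F z * χ z)]
  refine ⟨(Ts_integrable z₀ ha hb W.iw).const_mul _, fun j ↦ (Ts_integrable z₀ ha hb (W.iG j)).const_mul _,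
    fun j ↦ (Ts_integrable z₀ ha hb (W.iB j)).const_mul _, (Ts_integrable z₀ ha hb W.jf).const_mul _, ?_, ?_⟩
  · intro j ψ h1 h2 h3
    obtain ⟨χ, c1, c2, c3, c4, c5, c6⟩ := tst ψ h1 h2 h3
    simp only [c4, c5]
    have e1 : ∀ z, μ * w (Ts z₀ a b z) * (a * dxj χ j (Ts z₀ a b z)) =
      μ * a * (w (Ts z₀ a b z) * dxj χ j (Ts z₀ a b z)) := fun z ↦ by ring
    have e2 : ∀ z, μ * a * G j (Ts z₀ a b z) * χ (Ts z₀ a b z) =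
      μ * a * (G j (Ts z₀ a b z) * χ (Ts z₀ a b z)) := fun z ↦ by ring
    simp only [e1, e2, ch]
    rw [W.hx j χ c1 c2 c3]; ring
  · intro ψ h1 h2 h3
    obtain ⟨χ, c1, c2, c3, c4, c5, c6⟩ := tst ψ h1 h2 h3
    simp only [c4, c5, c6]
    have e1 : ∀ z, μ * w (Ts z₀ a b z) * (b * dts χ (Ts z₀ a b z)) =
      μ * b * (w (Ts z₀ a b z) * dts χ (Ts z₀ a b z)) := fun z ↦ by ring
    have e2 : ∀ z, μ * b * f (Ts z₀ a b z) * χ (Ts z₀ a b z) =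
      μ * b * (f (Ts z₀ a b z) * χ (Ts z₀ a b z)) := fun z ↦ by ring
    have e3 : ∀ j z, μ * (b / a) * B j (Ts z₀ a b z) * (a * dxj χ j (Ts z₀ a b z)) =
      μ * b * (B j (Ts z₀ a b z) * dxj χ j (Ts z₀ a b z)) := fun j z ↦ by field_simp
    simp only [e1, e2, e3, ch]
    rw [W.ht χ c1 c2 c3, ← Finset.mul_sum, ← Finset.mul_sum]; ring

theorem core₉ (n : ℕ) : ∃ K : ℝ, 0 < K ∧ ∀ lam h : ℝ, 0 < lam → 0 < h → ∀ g : Pt n → ℝ≥0∞,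
    Measurable g → ∫⁻ z, g z ≠ ∞ → ∃ O : Set (Pt n), MeasurableSet O ∧
    volume O ≤ ofReal K * ∫⁻ z in {z | 1 / 2 < g z}, g z ∧
    (∀ᵐ z, z ∈ Oᶜ → g z ≤ ofReal K) ∧
    ∀ w G B f, WE univ w G B f → HasCompactSupport w → (∀ᵐ z, ‖w z‖ₑ ≤ ofReal lam * g z) →
      (∀ j, ∀ᵐ z, ‖G j z‖ₑ ≤ ofReal lam * g z) →
      (∀ j, ∀ᵐ z, ‖B j z‖ₑ ≤ ofReal h * g z) →
      (∀ᵐ z, ‖f z‖ₑ ≤ ofReal h * g z) →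
    |∫ z in Oᶜ, ((∑ j, B j z * G j z) - f z * w z)| ≤ K * lam * h * (volume O).toReal := by
  obtain ⟨K, hK, hcore⟩ := core n
  refine ⟨max K (2 * 5 ^ (n + 2)), by positivity, fun lam h hl hh g hg hgi ↦ ?_⟩
  set b := lam / h with hb₉
  have hb : 0 < b := by positivity
  set T := Ts (0 : Pt n) 1 b with hT
  have hTm : Measurable T := (Ts_cd _ _ _).continuous.measurable
  have hTim : Measurable (Tsi (0 : Pt n) 1 b) := (Ts_cd _ _ _).continuous.measurable
  set g₉ := fun z ↦ g (T z) with hg₉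
  have hg₉m : Measurable g₉ := hg.comp hTm
  have hg₉i : ∫⁻ z, g₉ z ≠ ∞ := by
    rw [hg₉, hT, Ts_lint 0 one_pos hb]; exact ENNReal.mul_ne_top ENNReal.ofReal_ne_top hgi
  obtain ⟨c1, c2⟩ := hcore g₉ hg₉m hg₉i
  set O := Tsi (0 : Pt n) 1 b ⁻¹' (Ob g₉) with hO
  have hOm : MeasurableSet O := hTim (isOpen_Ob g₉).measurableSet
  have hTO : T ⁻¹' O = Ob g₉ := by
    ext z; simp only [hO, mem_preimage, hT, Tsi_Ts 0 one_pos hb]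
  have hJ : ((1 : ℝ) ^ n * b)⁻¹ = b⁻¹ := by simp
  have hvol : volume (Ob g₉) = ofReal b⁻¹ * volume O := by
    rw [← hTO, hT, Ts_vol 0 one_pos hb, hJ]
  have hbn : ofReal b * ofReal b⁻¹ = 1 := by
    rw [← ENNReal.ofReal_mul hb.le, mul_inv_cancel₀ hb.ne', ENNReal.ofReal_one]
  have hbx : ∀ x y : ℝ≥0∞, ofReal b⁻¹ * x ≤ ofReal b⁻¹ * y → x ≤ y := fun x y hxy ↦ by
    have := mul_le_mul_right hxy (ofReal b)
    rwa [← mul_assoc, ← mul_assoc, hbn, one_mul, one_mul] at this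
  refine ⟨O, hOm, ?_, ?_, fun w G B f W hcs bw bG bB bf ↦ ?_⟩
  · apply hbx
    rw [← hvol]
    refine (weak_type g₉ hg₉m hg₉i).trans ?_
    rw [← lintegral_indicator (measurableSet_lt measurable_const hg₉m),
      ← lintegral_indicator (measurableSet_lt measurable_const hg)]
    have : (fun z ↦ ({z | 1 / 2 < g₉ z}.indicator (fun z ↦ g₉ z)) z) =
      fun z ↦ ({z | 1 / 2 < g z}.indicator (fun z ↦ g z)) (T z) := by
      ext z; simp [indicator, hg₉]
    rw [this, hT, Ts_lint 0 one_pos hb, hJ, mul_left_comm]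
    gcongr
    exact le_max_right _ _
  · have : ∀ᵐ z, T z ∈ Oᶜ → g (T z) ≤ ofReal (max K (2 * 5 ^ (n + 2))) := by
      filter_upwards [c1] with z hz hzO
      refine (hz ?_).trans (ENNReal.ofReal_le_ofReal (le_max_left _ _))
      rwa [← hTO]
    have hn := Ts_ae (-((1 : ℝ)⁻¹ • (0 : Pt n).1), -(b⁻¹ * (0 : Pt n).2)) (inv_pos.2 one_pos)
      (inv_pos.2 hb) this
    filter_upwards [hn] with z hz
    have e := Ts_Tsi (0 : Pt n) one_pos hb z
    rw [Tsi] at e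
    rwa [hT, e] at hz
  · have W₉ := W.scale 0 one_pos hb lam⁻¹
    have sc : ∀ (F : Pt n → ℝ) (c d : ℝ), 0 < c → d = c⁻¹ → (∀ᵐ z, ‖F z‖ₑ ≤ ofReal c * g z) →
        ∀ᵐ z, ‖d * F (T z)‖ₑ ≤ g₉ z := by
      intro F c d hc hd hF
      have := Ts_ae (0 : Pt n) one_pos hb hF
      filter_upwards [this] with z hz
      rw [enorm_mul, hd, Real.enorm_eq_ofReal (by positivity)]
      refine (mul_le_mul_right hz _).trans (le_of_eq ?_)
      rw [← mul_assoc, ← ENNReal.ofReal_mul (by positivity), inv_mul_cancel₀ hc.ne', ENNReal.ofReal_one,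
        one_mul]
    have hd1 : lam⁻¹ * (b / 1) = h⁻¹ := by rw [hb₉]; field_simp
    have hd2 : lam⁻¹ * b = h⁻¹ := by rw [hb₉]; field_simp
    have DD : Dat g₉ _ _ _ _ := ⟨W₉, sc w lam _ hl rfl bw, fun j ↦ sc _ lam _ hl (mul_one _) (bG j),
      fun j ↦ sc _ h _ hh hd1 (bB j), sc f h _ hh hd2 bf⟩
    have := c2 _ _ _ _ DD ((hcs.comp_homeomorph (TsH 0 one_pos hb)).mul_left)
    have hfin : volume (Ob g₉) ≠ ∞ := (Ob_E hg₉m hg₉i).1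
    rw [hvol] at this
    have e : ∫ z in (Ob g₉)ᶜ, ((∑ j, lam⁻¹ * (b / 1) * B j (T z) * (lam⁻¹ * 1 * G j (T z))) -
        lam⁻¹ * b * f (T z) * (lam⁻¹ * w (T z))) =
        b⁻¹ * ((lam⁻¹ * h⁻¹) * ∫ z in Oᶜ, ((∑ j, B j z * G j z) - f z * w z)) := by
      rw [← integral_const_mul, ← integral_indicator (isOpen_Ob g₉).measurableSet.compl,
        ← integral_indicator hOm.compl, ← hJ, ← Ts_int 0 one_pos hb]
      congr 1
      ext z
      have : z ∈ (Ob g₉)ᶜ ↔ Ts 0 1 b z ∈ Oᶜ := by rw [← hTO]; rfl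
      by_cases hz : z ∈ (Ob g₉)ᶜ
      · rw [indicator_of_mem hz, indicator_of_mem (this.1 hz), hd1, hd2, mul_sub, Finset.mul_sum]
        congr 1
        · refine Finset.sum_congr rfl fun j _ ↦ ?_
          rw [hT]; ring
        · rw [hT]; ring
      · rw [indicator_of_notMem hz, indicator_of_notMem (fun h ↦ hz (this.2 h))]
    rw [e, enorm_mul, Real.enorm_eq_ofReal (by positivity), mul_left_comm] at this
    have h3 := hbx _ _ this
    have hOf : volume O ≠ ∞ := by
      intro h; rw [h, ENNReal.mul_top] at hvol
      · exact hfin hvol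
      · simpa using hb
    have h4 := ENNReal.toReal_mono (ENNReal.mul_ne_top ENNReal.ofReal_ne_top hOf) h3
    rw [ENNReal.toReal_mul, ENNReal.toReal_ofReal hK.le, toReal_enorm, Real.norm_eq_abs, abs_mul,
      abs_of_pos (by positivity)] at h4
    rw [← mul_inv, inv_mul_le_iff₀ (by positivity)] at h4
    refine h4.trans ?_
    have : K ≤ max K (2 * 5 ^ (n + 2)) := le_max_left _ _
    calc _ = K * lam * h * (volume O).toReal := by ring
      _ ≤ _ := by gcongr

lemma Wr_deriv {w : Pt n → ℝ} (hw : Integrable w) {r τ : ℝ} (hr : 0 < r) (hτ : 0 < τ) (z : Pt n) :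
    HasDerivAt (fun s ↦ cv (KK n) s τ w z) (r⁻¹ * cv (kR (KK n)) r τ w z) r := by
  have h := KK_isK (n := n)
  have hd := ((cv_cd h hw hr hτ z).differentiableAt (by simp)).hasFDerivAt
  have h1 : HasDerivAt (fun s : ℝ ↦ (((s, τ), z) : (ℝ × ℝ) × Pt n)) ((1, 0), 0) r :=
    HasDerivAt.prodMk (HasDerivAt.prodMk (hasDerivAt_id r) (hasDerivAt_const r τ))
      (hasDerivAt_const r z)
  have h2 := HasFDerivAt.comp_hasDerivAt (f := fun s : ℝ ↦ (((s, τ), z) : (ℝ × ℝ) × Pt n)) r hd h1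
  rw [cv_fd h hw hr hτ] at h2
  refine h2.congr_deriv ?_
  simp

lemma Wl_deriv {w : Pt n → ℝ} (hw : Integrable w) {r τ : ℝ} (hr : 0 < r) (hτ : 0 < τ) (z v : Pt n)
    (s : ℝ) :
    HasDerivAt (fun s : ℝ ↦ cv (KK n) r τ w (z + s • v))
      (∑ j, v.1 j * (r⁻¹ * cv (dxj (KK n) j) r τ w (z + s • v))
        + v.2 * (τ⁻¹ * cv (dts (KK n)) r τ w (z + s • v))) s := by
  have h := KK_isK (n := n)
  have hd := ((cv_cd h hw hr hτ (z + s • v)).differentiableAt (by simp)).hasFDerivAt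
  have h0 : HasDerivAt (fun s : ℝ ↦ z + s • v) v s := by
    simpa using ((hasDerivAt_id s).smul_const v).const_add z
  have h1 : HasDerivAt (fun s : ℝ ↦ (((r, τ), z + s • v) : (ℝ × ℝ) × Pt n)) ((0, 0), v) s :=
    HasDerivAt.prodMk (hasDerivAt_const s (r, τ)) h0
  have h2 := HasFDerivAt.comp_hasDerivAt
    (f := fun s : ℝ ↦ (((r, τ), z + s • v) : (ℝ × ℝ) × Pt n)) s hd h1
  rw [cv_fd h hw hr hτ] at h2
  refine h2.congr_deriv ?_
  simp only [zero_div, zero_mul, zero_add]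
  congr 1
  · exact Finset.sum_congr rfl fun j _ ↦ by rw [div_eq_mul_inv]; ring
  · rw [div_eq_mul_inv]; ring

def Ar (u : Pt n → ℝ≥0∞) (r τ : ℝ) (z : Pt n) : ℝ≥0∞ :=
  ofReal ((r ^ n * τ)⁻¹) * ∫⁻ y in Cl z r τ, u y

lemma Ar_fin {u : Pt n → ℝ≥0∞} (hu : ∫⁻ y, u y ≠ ∞) (r τ : ℝ) (z : Pt n) : Ar u r τ z ≠ ∞ :=
  ENNReal.mul_ne_top ENNReal.ofReal_ne_top
    ((setLIntegral_le_lintegral _ _).trans_lt hu.lt_top).ne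

lemma cv_Ar {κ : Pt n → ℝ} (h : IsK κ) {C : ℝ} (hC : ∀ y, |κ y| ≤ C) {r τ : ℝ} (hr : 0 < r)
    (hτ : 0 < τ) {w : Pt n → ℝ} {u : Pt n → ℝ≥0∞} (hw : ∀ᵐ y, ‖w y‖ₑ ≤ u y)
    (hu : ∫⁻ y, u y ≠ ∞) (z : Pt n) : |cv κ r τ w z| ≤ C * (Ar u r τ z).toReal := by
  have hC0 : 0 ≤ C := (abs_nonneg _).trans (hC 0)
  have h1 : ‖cv κ r τ w z‖ₑ ≤ ofReal C * Ar u r τ z := by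
    refine (cv_bd h hC hr hτ w z).trans ?_
    rw [ENNReal.ofReal_mul hC0, mul_assoc]
    unfold Ar
    refine mul_le_mul_right (mul_le_mul_right ?_ _) _
    exact lintegral_mono_ae (ae_restrict_of_ae hw)
  have h2 := ENNReal.toReal_mono (ENNReal.mul_ne_top ENNReal.ofReal_ne_top (Ar_fin hu r τ z)) h1
  rw [ENNReal.toReal_mul, ENNReal.toReal_ofReal hC0] at h2
  simpa using h2

lemma Ar_half {u : Pt n → ℝ≥0∞} (hu : ∫⁻ y, u y ≠ ∞) {r σ τ : ℝ} (hr : 0 < r) (hτ : 0 < τ)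
    (h1 : r / 2 ≤ σ) (h2 : σ ≤ r) (z : Pt n) :
    (Ar u σ τ z).toReal ≤ 2 ^ n * (Ar u r τ z).toReal := by
  have hσ : 0 < σ := by linarith
  have : Ar u σ τ z ≤ ofReal (2 ^ n) * Ar u r τ z := by
    unfold Ar
    rw [← mul_assoc, ← ENNReal.ofReal_mul (by positivity)]
    refine mul_le_mul' (ENNReal.ofReal_le_ofReal ?_) (lintegral_mono_set ?_)
    · have : (r / 2) ^ n * τ ≤ σ ^ n * τ := by gcongr
      calc _ ≤ ((r / 2) ^ n * τ)⁻¹ := by gcongr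
        _ = _ := by rw [div_pow]; field_simp
    · rintro y ⟨a, b⟩; exact ⟨a.trans h2, b⟩
  have h3 := ENNReal.toReal_mono (ENNReal.mul_ne_top ENNReal.ofReal_ne_top (Ar_fin hu r τ z)) this
  rwa [ENNReal.toReal_mul, ENNReal.toReal_ofReal (by positivity)] at h3

lemma Wr_step {v : Pt n → ℝ} {D P : Fin n → Pt n → ℝ} {U : Set (Pt n)} (W : WE U v D P 0)
    {C : ℝ} (hC : 0 ≤ C) (hCb : ∀ j y, |mulX (KK n) j y| ≤ C) {d : Pt n → ℝ≥0∞}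
    (hd : ∀ j, ∀ᵐ y, ‖D j y‖ₑ ≤ d y) (hdi : ∫⁻ y, d y ≠ ∞)
    {r τ : ℝ} (hr : 0 < r) (hτ : 0 < τ) {z : Pt n} (hU : Cl z r τ ⊆ U) :
    ‖cv (KK n) r τ v z - cv (KK n) (r / 2) τ v z‖ₑ ≤ ofReal (n * C * 2 ^ n * r) * Ar d r τ z := by
  have h := KK_isK (n := n)
  set a := (Ar d r τ z).toReal with ha
  have ha0 : 0 ≤ a := ENNReal.toReal_nonneg
  have := (convex_Icc (r / 2) r).norm_image_sub_le_of_norm_hasDerivWithin_le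
    (C := n * (C * (2 ^ n * a)))
    (f := fun s ↦ cv (KK n) s τ v z) (f' := fun r ↦ r⁻¹ * cv (kR (KK n)) r τ v z)
    (fun x hx ↦ (Wr_deriv W.iw (by linarith [hx.1]) hτ z).hasDerivWithinAt)
    (fun σ hx ↦ ?_) (left_mem_Icc.2 (by linarith)) (right_mem_Icc.2 (by linarith))
  · have h3 : |cv (KK n) r τ v z - cv (KK n) (r / 2) τ v z| ≤ n * C * 2 ^ n * r * a := by
      refine this.trans ?_
      rw [Real.norm_eq_abs, abs_of_nonneg (by linarith)]
      have : 0 ≤ n * (C * (2 ^ n * a)) := by positivity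
      nlinarith
    refine (enorm_le_of_abs h3).trans ?_
    rw [ENNReal.ofReal_mul (by positivity), ha, ENNReal.ofReal_toReal (Ar_fin hdi r τ z)]
  · have hσ : 0 < σ := by linarith [hx.1]
    have hU₉ : Cl z σ τ ⊆ U := fun y hy ↦ hU ⟨hy.1.trans hx.2, hy.2⟩
    simp only [Real.norm_eq_abs]
    rw [W.cvR h hσ hτ hU₉, abs_neg]
    refine sum_bd _ _ fun j ↦ ?_
    refine (cv_Ar (h.mX j) (hCb j) hσ hτ (hd j) hdi z).trans ?_
    exact mul_le_mul_of_nonneg_left (Ar_half hdi hr hτ hx.1 hx.2 z) hC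

def c0 (n : ℕ) : ℝ := max 1 (2 ^ (n + 1) * Vn n)

lemma Ar_Lp {u : Pt n → ℝ≥0∞} (hu : Measurable u) {r τ s : ℝ} (hr : 0 < r) (hτ : 0 < τ) (hs : 1 ≤ s)
    (A : Set (Pt n)) (hA : MeasurableSet A) :
    (∫⁻ z in A, Ar u r τ z ^ s) ^ (1 / s) ≤ ofReal (c0 n) * (∫⁻ y, u y ^ s) ^ (1 / s) := by
  have hs0 : 0 < s := by linarith
  have hc0 : 0 < c0 n := lt_max_of_lt_left one_pos
  have key : ∀ z, Ar u r τ z ^ s ≤ ofReal (c0 n) ^ (s - 1) * Ar (fun y ↦ u y ^ s) r τ z := by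
    intro z
    have h1 := eLpNorm'_le_eLpNorm'_mul_rpow_measure_univ (p := 1) (q := s) one_pos hs
      (μ := volume.restrict (Cl z r τ)) (f := u) hu.aestronglyMeasurable
    simp only [eLpNorm', enorm_eq_self, ENNReal.rpow_one, one_div, inv_one, Measure.restrict_apply_univ] at h1
    have h2 := ENNReal.rpow_le_rpow h1 hs0.le
    rw [ENNReal.mul_rpow_of_nonneg _ _ hs0.le, ← ENNReal.rpow_mul, ← ENNReal.rpow_mul,
      inv_mul_cancel₀ hs0.ne', ENNReal.rpow_one, sub_mul, inv_mul_cancel₀ hs0.ne', one_mul] at h2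
    have hv : volume (Cl z r τ) ≤ ofReal (c0 n) * ofReal (r ^ n * τ) := by
      refine (Cl_vol z hr hτ).trans ?_
      rw [← ENNReal.ofReal_mul hc0.le]
      apply ENNReal.ofReal_le_ofReal
      exact mul_le_mul_of_nonneg_right (le_max_right _ _) (by positivity)
    set m := ofReal (r ^ n * τ) with hm
    have hm0 : m ≠ 0 := by rw [hm]; simp; positivity
    have hmi : ofReal ((r ^ n * τ)⁻¹) = m⁻¹ := ENNReal.ofReal_inv_of_pos (by positivity)
    unfold Ar
    rw [hmi, ENNReal.mul_rpow_of_nonneg _ _ hs0.le]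
    calc _ ≤ m⁻¹ ^ s * ((∫⁻ y in Cl z r τ, u y ^ s) * (ofReal (c0 n) * m) ^ (s - 1)) := by
          refine mul_le_mul_right (h2.trans (mul_le_mul_right ?_ _)) _
          exact ENNReal.rpow_le_rpow hv (by linarith)
      _ = ofReal (c0 n) ^ (s - 1) * ((m⁻¹ ^ s * m ^ (s - 1)) * ∫⁻ y in Cl z r τ, u y ^ s) := by
          rw [ENNReal.mul_rpow_of_nonneg _ _ (by linarith : 0 ≤ s - 1)]; ring
      _ = _ := by
          congr 2
          rw [ENNReal.inv_rpow, ← ENNReal.rpow_neg, ← ENNReal.rpow_add _ _ hm0 ENNReal.ofReal_ne_top]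
          rw [show -s + (s - 1) = -1 by ring, ENNReal.rpow_neg_one]
  have h2 : ∫⁻ z in A, Ar u r τ z ^ s ≤ ofReal (c0 n) ^ s * ∫⁻ y, u y ^ s := by
    calc _ ≤ ∫⁻ z in A, ofReal (c0 n) ^ (s - 1) * Ar (fun y ↦ u y ^ s) r τ z :=
          lintegral_mono key
      _ = ofReal (c0 n) ^ (s - 1) * ∫⁻ z in A, Ar (fun y ↦ u y ^ s) r τ z :=
          lintegral_const_mul' _ _ (ENNReal.rpow_ne_top_of_nonneg (by linarith) ENNReal.ofReal_ne_top)
      _ ≤ ofReal (c0 n) ^ (s - 1) * (ofReal (c0 n) * ∫⁻ y in univ, u y ^ s) := by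
          refine mul_le_mul_right ((avg_tonelli (hu.pow_const s) hr hτ hA MeasurableSet.univ
            fun z _ ↦ subset_univ _).trans ?_) _
          exact mul_le_mul_left (ENNReal.ofReal_le_ofReal (le_max_right _ _)) _
      _ = _ := by
          rw [setLIntegral_univ, ← mul_assoc]
          congr 1
          conv_lhs => rw [← ENNReal.rpow_one (ofReal (c0 n))]
          rw [ENNReal.rpow_one, show ofReal (c0 n) ^ (s - 1) * ofReal (c0 n) =
            ofReal (c0 n) ^ (s - 1) * ofReal (c0 n) ^ (1:ℝ) by rw [ENNReal.rpow_one],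
            ← ENNReal.rpow_add _ _ (by simpa using hc0) ENNReal.ofReal_ne_top]
          congr 1; ring
  calc _ ≤ (ofReal (c0 n) ^ s * ∫⁻ y, u y ^ s) ^ (1 / s) :=
        ENNReal.rpow_le_rpow h2 (by positivity)
    _ = _ := by
        rw [ENNReal.mul_rpow_of_nonneg _ _ (by positivity), ← ENNReal.rpow_mul,
          mul_one_div_cancel hs0.ne', ENNReal.rpow_one]

def bt (u : Pt n → ℝ≥0∞) (τ t : ℝ) : ℝ≥0∞ :=
  ofReal τ⁻¹ * ∫⁻ y in {y : Pt n | |t - y.2| ≤ τ}, u y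

lemma bt_meas {u : Pt n → ℝ≥0∞} (hu : Measurable u) (τ : ℝ) : Measurable (bt u τ) ∧
    (0 < τ → ∫⁻ t, bt u τ t ≤ 2 * ∫⁻ y, u y) := by
  have hS : MeasurableSet {q : ℝ × Pt n | |q.1 - q.2.2| ≤ τ} :=
    (isClosed_le (by fun_prop) continuous_const).measurableSet
  have hm : Measurable (Function.uncurry fun (t : ℝ) (y : Pt n) ↦
      ({q : ℝ × Pt n | |q.1 - q.2.2| ≤ τ}.indicator (fun q ↦ u q.2) (t, y))) :=
    (hu.comp measurable_snd).indicator hS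
  have e : bt u τ = fun t ↦ ofReal τ⁻¹ *
      ∫⁻ y, ({q : ℝ × Pt n | |q.1 - q.2.2| ≤ τ}.indicator (fun q ↦ u q.2) (t, y)) := by
    funext t
    unfold bt
    rw [← lintegral_indicator (isClosed_le (by fun_prop) continuous_const).measurableSet]
    rfl
  refine ⟨?_, fun hτ ↦ ?_⟩
  · rw [e]; exact (hm.lintegral_prod_right').const_mul _
  · rw [e]
    rw [show (∫⁻ t, (fun t ↦ ofReal τ⁻¹ * ∫⁻ (y : Pt n), {q : ℝ × Pt n | |q.1 - q.2.2| ≤ τ}.indicator (fun q ↦ u q.2) (t, y)) t) = _ from lintegral_const_mul' _ _ ENNReal.ofReal_ne_top,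
      lintegral_lintegral_swap hm.aemeasurable]
    have : ∀ y : Pt n, ∫⁻ t, ({q : ℝ × Pt n | |q.1 - q.2.2| ≤ τ}.indicator (fun q ↦ u q.2) (t, y))
        = ofReal (2 * τ) * u y := by
      intro y
      have e2 : (fun t ↦ ({q : ℝ × Pt n | |q.1 - q.2.2| ≤ τ}.indicator (fun q ↦ u q.2) (t, y)))
          = (Icc (y.2 - τ) (y.2 + τ)).indicator fun _ ↦ u y := by
        funext t
        simp only [indicator_apply, mem_setOf_eq, mem_Icc, abs_le]
        congr 1
        apply propext
        constructor <;> intro h <;> constructor <;> linarith [h.1, h.2]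
      rw [e2, lintegral_indicator measurableSet_Icc, lintegral_const, Measure.restrict_apply_univ,
        Real.volume_Icc, mul_comm]
      congr 2; ring
    simp only [this]
    rw [lintegral_const_mul _ hu, ← mul_assoc, ← ENNReal.ofReal_mul (by positivity)]
    rw [show τ⁻¹ * (2 * τ) = 2 by field_simp]
    simp

lemma Ar_bt (u : Pt n → ℝ≥0∞) {r τ : ℝ} (hr : 0 < r) (z : Pt n) :
    Ar u r τ z ≤ ofReal ((r ^ n)⁻¹) * bt u τ z.2 := by
  unfold Ar bt
  rw [mul_inv, ENNReal.ofReal_mul (by positivity), mul_assoc]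
  exact mul_le_mul_right (mul_le_mul_right (lintegral_mono_set fun y hy ↦ hy.2) _) _

lemma Cl_Q2 {z : Pt n} (h1 : ‖z.1‖ ≤ 3 / 2) (h2 : |z.2| ≤ 9 / 4) {r τ : ℝ} (hr : r ≤ 1 / 4)
    (hτ : τ ≤ 1 / 4) : Cl z r τ ⊆ Qc 0 2 := by
  rintro y ⟨a, b⟩
  rw [mem_Qc]
  simp only [Prod.fst_zero, Prod.snd_zero, sub_zero]
  have := norm_sub_norm_le y.1 z.1
  have h3 := abs_sub_abs_le_abs_sub y.2 z.2
  rw [norm_sub_rev] at a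
  rw [abs_sub_comm] at b
  constructor
  · linarith
  · linarith

lemma V_time {v : Pt n → ℝ} {D P : Fin n → Pt n → ℝ} (W : WE (Qc 0 2) v D P 0)
    {C : ℝ} (hC : 0 ≤ C) (hCb : ∀ j y, |dxj (KK n) j y| ≤ C) {d : Pt n → ℝ≥0∞}
    (hdm : Measurable d)
    (hd : ∀ j, ∀ᵐ y, ‖P j y‖ₑ ≤ d y) (hdi : ∫⁻ y, d y ≠ ∞)
    {r τ : ℝ} (hr : 0 < r) (hr4 : r ≤ 1 / 4) (hτ : 0 < τ) (hτ4 : τ ≤ 1 / 4) {x : Spc n}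
    (hx : ‖x‖ ≤ 3 / 2) {t t₉ : ℝ} (ht : |t| ≤ 9 / 4) (ht₉ : |t₉| ≤ 9 / 4) :
    ‖cv (KK n) r τ v (x, t) - cv (KK n) r τ v (x, t₉)‖ₑ ≤
      ofReal (n * C * r⁻¹ * (r ^ n)⁻¹ * 2) * ∫⁻ y, d y := by
  have h := KK_isK (n := n)
  have hder : ∀ s, HasDerivAt (fun s : ℝ ↦ cv (KK n) r τ v (x, s))
      (τ⁻¹ * cv (dts (KK n)) r τ v (x, s)) s := by
    intro s
    have := Wl_deriv W.iw hr hτ (x, 0) (0, 1) s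
    simpa using this
  have hcont : Continuous fun s ↦ τ⁻¹ * cv (dts (KK n)) r τ v (x, s) :=
    continuous_const.mul ((cv_cont h.dt hr hτ W.iw).comp (by fun_prop))
  have e := intervalIntegral.integral_eq_sub_of_hasDerivAt (fun s _ ↦ hder s)
    (hcont.intervalIntegrable t₉ t)
  rw [← e]
  have hb : ∀ s ∈ uIoc t₉ t, ‖τ⁻¹ * cv (dts (KK n)) r τ v (x, s)‖ₑ ≤
      ofReal (n * C * r⁻¹ * (r ^ n)⁻¹) * bt d τ s := by
    intro s hs
    have hs' : |s| ≤ 9 / 4 := by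
      have := uIoc_subset_uIcc hs
      rw [mem_uIcc] at this
      rw [abs_le] at *
      rcases this with h | h <;> constructor <;> linarith [h.1, h.2, ht.1, ht.2, ht₉.1, ht₉.2]
    have hU : Cl ((x, s) : Pt n) r τ ⊆ Qc 0 2 := Cl_Q2 (z := (x, s)) hx hs' hr4 hτ4
    have e1 : |τ⁻¹ * cv (dts (KK n)) r τ v (x, s)| ≤ n * C * r⁻¹ * (Ar d r τ (x, s)).toReal := by
      rw [W.cvt h hr hτ hU]
      have : cv (KK n) r τ (0 : Pt n → ℝ) (x, s) = 0 := by simp [cv]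
      rw [this, add_zero]
      refine (sum_bd _ (r⁻¹ * (C * (Ar d r τ (x, s)).toReal)) fun j ↦ ?_).trans (le_of_eq (by ring))
      rw [abs_mul, abs_of_pos (inv_pos.2 hr)]
      exact mul_le_mul_of_nonneg_left (cv_Ar (h.dx j) (hCb j) hr hτ (hd j) hdi _) (by positivity)
    refine (enorm_le_of_abs e1).trans ?_
    rw [ENNReal.ofReal_mul (by positivity), ENNReal.ofReal_toReal (Ar_fin hdi _ _ _)]
    rw [ENNReal.ofReal_mul (q := (r ^ n)⁻¹) (by positivity), mul_assoc (ofReal _)]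
    exact mul_le_mul_right (Ar_bt d hr (x, s)) _
  rw [show ‖∫ (y : ℝ) in t₉..t, τ⁻¹ * cv (dts (KK n)) r τ v (x, y)‖ₑ =
    ‖∫ (y : ℝ) in uIoc t₉ t, τ⁻¹ * cv (dts (KK n)) r τ v (x, y)‖ₑ by
      rw [← ofReal_norm, ← ofReal_norm, intervalIntegral.norm_integral_eq_norm_integral_uIoc]]
  calc _ ≤ ∫⁻ s in uIoc t₉ t, ‖τ⁻¹ * cv (dts (KK n)) r τ v (x, s)‖ₑ :=
        enorm_integral_le_lintegral_enorm _
    _ ≤ ∫⁻ s in uIoc t₉ t, ofReal (n * C * r⁻¹ * (r ^ n)⁻¹) * bt d τ s :=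
        setLIntegral_mono ((bt_meas hdm τ).1.const_mul _) hb
    _ ≤ ∫⁻ s, ofReal (n * C * r⁻¹ * (r ^ n)⁻¹) * bt d τ s := setLIntegral_le_lintegral _ _
    _ = ofReal (n * C * r⁻¹ * (r ^ n)⁻¹) * ∫⁻ s, bt d τ s :=
        lintegral_const_mul _ (bt_meas hdm τ).1
    _ ≤ ofReal (n * C * r⁻¹ * (r ^ n)⁻¹) * (2 * ∫⁻ y, d y) :=
        mul_le_mul_right ((bt_meas hdm τ).2 hτ) _
    _ = _ := by
        rw [ENNReal.ofReal_mul (q := 2) (by positivity), mul_assoc (ofReal _)]; simp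

lemma V_space {v : Pt n → ℝ} {D P : Fin n → Pt n → ℝ} (W : WE (Qc 0 2) v D P 0)
    {C : ℝ} (hC : 0 ≤ C) (hCb : ∀ y, |KK n y| ≤ C) {d : Pt n → ℝ≥0∞}
    (hdm : Measurable d)
    (hd : ∀ j, ∀ᵐ y, ‖D j y‖ₑ ≤ d y) (hdi : ∫⁻ y, d y ≠ ∞)
    {r τ : ℝ} (hr : 0 < r) (hr4 : r ≤ 1 / 4) (hτ : 0 < τ) (hτ4 : τ ≤ 1 / 4) :
    ∃ t₉, |t₉| ≤ 9 / 4 ∧ ∀ x : Spc n, ‖x‖ ≤ 3 / 2 →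
    ‖cv (KK n) r τ v (x, t₉) - cv (KK n) r τ v (0, t₉)‖ₑ ≤
      ofReal (n * C * (r ^ n)⁻¹ * 2) * ∫⁻ y, d y := by
  have h := KK_isK (n := n)
  obtain ⟨t₉, ht₉, hb⟩ := exists_le_setLAverage (μ := volume) (s := Icc (-1:ℝ) 1) (f := bt d τ)
    (by rw [Real.volume_Icc]; simp) (by rw [Real.volume_Icc]; simp)
    (bt_meas hdm τ).1.aemeasurable
  have hbt : bt d τ t₉ ≤ ∫⁻ y, d y := by
    refine hb.trans ?_
    rw [setLAverage_eq, Real.volume_Icc]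
    refine ENNReal.div_le_of_le_mul' ?_
    refine (setLIntegral_le_lintegral _ _).trans (((bt_meas hdm τ).2 hτ).trans (le_of_eq ?_))
    norm_num
  have ht4 : |t₉| ≤ 9 / 4 := by rw [abs_le]; constructor <;> linarith [ht₉.1, ht₉.2]
  refine ⟨t₉, ht4, fun x hx ↦ ?_⟩
  set m := ofReal ((r ^ n)⁻¹) * ∫⁻ y, d y with hm
  have hmf : m ≠ ∞ := ENNReal.mul_ne_top ENNReal.ofReal_ne_top hdi
  have := (convex_Icc (0:ℝ) 1).norm_image_sub_le_of_norm_hasDerivWithin_le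
    (C := n * (C * m.toReal * 2))
    (f := fun s : ℝ ↦ cv (KK n) r τ v (((0, t₉) : Pt n) + s • ((x, 0) : Pt n)))
    (fun s _ ↦ (Wl_deriv W.iw hr hτ (0, t₉) (x, 0) s).hasDerivWithinAt)
    (fun s hs ↦ ?_) (left_mem_Icc.2 zero_le_one) (right_mem_Icc.2 zero_le_one)
  · simp only [one_smul, zero_smul, add_zero, Prod.mk_add_mk, zero_add, sub_zero, norm_one, mul_one] at this
    rw [Real.norm_eq_abs] at this
    refine (enorm_le_of_abs this).trans (le_of_eq ?_)
    rw [show n * (C * m.toReal * 2) = n * C * 2 * m.toReal by ring,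
      ENNReal.ofReal_mul (by positivity), ENNReal.ofReal_toReal hmf, hm, ← mul_assoc,
      ← ENNReal.ofReal_mul (by positivity)]
    congr 2; ring
  · simp only [zero_mul, add_zero, Real.norm_eq_abs]
    have hpt : ((0, t₉) : Pt n) + s • ((x, 0) : Pt n) = (s • x, t₉) := by simp
    rw [hpt]
    have hsx : ‖s • x‖ ≤ 3 / 2 := by
      rw [norm_smul, Real.norm_eq_abs, abs_of_nonneg hs.1]
      nlinarith [norm_nonneg x, hs.2, hs.1]
    have hU : Cl ((s • x, t₉) : Pt n) r τ ⊆ Qc 0 2 := Cl_Q2 (z := (s • x, t₉)) hsx ht4 hr4 hτ4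
    refine sum_bd _ _ fun j ↦ ?_
    rw [W.cvx h hr hτ hU, abs_mul]
    have h1 : |x j| ≤ 2 := by
      have := PiLp.norm_apply_le x j
      rw [Real.norm_eq_abs] at this; linarith
    have h2 := cv_Ar h hCb hr hτ (hd j) hdi ((s • x, t₉) : Pt n)
    have h3 : (Ar d r τ ((s • x, t₉) : Pt n)).toReal ≤ m.toReal :=
      ENNReal.toReal_mono hmf ((Ar_bt d hr _).trans (mul_le_mul_right hbt _))
    have h4 := h2.trans (mul_le_mul_of_nonneg_left h3 hC)
    calc _ ≤ 2 * (C * m.toReal) := mul_le_mul h1 h4 (abs_nonneg _) (by norm_num)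
      _ = _ := by ring

lemma mem_Q32 {z : Pt n} (hz : z ∈ Qc 0 (3 / 2)) : ‖z.1‖ ≤ 3 / 2 ∧ |z.2| ≤ 9 / 4 := by
  rw [mem_Qc] at hz
  simp only [Prod.fst_zero, Prod.snd_zero, sub_zero] at hz
  exact ⟨hz.1.le, by linarith [hz.2]⟩

lemma ehr1 (n : ℕ) : ∃ K : ℝ, 0 < K ∧ ∀ e : ℝ, 0 < e → e ≤ 1 / 4 → ∃ Ke : ℝ, 0 < Ke ∧
    ∀ (v : Pt n → ℝ) (D P : Fin n → Pt n → ℝ) (d Pd : Pt n → ℝ≥0∞), WE (Qc 0 2) v D P 0 →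
    Measurable d → Measurable Pd → ∫⁻ z, d z ≠ ∞ → ∫⁻ z, Pd z ≠ ∞ →
    (∀ j, ∀ᵐ y, ‖D j y‖ₑ ≤ d y) → (∀ j, ∀ᵐ y, ‖P j y‖ₑ ≤ Pd y) → ∀ τ, 0 < τ → τ ≤ 1 / 4 →
    ∃ c : ℝ, ∀ s : ℝ, 1 ≤ s → ∀ k : ℕ,
      eLpNorm (fun z ↦ cv (KK n) (e * (1 / 2) ^ k) τ v z - c) (ofReal s)
        (volume.restrict (Qc 0 (3 / 2))) ≤
      ofReal Ke * ((∫⁻ z, d z) + ∫⁻ z, Pd z) +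
      ofReal (K * e) * (∫⁻ z, d z ^ s) ^ (1 / s) := by
  obtain ⟨C, hC1, c1, c2, c3, -⟩ := exC n
  have hC : 0 < C := by linarith
  have h := KK_isK (n := n)
  have hc0 : 0 < c0 n := lt_max_of_lt_left one_pos
  set V : ℝ≥0∞ := max 1 (volume (Qc (0 : Pt n) (3 / 2))) with hV
  have hVf : V ≠ ∞ := by
    rw [hV, vol_Qc _ (by norm_num)]; exact (max_lt ENNReal.one_lt_top ENNReal.ofReal_lt_top).ne
  refine ⟨2 * (n * C * 2 ^ n * c0 n) + 1, by positivity, fun e he he4 ↦ ?_⟩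
  refine ⟨(n * C * e⁻¹ * (e ^ n)⁻¹ * 2 + n * C * (e ^ n)⁻¹ * 2) * V.toReal + 1, by positivity, ?_⟩
  intro v D P d Pd W hdm hPm hdi hPi hd hP τ hτ hτ4
  obtain ⟨t₉, ht₉, hsp⟩ := V_space W hC.le c1 hdm hd hdi he he4 hτ hτ4
  set c := cv (KK n) e τ v (0, t₉) with hc
  refine ⟨c, fun s hs k ↦ ?_⟩
  set X := (∫⁻ z, d z) + ∫⁻ z, Pd z with hX
  set Y := (∫⁻ z, d z ^ s) ^ (1 / s) with hY
  have hs1 : 1 ≤ ofReal s := by simpa using hs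
  have hs0 : ofReal s ≠ 0 := (zero_lt_one.trans_le hs1).ne'
  have hst : (ofReal s).toReal = s := ENNReal.toReal_ofReal (by linarith)
  set μ := volume.restrict (Qc (0 : Pt n) (3 / 2)) with hμ
  have hQm : MeasurableSet (Qc (0 : Pt n) (3 / 2)) := meas_Qc _ _
  have hr : ∀ i : ℕ, 0 < e * (1 / 2) ^ i := fun i ↦ by positivity
  have hr4 : ∀ i : ℕ, e * (1 / 2) ^ i ≤ 1 / 4 := fun i ↦
    (mul_le_of_le_one_right he.le (pow_le_one₀ (by norm_num) (by norm_num))).trans he4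
  have hcont : ∀ i : ℕ, Continuous (cv (KK n) (e * (1 / 2) ^ i) τ v) := fun i ↦
    cv_cont h (hr i) hτ W.iw
  set R0 := ofReal ((n * C * e⁻¹ * (e ^ n)⁻¹ * 2 + n * C * (e ^ n)⁻¹ * 2) * V.toReal + 1) * X
    with hR0
  have base : eLpNorm (fun z ↦ cv (KK n) e τ v z - c) (ofReal s) μ ≤ R0 := by
    have hb : ∀ᵐ z ∂μ, ‖cv (KK n) e τ v z - c‖ₑ ≤
        ofReal (n * C * e⁻¹ * (e ^ n)⁻¹ * 2 + n * C * (e ^ n)⁻¹ * 2) * X := by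
      refine (ae_restrict_iff' hQm).2 (Eventually.of_forall fun z hz ↦ ?_)
      obtain ⟨z1, z2⟩ := mem_Q32 hz
      have a1 := V_time W hC.le c2 hPm hP hPi he he4 hτ hτ4 z1 z2 ht₉
      have a2 := hsp z.1 z1
      have : cv (KK n) e τ v z - c = (cv (KK n) e τ v (z.1, z.2) - cv (KK n) e τ v (z.1, t₉)) +
        (cv (KK n) e τ v (z.1, t₉) - cv (KK n) e τ v (0, t₉)) := by rw [hc]; simp
      rw [this]
      refine (enorm_add_le _ _).trans ((add_le_add a1 a2).trans ?_)
      rw [ENNReal.ofReal_add (by positivity) (by positivity), add_mul]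
      refine add_le_add (mul_le_mul_right ?_ _) (mul_le_mul_right ?_ _)
      · exact le_add_self
      · exact le_self_add
    refine (eLpNorm_le_of_ae_enorm_bound hb).trans ?_
    rw [smul_eq_mul, hst, hR0, mul_comm, hμ, Measure.restrict_apply_univ]
    have : volume (Qc (0 : Pt n) (3 / 2)) ^ s⁻¹ ≤ V := by
      calc _ ≤ V ^ s⁻¹ := ENNReal.rpow_le_rpow (le_max_right _ _) (by positivity)
        _ ≤ V ^ (1:ℝ) := ENNReal.rpow_le_rpow_of_exponent_le (le_max_left _ _) (inv_le_one_of_one_le₀ hs)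
        _ = V := ENNReal.rpow_one V
    refine (mul_le_mul_left this _).trans ?_
    rw [← mul_assoc, mul_comm V]
    refine mul_le_mul_left ?_ _
    rw [← ENNReal.ofReal_toReal hVf, ← ENNReal.ofReal_mul (by positivity),
      ENNReal.toReal_ofReal ENNReal.toReal_nonneg]
    exact ENNReal.ofReal_le_ofReal (by linarith)
  have step : ∀ i : ℕ, eLpNorm (fun z ↦ cv (KK n) (e * (1 / 2) ^ (i+1)) τ v z -
      cv (KK n) (e * (1 / 2) ^ i) τ v z) (ofReal s) μ ≤
      ofReal (n * C * 2 ^ n * c0 n * e * (1 / 2) ^ i) * Y := by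
    intro i
    rw [eLpNorm_eq_lintegral_rpow_enorm_toReal hs0 ENNReal.ofReal_ne_top, hst]
    calc _ ≤ (∫⁻ z in Qc (0 : Pt n) (3 / 2), (ofReal (n * C * 2 ^ n * (e * (1 / 2) ^ i)) *
          Ar d (e * (1 / 2) ^ i) τ z) ^ s) ^ (1 / s) := by
          refine ENNReal.rpow_le_rpow (lintegral_mono_ae ?_) (by positivity)
          refine (ae_restrict_iff' hQm).2 (Eventually.of_forall fun z hz ↦ ?_)
          obtain ⟨z1, z2⟩ := mem_Q32 hz
          refine ENNReal.rpow_le_rpow ?_ (by linarith)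
          have := Wr_step W hC.le c3 hd hdi (hr i) hτ (Cl_Q2 z1 z2 (hr4 i) hτ4)
          rw [← enorm_neg, neg_sub]
          refine le_trans (le_of_eq ?_) this
          rw [pow_succ, ← mul_assoc]; ring_nf
      _ = ofReal (n * C * 2 ^ n * (e * (1 / 2) ^ i)) *
          (∫⁻ z in Qc (0 : Pt n) (3 / 2), Ar d (e * (1 / 2) ^ i) τ z ^ s) ^ (1 / s) := by
          have hs0₉ : 0 ≤ s := by linarith
          simp only [ENNReal.mul_rpow_of_nonneg _ _ hs0₉]
          rw [lintegral_const_mul' _ _ (ENNReal.rpow_ne_top_of_nonneg hs0₉ ENNReal.ofReal_ne_top),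
            ENNReal.mul_rpow_of_nonneg _ _ (by positivity), ← ENNReal.rpow_mul,
            mul_one_div_cancel (by linarith), ENNReal.rpow_one]
      _ ≤ ofReal (n * C * 2 ^ n * (e * (1 / 2) ^ i)) * (ofReal (c0 n) * Y) :=
          mul_le_mul_right (Ar_Lp hdm (hr i) hτ hs _ hQm) _
      _ = _ := by
          rw [← mul_assoc, ← ENNReal.ofReal_mul (by positivity)]; congr 2; ring
  have ind : ∀ k : ℕ, eLpNorm (fun z ↦ cv (KK n) (e * (1 / 2) ^ k) τ v z - c) (ofReal s) μ ≤
      R0 + ∑ i ∈ Finset.range k, ofReal (n * C * 2 ^ n * c0 n * e * (1 / 2) ^ i) * Y := by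
    intro k
    induction k with
    | zero => simpa using base
    | succ k ih =>
      rw [Finset.sum_range_succ, ← add_assoc]
      have := eLpNorm_add_le (μ := μ) (f := fun z ↦ cv (KK n) (e * (1 / 2) ^ k) τ v z - c)
        (g := fun z ↦ cv (KK n) (e * (1 / 2) ^ (k+1)) τ v z - cv (KK n) (e * (1 / 2) ^ k) τ v z)
        ((hcont k).sub continuous_const).aestronglyMeasurable
        ((hcont (k+1)).sub (hcont k)).aestronglyMeasurable hs1
      refine le_trans (le_of_eq ?_) (this.trans (add_le_add ih (step k)))
      congr 1; funext z; simp
  refine (ind k).trans (add_le_add le_rfl ?_)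
  rw [← Finset.sum_mul]
  refine mul_le_mul_left ?_ _
  refine (ENNReal.sum_le_tsum _).trans ?_
  rw [ofReal_geom _ (by positivity)]
  exact ENNReal.ofReal_le_ofReal (by nlinarith)

lemma ehrling (n : ℕ) : ∃ K : ℝ, 0 < K ∧ ∀ e : ℝ, 0 < e → e ≤ 1 / 4 → ∃ Ke : ℝ, 0 < Ke ∧
    ∀ (v : Pt n → ℝ) (D P : Fin n → Pt n → ℝ) (d Pd : Pt n → ℝ≥0∞), WE (Qc 0 2) v D P 0 →
    Measurable d → Measurable Pd → ∫⁻ z, d z ≠ ∞ → ∫⁻ z, Pd z ≠ ∞ →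
    (∀ j, ∀ᵐ y, ‖D j y‖ₑ ≤ d y) → (∀ j, ∀ᵐ y, ‖P j y‖ₑ ≤ Pd y) →
    ∀ s : ℝ, 1 ≤ s → ∃ c : ℝ, 
      (∫⁻ z in Qc 0 (3 / 2), ‖v z - c‖ₑ ^ s) ^ (1 / s) ≤
      ofReal Ke * ((∫⁻ z, d z) + ∫⁻ z, Pd z) +
      ofReal (K * e) * (∫⁻ z, d z ^ s) ^ (1 / s) := by
  obtain ⟨K, hK, H⟩ := ehr1 n
  refine ⟨K, hK, fun e he he4 ↦ ?_⟩
  obtain ⟨Ke, hKe, H⟩ := H e he he4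
  refine ⟨Ke, hKe, ?_⟩
  intro v D P d Pd W hdm hPm hdi hPi hd hP s hs
  have h := KK_isK (n := n)
  obtain ⟨C, hC1, cb, -⟩ := exC n
  set τ : ℕ → ℝ := fun k ↦ 1 / 4 * (1 / 2) ^ k with hτd
  have hτ : ∀ k, 0 < τ k := fun k ↦ by positivity
  have hτ4 : ∀ k, τ k ≤ 1 / 4 := fun k ↦
    (mul_le_of_le_one_right (by norm_num) (pow_le_one₀ (by norm_num) (by norm_num)))
  have hr : ∀ i : ℕ, 0 < e * (1 / 2) ^ i := fun i ↦ by positivity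
  choose c hcb using fun k ↦ H v D P d Pd W hdm hPm hdi hPi hd hP (τ k) (hτ k) (hτ4 k)
  set f : ℕ → Pt n → ℝ := fun k ↦ cv (KK n) (e * (1 / 2) ^ k) (τ k) v with hf
  have hfc : ∀ k, Continuous (f k) := fun k ↦ cv_cont h (hr k) (hτ k) W.iw
  have g0 : Tendsto (fun k : ℕ ↦ ((1:ℝ) / 2) ^ k) atTop (𝓝 0) :=
    tendsto_pow_atTop_nhds_zero_of_lt_one (by norm_num) (by norm_num)
  have ht := cv_tend h W.iw hr hτ (by simpa using g0.const_mul e) (by simpa [hτd] using g0.const_mul (4⁻¹ : ℝ))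
  rw [KK_int] at ht
  simp only [one_mul] at ht
  obtain ⟨ns, hns, hae⟩ := sub_ae (f := f) (fun k ↦ (hfc k).aestronglyMeasurable) W.iw.1 ht
  set μ := volume.restrict (Qc (0 : Pt n) (3 / 2)) with hμ
  have hQm : MeasurableSet (Qc (0 : Pt n) (3 / 2)) := meas_Qc _ _
  set X := (∫⁻ z, d z) + ∫⁻ z, Pd z with hX
  have hXf : X ≠ ∞ := ENNReal.add_ne_top.2 ⟨hdi, hPi⟩

  have hvol : 0 < volume (Qc (0 : Pt n) (3 / 2)) := by
    rw [vol_Qc _ (by norm_num)]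
    have := Vn_pos n
    simp; positivity
  obtain ⟨R, hR⟩ : ∃ R : ℝ, ∀ k, ‖c k‖ ≤ R := by
    set M : ℝ≥0∞ := (ofReal (C * (2 ^ (n + 1) * Vn n)) * ∫⁻ z, ‖v z‖ₑ) +
      (ofReal Ke * X + ofReal (K * e) * (∫⁻ z, d z)) with hM
    have hMf : M ≠ ∞ := by
      refine ENNReal.add_ne_top.2 ⟨ENNReal.mul_ne_top ENNReal.ofReal_ne_top W.iw.2.ne, ?_⟩
      exact ENNReal.add_ne_top.2 ⟨ENNReal.mul_ne_top ENNReal.ofReal_ne_top hXf,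
        ENNReal.mul_ne_top ENNReal.ofReal_ne_top hdi⟩
    refine ⟨(M / volume (Qc (0 : Pt n) (3 / 2))).toReal, fun k ↦ ?_⟩
    have h1 := hcb k 1 le_rfl k
    simp only [ENNReal.ofReal_one, eLpNorm_one_eq_lintegral_enorm, ENNReal.rpow_one, div_one] at h1
    have h2 : ‖c k‖ₑ * volume (Qc (0 : Pt n) (3 / 2)) ≤ M := by
      calc ‖c k‖ₑ * volume (Qc (0 : Pt n) (3 / 2)) = ∫⁻ z, ‖c k‖ₑ ∂μ := by
            rw [lintegral_const, hμ, Measure.restrict_apply_univ]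
        _ ≤ ∫⁻ z, (‖f k z‖ₑ + ‖f k z - c k‖ₑ) ∂μ := by
            refine lintegral_mono fun z ↦ ?_
            have : c k = f k z - (f k z - c k) := by ring
            conv_lhs => rw [this]
            exact enorm_sub_le
        _ = ∫⁻ z, ‖f k z‖ₑ ∂μ + ∫⁻ z, ‖f k z - c k‖ₑ ∂μ :=
            lintegral_add_left' (hfc k).aestronglyMeasurable.enorm _
        _ ≤ M := by
            refine add_le_add ?_ h1
            exact (setLIntegral_le_lintegral _ _).trans (cv_L1 h cb (hr k) (hτ k) W.iw)
    have h3 : ‖c k‖ₑ ≤ M / volume (Qc (0 : Pt n) (3 / 2)) :=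
      (ENNReal.le_div_iff_mul_le (Or.inl hvol.ne') (Or.inr hMf)).2 h2
    have h4 := ENNReal.toReal_mono (ENNReal.div_ne_top hMf hvol.ne') h3
    simpa using h4
  obtain ⟨cc, -, ms, hms, hlim⟩ := tendsto_subseq_of_bounded (s := closedBall (0:ℝ) R)
    isBounded_closedBall (x := fun k ↦ c (ns k)) (fun k ↦ by simpa using hR (ns k))
  refine ⟨cc, ?_⟩
  have hs1 : 1 ≤ ofReal s := by simpa using hs
  have hs0 : ofReal s ≠ 0 := (zero_lt_one.trans_le hs1).ne'
  have hst : (ofReal s).toReal = s := ENNReal.toReal_ofReal (by linarith)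
  have e1 := eLpNorm_eq_lintegral_rpow_enorm_toReal (μ := μ) hs0 ENNReal.ofReal_ne_top
    (f := fun z ↦ v z - cc)
  rw [hst] at e1
  rw [← e1]
  have hfat := Lp.eLpNorm_lim_le_liminf_eLpNorm (μ := μ) (p := ofReal s)
    (f := fun k z ↦ f (ns (ms k)) z - c (ns (ms k)))
    (fun k ↦ ((hfc _).sub continuous_const).aestronglyMeasurable) (fun z ↦ v z - cc)
    (by
      filter_upwards [ae_restrict_of_ae hae] with z hz
      exact (hz.comp hms.tendsto_atTop).sub hlim)
  refine hfat.trans ?_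
  refine liminf_le_of_le (by isBoundedDefault) fun b hb ↦ ?_
  obtain ⟨k, hk⟩ := hb.exists
  exact hk.trans (hcb _ s hs _)

structure SC (η : Pt n → ℝ) : Prop where
  cd : ContDiff ℝ (⊤ : ℕ∞) η
  cs : HasCompactSupport η

lemma SC.fd {η : Pt n → ℝ} (h : SC η) (v : Pt n) :
    Continuous (fun z ↦ fderiv ℝ η z v) ∧ HasCompactSupport (fun z ↦ fderiv ℝ η z v) :=
  ⟨(h.cd.continuous_fderiv (by simp)).clm_apply continuous_const, h.cs.fderiv_apply (𝕜 := ℝ) v⟩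

lemma cc_bdd {ζ : Pt n → ℝ} (h1 : Continuous ζ) (h2 : HasCompactSupport ζ) :
    ∃ C, 0 < C ∧ ∀ z, |ζ z| ≤ C := by
  obtain ⟨C, hC⟩ := h2.exists_bound_of_continuous h1
  exact ⟨max C 1, lt_max_of_lt_right one_pos, fun z ↦ (hC z).trans (le_max_left _ _)⟩

lemma int_mul_cc {f ζ : Pt n → ℝ} (hf : Integrable f) (h1 : Continuous ζ) (h2 : HasCompactSupport ζ) :
    Integrable (fun z ↦ f z * ζ z) := by
  obtain ⟨C, -, hC⟩ := cc_bdd h1 h2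
  exact hf.mul_bdd (c := C) h1.aestronglyMeasurable (Eventually.of_forall hC)

lemma int_sub_cc {f ζ : Pt n → ℝ} (c : ℝ) (hf : Integrable f) (h1 : Continuous ζ) (h2 : HasCompactSupport ζ) :
    Integrable (fun z ↦ (f z - c) * ζ z) := by
  have := (int_mul_cc hf h1 h2).sub ((h1.integrable_of_hasCompactSupport h2).const_mul c)
  refine this.congr (Eventually.of_forall fun z ↦ ?_)
  simp; ring

lemma SC.int0 {η : Pt n → ℝ} (h : SC η) (v : Pt n) : ∫ z, fderiv ℝ η z v = 0 := by
  have := integral_mul_fderiv_eq_neg_fderiv_mul_of_integrable (𝕜 := ℝ) (μ := (volume : Measure (Pt n)))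
    (f := fun _ ↦ (1 : ℝ)) (g := η) (v := v) (by simp)
    (by simp only [one_mul]
        exact (h.fd v).1.integrable_of_hasCompactSupport (h.fd v).2)
    (by simpa using (h.cd.continuous.integrable_of_hasCompactSupport h.cs)) (by simp)
    (fun x _ ↦ h.cd.differentiable (by simp) x)
  simpa using this

lemma SC.mul {η ψ : Pt n → ℝ} (h : SC η) (h₉ : SC ψ) : SC (fun z ↦ η z * ψ z) :=
  ⟨h.cd.mul h₉.cd, h.cs.mul_right⟩

lemma fd_mul {η ψ : Pt n → ℝ} (h : SC η) (h₉ : SC ψ) (z v : Pt n) :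
    fderiv ℝ (fun z ↦ η z * ψ z) z v = η z * fderiv ℝ ψ z v + ψ z * fderiv ℝ η z v := by
  rw [fderiv_fun_mul (h.cd.differentiable (by simp) z) (h₉.cd.differentiable (by simp) z)]
  simp

lemma cut_aux {w η ψ : Pt n → ℝ} (iw : Integrable w) (c : ℝ) (h : SC η) (h₉ : SC ψ) (v : Pt n) :
    ∫ z, (w z - c) * η z * fderiv ℝ ψ z v = (∫ z, w z * fderiv ℝ (fun z ↦ η z * ψ z) z v)
      - ∫ z, (w z - c) * fderiv ℝ η z v * ψ z := by
  have hm := h.mul h₉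
  have e0 : ∫ z, w z * fderiv ℝ (fun z ↦ η z * ψ z) z v
      = ∫ z, (w z - c) * fderiv ℝ (fun z ↦ η z * ψ z) z v := by
    have i1 := int_mul_cc iw (hm.fd v).1 (hm.fd v).2
    have i2 := ((hm.fd v).1.integrable_of_hasCompactSupport (μ := volume) (hm.fd v).2).const_mul c
    simp only [sub_mul]
    rw [integral_sub i1 i2, integral_const_mul, hm.int0 v]; simp
  have i3 := int_sub_cc c iw (hm.fd v).1 (hm.fd v).2
  have i4 : Integrable (fun z ↦ (w z - c) * fderiv ℝ η z v * ψ z) := by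
    have := int_mul_cc (int_sub_cc c iw (h.fd v).1 (h.fd v).2) h₉.cd.continuous h₉.cs
    exact this
  rw [e0, ← integral_sub i3 i4]
  congr 1; funext z
  rw [fd_mul h h₉]; ring

lemma WE.cut {U : Set (Pt n)} {w : Pt n → ℝ} {G B : Fin n → Pt n → ℝ} (W : WE U w G B 0) (c : ℝ)
    {η : Pt n → ℝ} (h : SC η) (hs : tsupport η ⊆ U) :
    WE univ (fun z ↦ (w z - c) * η z) (fun j z ↦ η z * G j z + (w z - c) * dxj η j z)
      (fun j z ↦ η z * B j z) (fun z ↦ (w z - c) * dts η z - ∑ j, B j z * dxj η j z) := by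
  have hsub : ∀ ψ : Pt n → ℝ, tsupport (fun z ↦ η z * ψ z) ⊆ U := fun ψ ↦
    (tsupport_mul_subset_left (f := η) (g := ψ)).trans hs
  have iG : ∀ j, Integrable (fun z ↦ η z * G j z) := fun j ↦
    (int_mul_cc (W.iG j) h.cd.continuous h.cs).congr (Eventually.of_forall fun z ↦ mul_comm _ _)
  have iB : ∀ j, Integrable (fun z ↦ η z * B j z) := fun j ↦
    (int_mul_cc (W.iB j) h.cd.continuous h.cs).congr (Eventually.of_forall fun z ↦ mul_comm _ _)
  have iw : ∀ v, Integrable (fun z ↦ (w z - c) * fderiv ℝ η z v) := fun v ↦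
    int_sub_cc c W.iw (h.fd v).1 (h.fd v).2
  have iBd : ∀ j, Integrable (fun z ↦ B j z * dxj η j z) := fun j ↦
    int_mul_cc (W.iB j) (h.fd _).1 (h.fd _).2
  refine ⟨int_sub_cc c W.iw h.cd.continuous h.cs, fun j ↦ (iG j).add (iw _), iB,
    (iw _).sub (integrable_finsetSum _ fun j _ ↦ iBd j), ?_, ?_⟩
  · intro j ψ p1 p2 _
    have h₉ : SC ψ := ⟨p1, p2⟩
    have e1 := cut_aux W.iw c h h₉ (EuclideanSpace.single j 1, 0)
    have e2 := W.hx j _ (h.mul h₉).cd (h.mul h₉).cs (hsub ψ)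
    unfold dxj at e2 ⊢
    rw [e1, e2]
    have i1 := int_mul_cc (iG j) p1.continuous p2
    have i2 := int_mul_cc (iw (EuclideanSpace.single j 1, 0)) p1.continuous p2
    rw [← neg_add', ← integral_add]
    · congr 2; funext z; ring
    · exact i1.congr (Eventually.of_forall fun z ↦ by simp only []; ring)
    · exact i2
  · intro ψ p1 p2 _
    have h₉ : SC ψ := ⟨p1, p2⟩
    have e1 := cut_aux W.iw c h h₉ (0, 1)
    have e2 := W.ht _ (h.mul h₉).cd (h.mul h₉).cs (hsub ψ)
    simp only [Pi.zero_apply, zero_mul, integral_zero, sub_zero] at e2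
    unfold dts at e2 ⊢
    rw [e1, e2]
    have i2 := int_mul_cc (iw (0, 1)) p1.continuous p2
    have i3 : ∀ j, Integrable (fun z ↦ B j z * dxj η j z * ψ z) := fun j ↦
      int_mul_cc (iBd j) p1.continuous p2
    have i4 : ∀ j, Integrable (fun z ↦ η z * B j z * dxj ψ j z) := fun j ↦
      int_mul_cc (iB j) (h₉.fd _).1 (h₉.fd _).2
    have e3 : ∀ j, ∫ z, B j z * dxj (fun z ↦ η z * ψ z) j z =
        (∫ z, η z * B j z * dxj ψ j z) + ∫ z, B j z * dxj η j z * ψ z := by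
      intro j
      rw [← integral_add (i4 j) (i3 j)]
      congr 1; funext z
      unfold dxj
      rw [fd_mul h h₉]; ring
    have e4 : ∫ z, ((w z - c) * fderiv ℝ η z (0, 1) - ∑ j, B j z * dxj η j z) * ψ z =
        (∫ z, (w z - c) * fderiv ℝ η z (0, 1) * ψ z) - ∑ j, ∫ z, B j z * dxj η j z * ψ z := by
      rw [← integral_finsetSum _ fun j _ ↦ i3 j, ← integral_sub i2 (integrable_finsetSum _ fun j _ ↦ i3 j)]
      congr 1; funext z
      rw [sub_mul, Finset.sum_mul]
    rw [e4]
    simp only [e3, Finset.sum_add_distrib]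
    ring

lemma exists_cut (n : ℕ) : ∃ η : Pt n → ℝ, SC η ∧ tsupport η ⊆ Qc 0 (3 / 2) ∧ (∀ z, 0 ≤ η z) ∧
    (∀ z, η z ≤ 1) ∧ ∀ z ∈ Qc (0 : Pt n) 1, η z = 1 := by
  let f : ContDiffBump (0 : Spc n) := ⟨1, 5 / 4, by norm_num, by norm_num⟩
  let g : ContDiffBump (0 : ℝ) := ⟨1, 2, by norm_num, by norm_num⟩
  have hts : Function.support (fun z : Pt n ↦ f z.1 * g z.2) ⊆ closedBall 0 (5/4) ×ˢ closedBall 0 2 := by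
    intro z hz
    rw [Function.mem_support] at hz
    have h1 : z.1 ∈ Function.support f := fun h ↦ hz (by rw [h, zero_mul])
    have h2 : z.2 ∈ Function.support g := fun h ↦ hz (by rw [h, mul_zero])
    rw [f.support_eq] at h1
    rw [g.support_eq] at h2
    exact ⟨ball_subset_closedBall h1, ball_subset_closedBall h2⟩
  have hK : IsCompact (closedBall (0 : Spc n) (5/4) ×ˢ closedBall (0:ℝ) 2) :=
    (isCompact_closedBall _ _).prod (isCompact_closedBall _ _)
  have hts₉ := closure_minimal hts hK.isClosed
  refine ⟨fun z ↦ f z.1 * g z.2, ⟨?_, hK.of_isClosed_subset isClosed_closure hts₉⟩, ?_, ?_, ?_, ?_⟩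
  · exact (f.contDiff.comp contDiff_fst).mul (g.contDiff.comp contDiff_snd)
  · refine hts₉.trans ?_
    rintro z ⟨h1, h2⟩
    rw [mem_Qc]
    simp only [mem_closedBall, dist_zero_right, Real.norm_eq_abs] at h1 h2
    simp only [Prod.fst_zero, Prod.snd_zero, sub_zero]
    constructor <;> linarith
  · exact fun z ↦ mul_nonneg f.nonneg g.nonneg
  · exact fun z ↦ mul_le_one₀ f.le_one g.nonneg g.le_one
  · intro z hz
    rw [mem_Qc] at hz
    simp only [Prod.fst_zero, Prod.snd_zero, sub_zero] at hz
    have h1 : f z.1 = 1 := f.one_of_mem_closedBall (by simpa using hz.1.le)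
    have h2 : g z.2 = 1 := g.one_of_mem_closedBall (by simpa using hz.2.le)
    simp [h1, h2]

lemma exists_cut' (n : ℕ) : ∃ η : Pt n → ℝ, SC η ∧ tsupport η ⊆ Qc 0 (3 / 2) ∧ (∀ z, 0 ≤ η z) ∧
    (∀ z, η z ≤ 1) ∧ (∀ z ∈ Qc (0 : Pt n) 1, η z = 1) ∧ ∃ C : ℝ, 1 ≤ C ∧ (∀ j z, |dxj η j z| ≤ C) ∧
    ∀ z, |dts η z| ≤ C := by
  obtain ⟨η, h, h1, h2, h3, h4⟩ := exists_cut n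
  refine ⟨η, h, h1, h2, h3, h4, ?_⟩
  obtain ⟨C, hC, hCb⟩ := cc_bdd (h.fd (0, 1)).1 (h.fd (0, 1)).2
  choose C2 hC2 hC2b using fun j : Fin n ↦ cc_bdd (h.fd (EuclideanSpace.single j 1, 0)).1
    (h.fd (EuclideanSpace.single j 1, 0)).2
  have hs : 0 ≤ ∑ j, C2 j := Finset.sum_nonneg fun j _ ↦ (hC2 j).le
  refine ⟨1 + C + ∑ j, C2 j, by linarith, fun j z ↦ ?_, fun z ↦ ?_⟩
  · have := Finset.single_le_sum (f := C2) (fun j _ ↦ (hC2 j).le) (Finset.mem_univ j)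
    have h5 := hC2b j z
    unfold dxj; linarith
  · have := hCb z
    unfold dts; linarith

lemma yg1 {q ε x y : ℝ} (hq : 2 < q) (hε : 0 < ε) (hx : 0 ≤ x) (hy : 0 ≤ y) :
    x ^ (q - 1) * y ≤ ε * x ^ q + ε⁻¹ ^ (q - 1) * y ^ q := by
  have hxq : x ^ (q - 1) * x = x ^ q := by
    rw [← Real.rpow_add_one' hx (by linarith)]; congr 1; ring
  have hyq : y ^ (q - 1) * y = y ^ q := by
    rw [← Real.rpow_add_one' hy (by linarith)]; congr 1; ring
  have e1 : 0 ≤ ε * x ^ q := by positivity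
  have e2 : 0 ≤ ε⁻¹ ^ (q - 1) * y ^ q := by positivity
  by_cases h : y ≤ ε * x
  · have : x ^ (q - 1) * y ≤ x ^ (q - 1) * (ε * x) := by gcongr
    nlinarith
  · push Not at h
    have : x ≤ ε⁻¹ * y := by rw [← div_eq_inv_mul, le_div_iff₀ hε]; linarith
    have : x ^ (q - 1) ≤ (ε⁻¹ * y) ^ (q - 1) := by gcongr; linarith
    rw [Real.mul_rpow (by positivity) hy] at this
    have : x ^ (q - 1) * y ≤ ε⁻¹ ^ (q - 1) * y ^ (q - 1) * y := by gcongr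
    rw [mul_assoc, hyq] at this; linarith

lemma yg2 {q ε x y : ℝ} (hq : 2 < q) (hε : 0 < ε) (hε1 : ε ≤ 1) (hx : 0 ≤ x) (hy : 0 ≤ y) :
    x ^ (q - 1) * y ≤ ε⁻¹ * x ^ q + ε * y ^ q := by
  have hxq : x ^ (q - 1) * x = x ^ q := by
    rw [← Real.rpow_add_one' hx (by linarith)]; congr 1; ring
  have := yg1 hq (inv_pos.2 hε) hx hy
  rw [inv_inv] at this
  refine this.trans ?_
  gcongr
  calc ε ^ (q - 1) ≤ ε ^ (1:ℝ) := Real.rpow_le_rpow_of_exponent_ge hε hε1 (by linarith)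
    _ = ε := Real.rpow_one ε

lemma young_all {q M K τ : ℝ} (hq : 2 < q) (hM : 0 < M) (hK : 0 < K) (hτ : 0 < τ) :
    ∃ Cτ : ℝ, 0 < Cτ ∧ ∀ d b V : ℝ, 0 ≤ d → 0 ≤ b → 0 ≤ V →
      M * b ^ (q - 1) * d + K * V * (1 + d ^ (q - 1) + b ^ (q - 1)) + K * V ^ 2 ≤
        τ * d ^ q + Cτ * (b ^ q + V ^ q) + τ := by
  obtain ⟨ε, hε, hε1, h1, h2⟩ : ∃ ε : ℝ, 0 < ε ∧ ε ≤ 1 ∧ M * ε + K * ε ≤ τ ∧ 2 * K * ε ≤ τ := by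
    refine ⟨min 1 (τ / (M + 2 * K)), by positivity, min_le_left _ _, ?_, ?_⟩
    · have : min 1 (τ / (M + 2 * K)) ≤ τ / (M + 2 * K) := min_le_right _ _
      rw [le_div_iff₀ (by positivity)] at this
      have h0 : 0 < min 1 (τ / (M + 2 * K)) := by positivity
      nlinarith
    · have : min 1 (τ / (M + 2 * K)) ≤ τ / (M + 2 * K) := min_le_right _ _
      rw [le_div_iff₀ (by positivity)] at this
      have h0 : 0 < min 1 (τ / (M + 2 * K)) := by positivity
      nlinarith
  set A := ε⁻¹ ^ (q - 1) with hA
  have hA0 : 0 < A := by positivity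
  have hε0 : 0 < ε⁻¹ := by positivity
  have hAB : 0 < ε⁻¹ ^ (q - 2) := by positivity
  refine ⟨M * ε⁻¹ + 3 * K * A + K * ε + K * ε⁻¹ ^ (q - 2), by positivity, ?_⟩
  intro d b V hd hb hV
  have a1 := yg2 hq hε hε1 hb hd
  have a2 := yg1 hq hε (zero_le_one' ℝ) hV
  have a3 := yg1 hq hε hd hV
  have a4 := yg1 hq hε hb hV
  have a5 : V ^ 2 ≤ ε + ε⁻¹ ^ (q - 2) * V ^ q := by
    have : 0 ≤ ε⁻¹ ^ (q - 2) * V ^ q := by positivity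
    by_cases h : V ≤ ε
    · nlinarith
    · push Not at h
      have hV0 : 0 < V := hε.trans h
      have e : V ^ q = V ^ (q - 2) * V ^ 2 := by
        rw [← Real.rpow_natCast V 2, ← Real.rpow_add hV0]; congr 1; norm_num
      have : 1 ≤ (ε⁻¹ * V) ^ (q - 2) := Real.one_le_rpow
        (by rw [← div_eq_inv_mul, le_div_iff₀ hε]; linarith) (by linarith)
      rw [Real.mul_rpow (by positivity) hV0.le] at this
      rw [e, ← mul_assoc]
      nlinarith [sq_nonneg V]
  rw [Real.one_rpow, Real.one_rpow, ← hA] at a2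
  rw [← hA] at a3 a4
  have dq : 0 ≤ d ^ q := by positivity
  have bq : 0 ≤ b ^ q := by positivity
  have Vq : 0 ≤ V ^ q := by positivity
  have b1 := mul_le_mul_of_nonneg_left a1 hM.le
  have b2 := mul_le_mul_of_nonneg_left a2 hK.le
  have b3 := mul_le_mul_of_nonneg_left a3 hK.le
  have b4 := mul_le_mul_of_nonneg_left a4 hK.le
  have b5 := mul_le_mul_of_nonneg_left a5 hK.le
  have c1 := mul_le_mul_of_nonneg_right h1 dq
  have p1 : 0 ≤ M * ε⁻¹ * V ^ q := by positivity
  have p2 : 0 ≤ K * A * b ^ q := by positivity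
  have p3 : 0 ≤ K * ε * V ^ q := by positivity
  have p4 : 0 ≤ K * ε⁻¹ ^ (q - 2) * b ^ q := by positivity
  nlinarith

lemma ptw {N : ℕ} (y : Fin N → ℝ) (P D : Fin N → Fin n → ℝ) (e t C Pd : ℝ) (dx : Fin n → ℝ)
    (he : 0 ≤ e) (he1 : e ≤ 1) (hC : 0 ≤ C) (hdx : ∀ j, |dx j| ≤ C) (ht : |t| ≤ C)
    (hP : ∀ i j, |P i j| ≤ Pd) (hPd : 0 ≤ Pd) :
    e ^ 2 * (∑ i, ∑ j, P i j * D i j) - 2 * n * C * (∑ i, |y i|) * Pd - C * (∑ i, |y i|) ^ 2 ≤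
    ∑ i, ((∑ j, e * P i j * (e * D i j + y i * dx j)) -
      (y i * t - ∑ j, P i j * dx j) * (y i * e)) := by
  have hid : ∀ i, (∑ j, e * P i j * (e * D i j + y i * dx j)) -
      (y i * t - ∑ j, P i j * dx j) * (y i * e) =
      e ^ 2 * (∑ j, P i j * D i j) + 2 * e * y i * (∑ j, P i j * dx j) - y i ^ 2 * (t * e) := by
    intro i
    have : ∑ j, e * P i j * (e * D i j + y i * dx j) =
        e ^ 2 * (∑ j, P i j * D i j) + e * y i * ∑ j, P i j * dx j := by
      rw [Finset.mul_sum, Finset.mul_sum, ← Finset.sum_add_distrib]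
      exact Finset.sum_congr rfl fun j _ ↦ by ring
    rw [this]; ring
  simp only [hid]
  have h1 : ∀ i, e ^ 2 * (∑ j, P i j * D i j) - 2 * (n * C * Pd) * |y i| - C * |y i| ^ 2 ≤
      e ^ 2 * (∑ j, P i j * D i j) + 2 * e * y i * (∑ j, P i j * dx j) - y i ^ 2 * (t * e) := by
    intro i
    have a : |∑ j, P i j * dx j| ≤ n * (Pd * C) := by
      refine sum_bd _ _ fun j ↦ ?_
      rw [abs_mul]
      exact mul_le_mul (hP i j) (hdx j) (abs_nonneg _) hPd
    have a2 : |2 * e * y i * (∑ j, P i j * dx j)| ≤ 2 * (n * C * Pd) * |y i| := by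
      rw [abs_mul, abs_mul, abs_mul, abs_of_nonneg he, abs_two]
      have := mul_le_mul_of_nonneg_left a (abs_nonneg (y i))
      have h0 : 0 ≤ |y i| * |∑ j, P i j * dx j| := by positivity
      nlinarith
    have a3 : |y i ^ 2 * (t * e)| ≤ C * |y i| ^ 2 := by
      rw [abs_mul, abs_mul, abs_pow, abs_of_nonneg he]
      have : |t| * e ≤ C := by nlinarith [abs_nonneg t]
      nlinarith [sq_nonneg |y i|]
    have := abs_le.1 a2
    have := abs_le.1 a3
    linarith
  refine le_trans ?_ (Finset.sum_le_sum fun i _ ↦ h1 i)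
  rw [Finset.sum_sub_distrib, Finset.sum_sub_distrib, ← Finset.mul_sum, ← Finset.mul_sum, ← Finset.mul_sum]
  have : ∑ i, |y i| ^ 2 ≤ (∑ i, |y i|) ^ 2 :=
    Finset.sum_sq_le_sq_sum_of_nonneg fun i _ ↦ abs_nonneg _
  have := mul_le_mul_of_nonneg_left this hC
  linarith

structure NP (N : ℕ) (q m M : ℝ) (v : Fin N → Pt n → ℝ) (D P : Fin N → Fin n → Pt n → ℝ)
    (d Pd b : Pt n → ℝ) : Prop where
  W : ∀ i, WE (Qc 0 2) (v i) (D i) (P i) 0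
  vm : ∀ i, Measurable (v i)
  dm : Measurable d
  Pm : Measurable Pd
  bm : Measurable b
  d0 : ∀ z, 0 ≤ d z
  P0 : ∀ z, 0 ≤ Pd z
  b0 : ∀ z, 0 ≤ b z
  hD : ∀ i j, ∀ᵐ z, |D i j z| ≤ d z
  hP : ∀ i j, ∀ᵐ z, |P i j z| ≤ Pd z
  hPb : ∀ᵐ z, z ∈ Qc (0 : Pt n) 2 → Pd z ≤ M * (1 + d z ^ (q - 1) + b z ^ (q - 1))
  hco : ∀ᵐ z, z ∈ Qc (0 : Pt n) 2 →
    m * d z ^ q - M * b z ^ (q - 1) * d z ≤ ∑ i, ∑ j, P i j z * D i j z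

def VV {N : ℕ} (v : Fin N → Pt n → ℝ) (c : Fin N → ℝ) (z : Pt n) : ℝ := ∑ i, |v i z - c i|
def el {N : ℕ} (v : Fin N → Pt n → ℝ) (c : Fin N → ℝ) (d b : Pt n → ℝ) (z : Pt n) : ℝ :=
  max 1 (max (d z) (max (b z) (VV v c z)))

lemma el_1 {N : ℕ} (v : Fin N → Pt n → ℝ) (c : Fin N → ℝ) (d b : Pt n → ℝ) (z : Pt n) :
    1 ≤ el v c d b z := le_max_left _ _
lemma el_d {N : ℕ} (v : Fin N → Pt n → ℝ) (c : Fin N → ℝ) (d b : Pt n → ℝ) (z : Pt n) :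
    d z ≤ el v c d b z := (le_max_left _ _).trans (le_max_right _ _)
lemma el_b {N : ℕ} (v : Fin N → Pt n → ℝ) (c : Fin N → ℝ) (d b : Pt n → ℝ) (z : Pt n) :
    b z ≤ el v c d b z := ((le_max_left _ _).trans (le_max_right _ _)).trans (le_max_right _ _)
lemma el_V {N : ℕ} (v : Fin N → Pt n → ℝ) (c : Fin N → ℝ) (d b : Pt n → ℝ) (z : Pt n) :
    VV v c z ≤ el v c d b z := ((le_max_right _ _).trans (le_max_right _ _)).trans (le_max_right _ _)
lemma VV_0 {N : ℕ} (v : Fin N → Pt n → ℝ) (c : Fin N → ℝ) (z : Pt n) : 0 ≤ VV v c z :=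
  Finset.sum_nonneg fun _ _ ↦ abs_nonneg _
lemma VV_i {N : ℕ} (v : Fin N → Pt n → ℝ) (c : Fin N → ℝ) (z : Pt n) (i : Fin N) :
    |v i z - c i| ≤ VV v c z :=
  Finset.single_le_sum (f := fun i ↦ |v i z - c i|) (fun _ _ ↦ abs_nonneg _) (Finset.mem_univ i)
lemma VV_m {N : ℕ} {v : Fin N → Pt n → ℝ} (h : ∀ i, Measurable (v i)) (c : Fin N → ℝ) :
    Measurable (VV v c) := by
  unfold VV
  exact Finset.measurable_fun_sum _ fun i _ ↦ ((h i).sub_const _).abs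
lemma el_m {N : ℕ} {v : Fin N → Pt n → ℝ} (h : ∀ i, Measurable (v i)) (c : Fin N → ℝ)
    {d b : Pt n → ℝ} (hd : Measurable d) (hb : Measurable b) : Measurable (el v c d b) :=
  measurable_const.max (hd.max (hb.max (VV_m h c)))

lemma lint_le {μ : Measure (Pt n)} {Y X R : Pt n → ℝ} (hX : Integrable X μ) (hR : Measurable R)
    (hR0 : ∀ z, 0 ≤ R z) (hY0 : ∀ z, 0 ≤ Y z) (h : ∀ᵐ z ∂μ, Y z ≤ X z + R z) :
    ∫⁻ z, ofReal (Y z) ∂μ ≤ ofReal (∫ z, X z ∂μ) + ∫⁻ z, ofReal (R z) ∂μ := by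
  by_cases hf : ∫⁻ z, ofReal (R z) ∂μ = ∞
  · rw [hf, add_top]; exact le_top
  have hRi : Integrable R μ := ⟨hR.aestronglyMeasurable, by
    rw [hasFiniteIntegral_iff_ofReal (Eventually.of_forall hR0)]; exact Ne.lt_top hf⟩
  calc ∫⁻ z, ofReal (Y z) ∂μ ≤ ∫⁻ z, ofReal (X z + R z) ∂μ :=
        lintegral_mono_ae (h.mono fun z hz ↦ ENNReal.ofReal_le_ofReal hz)
    _ = ofReal (∫ z, (X z + R z) ∂μ) :=
        (ofReal_integral_eq_lintegral_ofReal (hX.add hRi)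
          (h.mono fun z hz ↦ (hY0 z).trans hz)).symm
    _ = ofReal ((∫ z, X z ∂μ) + ∫ z, R z ∂μ) := by rw [integral_add hX hRi]
    _ ≤ _ := by
        rw [← ofReal_integral_eq_lintegral_ofReal hRi (Eventually.of_forall hR0)]
        exact ENNReal.ofReal_add_le

lemma gbd {C r q : ℝ} (hq : 2 < q) (hC : 1 ≤ C) (hr : 0 < r) (h : 1 / 2 < C * (r + r ^ (q - 1))) :
    1 < 4 * C * r ∧ C * (r + r ^ (q - 1)) ≤ 2 * C * (4 * C) ^ (q - 2) * r ^ (q - 1) := by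
  have h1 : 1 < 4 * C * r := by
    by_cases h1 : r ≤ 1
    · have : r ^ (q - 1) ≤ r ^ (1:ℝ) := Real.rpow_le_rpow_of_exponent_ge hr h1 (by linarith)
      rw [Real.rpow_one] at this
      nlinarith
    · nlinarith
  refine ⟨h1, ?_⟩
  have h2 : 1 ≤ (4 * C * r) ^ (q - 2) := Real.one_le_rpow h1.le (by linarith)
  have h3 : 1 ≤ (4 * C) ^ (q - 2) := Real.one_le_rpow (by linarith) (by linarith)
  rw [Real.mul_rpow (by positivity) hr.le] at h2
  have e : r ^ (q - 1) = r ^ (q - 2) * r := by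
    rw [← Real.rpow_add_one hr.ne']; congr 1; ring
  have h4 : r ≤ (4 * C) ^ (q - 2) * r ^ (q - 1) := by rw [e, ← mul_assoc]; nlinarith
  have h5 : r ^ (q - 1) ≤ (4 * C) ^ (q - 2) * r ^ (q - 1) :=
    le_mul_of_one_le_left (by positivity) h3
  have := mul_le_mul_of_nonneg_left (add_le_add h4 h5) (by linarith : 0 ≤ C)
  linarith

set_option maxHeartbeats 1000000 in
lemma level (n N : ℕ) {q m M : ℝ} (hq : 2 < q) (hm : 0 < m) (hM : 0 < M) :
    ∃ K : ℝ, 1 ≤ K ∧ ∀ τ : ℝ, 0 < τ → ∃ Cτ : ℝ, 0 < Cτ ∧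
    ∀ (v : Fin N → Pt n → ℝ) (D P : Fin N → Fin n → Pt n → ℝ) (d Pd b : Pt n → ℝ),
    NP N q m M v D P d Pd b → ∀ c : Fin N → ℝ,
    (∫⁻ z in Qc 0 (3 / 2), ofReal (el v c d b z ^ (q - 1))) ≠ ∞ →
    ∀ lam : ℝ, 1 ≤ lam → ∃ O : Set (Pt n), MeasurableSet O ∧
      volume O ≤ ofReal K * ∫⁻ z in Qc 0 (3 / 2) ∩ {z | lam < K * el v c d b z},
        ofReal ((el v c d b z / lam) ^ (q - 1)) ∧
      (∀ᵐ z, z ∈ Oᶜ → z ∈ Qc (0 : Pt n) (3 / 2) → el v c d b z ≤ K * lam) ∧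
      ofReal m * ∫⁻ z in Oᶜ ∩ Qc 0 1, ofReal (d z ^ q) ≤
        (∫⁻ z in Oᶜ ∩ Qc 0 (3 / 2), ofReal
          (τ * d z ^ q + Cτ * (b z ^ q + VV v c z ^ q) + τ)) +
        ofReal (K * lam ^ q) * volume O := by
  obtain ⟨η, hη, hηs, hη0, hη1, hηQ, Cη, hCη, hdx, hdt⟩ := exists_cut' n
  obtain ⟨K₀, hK₀, core⟩ := core₉ n
  set Cg : ℝ := 1 + Cη + 3 * M + 3 * n * M * Cη with hCg
  have hCg1 : 1 ≤ Cg := by rw [hCg]; have : 0 ≤ 3 * n * M * Cη := by positivity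
                           linarith
  set K₁ : ℝ := (2 * n * M + 1) * Cη with hK₁
  set K : ℝ := 1 + K₀ + 4 * Cg + K₀ * (2 * Cg * (4 * Cg) ^ (q - 2)) + N * K₀ with hK
  have hK1 : K₀ ≤ K ∧ 1 ≤ K ∧ 4 * Cg ≤ K ∧ K₀ * (2 * Cg * (4 * Cg) ^ (q - 2)) ≤ K ∧ N * K₀ ≤ K := by
    have a1 : 0 ≤ K₀ * (2 * Cg * (4 * Cg) ^ (q - 2)) := by positivity
    have a2 : 0 ≤ N * K₀ := by positivity
    refine ⟨?_, ?_, ?_, ?_, ?_⟩ <;> rw [hK] <;> linarith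
  refine ⟨K, hK1.2.1, fun τ hτ ↦ ?_⟩
  obtain ⟨Cτ, hCτ, yg⟩ := young_all (q := q) (M := M) (K := K₁) (τ := τ) hq hM (by positivity) hτ
  refine ⟨Cτ, hCτ, ?_⟩
  intro v D P d Pd b np c hfin lam hlam
  have hlam0 : 0 < lam := by linarith
  set l := el v c d b with hl
  have lm : Measurable l := el_m np.vm c np.dm np.bm
  have l1 : ∀ z, 1 ≤ l z := el_1 v c d b
  set Q : Set (Pt n) := Qc 0 (3 / 2) with hQ
  have Qm : MeasurableSet Q := meas_Qc _ _
  have QQ : ∀ {r s : ℝ}, 0 < r → r ≤ s → Qc (0 : Pt n) r ⊆ Qc 0 s := fun hr hs z hz ↦ by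
    rw [mem_Qc] at hz ⊢; exact ⟨hz.1.trans_le hs, hz.2.trans_le (by gcongr)⟩
  have Q2 : Q ⊆ Qc 0 2 := QQ (by norm_num) (by norm_num)
  set g : Pt n → ℝ≥0∞ := Q.indicator fun z ↦
    ofReal (Cg * (l z / lam + (l z / lam) ^ (q - 1))) with hg
  have gm : Measurable g := Measurable.indicator (by fun_prop) Qm
  have gfin : ∫⁻ z, g z ≠ ∞ := by
    rw [hg, lintegral_indicator Qm]
    refine ne_top_of_le_ne_top (ENNReal.mul_ne_top (ENNReal.ofReal_ne_top (r := 2 * Cg)) hfin) ?_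
    rw [← lintegral_const_mul _ (by fun_prop)]
    refine lintegral_mono fun z ↦ ?_
    rw [← ENNReal.ofReal_mul (by positivity)]
    refine ENNReal.ofReal_le_ofReal ?_
    have a1 : l z / lam ≤ l z := div_le_self (by linarith [l1 z]) hlam
    have a0 : 0 ≤ l z / lam := div_nonneg (by linarith [l1 z]) hlam0.le
    have a2 : (l z / lam) ^ (q - 1) ≤ l z ^ (q - 1) := by gcongr; linarith
    have a3 : l z ≤ l z ^ (q - 1) := Real.self_le_rpow_of_one_le (l1 z) (by linarith)
    have := mul_le_mul_of_nonneg_left (add_le_add (a1.trans a3) a2) (by linarith : 0 ≤ Cg)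
    linarith
  have hh : 0 < lam ^ (q - 1) := by positivity
  obtain ⟨O, Om, Ovol, Og, Oen⟩ := core lam (lam ^ (q - 1)) hlam0 hh g gm gfin
  have off : ∀ z, z ∉ Q → η z = 0 ∧ (∀ j, dxj η j z = 0) ∧ dts η z = 0 := by
    intro z hz
    have h1 : z ∉ tsupport η := fun h ↦ hz (hηs h)
    have h2 : fderiv ℝ η z = 0 := fderiv_of_notMem_tsupport ℝ h1
    refine ⟨image_eq_zero_of_notMem_tsupport h1, fun j ↦ ?_, ?_⟩
    · simp [dxj, h2]
    · simp [dts, h2]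
  have bd1 : ∀ (x : ℝ) z, (z ∉ Q → x = 0) → (z ∈ Q → |x| ≤ Cg * l z) →
      ‖x‖ₑ ≤ ofReal lam * g z := by
    intro x z h1 h2
    by_cases hz : z ∈ Q
    · rw [hg, indicator_of_mem hz, ← ENNReal.ofReal_mul hlam0.le]
      refine enorm_le_of_abs ((h2 hz).trans ?_)
      have a0 : 0 ≤ (l z / lam) ^ (q - 1) :=
        Real.rpow_nonneg (div_nonneg (by linarith [l1 z]) hlam0.le) _
      have e : lam * (Cg * (l z / lam + (l z / lam) ^ (q - 1))) =
        Cg * l z + lam * Cg * (l z / lam) ^ (q - 1) := by field_simp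
      rw [e]; have : 0 ≤ lam * Cg * (l z / lam) ^ (q - 1) := by positivity
      linarith
    · simp [h1 hz]
  have bd2 : ∀ (x : ℝ) z, (z ∉ Q → x = 0) → (z ∈ Q → |x| ≤ Cg * l z ^ (q - 1)) →
      ‖x‖ₑ ≤ ofReal (lam ^ (q - 1)) * g z := by
    intro x z h1 h2
    by_cases hz : z ∈ Q
    · rw [hg, indicator_of_mem hz, ← ENNReal.ofReal_mul hh.le]
      refine enorm_le_of_abs ((h2 hz).trans ?_)
      have l0 : 0 ≤ l z := by linarith [l1 z]
      have a0 : 0 ≤ lam ^ (q - 1) * Cg * (l z / lam) := by positivity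
      have e : lam ^ (q - 1) * (Cg * (l z / lam + (l z / lam) ^ (q - 1))) =
          Cg * l z ^ (q - 1) + lam ^ (q - 1) * Cg * (l z / lam) := by
        rw [Real.div_rpow l0 hlam0.le]; field_simp; ring
      rw [e]; linarith
    · simp [h1 hz]
  have hPl : ∀ᵐ z, z ∈ Q → Pd z ≤ 3 * M * l z ^ (q - 1) := by
    filter_upwards [np.hPb] with z hz hzQ
    have a1 : d z ^ (q - 1) ≤ l z ^ (q - 1) :=
      Real.rpow_le_rpow (np.d0 z) (el_d v c d b z) (by linarith)
    have a2 : b z ^ (q - 1) ≤ l z ^ (q - 1) :=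
      Real.rpow_le_rpow (np.b0 z) (el_b v c d b z) (by linarith)
    have a3 : 1 ≤ l z ^ (q - 1) := Real.one_le_rpow (l1 z) (by linarith)
    have a4 := hz (Q2 hzQ)
    have := mul_le_mul_of_nonneg_left (add_le_add (add_le_add a3 a1) a2) hM.le
    linarith
  have cM : 0 ≤ 3 * n * M * Cη := by positivity
  set w : Fin N → Pt n → ℝ := fun i z ↦ (v i z - c i) * η z with hw
  set G : Fin N → Fin n → Pt n → ℝ := fun i j z ↦ η z * D i j z + (v i z - c i) * dxj η j z with hG
  set B : Fin N → Fin n → Pt n → ℝ := fun i j z ↦ η z * P i j z with hB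
  set f : Fin N → Pt n → ℝ := fun i z ↦ (v i z - c i) * dts η z - ∑ j, P i j z * dxj η j z with hf
  have W : ∀ i, WE univ (w i) (G i) (B i) (f i) := fun i ↦ (np.W i).cut (c i) hη (hηs.trans Q2)
  have vl : ∀ i z, |v i z - c i| ≤ l z := fun i z ↦ (VV_i v c z i).trans (el_V v c d b z)
  have ll : ∀ z, l z ≤ l z ^ (q - 1) := fun z ↦ Real.self_le_rpow_of_one_le (l1 z) (by linarith)
  have wb : ∀ i, ∀ z, ‖w i z‖ₑ ≤ ofReal lam * g z := fun i z ↦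
    bd1 _ _ (fun h ↦ by simp [hw, (off z h).1]) fun h ↦ by
      rw [hw, abs_mul, abs_of_nonneg (hη0 z)]
      exact (mul_le_of_le_one_right (abs_nonneg _) (hη1 z)).trans
        ((vl i z).trans (le_mul_of_one_le_left (by linarith [l1 z]) hCg1))
  have Gb : ∀ i j, ∀ᵐ z, ‖G i j z‖ₑ ≤ ofReal lam * g z := by
    intro i j
    filter_upwards [np.hD i j] with z hz
    refine bd1 _ _ (fun h ↦ by simp [hG, (off z h).1, (off z h).2.1]) fun h ↦ ?_
    rw [hG]
    refine (abs_add_le _ _).trans ?_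
    rw [abs_mul, abs_mul, abs_of_nonneg (hη0 z)]
    have a1 : η z * |D i j z| ≤ l z :=
      (mul_le_of_le_one_left (abs_nonneg _) (hη1 z)).trans (hz.trans (el_d v c d b z))
    have a2 : |v i z - c i| * |dxj η j z| ≤ l z * Cη :=
      mul_le_mul (vl i z) (hdx j z) (abs_nonneg _) (by linarith [l1 z])
    have : (1 + Cη) * l z ≤ Cg * l z := by
      have := l1 z; gcongr; rw [hCg]; linarith
    linarith
  have Bb : ∀ i j, ∀ᵐ z, ‖B i j z‖ₑ ≤ ofReal (lam ^ (q - 1)) * g z := by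
    intro i j
    filter_upwards [np.hP i j, hPl] with z hz hz2
    refine bd2 _ _ (fun h ↦ by simp [hB, (off z h).1]) fun h ↦ ?_
    rw [hB, abs_mul, abs_of_nonneg (hη0 z)]
    refine (mul_le_of_le_one_left (abs_nonneg _) (hη1 z)).trans (hz.trans ((hz2 h).trans ?_))
    have : 0 ≤ l z ^ (q - 1) := Real.rpow_nonneg (by linarith [l1 z]) _
    gcongr; rw [hCg]; linarith
  have fb : ∀ i, ∀ᵐ z, ‖f i z‖ₑ ≤ ofReal (lam ^ (q - 1)) * g z := by
    intro i
    filter_upwards [ae_all_iff.2 (np.hP i), hPl] with z hz hz2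
    refine bd2 _ _ (fun h ↦ by simp [hf, (off z h).2.1, (off z h).2.2]) fun h ↦ ?_
    rw [hf]
    refine (abs_sub _ _).trans ?_
    have lq : 0 ≤ l z ^ (q - 1) := Real.rpow_nonneg (by linarith [l1 z]) _
    have a1 : |(v i z - c i) * dts η z| ≤ l z ^ (q - 1) * Cη := by
      rw [abs_mul]
      exact mul_le_mul ((vl i z).trans (ll z)) (hdt z) (abs_nonneg _) lq
    have a2 : |∑ j, P i j z * dxj η j z| ≤ n * (3 * M * l z ^ (q - 1) * Cη) := by
      refine sum_bd _ _ fun j ↦ ?_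
      rw [abs_mul]
      exact mul_le_mul ((hz j).trans (hz2 h)) (hdx j z) (abs_nonneg _) (by positivity)
    have : (Cη + 3 * n * M * Cη) * l z ^ (q - 1) ≤ Cg * l z ^ (q - 1) := by
      gcongr; rw [hCg]; linarith
    linarith
  have En : ∀ i, |∫ z in Oᶜ, ((∑ j, B i j z * G i j z) - f i z * w i z)| ≤
      K₀ * lam * lam ^ (q - 1) * (volume O).toReal := fun i ↦
    Oen (w i) (G i) (B i) (f i) (W i) hη.cs.mul_left (Eventually.of_forall (wb i)) (Gb i) (Bb i) (fb i)
  have bdO : ∀ (h : ℝ) (x : Pt n → ℝ), 0 ≤ h → (∀ᵐ z, ‖x z‖ₑ ≤ ofReal h * g z) →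
      ∀ᵐ z ∂(volume.restrict Oᶜ), ‖x z‖ ≤ h * K₀ := by
    intro h x h0 hx
    rw [ae_restrict_iff' Om.compl]
    filter_upwards [hx, Og] with z h1 h2 hz
    have := h1.trans (mul_le_mul_right (h2 hz) _)
    rw [← ENNReal.ofReal_mul h0, ← ofReal_norm] at this
    exact (ENNReal.ofReal_le_ofReal_iff (by positivity)).1 this
  have Xi : ∀ i, Integrable (fun z ↦ (∑ j, B i j z * G i j z) - f i z * w i z)
      (volume.restrict Oᶜ) := by
    intro i
    refine Integrable.sub (integrable_finsetSum _ fun j _ ↦ ?_) ?_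
    · exact ((W i).iG j).restrict.bdd_mul ((W i).iB j).restrict.1
        (bdO _ _ hh.le (Bb i j))
    · exact (W i).jf.restrict.mul_bdd (W i).iw.restrict.1
        (bdO _ _ hlam0.le (Eventually.of_forall (wb i)))
  refine ⟨O, Om, ?_, ?_, ?_⟩
  · refine Ovol.trans ?_
    set E : Set (Pt n) := Q ∩ {z | lam < K * l z} with hE
    have sub : ∀ z ∈ {z | 1 / 2 < g z}, z ∈ E ∧ g z ≤
        ofReal (2 * Cg * (4 * Cg) ^ (q - 2)) * ofReal ((l z / lam) ^ (q - 1)) := by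
      intro z hz
      rw [mem_setOf_eq] at hz
      by_cases hzQ : z ∈ Q
      · rw [hg, indicator_of_mem hzQ] at hz ⊢
        have h1 : 1 / 2 < Cg * (l z / lam + (l z / lam) ^ (q - 1)) := by
          have e : (1 / 2 : ℝ≥0∞) = ofReal (1 / 2) := by
            rw [ENNReal.ofReal_div_of_pos two_pos]; simp
          rw [e] at hz
          exact ((ENNReal.ofReal_lt_ofReal_iff_of_nonneg (by norm_num)).1 hz)
        have l0 : 0 < l z := by linarith [l1 z]
        obtain ⟨h2, h3⟩ := gbd hq hCg1 (div_pos l0 hlam0) h1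
        refine ⟨⟨hzQ, ?_⟩, ?_⟩
        · rw [mem_setOf_eq]
          rw [← mul_div_assoc, one_lt_div hlam0] at h2
          have := mul_le_mul_of_nonneg_right hK1.2.2.1 l0.le; linarith
        · rw [← ENNReal.ofReal_mul (by positivity)]
          exact ENNReal.ofReal_le_ofReal h3
      · rw [hg, indicator_of_notMem hzQ] at hz; simp at hz
    calc _ ≤ ofReal K₀ * ∫⁻ z in {z | 1 / 2 < g z},
            ofReal (2 * Cg * (4 * Cg) ^ (q - 2)) * ofReal ((l z / lam) ^ (q - 1)) := by
          refine mul_le_mul_right ?_ _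
          exact setLIntegral_mono' (measurableSet_lt measurable_const gm) fun z hz ↦ (sub z hz).2
      _ ≤ ofReal K₀ * ∫⁻ z in E,
            ofReal (2 * Cg * (4 * Cg) ^ (q - 2)) * ofReal ((l z / lam) ^ (q - 1)) := by
          refine mul_le_mul_right (lintegral_mono_set fun z hz ↦ ?_) _
          exact (sub z hz).1
      _ ≤ _ := by
          rw [lintegral_const_mul _ (by fun_prop), ← mul_assoc, ← ENNReal.ofReal_mul hK₀.le]
          gcongr; exact hK1.2.2.2.1
  · filter_upwards [Og] with z hz hzO hzQ
    have := hz hzO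
    rw [hg, indicator_of_mem hzQ, ENNReal.ofReal_le_ofReal_iff hK₀.le] at this
    have l0 : 0 ≤ l z := by linarith [l1 z]
    have a0 : 0 ≤ (l z / lam) ^ (q - 1) := by positivity
    have a1 : 0 ≤ l z / lam := by positivity
    have a2 : l z / lam ≤ Cg * (l z / lam + (l z / lam) ^ (q - 1)) :=
      (le_add_of_nonneg_right a0).trans (le_mul_of_one_le_left (add_nonneg a1 a0) hCg1)
    have : l z / lam ≤ K := by linarith [hK1.1]
    rwa [div_le_iff₀ hlam0] at this
  · set X : Pt n → ℝ := fun z ↦ ∑ i, ((∑ j, B i j z * G i j z) - f i z * w i z) with hX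
    set R : Pt n → ℝ := fun z ↦ τ * d z ^ q + Cτ * (b z ^ q + VV v c z ^ q) + τ with hR
    have dm := np.dm
    have bm := np.bm
    have Vm : Measurable (VV v c) := VV_m np.vm c
    have Rm : Measurable R := by fun_prop
    have R0 : ∀ z, 0 ≤ R z := fun z ↦ by
      have := np.d0 z; have := np.b0 z; have := VV_0 v c z; positivity
    have Xint : Integrable X (volume.restrict Oᶜ) := integrable_finsetSum _ fun i _ ↦ Xi i
    have main := lint_le (μ := volume.restrict Oᶜ)
      (Y := (Qc (0 : Pt n) 1).indicator fun z ↦ m * d z ^ q) (R := Q.indicator R) Xint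
      (Rm.indicator Qm) (fun z ↦ indicator_nonneg (fun z _ ↦ R0 z) z)
      (fun z ↦ indicator_nonneg (fun z _ ↦ by have := np.d0 z; positivity) z) (by
        refine ae_restrict_of_ae ?_
        filter_upwards [np.hPb, np.hco, ae_all_iff.2 fun i ↦ ae_all_iff.2 (np.hP i)] with z h1 h2 h3
        by_cases hz : z ∈ Q
        · rw [indicator_of_mem hz]
          have h1 := h1 (Q2 hz)
          have h2 := h2 (Q2 hz)
          have d0 := np.d0 z
          have b0 := np.b0 z
          have V0 := VV_0 v c z
          have k1 := ptw (fun i ↦ v i z - c i) (fun i j ↦ P i j z) (fun i j ↦ D i j z) (η z)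
            (dts η z) Cη (Pd z) (fun j ↦ dxj η j z) (hη0 z) (hη1 z) (by linarith)
            (fun j ↦ hdx j z) (hdt z) h3 (np.P0 z)
          have k2 := yg (d z) (b z) (VV v c z) d0 b0 V0
          change _ ≤ X z at k1
          change _ - 2 * n * Cη * VV v c z * Pd z - Cη * VV v c z ^ 2 ≤ _ at k1
          have e2 : η z ^ 2 ≤ 1 := pow_le_one₀ (hη0 z) (hη1 z)
          have k3 : η z ^ 2 * (m * d z ^ q) - M * b z ^ (q - 1) * d z ≤
              η z ^ 2 * (∑ i, ∑ j, P i j z * D i j z) := by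
            have := mul_le_mul_of_nonneg_left h2 (sq_nonneg (η z))
            have p0 : 0 ≤ M * b z ^ (q - 1) * d z := by positivity
            have p1 := mul_le_of_le_one_left p0 e2
            rw [mul_sub] at this; linarith
          have k4 : 2 * n * Cη * VV v c z * Pd z + Cη * VV v c z ^ 2 ≤
              K₁ * VV v c z * (1 + d z ^ (q - 1) + b z ^ (q - 1)) + K₁ * VV v c z ^ 2 := by
            have p1 : 2 * n * Cη * VV v c z * Pd z ≤
              2 * n * Cη * VV v c z * (M * (1 + d z ^ (q - 1) + b z ^ (q - 1))) := by gcongr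
            have p2 : 0 ≤ Cη * VV v c z * (1 + d z ^ (q - 1) + b z ^ (q - 1)) := by positivity
            have p3 : 0 ≤ 2 * n * M * Cη * VV v c z ^ 2 := by positivity
            rw [hK₁]; linarith
          have k5 : (Qc (0 : Pt n) 1).indicator (fun z ↦ m * d z ^ q) z ≤ η z ^ 2 * (m * d z ^ q) := by
            by_cases hz1 : z ∈ Qc (0 : Pt n) 1
            · rw [indicator_of_mem hz1, hηQ z hz1]; simp
            · rw [indicator_of_notMem hz1]; positivity
          have k6 : R z = τ * d z ^ q + Cτ * (b z ^ q + VV v c z ^ q) + τ := rfl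
          linarith
        · have hz1 : z ∉ Qc (0 : Pt n) 1 := fun h ↦ hz (QQ (by norm_num) (by norm_num) h)
          rw [indicator_of_notMem hz, indicator_of_notMem hz1]
          simp [hX, hB, hw, (off z hz).1])
    have e1 : ∫⁻ z in Oᶜ, ofReal ((Qc (0 : Pt n) 1).indicator (fun z ↦ m * d z ^ q) z) =
        ofReal m * ∫⁻ z in Oᶜ ∩ Qc 0 1, ofReal (d z ^ q) := by
      rw [← lintegral_const_mul _ (by fun_prop), inter_comm, ← Measure.restrict_restrict (meas_Qc _ _),
        ← lintegral_indicator (meas_Qc _ _)]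
      refine lintegral_congr fun z ↦ ?_
      by_cases h : z ∈ Qc (0 : Pt n) 1 <;> simp [h, ENNReal.ofReal_mul hm.le]
    have e2 : ∫⁻ z in Oᶜ, ofReal (Q.indicator R z) =
        ∫⁻ z in Oᶜ ∩ Q, ofReal (R z) := by
      rw [inter_comm, ← Measure.restrict_restrict Qm, ← lintegral_indicator Qm]
      refine lintegral_congr fun z ↦ ?_
      by_cases h : z ∈ Q <;> simp [h]
    rw [e1, e2] at main
    refine main.trans ?_
    rw [add_comm]
    gcongr
    have Of : volume O ≠ ∞ := by
      refine ne_top_of_le_ne_top (ENNReal.mul_ne_top ENNReal.ofReal_ne_top ?_) Ovol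
      exact ne_top_of_le_ne_top gfin (setLIntegral_le_lintegral _ _)
    have : ∫ z in Oᶜ, X z ≤ K * lam ^ q * (volume O).toReal := by
      rw [hX, integral_finsetSum _ fun i _ ↦ Xi i]
      calc _ ≤ ∑ i : Fin N, K₀ * lam * lam ^ (q - 1) * (volume O).toReal :=
            Finset.sum_le_sum fun i _ ↦ (le_abs_self _).trans (En i)
        _ = N * K₀ * (lam ^ (q - 1) * lam) * (volume O).toReal := by simp; ring
        _ ≤ _ := by
          rw [← Real.rpow_add_one hlam0.ne', sub_add_cancel]
          gcongr; exact hK1.2.2.2.2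
    refine (ENNReal.ofReal_le_ofReal this).trans ?_
    rw [ENNReal.ofReal_mul (by have := hK1.2.1; positivity)]
    gcongr
    exact ENNReal.ofReal_toReal_le

def ak (κ : ℝ) (k : ℕ) : ℝ := ((2:ℝ) ^ (-κ)) ^ k * (1 - (2:ℝ) ^ (-κ))
def ch (P : Prop) : ℝ≥0∞ := if P then 1 else 0

lemma x01 {κ : ℝ} (h : 0 < κ) : 0 < (2:ℝ) ^ (-κ) ∧ (2:ℝ) ^ (-κ) < 1 ∧ 1 - (2:ℝ) ^ (-κ) ≤ κ := by
  refine ⟨by positivity, Real.rpow_lt_one_of_one_lt_of_neg (by norm_num) (by linarith), ?_⟩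
  rw [Real.rpow_def_of_pos two_pos]
  have h1 := Real.add_one_le_exp (Real.log 2 * -κ)
  have h2 := Real.log_two_lt_d9
  nlinarith
lemma ak_0 {κ : ℝ} (h : 0 < κ) (k : ℕ) : 0 ≤ ak κ k := by
  have := x01 h; exact mul_nonneg (by positivity) (by linarith)

lemma xp (κ : ℝ) (k : ℕ) : ((2:ℝ) ^ (-κ)) ^ k = ((2:ℝ) ^ k) ^ (-κ) := by
  rw [← Real.rpow_natCast, ← Real.rpow_natCast, ← Real.rpow_mul two_pos.le, ← Real.rpow_mul two_pos.le,
    mul_comm]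

lemma ak_tail {κ : ℝ} (h : 0 < κ) (J : ℕ) (P : ℕ → Prop) (hP : ∀ k, P k ↔ J ≤ k) :
    ∑' k, ofReal (ak κ k) * ch (P k) = ofReal (((2:ℝ) ^ J) ^ (-κ)) := by
  obtain ⟨x0, x1, -⟩ := x01 h
  have e : ∑' k, ofReal (ak κ k) * ch (P k) = ∑' k, ofReal (ak κ (k + J)) := by
    rw [← (ENNReal.summable).sum_add_tsum_nat_add' (k := J), Finset.sum_eq_zero, zero_add]
    · exact tsum_congr fun k ↦ by simp [ch, hP]
    · intro k hk
      have := Finset.mem_range.1 hk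
      simp [ch, hP, this]
  have hs : HasSum (fun k ↦ ak κ (k + J)) (((2:ℝ) ^ (-κ)) ^ J) := by
    have := (hasSum_geometric_of_lt_one x0.le x1).mul_right (((2:ℝ) ^ (-κ)) ^ J * (1 - (2:ℝ) ^ (-κ)))
    have hx : 1 - (2:ℝ) ^ (-κ) ≠ 0 := by linarith
    have e1 : (fun k ↦ ak κ (k + J)) =
        fun i ↦ ((2:ℝ) ^ (-κ)) ^ i * (((2:ℝ) ^ (-κ)) ^ J * (1 - (2:ℝ) ^ (-κ))) := by
      funext k; simp only [ak]; ring
    have e2 : (1 - (2:ℝ) ^ (-κ))⁻¹ * (((2:ℝ) ^ (-κ)) ^ J * (1 - (2:ℝ) ^ (-κ))) = ((2:ℝ) ^ (-κ)) ^ J := by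
      field_simp
    rw [e2] at this; rwa [e1]
  rw [e, ← ENNReal.ofReal_tsum_of_nonneg (fun k ↦ ak_0 h _) hs.summable, hs.tsum_eq, xp]

lemma two_min {t : ℝ} : ∃ J : ℕ, (∀ k : ℕ, t ≤ 2 ^ k ↔ J ≤ k) ∧ (1 ≤ t → (2:ℝ) ^ J ≤ 2 * t) := by
  have hex : ∃ k : ℕ, t ≤ (2:ℝ) ^ k := pow_unbounded_of_one_lt t one_lt_two |>.imp fun _ h ↦ h.le
  refine ⟨Nat.find hex, fun k ↦ ⟨fun h ↦ Nat.find_min' hex h, fun h ↦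
    (Nat.find_spec hex).trans (pow_le_pow_right₀ one_le_two h)⟩, fun ht ↦ ?_⟩
  rcases h : Nat.find hex with _ | j
  · simp; linarith
  · have := Nat.find_min hex (m := j) (by omega)
    push Not at this
    rw [pow_succ]; linarith

lemma F1 {κ t : ℝ} (h : 0 < κ) (ht : 0 < t) :
    ∑' k, ofReal (ak κ k) * ch (t ≤ 2 ^ k) ≤ ofReal (t ^ (-κ)) := by
  obtain ⟨J, h1, -⟩ := two_min (t := t)
  rw [ak_tail h J _ h1]
  exact ENNReal.ofReal_le_ofReal (Real.rpow_le_rpow_of_nonpos ht ((h1 J).2 le_rfl) (by linarith))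

lemma F2 {κ t : ℝ} (h : 0 < κ) (hκ : κ ≤ 1) (ht : 1 ≤ t) :
    ofReal (1 / 2 * t ^ (-κ)) ≤ ∑' k, ofReal (ak κ k) * ch (t ≤ 2 ^ k) := by
  obtain ⟨J, h1, h2⟩ := two_min (t := t)
  rw [ak_tail h J _ h1]
  refine ENNReal.ofReal_le_ofReal (le_trans ?_
    (Real.rpow_le_rpow_of_nonpos (by positivity) (h2 ht) (by linarith)))
  rw [Real.mul_rpow two_pos.le (by linarith)]
  gcongr
  calc (1 / 2 : ℝ) = 2 ^ (-1 : ℝ) := by norm_num [Real.rpow_neg_one]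
    _ ≤ _ := Real.rpow_le_rpow_of_exponent_le one_le_two (by linarith)

lemma F3 {κ q K l : ℝ} (h : 0 < κ) (hκ : κ ≤ 1 / 2) (hK : 1 ≤ K) (hl : 1 ≤ l) :
    ∑' k : ℕ, ofReal (ak κ k) * (ch (2 ^ k < K * l) *
      ofReal (((2:ℝ) ^ k) ^ q * (l / 2 ^ k) ^ (q - 1))) ≤
    ofReal (8 * K * κ * l ^ (q - κ)) := by
  obtain ⟨J, h1, h2⟩ := two_min (t := K * l)
  have hl0 : 0 < l := by linarith
  have hJ := h2 (by nlinarith)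
  set y : ℝ := 2 ^ (1 - κ) with hy
  have y1 : 5 / 4 ≤ y := by
    calc (5 / 4 : ℝ) ≤ Real.sqrt 2 := Real.le_sqrt_of_sq_le (by norm_num)
      _ = 2 ^ (1 / 2 : ℝ) := Real.sqrt_eq_rpow 2
      _ ≤ y := Real.rpow_le_rpow_of_exponent_le one_le_two (by linarith)
  have term : ∀ k : ℕ, ak κ k * (((2:ℝ) ^ k) ^ q * (l / 2 ^ k) ^ (q - 1)) ≤ κ * l ^ (q - 1) * y ^ k := by
    intro k
    obtain ⟨x0, x1, x2⟩ := x01 h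
    have p : (0:ℝ) < 2 ^ k := by positivity
    have e1 : ((2:ℝ) ^ k) ^ q * (l / 2 ^ k) ^ (q - 1) = l ^ (q - 1) * 2 ^ k := by
      rw [Real.div_rpow hl0.le p.le, Real.rpow_sub_one p.ne']
      have : ((2:ℝ) ^ k) ^ q ≠ 0 := by positivity
      field_simp
    have e2 : y ^ k = ((2:ℝ) ^ (-κ)) ^ k * 2 ^ k := by
      rw [← mul_pow, ← Real.rpow_add_one two_ne_zero, hy]; congr 2; ring
    rw [e1, e2, ak]
    have : 0 ≤ ((2:ℝ) ^ (-κ)) ^ k * (l ^ (q - 1) * 2 ^ k) := by positivity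
    calc _ = (1 - 2 ^ (-κ)) * (((2:ℝ) ^ (-κ)) ^ k * (l ^ (q - 1) * 2 ^ k)) := by ring
      _ ≤ κ * (((2:ℝ) ^ (-κ)) ^ k * (l ^ (q - 1) * 2 ^ k)) := by gcongr
      _ = _ := by ring
  rw [tsum_eq_sum (s := Finset.range J)]
  · calc _ ≤ ∑ k ∈ Finset.range J, ofReal (κ * l ^ (q - 1) * y ^ k) := by
          refine Finset.sum_le_sum fun k _ ↦ ?_
          calc _ ≤ ofReal (ak κ k) * (1 * ofReal
                  (((2:ℝ) ^ k) ^ q * (l / 2 ^ k) ^ (q - 1))) := by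
                gcongr; unfold ch; split_ifs <;> simp
            _ ≤ _ := by
              rw [one_mul, ← ENNReal.ofReal_mul (ak_0 h k)]
              exact ENNReal.ofReal_le_ofReal (term k)
      _ = ofReal (κ * l ^ (q - 1) * ((y ^ J - 1) / (y - 1))) := by
          rw [← ENNReal.ofReal_sum_of_nonneg fun k _ ↦ by positivity, ← Finset.mul_sum,
            geom_sum_eq (by linarith)]
      _ ≤ _ := by
          refine ENNReal.ofReal_le_ofReal ?_
          have e3 : y ^ J ≤ 2 * K * l ^ (1 - κ) := by
            calc y ^ J = ((2:ℝ) ^ J) ^ (1 - κ) := by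
                  rw [hy, ← Real.rpow_natCast, ← Real.rpow_natCast, ← Real.rpow_mul two_pos.le,
                    ← Real.rpow_mul two_pos.le, mul_comm]
              _ ≤ (2 * K * l) ^ (1 - κ) := by gcongr <;> linarith
              _ = (2 * K) ^ (1 - κ) * l ^ (1 - κ) := Real.mul_rpow (by linarith) hl0.le
              _ ≤ (2 * K) ^ (1 : ℝ) * l ^ (1 - κ) := by gcongr <;> linarith
              _ = _ := by rw [Real.rpow_one]
          have e4 : (y ^ J - 1) / (y - 1) ≤ 8 * K * l ^ (1 - κ) := by
            rw [div_le_iff₀ (by linarith)]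
            have : 0 ≤ 8 * K * l ^ (1 - κ) := by positivity
            nlinarith
          calc _ ≤ κ * l ^ (q - 1) * (8 * K * l ^ (1 - κ)) := by gcongr
            _ = 8 * K * κ * (l ^ (q - 1) * l ^ (1 - κ)) := by ring
            _ = _ := by rw [← Real.rpow_add hl0]; congr 2; ring
  · intro k hk
    have : K * l ≤ 2 ^ k := (h1 k).2 (by simpa using hk)
    simp [ch, not_lt.2 this]

lemma sumswap {μ : Measure (Pt n)} (A : ℕ → ℝ≥0∞) {f : ℕ → Pt n → ℝ≥0∞} (hf : ∀ k, Measurable (f k)) :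
    ∑' k, A k * ∫⁻ z, f k z ∂μ = ∫⁻ z, ∑' k, A k * f k z ∂μ := by
  rw [lintegral_tsum fun k ↦ ((hf k).const_mul _).aemeasurable]
  exact tsum_congr fun k ↦ (lintegral_const_mul _ (hf k)).symm

lemma dk {q κ d l : ℝ} (hq : 2 < q) (h : 0 < κ) (hκ : κ ≤ 1 / 2) (d0 : 0 ≤ d) (dl : d ≤ l) (hl : 1 ≤ l) :
    d ^ q * l ^ (-κ) ≤ d ^ (q - κ) ∧ d ^ (q - κ) ≤ d ^ q * l ^ (-κ) + κ * l ^ (q - κ) := by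
  have hl0 : 0 < l := by linarith
  rcases d0.eq_or_lt with rfl | dp
  · rw [Real.zero_rpow (by linarith), Real.zero_rpow (by linarith)]
    exact ⟨by simp, by positivity⟩
  refine ⟨?_, ?_⟩
  · rw [sub_eq_add_neg, Real.rpow_add dp]
    gcongr _ * ?_
    exact Real.rpow_le_rpow_of_nonpos dp dl (by linarith)
  · have hg := Real.geom_mean_le_arith_mean2_weighted (w₁ := (q - κ) / q) (w₂ := κ / q)
      (p₁ := (d / l) ^ q) (p₂ := 1) (by apply div_nonneg <;> linarith) (by apply div_nonneg <;> linarith)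
      (by positivity) (by norm_num) (by field_simp; ring)
    have w1 : (q - κ) / q ≤ 1 := by rw [div_le_one (by linarith)]; linarith
    have w2 : κ / q ≤ κ := div_le_self h.le (by linarith)
    rw [Real.one_rpow, mul_one, mul_one, ← Real.rpow_mul (by positivity), mul_div_cancel₀ _ (by linarith)] at hg
    have : (d / l) ^ (q - κ) ≤ (d / l) ^ q + κ := by
      have : 0 ≤ (d / l) ^ q := by positivity
      nlinarith
    rw [Real.div_rpow d0 hl0.le, Real.div_rpow d0 hl0.le, div_le_iff₀ (by positivity)] at this
    refine this.trans (le_of_eq ?_)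
    rw [add_mul]
    congr 1
    rw [sub_eq_add_neg, Real.rpow_add hl0]
    have : l ^ q ≠ 0 := by positivity
    field_simp

lemma ch_m {p : Pt n → Prop} (h : MeasurableSet {z | p z}) : Measurable fun z ↦ ch (p z) :=
  Measurable.ite h measurable_const measurable_const

lemma ch_int {E S : Set (Pt n)} (hS : MeasurableSet S) (f : Pt n → ℝ≥0∞) :
    ∫⁻ z in E, ch (z ∈ S) * f z = ∫⁻ z in E ∩ S, f z := by
  rw [inter_comm, ← Measure.restrict_restrict hS, ← lintegral_indicator hS]
  refine lintegral_congr fun z ↦ ?_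
  by_cases h : z ∈ S <;> simp [h, ch]

lemma level2 (n N : ℕ) {q m M : ℝ} (hq : 2 < q) (hm : 0 < m) (hM : 0 < M) :
    ∃ K : ℝ, 1 ≤ K ∧ ∀ τ : ℝ, 0 < τ → ∃ Cτ : ℝ, 0 < Cτ ∧
    ∀ (v : Fin N → Pt n → ℝ) (D P : Fin N → Fin n → Pt n → ℝ) (d Pd b : Pt n → ℝ),
    NP N q m M v D P d Pd b → ∀ c : Fin N → ℝ,
    (∫⁻ z in Qc 0 (3 / 2), ofReal (el v c d b z ^ (q - 1))) ≠ ∞ → ∀ k : ℕ,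
      ofReal m * ∫⁻ z in Qc 0 1, ch (el v c d b z ≤ 2 ^ k) * ofReal (d z ^ q) ≤
      (∫⁻ z in Qc 0 (3 / 2), ch (el v c d b z / K ≤ 2 ^ k) * ofReal
          (τ * d z ^ q + Cτ * (b z ^ q + VV v c z ^ q) + τ)) +
      ofReal ((K + m) * K) * ∫⁻ z in Qc 0 (3 / 2), ch (2 ^ k < K * el v c d b z) *
        ofReal (((2:ℝ) ^ k) ^ q * (el v c d b z / 2 ^ k) ^ (q - 1)) := by
  obtain ⟨K, hK, H⟩ := level n N hq hm hM
  refine ⟨K, hK, fun τ hτ ↦ ?_⟩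
  obtain ⟨Cτ, hCτ, H⟩ := H τ hτ
  refine ⟨Cτ, hCτ, fun v D P d Pd b np c hfin k ↦ ?_⟩
  have hk1 : (1:ℝ) ≤ 2 ^ k := one_le_pow₀ one_le_two
  obtain ⟨O, Om, Ov, Ob, Oe⟩ := H v D P d Pd b np c hfin (2 ^ k) hk1
  set l := el v c d b with hl
  have lm : Measurable l := el_m np.vm c np.dm np.bm
  have dm := np.dm
  have bm := np.bm
  have Vm : Measurable (VV v c) := VV_m np.vm c
  have E1m : MeasurableSet {z | l z ≤ 2 ^ k} := measurableSet_le lm measurable_const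
  have E2m : MeasurableSet {z | 2 ^ k < K * l z} := measurableSet_lt measurable_const (by fun_prop)
  have E3m : MeasurableSet {z | l z / K ≤ 2 ^ k} := measurableSet_le (by fun_prop) measurable_const
  have c1 := ch_int (E := Qc 0 1) E1m fun z ↦ ofReal (d z ^ q)
  have c2 := ch_int (E := Qc 0 (3 / 2)) E2m fun z ↦
    ofReal (((2:ℝ) ^ k) ^ q * (l z / 2 ^ k) ^ (q - 1))
  have c3 := ch_int (E := Qc 0 (3 / 2)) E3m fun z ↦ ofReal
          (τ * d z ^ q + Cτ * (b z ^ q + VV v c z ^ q) + τ)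
  simp only [mem_setOf_eq] at c1 c2 c3
  rw [c1, c2, c3]
  have pk : 0 < ((2:ℝ) ^ k) ^ q := by positivity
  have s1 : ∫⁻ z in Qc 0 1 ∩ {z | l z ≤ 2 ^ k}, ofReal (d z ^ q) ≤
      (∫⁻ z in Oᶜ ∩ Qc 0 1, ofReal (d z ^ q)) + ofReal (((2:ℝ) ^ k) ^ q) * volume O := by
    have : ∫⁻ z in O ∩ {z | l z ≤ 2 ^ k}, ofReal (d z ^ q) ≤
        ofReal (((2:ℝ) ^ k) ^ q) * volume O := by
      refine (setLIntegral_mono' (Om.inter E1m) (g := fun _ ↦ ofReal (((2:ℝ) ^ k) ^ q))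
        fun z hz ↦ ENNReal.ofReal_le_ofReal ?_).trans ?_
      · exact Real.rpow_le_rpow (np.d0 z) ((el_d v c d b z).trans hz.2) (by linarith)
      · rw [setLIntegral_const]
        gcongr; exact inter_subset_left
    refine le_trans ?_ (add_le_add_right this _)
    refine (lintegral_mono_set ?_).trans (lintegral_union_le _ _ _)
    intro z hz
    by_cases h : z ∈ O
    · exact Or.inr ⟨h, hz.2⟩
    · exact Or.inl ⟨h, hz.1⟩
  have s2 : ∫⁻ z in Oᶜ ∩ Qc 0 (3 / 2), ofReal
        (τ * d z ^ q + Cτ * (b z ^ q + VV v c z ^ q) + τ) ≤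
      ∫⁻ z in Qc 0 (3 / 2) ∩ {z | l z / K ≤ 2 ^ k}, ofReal
        (τ * d z ^ q + Cτ * (b z ^ q + VV v c z ^ q) + τ) := by
    refine lintegral_mono_set' ?_
    filter_upwards [Ob] with z hz hzO
    exact ⟨hzO.2, by rw [mem_setOf_eq, div_le_iff₀ (by linarith), mul_comm]; exact hz hzO.1 hzO.2⟩
  have s3 : ofReal (((2:ℝ) ^ k) ^ q) * volume O ≤ ofReal K *
      ∫⁻ z in Qc 0 (3 / 2) ∩ {z | 2 ^ k < K * l z},
        ofReal (((2:ℝ) ^ k) ^ q * (l z / 2 ^ k) ^ (q - 1)) := by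
    simp only [ENNReal.ofReal_mul pk.le]
    rw [lintegral_const_mul _ (by fun_prop), mul_left_comm]
    exact mul_le_mul_right Ov _
  calc _ ≤ ofReal m * ((∫⁻ z in Oᶜ ∩ Qc 0 1, ofReal (d z ^ q)) +
        ofReal (((2:ℝ) ^ k) ^ q) * volume O) := mul_le_mul_right s1 _
    _ ≤ ((∫⁻ z in Qc 0 (3 / 2) ∩ {z | l z / K ≤ 2 ^ k}, ofReal
        (τ * d z ^ q + Cτ * (b z ^ q + VV v c z ^ q) + τ)) +
        ofReal (K * ((2:ℝ) ^ k) ^ q) * volume O) +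
        ofReal m * (ofReal (((2:ℝ) ^ k) ^ q) * volume O) := by
      rw [mul_add]
      exact add_le_add_left (Oe.trans (add_le_add_left s2 _)) _
    _ = (∫⁻ z in Qc 0 (3 / 2) ∩ {z | l z / K ≤ 2 ^ k}, ofReal
        (τ * d z ^ q + Cτ * (b z ^ q + VV v c z ^ q) + τ)) +
        ofReal (K + m) * (ofReal (((2:ℝ) ^ k) ^ q) * volume O) := by
      rw [ENNReal.ofReal_mul (by linarith), ENNReal.ofReal_add (by linarith) hm.le, add_assoc,
        add_mul, mul_assoc]
    _ ≤ _ := by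
      rw [ENNReal.ofReal_mul (by linarith), mul_assoc]
      exact add_le_add_right (mul_le_mul_right s3 _) _

lemma el_s {N : ℕ} {q κ : ℝ} (hs : 0 ≤ q - κ) {v : Fin N → Pt n → ℝ} {c : Fin N → ℝ} {d b : Pt n → ℝ}
    (d0 : ∀ z, 0 ≤ d z) (b0 : ∀ z, 0 ≤ b z) (z : Pt n) :
    el v c d b z ^ (q - κ) ≤ 1 + d z ^ (q - κ) + b z ^ (q - κ) + VV v c z ^ (q - κ) := by
  have h1 : 0 ≤ d z ^ (q - κ) := Real.rpow_nonneg (d0 z) _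
  have h2 : 0 ≤ b z ^ (q - κ) := Real.rpow_nonneg (b0 z) _
  have h3 : 0 ≤ VV v c z ^ (q - κ) := Real.rpow_nonneg (VV_0 v c z) _
  unfold el
  rcases max_choice 1 (max (d z) (max (b z) (VV v c z))) with h | h <;> rw [h]
  · rw [Real.one_rpow]; linarith
  rcases max_choice (d z) (max (b z) (VV v c z)) with h | h <;> rw [h]
  · linarith
  rcases max_choice (b z) (VV v c z) with h | h <;> rw [h] <;> linarith

lemma tsl {A B : ℝ≥0∞} {x y w : ℕ → ℝ≥0∞} (a : ℕ → ℝ≥0∞) (h : ∀ k, A * x k ≤ y k + B * w k) :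
    A * ∑' k, a k * x k ≤ (∑' k, a k * y k) + B * ∑' k, a k * w k := by
  rw [← ENNReal.tsum_mul_left, ← ENNReal.tsum_mul_left, ← ENNReal.tsum_add]
  refine ENNReal.tsum_le_tsum fun k ↦ ?_
  rw [mul_left_comm, mul_left_comm B, ← mul_add]
  exact mul_le_mul_right (h k) _

set_option maxHeartbeats 1000000 in
lemma mid (n N : ℕ) {q m M : ℝ} (hq : 2 < q) (hm : 0 < m) (hM : 0 < M) :
    ∃ K : ℝ, 0 < K ∧ ∀ τ : ℝ, 0 < τ → ∃ Cτ : ℝ, 0 < Cτ ∧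
    ∀ (v : Fin N → Pt n → ℝ) (D P : Fin N → Fin n → Pt n → ℝ) (d Pd b : Pt n → ℝ),
    NP N q m M v D P d Pd b → ∀ (c : Fin N → ℝ) (κ : ℝ), 0 < κ → κ ≤ 1 / 2 →
      ∫⁻ z in Qc 0 1, ofReal (d z ^ (q - κ)) ≤
        ofReal (K * (τ + κ)) *
          ((∫⁻ z in Qc 0 (3 / 2), ofReal (d z ^ (q - κ))) + volume (Qc (0 : Pt n) (3 / 2))) +
        ofReal Cτ * ((∫⁻ z in Qc 0 (3 / 2), ofReal (b z ^ (q - κ))) +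
          ∫⁻ z in Qc 0 (3 / 2), ofReal (VV v c z ^ (q - κ))) := by
  obtain ⟨K, hK, H⟩ := level2 n N hq hm hM
  have hK0 : 0 < K := by linarith
  set K₉ : ℝ := 2 / m * (K + 8 * (K + m) * K ^ 2) + 1 with hK₉
  have hK₉0 : 0 < K₉ := by positivity
  refine ⟨K₉, hK₉0, fun τ hτ ↦ ?_⟩
  obtain ⟨Cτ, hCτ, H⟩ := H τ hτ
  set C₉ : ℝ := 2 / m * K * Cτ + K₉ with hC₉
  have hC₉0 : 0 < C₉ := by positivity
  refine ⟨C₉, hC₉0, fun v D P d Pd b np c κ h0 hκ ↦ ?_⟩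
  have hs : 0 < q - κ := by linarith
  set l := el v c d b with hl
  have lm : Measurable l := el_m np.vm c np.dm np.bm
  have l1 : ∀ z, 1 ≤ l z := el_1 v c d b
  have dm := np.dm
  have bm := np.bm
  have Vm : Measurable (VV v c) := VV_m np.vm c
  have d0 := np.d0
  have b0 := np.b0
  have V0 := VV_0 v c
  have ls : ∀ z, l z ^ (q - κ) ≤ 1 + d z ^ (q - κ) + b z ^ (q - κ) + VV v c z ^ (q - κ) :=
    el_s hs.le d0 b0
  have pd : ∀ z, 0 ≤ d z ^ (q - κ) := fun z ↦ Real.rpow_nonneg (d0 z) _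
  have pb : ∀ z, 0 ≤ b z ^ (q - κ) := fun z ↦ Real.rpow_nonneg (b0 z) _
  have pV : ∀ z, 0 ≤ VV v c z ^ (q - κ) := fun z ↦ Real.rpow_nonneg (V0 z) _
  set Q : Set (Pt n) := Qc 0 (3 / 2) with hQ
  have split : ∀ A B : ℝ, 0 ≤ A → 0 ≤ B → ∫⁻ z in Q, ofReal
      (A * (d z ^ (q - κ) + 1) + B * (b z ^ (q - κ) + VV v c z ^ (q - κ))) =
      ofReal A * ((∫⁻ z in Q, ofReal (d z ^ (q - κ))) + volume Q) +
      ofReal B * ((∫⁻ z in Q, ofReal (b z ^ (q - κ))) +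
          ∫⁻ z in Q, ofReal (VV v c z ^ (q - κ))) := by
    intro A B hA hB
    have e : ∀ z, ofReal
      (A * (d z ^ (q - κ) + 1) + B * (b z ^ (q - κ) + VV v c z ^ (q - κ))) =
      ofReal A * (ofReal (d z ^ (q - κ)) + 1) +
      ofReal B * (ofReal (b z ^ (q - κ)) + ofReal (VV v c z ^ (q - κ))) := by
      intro z
      rw [ENNReal.ofReal_add (mul_nonneg hA (by linarith [pd z]))
        (mul_nonneg hB (add_nonneg (pb z) (pV z))),
        ENNReal.ofReal_mul hA, ENNReal.ofReal_mul hB, ENNReal.ofReal_add (pd z) zero_le_one,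
        ENNReal.ofReal_add (pb z) (pV z), ENNReal.ofReal_one]
    simp only [e]
    rw [lintegral_add_left (by fun_prop), lintegral_const_mul _ (by fun_prop),
      lintegral_const_mul _ (by fun_prop), lintegral_add_left (by fun_prop),
      lintegral_add_left (by fun_prop)]
    simp
  have l0 : ∀ z, 0 < l z := fun z ↦ by linarith [l1 z]
  by_cases hfin : (∫⁻ z in Q, ofReal (l z ^ (q - 1))) = ∞
  · have h1 : (∞ : ℝ≥0∞) ≤ ∫⁻ z in Q, ofReal
        (1 * (d z ^ (q - κ) + 1) + 1 * (b z ^ (q - κ) + VV v c z ^ (q - κ))) := by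
      rw [← hfin]
      refine lintegral_mono fun z ↦ ENNReal.ofReal_le_ofReal ?_
      have : l z ^ (q - 1) ≤ l z ^ (q - κ) :=
        Real.rpow_le_rpow_of_exponent_le (l1 z) (by linarith)
      linarith [ls z]
    rw [split 1 1 zero_le_one zero_le_one, top_le_iff, ENNReal.ofReal_one, one_mul, one_mul,
      ENNReal.add_eq_top] at h1
    refine le_of_le_of_eq le_top (Eq.symm ?_)
    have p1 : ofReal (K₉ * (τ + κ)) ≠ 0 := by
      rw [Ne, ENNReal.ofReal_eq_zero, not_le]; positivity
    have p2 : ofReal C₉ ≠ 0 := by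
      rw [Ne, ENNReal.ofReal_eq_zero, not_le]; positivity
    rcases h1 with h1 | h1
    · rw [h1, ENNReal.mul_top p1, top_add]
    · rw [h1, ENNReal.mul_top p2, add_top]
  have H := H v D P d Pd b np c hfin
  set R : Pt n → ℝ := fun z ↦ τ * d z ^ q + Cτ * (b z ^ q + VV v c z ^ q) + τ with hR
  have Rm : Measurable R := by fun_prop
  have m1 : ∀ k : ℕ, Measurable fun z ↦ ch (l z ≤ 2 ^ k) * ofReal (d z ^ q) := fun k ↦
    (ch_m (measurableSet_le lm measurable_const)).mul (by fun_prop)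
  have m2 : ∀ k : ℕ, Measurable fun z ↦ ch (l z / K ≤ 2 ^ k) * ofReal (R z) := fun k ↦
    (ch_m (measurableSet_le (by fun_prop) measurable_const)).mul (by fun_prop)
  have m3 : ∀ k : ℕ, Measurable fun z ↦ ch (2 ^ k < K * l z) *
      ofReal (((2:ℝ) ^ k) ^ q * (l z / 2 ^ k) ^ (q - 1)) := fun k ↦
    (ch_m (measurableSet_lt measurable_const (by fun_prop))).mul (by fun_prop)
  have S := tsl (fun k ↦ ofReal (ak κ k)) H
  rw [sumswap _ m1, sumswap _ m2, sumswap _ m3] at S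
  have lk : ∀ z, 0 < l z ^ (-κ) := fun z ↦ Real.rpow_pos_of_pos (l0 z) _
  have dq : ∀ z, 0 ≤ d z ^ q := fun z ↦ Real.rpow_nonneg (d0 z) _
  have L : ofReal (m / 2) * ∫⁻ z in Qc 0 1, ofReal (d z ^ q * l z ^ (-κ)) ≤
      ofReal m * ∫⁻ z in Qc 0 1, ∑' k, ofReal (ak κ k) *
        (ch (l z ≤ 2 ^ k) * ofReal (d z ^ q)) := by
    rw [div_eq_mul_one_div, ENNReal.ofReal_mul hm.le, mul_assoc, ← lintegral_const_mul _ (by fun_prop)]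
    refine mul_le_mul_right (lintegral_mono fun z ↦ ?_) _
    simp only [← mul_assoc]
    rw [ENNReal.tsum_mul_right, ← ENNReal.ofReal_mul (by norm_num), mul_comm (d z ^ q), ← mul_assoc,
      ENNReal.ofReal_mul (by have := lk z; positivity)]
    exact mul_le_mul_left (F2 h0 (by linarith) (l1 z)) _
  have R1 : ∫⁻ z in Q, ∑' k, ofReal (ak κ k) * (ch (l z / K ≤ 2 ^ k) * ofReal (R z)) ≤
      ∫⁻ z in Q, ofReal (K * (τ * d z ^ (q - κ) +
        Cτ * (b z ^ (q - κ) + VV v c z ^ (q - κ)) + τ)) := by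
    refine lintegral_mono fun z ↦ ?_
    simp only [← mul_assoc]
    rw [ENNReal.tsum_mul_right]
    refine (mul_le_mul_left (F1 h0 (div_pos (l0 z) hK0)) _).trans ?_
    have hp : 0 ≤ (l z / K) ^ (-κ) := by have := l0 z; positivity
    rw [← ENNReal.ofReal_mul hp]
    refine ENNReal.ofReal_le_ofReal ?_
    have e1 : (l z / K) ^ (-κ) ≤ K * l z ^ (-κ) := by
      rw [Real.div_rpow (l0 z).le hK0.le, div_eq_inv_mul, ← Real.rpow_neg hK0.le, neg_neg]
      have := lk z
      gcongr
      calc K ^ κ ≤ K ^ (1:ℝ) := Real.rpow_le_rpow_of_exponent_le hK (by linarith)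
        _ = K := Real.rpow_one K
    have bq : 0 ≤ b z ^ q := Real.rpow_nonneg (b0 z) _
    have Vq : 0 ≤ VV v c z ^ q := Real.rpow_nonneg (V0 z) _
    have R0 : 0 ≤ R z := by have := dq z; positivity
    have f1 := (dk hq h0 hκ (d0 z) (el_d v c d b z) (l1 z)).1
    have f2 := (dk hq h0 hκ (b0 z) (el_b v c d b z) (l1 z)).1
    have f3 := (dk hq h0 hκ (V0 z) (el_V v c d b z) (l1 z)).1
    have f4 : l z ^ (-κ) ≤ 1 := Real.rpow_le_one_of_one_le_of_nonpos (l1 z) (by linarith)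
    calc (l z / K) ^ (-κ) * R z ≤ K * l z ^ (-κ) * R z := by gcongr
      _ = K * (τ * (d z ^ q * l z ^ (-κ)) + Cτ * (b z ^ q * l z ^ (-κ) + VV v c z ^ q * l z ^ (-κ)) +
          τ * l z ^ (-κ)) := by rw [hR]; ring
      _ ≤ _ := by gcongr; exact mul_le_of_le_one_right hτ.le f4
  have R2 : ∫⁻ z in Q, ∑' k, ofReal (ak κ k) * (ch (2 ^ k < K * l z) *
      ofReal (((2:ℝ) ^ k) ^ q * (l z / 2 ^ k) ^ (q - 1))) ≤
      ∫⁻ z in Q, ofReal (8 * K * κ * l z ^ (q - κ)) :=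
    lintegral_mono fun z ↦ F3 h0 hκ hK (l1 z)
  have S2 : ofReal (m / 2) * ∫⁻ z in Qc 0 1, ofReal (d z ^ q * l z ^ (-κ)) ≤
      ∫⁻ z in Q, ofReal (K * (τ * d z ^ (q - κ) +
        Cτ * (b z ^ (q - κ) + VV v c z ^ (q - κ)) + τ) + (K + m) * K * (8 * K * κ * l z ^ (q - κ))) := by
    refine (L.trans (S.trans (add_le_add R1 (mul_le_mul_right R2 _)))).trans (le_of_eq ?_)
    rw [← lintegral_const_mul _ (by fun_prop), ← lintegral_add_left (by fun_prop)]
    refine lintegral_congr fun z ↦ ?_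
    have a1 := pd z
    have a2 := pb z
    have a3 := pV z
    have a4 := l0 z
    rw [← ENNReal.ofReal_mul (by positivity), ← ENNReal.ofReal_add (by positivity) (by positivity)]
  have S3 : ∫⁻ z in Qc 0 1, ofReal (d z ^ q * l z ^ (-κ)) ≤ ofReal (2 / m) *
      ∫⁻ z in Q, ofReal (K * (τ * d z ^ (q - κ) +
        Cτ * (b z ^ (q - κ) + VV v c z ^ (q - κ)) + τ) + (K + m) * K * (8 * K * κ * l z ^ (q - κ))) := by
    refine le_trans (le_of_eq ?_) (mul_le_mul_right S2 _)
    rw [← mul_assoc, ← ENNReal.ofReal_mul (by positivity), show 2 / m * (m / 2) = 1 by field_simp,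
      ENNReal.ofReal_one, one_mul]
  calc ∫⁻ z in Qc 0 1, ofReal (d z ^ (q - κ))
      ≤ ∫⁻ z in Qc 0 1, (ofReal (d z ^ q * l z ^ (-κ)) + ofReal (κ * l z ^ (q - κ))) := by
        refine lintegral_mono fun z ↦ ?_
        have a1 := lk z
        have a2 := dq z
        have a4 := l0 z
        rw [← ENNReal.ofReal_add (by positivity) (by positivity)]
        exact ENNReal.ofReal_le_ofReal (dk hq h0 hκ (d0 z) (el_d v c d b z) (l1 z)).2
    _ ≤ ∫⁻ z in Q, ofReal (2 / m * (K * (τ * d z ^ (q - κ) +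
        Cτ * (b z ^ (q - κ) + VV v c z ^ (q - κ)) + τ) + (K + m) * K * (8 * K * κ * l z ^ (q - κ))) +
        κ * l z ^ (q - κ)) := by
        rw [lintegral_add_left (by fun_prop)]
        refine (add_le_add S3 (lintegral_mono_set (t := Q) fun z hz ↦ by
          rw [hQ]; rw [mem_Qc] at hz ⊢
          exact ⟨hz.1.trans (by norm_num), hz.2.trans (by norm_num)⟩)).trans (le_of_eq ?_)
        rw [← lintegral_const_mul _ (by fun_prop), ← lintegral_add_left (by fun_prop)]
        refine lintegral_congr fun z ↦ ?_
        have a1 := pd z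
        have a2 := pb z
        have a3 := pV z
        have a4 := l0 z
        rw [← ENNReal.ofReal_mul (by positivity), ← ENNReal.ofReal_add (by positivity) (by positivity)]
    _ ≤ ∫⁻ z in Q, ofReal
      (K₉ * (τ + κ) * (d z ^ (q - κ) + 1) + C₉ * (b z ^ (q - κ) + VV v c z ^ (q - κ))) := by
        refine lintegral_mono fun z ↦ ENNReal.ofReal_le_ofReal ?_
        have a1 := pd z
        have a2 : 0 ≤ b z ^ (q - κ) + VV v c z ^ (q - κ) := add_nonneg (pb z) (pV z)
        have a3 := ls z
        set X := d z ^ (q - κ)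
        set Y := b z ^ (q - κ) + VV v c z ^ (q - κ)
        set G := 2 / m * (8 * (K + m) * K ^ 2) + 1 with hG
        have g0 : 0 < G := by positivity
        have e1 : κ * G * l z ^ (q - κ) ≤ κ * G * (1 + X + Y) := by
          refine mul_le_mul_of_nonneg_left ?_ (by positivity); linarith
        have e2 : κ * G * Y ≤ G * Y := by nlinarith [mul_nonneg g0.le a2]
        have e3 : 0 ≤ 2 / m * K * κ * (1 + X) := by positivity
        have e4 : 0 ≤ G * τ * (1 + X) := by positivity
        have e5 : 0 ≤ 2 / m * K * Y := by positivity
        have e6 : K₉ = 2 / m * K + G := by rw [hK₉, hG]; ring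
        rw [hC₉, e6]
        calc _ = 2 / m * K * τ * (1 + X) + 2 / m * K * Cτ * Y + κ * G * l z ^ (q - κ) := by
              rw [hG]; ring
          _ ≤ _ := by linarith
    _ = _ := split _ _ (by positivity) hC₉0.le

lemma ehr2 (n N : ℕ) {q C₀ ε : ℝ} (hq : 2 < q) (hC₀ : 1 ≤ C₀) (hε : 0 < ε) :
    ∃ c₁ : ℝ, 0 < c₁ ∧ ∀ (m M : ℝ) (v : Fin N → Pt n → ℝ) (D P : Fin N → Fin n → Pt n → ℝ)
    (d Pd b : Pt n → ℝ), NP N q m M v D P d Pd b → ∀ s : ℝ, 1 ≤ s → s ≤ q →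
    ∫⁻ z, ofReal (d z ^ s) ≤ ofReal C₀ →
    (∫⁻ z, ofReal (d z)) + ∫⁻ z, ofReal (Pd z) ≤ ofReal c₁ →
    ∃ c : Fin N → ℝ, ∫⁻ z in Qc 0 (3 / 2), ofReal (VV v c z ^ s) ≤ ofReal ε := by
  obtain ⟨K, hK, H⟩ := ehrling n
  set η : ℝ := min 1 (ε / (((N:ℝ) + 1) ^ q * (N + 1))) with hη
  have η0 : 0 < η := by positivity
  have η1 : η ≤ 1 := min_le_left _ _
  have ηε : ((N:ℝ) + 1) ^ q * (N * η) ≤ ε := by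
    have : η ≤ ε / (((N:ℝ) + 1) ^ q * (N + 1)) := min_le_right _ _
    rw [le_div_iff₀ (by positivity)] at this
    have : 0 ≤ ((N:ℝ) + 1) ^ q * η := by positivity
    nlinarith
  set e : ℝ := min (1 / 4) (η / (2 * K * C₀)) with he
  have e0 : 0 < e := by positivity
  have eK : K * e * C₀ ≤ η / 2 := by
    have : e ≤ η / (2 * K * C₀) := min_le_right _ _
    rw [le_div_iff₀ (by positivity)] at this
    linarith
  obtain ⟨Ke, hKe, H⟩ := H e e0 (min_le_left _ _)
  refine ⟨η / (2 * Ke), by positivity, fun m M v D P d Pd b np s hs hsq h1 h2 ↦ ?_⟩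
  have dm := np.dm
  have Pm := np.Pm
  have fin := ne_top_of_le_ne_top ENNReal.ofReal_ne_top h2
  rw [ENNReal.add_ne_top] at fin
  have s0 : 0 < s := by linarith
  have key : ∀ i, ∃ c : ℝ, ∫⁻ z in Qc 0 (3 / 2), ‖v i z - c‖ₑ ^ s ≤ ofReal η := by
    intro i
    obtain ⟨c, hc⟩ := H (v i) (D i) (P i) (fun z ↦ ofReal (d z)) (fun z ↦ ofReal (Pd z))
      (np.W i) (by fun_prop) (by fun_prop) fin.1 fin.2
      (fun j ↦ (np.hD i j).mono fun z hz ↦ enorm_le_of_abs hz)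
      (fun j ↦ (np.hP i j).mono fun z hz ↦ enorm_le_of_abs hz) s hs
    refine ⟨c, ?_⟩
    have a1 : (∫⁻ z, ofReal (d z) ^ s) ^ (1 / s) ≤ ofReal C₀ := by
      have : ∫⁻ z, ofReal (d z) ^ s ≤ ofReal C₀ := by
        simpa only [ENNReal.ofReal_rpow_of_nonneg (np.d0 _) s0.le] using h1
      refine (ENNReal.rpow_le_rpow this (by positivity)).trans ?_
      rw [ENNReal.ofReal_rpow_of_nonneg (by linarith) (by positivity)]
      refine ENNReal.ofReal_le_ofReal ?_
      calc C₀ ^ (1 / s) ≤ C₀ ^ (1:ℝ) := Real.rpow_le_rpow_of_exponent_le hC₀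
            (by rw [div_le_one s0]; exact hs)
        _ = C₀ := Real.rpow_one _
    have a2 : (∫⁻ z in Qc 0 (3 / 2), ‖v i z - c‖ₑ ^ s) ^ (1 / s) ≤ ofReal η := by
      refine hc.trans ((add_le_add (mul_le_mul_right h2 _) (mul_le_mul_right a1 _)).trans ?_)
      rw [← ENNReal.ofReal_mul hKe.le, ← ENNReal.ofReal_mul (by positivity),
        ← ENNReal.ofReal_add (by positivity) (by positivity)]
      refine ENNReal.ofReal_le_ofReal ?_
      have : Ke * (η / (2 * Ke)) = η / 2 := by field_simp
      linarith
    have a3 := ENNReal.rpow_le_rpow a2 s0.le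
    rw [← ENNReal.rpow_mul, one_div, inv_mul_cancel₀ s0.ne', ENNReal.rpow_one,
      ENNReal.ofReal_rpow_of_pos η0] at a3
    refine a3.trans (ENNReal.ofReal_le_ofReal ?_)
    calc η ^ s ≤ η ^ (1:ℝ) := Real.rpow_le_rpow_of_exponent_ge η0 η1 hs
      _ = η := Real.rpow_one _
  choose c hc using key
  refine ⟨c, ?_⟩
  have vm := np.vm
  have pt : ∀ z, ofReal (VV v c z ^ s) ≤
      ofReal (((N:ℝ) + 1) ^ q) * ∑ i, ‖v i z - c i‖ₑ ^ s := by
    intro z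
    have e1 : VV v c z ^ s ≤ ((N:ℝ) + 1) ^ q * ∑ i, |v i z - c i| ^ s := by
      have := Real.rpow_sum_le_const_mul_sum_rpow_of_nonneg (s := Finset.univ)
        (f := fun i ↦ |v i z - c i|) hs fun i _ ↦ abs_nonneg _
      refine this.trans (mul_le_mul_of_nonneg_right ?_ (Finset.sum_nonneg fun i _ ↦ by positivity))
      rw [Finset.card_univ, Fintype.card_fin]
      calc (N:ℝ) ^ (s - 1) ≤ ((N:ℝ) + 1) ^ (s - 1) :=
            Real.rpow_le_rpow (by positivity) (by linarith) (by linarith)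
        _ ≤ _ := Real.rpow_le_rpow_of_exponent_le (by linarith [(Nat.cast_nonneg N : (0:ℝ) ≤ N)]) (by linarith)
    refine (ENNReal.ofReal_le_ofReal e1).trans (le_of_eq ?_)
    rw [ENNReal.ofReal_mul (by positivity), ENNReal.ofReal_sum_of_nonneg fun i _ ↦ by positivity]
    congr 1
    refine Finset.sum_congr rfl fun i _ ↦ ?_
    rw [← ofReal_norm, Real.norm_eq_abs, ENNReal.ofReal_rpow_of_nonneg (abs_nonneg _) s0.le]
  calc _ ≤ ∫⁻ z in Qc 0 (3 / 2), ofReal (((N:ℝ) + 1) ^ q) * ∑ i, ‖v i z - c i‖ₑ ^ s :=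
        lintegral_mono pt
    _ = ofReal (((N:ℝ) + 1) ^ q) * ∑ i, ∫⁻ z in Qc 0 (3 / 2), ‖v i z - c i‖ₑ ^ s := by
        rw [lintegral_const_mul _ (Finset.measurable_fun_sum _ fun i _ ↦ by
          have := vm i; fun_prop), lintegral_finsetSum' _ fun i _ ↦ by
            have := vm i
            exact Measurable.aemeasurable (by fun_prop)]
    _ ≤ ofReal (((N:ℝ) + 1) ^ q) * ∑ i : Fin N, ofReal η :=
        mul_le_mul_right (Finset.sum_le_sum fun i _ ↦ hc i) _
    _ = ofReal (((N:ℝ) + 1) ^ q * (N * η)) := by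
        rw [ENNReal.ofReal_mul (by positivity), ENNReal.ofReal_mul (by positivity)]; simp
    _ ≤ _ := ENNReal.ofReal_le_ofReal ηε

lemma norm_main (n N : ℕ) {q m M C₀ ε : ℝ} (hq : 2 < q) (hm : 0 < m) (hM : 0 < M) (hC₀ : 1 ≤ C₀)
    (hε : 0 < ε) : ∃ κ₀ c₁ : ℝ, 0 < κ₀ ∧ κ₀ ≤ 1 / 2 ∧ 0 < c₁ ∧
    ∀ (v : Fin N → Pt n → ℝ) (D P : Fin N → Fin n → Pt n → ℝ)
    (d Pd b : Pt n → ℝ), NP N q m M v D P d Pd b → ∀ κ : ℝ, 0 < κ → κ ≤ κ₀ →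
    ∫⁻ z, ofReal (d z ^ (q - κ)) ≤ ofReal C₀ →
    (∫⁻ z, ofReal (d z)) + ∫⁻ z, ofReal (Pd z) ≤ ofReal c₁ →
    ∫⁻ z in Qc 0 (3 / 2), ofReal (b z ^ (q - κ)) ≤ ofReal c₁ →
    ∫⁻ z in Qc 0 1, ofReal (d z ^ (q - κ)) ≤ ofReal ε := by
  obtain ⟨K, hK, H⟩ := mid n N hq hm hM
  set V : ℝ := (3 / 2) ^ (n + 2) * Vn n with hV
  have V0 : 0 < V := by have := Vn_pos n; positivity
  set κ₀ : ℝ := min (1 / 2) (ε / (4 * K * (C₀ + V))) with hκ₀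
  have k0 : 0 < κ₀ := by positivity
  obtain ⟨Cτ, hCτ, H⟩ := H κ₀ k0
  obtain ⟨c₂, hc₂, H2⟩ := ehr2 n N hq hC₀ (ε := ε / (4 * Cτ)) (by positivity)
  refine ⟨κ₀, min c₂ (ε / (4 * Cτ)), k0, min_le_left _ _, by positivity, ?_⟩
  intro v D P d Pd b np κ h0 hκ h1 h2 h3
  have k2 : κ₀ ≤ 1 / 2 := min_le_left _ _
  obtain ⟨c, hc⟩ := H2 m M v D P d Pd b np (q - κ) (by linarith) (by linarith) h1
    (h2.trans (ENNReal.ofReal_le_ofReal (min_le_left _ _)))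
  refine (H v D P d Pd b np c κ h0 (hκ.trans k2)).trans ?_
  rw [vol_Qc _ (by norm_num), ← hV]
  refine (add_le_add (mul_le_mul_right (add_le_add_left ((setLIntegral_le_lintegral _ _).trans h1) _) _)
    (mul_le_mul_right (add_le_add (h3.trans (ENNReal.ofReal_le_ofReal (min_le_right _ _))) hc) _)).trans ?_
  rw [← ENNReal.ofReal_add (by positivity) V0.le, ← ENNReal.ofReal_add (by positivity) (by positivity),
    ← ENNReal.ofReal_mul (by positivity), ← ENNReal.ofReal_mul (by positivity),
    ← ENNReal.ofReal_add (by positivity) (by positivity)]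
  refine ENNReal.ofReal_le_ofReal ?_
  have a1 : κ₀ ≤ ε / (4 * K * (C₀ + V)) := min_le_right _ _
  rw [le_div_iff₀ (by positivity)] at a1
  have a2 : Cτ * (ε / (4 * Cτ) + ε / (4 * Cτ)) = ε / 2 := by field_simp; ring
  have a3 : K * (κ₀ + κ) * (C₀ + V) ≤ K * (κ₀ + κ₀) * (C₀ + V) := by gcongr
  rw [a2]; linarith

lemma psplit {η s t q x : ℝ} (hη : 0 < η) (hη1 : η ≤ 1) (hs : 1 ≤ s) (hst : s ≤ t) (htq : t ≤ q)
    (hx : 0 ≤ x) : x ^ s ≤ η + η ^ (-q) * x ^ t := by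
  have h0 : 0 ≤ η ^ (-q) * x ^ t := by positivity
  rcases le_total x η with h | h
  · have h1 : x ^ s ≤ η ^ s := Real.rpow_le_rpow hx h (by linarith)
    have h2 : η ^ s ≤ η ^ (1:ℝ) := Real.rpow_le_rpow_of_exponent_ge hη hη1 hs
    rw [Real.rpow_one] at h2
    linarith
  · have hx0 : 0 < x := hη.trans_le h
    have e : x ^ s = x ^ (s - t) * x ^ t := by rw [← Real.rpow_add hx0]; ring_nf
    have h1 : x ^ (s - t) ≤ η ^ (s - t) := Real.rpow_le_rpow_of_nonpos hη h (by linarith)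
    have h2 : η ^ (s - t) ≤ η ^ (-q) := Real.rpow_le_rpow_of_exponent_ge hη hη1 (by linarith)
    have := mul_le_mul_of_nonneg_right (h1.trans h2) (by positivity : 0 ≤ x ^ t)
    linarith

lemma one_le_eta {η q : ℝ} (hη : 0 < η) (hη1 : η ≤ 1) (hq : 0 ≤ q) : 1 ≤ η ^ (-q) :=
  Real.one_le_rpow_of_pos_of_le_one_of_nonpos hη hη1 (by linarith)

lemma pw4 {q t x h : ℝ} (hq : 0 < q) (ht0 : 0 ≤ t) (ht : t ≤ 1) (hx : 0 ≤ x) (h4 : x ^ q / 4 ≤ h) :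
    x ^ (q * t) ≤ 4 * h ^ t := by
  have h0 : 0 ≤ x ^ q := by positivity
  have hh : 0 ≤ h := by linarith
  rw [Real.rpow_mul hx]
  calc (x ^ q) ^ t ≤ (4 * h) ^ t := Real.rpow_le_rpow h0 (by linarith) ht0
    _ = 4 ^ t * h ^ t := Real.mul_rpow (by norm_num) hh
    _ ≤ 4 * h ^ t := by
      gcongr
      calc (4:ℝ) ^ t ≤ 4 ^ (1:ℝ) := Real.rpow_le_rpow_of_exponent_le (by norm_num) ht
        _ = 4 := Real.rpow_one _

lemma addpow {t x y : ℝ} (ht0 : 0 ≤ t) (ht : t ≤ 1) (hx : 0 ≤ x) (hy : 0 ≤ y) :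
    (x + y) ^ t ≤ x ^ t + y ^ t := Real.rpow_add_le_add_rpow hx hy ht0 ht

structure NQ (N : ℕ) (p q δ m L C : ℝ) (v : Fin N → Pt n → ℝ) (D P : Fin N → Fin n → Pt n → ℝ)
    (d Pd f h g : Pt n → ℝ) : Prop where
  W : ∀ i, WE (Qc 0 2) (v i) (D i) (P i) 0
  vm : ∀ i, Measurable (v i)
  dm : Measurable d
  Pm : Measurable Pd
  fm : Measurable f
  hm : Measurable h
  gm : Measurable g
  d0 : ∀ z, 0 ≤ d z
  P0 : ∀ z, 0 ≤ Pd z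
  f0 : ∀ z, 0 ≤ f z
  h0 : ∀ z, 0 ≤ h z
  g0 : ∀ z, 0 ≤ g z
  dz : ∀ z, z ∉ Qc (0 : Pt n) 2 → d z = 0
  Pz : ∀ z, z ∉ Qc (0 : Pt n) 2 → Pd z = 0
  hD : ∀ i j, ∀ᵐ z, |D i j z| ≤ d z
  hP : ∀ i j, ∀ᵐ z, |P i j z| ≤ Pd z
  h1 : ∀ z ∈ Qc (0 : Pt n) 2, d z ^ q / 4 ≤ h z
  h2 : ∀ z ∈ Qc (0 : Pt n) 2, h z ≤ 3 * (d z ^ p + d z ^ q)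
  g1 : ∀ z ∈ Qc (0 : Pt n) 2, f z ^ q / 4 ≤ g z
  hPb : ∀ᵐ z, z ∈ Qc (0 : Pt n) 2 →
    Pd z ≤ L * (d z ^ (p - 1) + d z ^ (q - 1) + (f z ^ (p - 1) + f z ^ (q - 1)))
  hco : ∀ᵐ z, z ∈ Qc (0 : Pt n) 2 →
    m * d z ^ q - L * (f z ^ (p - 1) + f z ^ (q - 1)) * d z ≤ ∑ i, ∑ j, P i j z * D i j z
  up : ∫⁻ z in Qc (0 : Pt n) 2, ofReal (h z ^ δ) ≤ ofReal C
  low : ofReal (Vn n) ≤ ∫⁻ z in Qc (0 : Pt n) 1, ofReal ((h z + g z) ^ δ)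

lemma ofr_split {K η Y V c : ℝ} {s : Set (Pt n)} {X : Pt n → ℝ} (hK : 0 ≤ K) (hη : 0 ≤ η) (hY : 0 ≤ Y)
    (hc : 0 ≤ c) (hV0 : 0 ≤ V)
    (hV : volume s ≤ ofReal V)
    (hX : ∫⁻ z in s, ofReal (X z) ≤ ofReal c) :
    ∫⁻ z in s, ofReal (K * (η + Y * X z)) ≤ ofReal (K * (η * V + Y * c)) := by
  calc ∫⁻ z in s, ofReal (K * (η + Y * X z))
      ≤ ∫⁻ z in s, (ofReal (K * η) + ofReal (K * Y) * ofReal (X z)) := by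
        refine lintegral_mono fun z ↦ ?_
        rw [← ENNReal.ofReal_mul (by positivity), mul_add, ← mul_assoc]
        exact ENNReal.ofReal_add_le
    _ = ofReal (K * η) * volume s + ofReal (K * Y) * ∫⁻ z in s, ofReal (X z) := by
        rw [lintegral_add_left measurable_const, lintegral_const, lintegral_const_mul' _ _ ENNReal.ofReal_ne_top,
          Measure.restrict_apply_univ]
    _ ≤ ofReal (K * η) * ofReal V + ofReal (K * Y) * ofReal c := by gcongr
    _ = _ := by
        rw [← ENNReal.ofReal_mul (by positivity), ← ENNReal.ofReal_mul (by positivity),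
          ← ENNReal.ofReal_add (by positivity) (by positivity)]
        congr 1; ring

theorem dich (n N : ℕ) {p q m L C : ℝ} (hp : 2 < p) (hpq : p < q) (hm : 0 < m) (hL : 0 < L) (hC : 0 ≤ C) :
    ∃ κ₀ c₉ : ℝ, 0 < κ₀ ∧ κ₀ ≤ 1 / 2 ∧ 0 < c₉ ∧ ∀ (δ : ℝ), δ < 1 → q * (1 - δ) ≤ κ₀ →
      ∀ v D P d Pd f h g, NQ (n := n) N p q δ m L C v D P d Pd f h g →
      ofReal c₉ ≤ (∫⁻ z in Qc (0 : Pt n) 2, ofReal (h z ^ ((q - 1) / q))) ∨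
      ofReal c₉ ≤ ∫⁻ z in Qc (0 : Pt n) 2, ofReal (g z ^ δ) := by
  have hq : 2 < q := hp.trans hpq
  have hVp := Vn_pos n
  set V : ℝ := 2 ^ (n + 2) * Vn n with hVd
  have hV0 : 0 < V := by positivity
  have vol2 : volume (Qc (0 : Pt n) 2) ≤ ofReal V := (vol_Qc (0 : Pt n) (by norm_num : (0:ℝ) < 2)).le
  have vol1 : volume (Qc (0 : Pt n) 1) ≤ ofReal (Vn n) := by
    rw [vol_Qc (0 : Pt n) (by norm_num : (0:ℝ) < 1)]; simp
  set Y₁ : ℝ := (1 / 12) ^ (-q) with hY₁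
  have hY₁1 : 1 ≤ Y₁ := one_le_eta (by norm_num) (by norm_num) (by linarith)
  set ε : ℝ := Vn n / (24 * Y₁) with hεd
  have hε : 0 < ε := by positivity
  obtain ⟨κ₀, c₁, hκ0, hκ1, hc₁, hmain⟩ := norm_main n N (C₀ := 4 * C + 1) (M := 2 * L) hq hm (by positivity)
    (by linarith) hε
  set K : ℝ := 32 + 12 * L with hK
  have hK0 : 0 < K := by positivity
  set η : ℝ := min 1 (c₁ / (2 * K * V)) with hηd
  have hη : 0 < η := by positivity
  have hη1 : η ≤ 1 := min_le_left _ _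
  have hηV : K * (η * V) ≤ c₁ / 2 := by
    have : η ≤ c₁ / (2 * K * V) := min_le_right _ _
    calc K * (η * V) ≤ K * (c₁ / (2 * K * V) * V) := by gcongr
      _ = c₁ / 2 := by field_simp
  set Y : ℝ := η ^ (-q) with hYd
  have hY1 : 1 ≤ Y := one_le_eta hη hη1 (by linarith)
  have hY0 : 0 < Y := by linarith
  set c₉ : ℝ := min (Vn n / 4) (c₁ / (4 * K * Y)) with hc₉d
  have hc₉ : 0 < c₉ := by positivity
  have hc₉1 : K * (Y * (2 * c₉)) ≤ c₁ / 2 := by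
    have : c₉ ≤ c₁ / (4 * K * Y) := min_le_right _ _
    calc K * (Y * (2 * c₉)) ≤ K * (Y * (2 * (c₁ / (4 * K * Y)))) := by gcongr
      _ = c₁ / 2 := by field_simp; norm_num
  refine ⟨κ₀, c₉, hκ0, hκ1, hc₉, ?_⟩
  intro δ hδ1 hδ v D P d Pd f h g H
  have hmQ : MeasurableSet (Qc (0 : Pt n) 2) := meas_Qc _ _
  have hmQ1 : MeasurableSet (Qc (0 : Pt n) 1) := meas_Qc _ _
  have hq0 : 0 < q := by linarith
  have hδ2 : 3 / 4 ≤ δ := by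
    by_contra hc; push Not at hc
    have : 2 * (1 - δ) < q * (1 - δ) := mul_lt_mul_of_pos_right hq (by linarith)
    linarith
  have hqd : q - 1 / 2 ≤ q * δ := by linarith
  have hqd2 : q * δ ≤ q := by have := mul_le_mul_of_nonneg_left hδ1.le hq0.le; linarith
  have eκ : q - q * (1 - δ) = q * δ := by ring
  by_contra hcon
  rw [not_or, not_le, not_le] at hcon
  obtain ⟨hX, hYY⟩ := hcon
  set b : Pt n → ℝ := fun z ↦ (f z ^ (p - 1) + f z ^ (q - 1)) ^ (1 / (q - 1)) with hb
  have hdm := H.dm; have hPm := H.Pm; have hfm := H.fm; have hhm := H.hm; have hgm := H.gm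
  have hB0 : ∀ z, 0 ≤ f z ^ (p - 1) + f z ^ (q - 1) := fun z ↦
    add_nonneg (Real.rpow_nonneg (H.f0 z) _) (Real.rpow_nonneg (H.f0 z) _)
  have hbq : ∀ z, b z ^ (q - 1) = f z ^ (p - 1) + f z ^ (q - 1) := fun z ↦ by
    simp only [hb]
    rw [← Real.rpow_mul (hB0 z), one_div_mul_cancel (by linarith), Real.rpow_one]
  have hNP : NP N q m (2 * L) v D P d Pd b := by
    refine ⟨H.W, H.vm, H.dm, H.Pm, by fun_prop, H.d0, H.P0, fun z ↦ Real.rpow_nonneg (hB0 z) _, H.hD, H.hP, ?_, ?_⟩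
    · filter_upwards [H.hPb] with z hz hzQ
      rw [hbq]
      have h3 := psplit (q := q) one_pos le_rfl (by linarith : (1:ℝ) ≤ p - 1) (by linarith : p - 1 ≤ q - 1)
        (by linarith) (H.d0 z)
      rw [Real.one_rpow, one_mul] at h3
      refine (hz hzQ).trans ?_
      have h4 := mul_le_mul_of_nonneg_left h3 hL.le
      have h5 := mul_nonneg hL.le (hB0 z)
      linarith
    · filter_upwards [H.hco] with z hz hzQ
      rw [hbq]
      refine le_trans ?_ (hz hzQ)
      have h5 := mul_nonneg (mul_nonneg hL.le (hB0 z)) (H.d0 z)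
      linarith

  have fd : ∀ z ∈ Qc (0 : Pt n) 2, f z ^ (q * δ) ≤ 4 * g z ^ δ := fun z hz ↦
    pw4 hq0 (by linarith) hδ1.le (H.f0 z) (H.g1 z hz)
  have dd : ∀ z ∈ Qc (0 : Pt n) 2, d z ^ (q * δ) ≤ 4 * h z ^ δ := fun z hz ↦
    pw4 hq0 (by linarith) hδ1.le (H.d0 z) (H.h1 z hz)
  have dθ : ∀ z ∈ Qc (0 : Pt n) 2, d z ^ (q - 1) ≤ 4 * h z ^ ((q - 1) / q) := fun z hz ↦ by
    have := pw4 hq0 (div_nonneg (by linarith) hq0.le) ((div_le_one hq0).2 (by linarith : q - 1 ≤ q)) (H.d0 z) (H.h1 z hz)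
    rwa [mul_div_cancel₀ _ hq0.ne'] at this
  have hg0 : ∀ z, 0 ≤ g z ^ δ := fun z ↦ Real.rpow_nonneg (H.g0 z) _
  have hh0 : ∀ z, 0 ≤ h z ^ ((q - 1) / q) := fun z ↦ Real.rpow_nonneg (H.h0 z) _
  have hXY : ∫⁻ z in Qc (0 : Pt n) 2, ofReal (h z ^ ((q - 1) / q) + g z ^ δ) ≤ ofReal (2 * c₉) := by
    calc _ = (∫⁻ z in Qc (0 : Pt n) 2, ofReal (h z ^ ((q - 1) / q))) +
        ∫⁻ z in Qc (0 : Pt n) 2, ofReal (g z ^ δ) := by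
          rw [← lintegral_add_left (by fun_prop)]
          refine lintegral_congr fun z ↦ ?_
          exact ENNReal.ofReal_add (hh0 z) (hg0 z)
      _ ≤ ofReal c₉ + ofReal c₉ := add_le_add hX.le hYY.le
      _ = _ := by rw [← ENNReal.ofReal_add hc₉.le hc₉.le]; congr 1; ring
  have hfin : ∫⁻ z in Qc (0 : Pt n) 2, ofReal (K * (η + Y * (h z ^ ((q - 1) / q) + g z ^ δ))) ≤ ofReal c₁ := by
    refine (ofr_split hK0.le hη.le hY0.le (by positivity) hV0.le vol2 hXY).trans (ENNReal.ofReal_le_ofReal ?_)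
    linarith [mul_add K (η * V) (Y * (2 * c₉))]
  have hs1 : ∫⁻ z, ofReal (d z ^ (q - q * (1 - δ))) ≤ ofReal (4 * C + 1) := by
    rw [eκ]
    calc _ = ∫⁻ z in Qc (0 : Pt n) 2, ofReal (d z ^ (q * δ)) := by
          refine (setLIntegral_eq_of_support_subset ?_).symm
          intro z hz
          by_contra hzQ
          refine hz ?_
          simp only [H.dz z hzQ]
          rw [Real.zero_rpow (by positivity), ENNReal.ofReal_zero]
      _ ≤ ∫⁻ z in Qc (0 : Pt n) 2, ofReal 4 * ofReal (h z ^ δ) := by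
          refine setLIntegral_mono' hmQ fun z hz ↦ ?_
          rw [← ENNReal.ofReal_mul (by norm_num)]
          exact ENNReal.ofReal_le_ofReal (dd z hz)
      _ ≤ ofReal 4 * ofReal C := by
          rw [lintegral_const_mul' _ _ ENNReal.ofReal_ne_top]
          exact mul_le_mul_right H.up _
      _ ≤ _ := by
          rw [← ENNReal.ofReal_mul (by norm_num)]
          exact ENNReal.ofReal_le_ofReal (by linarith)
  have hs2 : (∫⁻ z, ofReal (d z)) + ∫⁻ z, ofReal (Pd z) ≤ ofReal c₁ := by
    refine le_trans ?_ hfin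
    rw [← lintegral_add_left (by fun_prop)]
    rw [← setLIntegral_eq_of_support_subset (s := Qc (0 : Pt n) 2)]
    · refine lintegral_mono_ae ?_
      filter_upwards [ae_restrict_of_ae H.hPb, ae_restrict_mem hmQ] with z hz hzQ
      rw [← ENNReal.ofReal_add (H.d0 z) (H.P0 z)]
      refine ENNReal.ofReal_le_ofReal ?_
      have a1 := psplit (q := q) hη hη1 (le_refl (1:ℝ)) (by linarith : (1:ℝ) ≤ q - 1) (by linarith) (H.d0 z)
      have a2 := psplit (q := q) hη hη1 (by linarith : (1:ℝ) ≤ p - 1) (by linarith : p - 1 ≤ q - 1) (by linarith) (H.d0 z)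
      have a3 := psplit (q := q) hη hη1 (by linarith : (1:ℝ) ≤ p - 1) (by linarith : p - 1 ≤ q * δ) hqd2 (H.f0 z)
      have a4 := psplit (q := q) hη hη1 (by linarith : (1:ℝ) ≤ q - 1) (by linarith : q - 1 ≤ q * δ) hqd2 (H.f0 z)
      rw [Real.rpow_one] at a1
      have b1 := hz hzQ
      have b2 := mul_le_mul_of_nonneg_left (dθ z hzQ) hY0.le
      have b3 := mul_le_mul_of_nonneg_left (fd z hzQ) hY0.le
      have b4 : d z ^ (q - 1) ≤ Y * d z ^ (q - 1) := le_mul_of_one_le_left (Real.rpow_nonneg (H.d0 z) _) hY1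
      have b5 := mul_nonneg hY0.le (hh0 z)
      have b6 := mul_nonneg hY0.le (hg0 z)
      have b7 : d z ^ (p - 1) + d z ^ (q - 1) + (f z ^ (p - 1) + f z ^ (q - 1)) ≤
          3 * η + 8 * (Y * h z ^ ((q - 1) / q)) + 8 * (Y * g z ^ δ) := by linarith
      have b8 := mul_le_mul_of_nonneg_left b7 hL.le
      have b9 := mul_nonneg hL.le b5
      have b10 := mul_nonneg hL.le b6
      have b11 := mul_nonneg hL.le hη.le
      rw [hK]
      linarith
    · intro z hz
      by_contra hzQ
      refine hz ?_
      simp [H.dz z hzQ, H.Pz z hzQ]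
  have hs3 : ∫⁻ z in Qc (0 : Pt n) (3 / 2), ofReal (b z ^ (q - q * (1 - δ))) ≤ ofReal c₁ := by
    rw [eκ]
    refine le_trans ?_ hfin
    refine (lintegral_mono_set (?_ : Qc (0 : Pt n) (3 / 2) ⊆ Qc 0 2)).trans ?_
    · exact Qc_mono (by norm_num) (by simp [pd]; norm_num)
    · refine setLIntegral_mono' hmQ fun z hzQ ↦ ENNReal.ofReal_le_ofReal ?_
      set e : ℝ := q * δ / (q - 1) with he
      have hq1 : 0 < q - 1 := by linarith
      have he1 : 1 ≤ e := by rw [he, one_le_div hq1]; linarith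
      have he2 : e ≤ 2 := by rw [he, div_le_iff₀ hq1]; linarith
      have eb : b z ^ (q * δ) = (f z ^ (p - 1) + f z ^ (q - 1)) ^ e := by
        rw [← hbq, ← Real.rpow_mul (Real.rpow_nonneg (hB0 z) _), he, mul_div_cancel₀ _ hq1.ne']
      have f0 := H.f0 z
      have x0 : 0 ≤ f z ^ (p - 1) := Real.rpow_nonneg f0 _
      have y0 : 0 ≤ f z ^ (q - 1) := Real.rpow_nonneg f0 _
      have c1 : ∀ x y : ℝ, 0 ≤ x → 0 ≤ y → y ≤ x → (x + y) ^ e ≤ 4 * (x ^ e + y ^ e) := by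
        intro x y hx hy hyx
        calc (x + y) ^ e ≤ (2 * x) ^ e := Real.rpow_le_rpow (by positivity) (by linarith) (by linarith)
          _ = 2 ^ e * x ^ e := Real.mul_rpow (by norm_num) hx
          _ ≤ 4 * x ^ e := by
            gcongr
            calc (2:ℝ) ^ e ≤ 2 ^ (2:ℝ) := Real.rpow_le_rpow_of_exponent_le (by norm_num) he2
              _ = 4 := by norm_num
          _ ≤ _ := by have : 0 ≤ y ^ e := by positivity
                      linarith
      have c2 : (f z ^ (p - 1) + f z ^ (q - 1)) ^ e ≤ 4 * ((f z ^ (p - 1)) ^ e + (f z ^ (q - 1)) ^ e) := by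
        rcases le_total (f z ^ (q - 1)) (f z ^ (p - 1)) with hh | hh
        · exact c1 _ _ x0 y0 hh
        · have := c1 _ _ y0 x0 hh
          rwa [add_comm, add_comm (_ ^ e)] at this
      rw [← Real.rpow_mul f0, ← Real.rpow_mul f0, mul_comm (q - 1) e, he, div_mul_cancel₀ _ hq1.ne', ← he] at c2
      have hpe : (p - 1) * 1 ≤ (p - 1) * e := mul_le_mul_of_nonneg_left he1 (by linarith)
      have hpe2 : (p - 1) * e ≤ (q - 1) * e := mul_le_mul_of_nonneg_right (by linarith) (by linarith)
      have hpe3 : (q - 1) * e = q * δ := by rw [he, mul_div_cancel₀ _ hq1.ne']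
      have c3 := psplit (q := q) hη hη1 (by linarith : (1:ℝ) ≤ (p - 1) * e) (by linarith : (p - 1) * e ≤ q * δ) hqd2 f0
      have b4 : f z ^ (q * δ) ≤ Y * f z ^ (q * δ) := le_mul_of_one_le_left (Real.rpow_nonneg f0 _) hY1
      have b3 := mul_le_mul_of_nonneg_left (fd z hzQ) hY0.le
      have b5 := mul_nonneg hY0.le (hh0 z)
      have b6 := mul_nonneg hY0.le (hg0 z)
      have b9 := mul_nonneg hL.le b5
      have b10 := mul_nonneg hL.le b6
      have b11 := mul_nonneg hL.le hη.le
      rw [eb, hK]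
      linarith
  have hfinal := hmain v D P d Pd b hNP (q * (1 - δ)) (mul_pos hq0 (by linarith)) hδ hs1 hs2 hs3
  rw [eκ] at hfinal
  have hQ12 : Qc (0 : Pt n) 1 ⊆ Qc 0 2 := Qc_mono (by norm_num) (by simp [pd])
  have hlow := H.low
  have key : ∫⁻ z in Qc (0 : Pt n) 1, ofReal ((h z + g z) ^ δ) ≤
      ofReal (3 * ((1 / 12) * Vn n + 2 * Y₁ * ε)) + ofReal c₉ := by
    calc _ ≤ ∫⁻ z in Qc (0 : Pt n) 1, (ofReal (3 * (1 / 12 + 2 * Y₁ * d z ^ (q * δ))) + ofReal (g z ^ δ)) := by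
          refine setLIntegral_mono' hmQ1 fun z hz ↦ ?_
          rw [← ENNReal.ofReal_add (by have := Real.rpow_nonneg (H.d0 z) (q * δ); positivity) (hg0 z)]
          refine ENNReal.ofReal_le_ofReal ?_
          have e1 := addpow (by linarith) hδ1.le (H.h0 z) (H.g0 z) (t := δ)
          have dp := Real.rpow_nonneg (H.d0 z) p
          have dq := Real.rpow_nonneg (H.d0 z) q
          have e2 : h z ^ δ ≤ 3 * (d z ^ (p * δ) + d z ^ (q * δ)) := by
            calc h z ^ δ ≤ (3 * (d z ^ p + d z ^ q)) ^ δ := Real.rpow_le_rpow (H.h0 z) (H.h2 z (hQ12 hz)) (by linarith)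
              _ = 3 ^ δ * (d z ^ p + d z ^ q) ^ δ := Real.mul_rpow (by norm_num) (by positivity)
              _ ≤ 3 * ((d z ^ p) ^ δ + (d z ^ q) ^ δ) := by
                have : (3:ℝ) ^ δ ≤ 3 := by
                  calc (3:ℝ) ^ δ ≤ 3 ^ (1:ℝ) := Real.rpow_le_rpow_of_exponent_le (by norm_num) hδ1.le
                    _ = 3 := Real.rpow_one _
                exact mul_le_mul this (addpow (by linarith) hδ1.le dp dq) (by positivity) (by norm_num)
              _ = _ := by rw [← Real.rpow_mul (H.d0 z), ← Real.rpow_mul (H.d0 z)]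
          have hpδ : 2 * δ ≤ p * δ := mul_le_mul_of_nonneg_right hp.le (by linarith)
          have hpδ2 : p * δ ≤ q * δ := mul_le_mul_of_nonneg_right hpq.le (by linarith)
          have e3 := psplit (q := q) (by norm_num : (0:ℝ) < 1 / 12) (by norm_num) (by linarith : (1:ℝ) ≤ p * δ) hpδ2 hqd2 (H.d0 z)
          rw [← hY₁] at e3
          have e4 : d z ^ (q * δ) ≤ Y₁ * d z ^ (q * δ) := le_mul_of_one_le_left (Real.rpow_nonneg (H.d0 z) _) hY₁1
          linarith
      _ = (∫⁻ z in Qc (0 : Pt n) 1, ofReal (3 * (1 / 12 + 2 * Y₁ * d z ^ (q * δ)))) +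
            ∫⁻ z in Qc (0 : Pt n) 1, ofReal (g z ^ δ) := lintegral_add_left (by fun_prop) _
      _ ≤ _ := by
          refine add_le_add ?_ ((lintegral_mono_set hQ12).trans hYY.le)
          exact ofr_split (by norm_num) (by norm_num) (by positivity) hε.le hVp.le vol1 hfinal
  have h2 := hlow.trans key
  rw [← ENNReal.ofReal_add (by positivity) hc₉.le, ENNReal.ofReal_le_ofReal_iff (by positivity)] at h2
  have h3 : c₉ ≤ Vn n / 4 := min_le_left _ _
  have h4 : Y₁ * ε = Vn n / 24 := by rw [hεd]; field_simp
  linarith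

lemma mn0 {N : ℕ} (A : Mat N n) : 0 ≤ mnorm A := Real.sqrt_nonneg _

lemma mn_entry {N : ℕ} (A : Mat N n) (i : Fin N) (j : Fin n) : |A i j| ≤ mnorm A := by
  unfold mnorm mdot
  refine Real.abs_le_sqrt ?_
  have h1 : ∀ k, 0 ≤ ∑ l, A k l * A k l := fun k ↦ Finset.sum_nonneg fun l _ ↦ mul_self_nonneg _
  have h2 := Finset.single_le_sum (f := fun k ↦ ∑ l, A k l * A k l) (fun k _ ↦ h1 k) (Finset.mem_univ i)
  have h3 := Finset.single_le_sum (f := fun l ↦ A i l * A i l) (fun k _ ↦ mul_self_nonneg _) (Finset.mem_univ j)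
  rw [sq]; exact h3.trans h2

lemma mn_m {N : ℕ} {f : Pt n → Mat N n} (hf : Measurable f) : Measurable (fun z ↦ mnorm (f z)) := by
  unfold mnorm mdot
  have : ∀ i j, Measurable (fun z ↦ f z i j) := fun i j ↦ by fun_prop
  exact (Finset.measurable_fun_sum _ fun i _ ↦ Finset.measurable_fun_sum _ fun j _ ↦ (this i j).mul (this i j)).sqrt

lemma rp1 {x p : ℝ} (hx : 0 ≤ x) (hp : 2 < p) : x ^ (p - 2) * x = x ^ (p - 1) := by
  nth_rewrite 2 [← Real.rpow_one x]
  rw [← Real.rpow_add' hx (by linarith)]; ring_nf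

lemma gl {p q δ a A₀ x : ℝ} (hp : 2 < p) (hpq : p < q) (hδ : δ < 1) (hqd : q * (1 - δ) ≤ 1 / 2) (ha : 0 ≤ a)
    (haA : a ≤ A₀) (hA : 1 ≤ A₀) (hx : 0 ≤ x) :
    x ^ (p - 1) + a * x ^ (q - 1) ≤ 2 * A₀ * (1 + (x ^ p + a * x ^ q) ^ δ) := by
  have hδ0 : 0 < δ := by
    by_contra h; push Not at h
    have : q * 1 ≤ q * (1 - δ) := mul_le_mul_of_nonneg_left (by linarith) (by linarith)
    linarith
  have hpd : p * (1 - δ) ≤ q * (1 - δ) := mul_le_mul_of_nonneg_right hpq.le (by linarith)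
  have hp' := Real.rpow_nonneg hx p
  have hq' := mul_nonneg ha (Real.rpow_nonneg hx q)
  set Hh := (x ^ p + a * x ^ q) ^ δ with hH
  have hH0 : 0 ≤ Hh := by positivity
  have e1 := psplit (q := q) one_pos le_rfl (by linarith : (1:ℝ) ≤ p - 1) (by linarith : p - 1 ≤ p * δ)
    (by have := mul_le_mul_of_nonneg_left hδ.le (by linarith : 0 ≤ p); linarith) hx
  have e2 := psplit (q := q) one_pos le_rfl (by linarith : (1:ℝ) ≤ q - 1) (by linarith : q - 1 ≤ q * δ)
    (by have := mul_le_mul_of_nonneg_left hδ.le (by linarith : 0 ≤ q); linarith) hx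
  rw [Real.one_rpow, one_mul] at e1 e2
  rw [Real.rpow_mul hx] at e1 e2
  have e3 : (x ^ p) ^ δ ≤ Hh := Real.rpow_le_rpow hp' (by linarith) hδ0.le
  have e4 : a * (x ^ q) ^ δ ≤ A₀ * Hh := by
    rcases ha.eq_or_lt with h | h
    · rw [← h, zero_mul]; positivity
    calc a * (x ^ q) ^ δ = a ^ (1 - δ) * (a * x ^ q) ^ δ := by
          rw [Real.mul_rpow ha (by positivity), ← mul_assoc, ← Real.rpow_add h]; simp
      _ ≤ A₀ * Hh := by
          refine mul_le_mul ?_ (Real.rpow_le_rpow hq' (by linarith) hδ0.le) (by positivity) (by linarith)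
          calc a ^ (1 - δ) ≤ A₀ ^ (1 - δ) := Real.rpow_le_rpow ha haA (by linarith)
            _ ≤ A₀ ^ (1:ℝ) := Real.rpow_le_rpow_of_exponent_le hA (by linarith)
            _ = A₀ := Real.rpow_one _
  have e5 := mul_le_mul_of_nonneg_left e2 ha
  have e6 : 1 * Hh ≤ A₀ * Hh := mul_le_mul_of_nonneg_right hA hH0
  linarith

lemma ind_int {G U : Set (Pt n)} (hU : MeasurableSet U) (hGU : G ⊆ U) {w κ : Pt n → ℝ} (hκ : ∀ z, z ∉ G → κ z = 0) :
    ∫ z, G.indicator w z * κ z = ∫ z in U, w z * κ z := by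
  rw [← integral_indicator hU]
  refine integral_congr_ae (ae_of_all _ fun z ↦ ?_)
  by_cases hz : z ∈ G
  · simp [hz, hGU hz]
  · by_cases h2 : z ∈ U <;> simp [h2, hκ z hz]

section
variable {N : ℕ} {p q α L₁ L₂ aH δ : ℝ}

lemma H_m {S : Setting n N p q α L₁ L₂ aH} {X : Pt n → Mat N n} (hX : Measurable X) :
    Measurable (fun z ↦ Hf S.a p q z (mnorm (X z))) := by
  have h1 := mn_m hX; have h2 := S.haM
  unfold Hf; fun_prop

lemma H_0 (S : Setting n N p q α L₁ L₂ aH) (z : Pt n) {x : ℝ} (hx : 0 ≤ x) : 0 ≤ Hf S.a p q z x := by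
  have := S.ha0 z
  unfold Hf; positivity

lemma cyl_m (S : Setting n N p q α L₁ L₂ aH) : MeasurableSet (cyl S.Ω S.T) :=
  S.hΩo.measurableSet.prod measurableSet_Ioo

lemma cyl_fin (S : Setting n N p q α L₁ L₂ aH) : volume (cyl S.Ω S.T) ≠ ∞ := by
  have : Bornology.IsBounded (cyl S.Ω S.T) := S.hΩb.prod (Metric.isBounded_Ioo 0 S.T)
  exact this.measure_lt_top.ne

lemma int_dom {s : Set (Pt n)} (hs : volume s ≠ ∞) (hm : MeasurableSet s) {f g : Pt n → ℝ} {C : ℝ} (hf : Measurable f)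
    (hg : IntegrableOn g s) (h : ∀ᵐ z ∂(volume.restrict s), |f z| ≤ C * (1 + g z)) : IntegrableOn f s :=
  Integrable.mono' (((integrableOn_const (C := (1:ℝ)) hs).add hg).const_mul C) hf.aestronglyMeasurable h

lemma pw_int {s : Set (Pt n)} (hs : volume s ≠ ∞) (hm : MeasurableSet s) {f : Pt n → ℝ} {a b : ℝ} (ha : 0 ≤ a) (hab : a ≤ b)
    (hf : Measurable f) (f0 : ∀ z, 0 ≤ f z)
    (hg : IntegrableOn (fun z ↦ f z ^ b) s) : IntegrableOn (fun z ↦ f z ^ a) s := by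
  refine int_dom hs hm (C := 1) (by fun_prop) hg (ae_of_all _ fun z ↦ ?_)
  have h1 := Real.rpow_nonneg (f0 z) a
  have h2 := Real.rpow_nonneg (f0 z) b
  rw [abs_of_nonneg h1, one_mul]
  rcases le_total (f z) 1 with h | h
  · have := Real.rpow_le_one (f0 z) h ha; linarith
  · have := Real.rpow_le_rpow_of_exponent_le h hab; linarith

lemma F_int {S : Setting n N p q α L₁ L₂ aH} (hδ0 : 0 < δ) (hδ : δ < 1) :
    IntegrableOn (fun z ↦ HFf S z ^ δ) (cyl S.Ω S.T) := by
  refine pw_int (b := 1) (cyl_fin S) (cyl_m S) hδ0.le hδ.le (H_m S.hFM) (fun z ↦ H_0 S z (mn0 _)) ?_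
  simp only [Real.rpow_one]
  exact S.hFint

lemma R_bd (S : Setting n N p q α L₁ L₂ aH) (z : Pt n) (i : Fin N) (j : Fin n) :
    |rhsF S z i j| ≤ mnorm (S.F z) ^ (p - 1) + S.a z * mnorm (S.F z) ^ (q - 1) := by
  have h := mn_entry (S.F z) i j
  have h0 := mn0 (S.F z)
  have ha := S.ha0 z
  have hp := S.hp2; have hq := S.hpq
  unfold rhsF
  rw [← add_mul, abs_mul, abs_of_nonneg (by positivity), ← rp1 h0 hp, ← rp1 h0 (hp.trans hq), ← mul_assoc, ← add_mul]
  gcongr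

lemma A_m {S : Setting n N p q α L₁ L₂ aH} {Du : Pt n → Mat N n} (hDu : Measurable Du) :
    Measurable (fun z ↦ S.A z (Du z)) := S.hAM.comp (measurable_id.prodMk hDu)

lemma R_m (S : Setting n N p q α L₁ L₂ aH) : Measurable (rhsF S) := by
  have h1 := mn_m S.hFM; have h2 := S.haM; have h3 := S.hFM
  have h4 : ∀ i j, Measurable (fun z ↦ S.F z i j) := fun i j ↦ by fun_prop
  unfold rhsF
  refine measurable_pi_lambda _ fun i ↦ measurable_pi_lambda _ fun j ↦ ?_
  have := h4 i j
  fun_prop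

lemma A0 (S : Setting n N p q α L₁ L₂ aH) : ∃ A₀, 1 ≤ A₀ ∧ ∀ z, S.a z ≤ A₀ := by
  obtain ⟨B, hB⟩ := S.haB
  exact ⟨max B 1, le_max_right _ _, fun z ↦ (hB ⟨z, rfl⟩).trans (le_max_left _ _)⟩

lemma AR_int {S : Setting n N p q α L₁ L₂ aH} {u : Pt n → Vec N} {Du : Pt n → Mat N n}
    (V : VeryWeakSolution S u Du δ) (hqd : q * (1 - δ) ≤ 1 / 2) (i : Fin N) (j : Fin n) :
    IntegrableOn (fun z ↦ S.A z (Du z) i j) (cyl S.Ω S.T) ∧ IntegrableOn (fun z ↦ rhsF S z i j) (cyl S.Ω S.T) := by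
  obtain ⟨A₀, hA1, hA⟩ := A0 S
  have hL : 0 < L₂ := S.hL₁.trans_le S.hL₁₂
  constructor
  · have := A_m (S := S) V.hDuM
    refine int_dom (cyl_fin S) (cyl_m S) (C := L₂ * (2 * A₀)) (by fun_prop) V.henergy ?_
    filter_upwards [S.hAgrow] with z hz
    refine ((mn_entry _ i j).trans (hz (Du z))).trans ?_
    rw [mul_assoc]
    exact mul_le_mul_of_nonneg_left (gl S.hp2 S.hpq V.hδ.2 hqd (S.ha0 z) (hA z) hA1 (mn0 _)) hL.le
  · have := R_m S
    refine int_dom (cyl_fin S) (cyl_m S) (C := 2 * A₀) (by fun_prop) (F_int V.hδ.1 V.hδ.2) (ae_of_all _ fun z ↦ ?_)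
    exact (R_bd S z i j).trans (gl S.hp2 S.hpq V.hδ.2 hqd (S.ha0 z) (hA z) hA1 (mn0 _))

lemma we_of {S : Setting n N p q α L₁ L₂ aH} {u : Pt n → Vec N} {Du : Pt n → Mat N n}
    (V : VeryWeakSolution S u Du δ) (hqd : q * (1 - δ) ≤ 1 / 2) {G : Set (Pt n)} (hG : MeasurableSet G)
    (hGc : G ⊆ cyl S.Ω S.T) (i : Fin N) :
    WE G (G.indicator fun z ↦ u z i) (fun j ↦ G.indicator fun z ↦ Du z i j)
      (fun j ↦ G.indicator fun z ↦ S.A z (Du z) i j - rhsF S z i j) 0 := by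
  have hcm := cyl_m S
  have iu : IntegrableOn (fun z ↦ u z i) (cyl S.Ω S.T) := by
    refine Integrable.mono' V.huL1 (by have := V.huM; fun_prop) (ae_of_all _ fun z ↦ ?_)
    unfold vnorm vdot
    refine Real.abs_le_sqrt ?_
    rw [sq]
    exact Finset.single_le_sum (f := fun k ↦ u z k * u z k) (fun k _ ↦ mul_self_nonneg _) (Finset.mem_univ i)
  have iD : ∀ j, IntegrableOn (fun z ↦ Du z i j) (cyl S.Ω S.T) := fun j ↦
    Integrable.mono' V.hDuL1 (by have := V.hDuM; fun_prop) (ae_of_all _ fun z ↦ mn_entry _ i j)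
  have iA := fun j ↦ (AR_int V hqd i j).1
  have iR := fun j ↦ (AR_int V hqd i j).2
  refine ⟨(integrable_indicator_iff hG).2 (iu.mono_set hGc), fun j ↦ (integrable_indicator_iff hG).2 ((iD j).mono_set hGc),
    fun j ↦ (integrable_indicator_iff hG).2 (((iA j).sub (iR j)).mono_set hGc), integrable_zero _ _ _, ?_, ?_⟩
  · intro j ψ h1 h2 h3
    rw [ind_int hcm hGc fun z hz ↦ ?_, ind_int hcm hGc fun z hz ↦ image_eq_zero_of_notMem_tsupport fun h ↦ hz (h3 h)]
    · exact V.hgrad i j ψ h1 h2 (h3.trans hGc)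
    · unfold dxj; rw [fderiv_of_notMem_tsupport ℝ fun h ↦ hz (h3 h)]; simp
  · intro ψ h1 h2 h3
    have sc : SC ψ := ⟨h1, h2⟩
    have z1 : ∀ v : Pt n, ∀ z, z ∉ G → fderiv ℝ ψ z v = 0 := fun v z hz ↦ by
      rw [fderiv_of_notMem_tsupport ℝ fun h ↦ hz (h3 h)]; simp
    set e : Vec N := Pi.single i 1 with he
    have hdi : ∀ z, DifferentiableAt ℝ ψ z := fun z ↦ h1.differentiable (by simp) z
    have hw := V.hweak (fun z ↦ ψ z • e) (h1.smul contDiff_const) h2.smul_right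
      ((tsupport_smul_subset_left ψ fun _ ↦ e).trans (h3.trans hGc))
    have hd1 : ∀ z, vdot (u z) (dtd (fun z ↦ ψ z • e) z) = u z i * dts ψ z := by
      intro z
      unfold vdot dtd dts
      rw [fderiv_smul_const (hdi z)]
      simp [he, Pi.single_apply]
    have hd2 : ∀ (B : Mat N n) z, mdot B (gradm (fun z ↦ ψ z • e) z) = ∑ j, B i j * dxj ψ j z := by
      intro B z
      unfold mdot gradm dxj
      have : ∀ k, fderiv ℝ (fun w ↦ (ψ w • e) k) z = e k • fderiv ℝ ψ z := fun k ↦ by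
        simp only [Pi.smul_apply, smul_eq_mul]
        rw [fderiv_mul_const (hdi z)]
      simp only [this]
      rw [Finset.sum_eq_single i]
      · simp [he]
      · intro k _ hk; simp [he, hk]
      · simp
    simp only [hd1, hd2] at hw
    have mulb : ∀ {f : Pt n → ℝ} (v : Pt n), IntegrableOn f (cyl S.Ω S.T) → IntegrableOn (fun z ↦ f z * fderiv ℝ ψ z v) (cyl S.Ω S.T) := by
      intro f v hf
      obtain ⟨C, -, hC⟩ := cc_bdd (sc.fd v).1 (sc.fd v).2
      exact hf.mul_bdd (c := C) (sc.fd v).1.aestronglyMeasurable (Eventually.of_forall hC)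
    have i1 : IntegrableOn (fun z ↦ u z i * dts ψ z) (cyl S.Ω S.T) := mulb _ iu
    have i2 : ∀ j, IntegrableOn (fun z ↦ S.A z (Du z) i j * dxj ψ j z) (cyl S.Ω S.T) := fun j ↦ mulb _ (iA j)
    have i3 : ∀ j, IntegrableOn (fun z ↦ rhsF S z i j * dxj ψ j z) (cyl S.Ω S.T) := fun j ↦ mulb _ (iR j)
    rw [integral_add (f := fun z ↦ -(u z i * dts ψ z)) i1.neg (integrable_finsetSum _ fun j _ ↦ i2 j), integral_neg,
      integral_finsetSum _ (fun j _ ↦ i2 j), integral_finsetSum _ (fun j _ ↦ i3 j)] at hw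
    rw [ind_int (κ := dts ψ) hcm hGc (z1 _)]
    have e2 : ∀ j, ∫ z, G.indicator (fun z ↦ S.A z (Du z) i j - rhsF S z i j) z * dxj ψ j z =
        (∫ z in cyl S.Ω S.T, S.A z (Du z) i j * dxj ψ j z) - ∫ z in cyl S.Ω S.T, rhsF S z i j * dxj ψ j z := by
      intro j
      rw [ind_int (κ := dxj ψ j) hcm hGc (z1 _), ← integral_sub (i2 j) (i3 j)]
      simp only [sub_mul]
    simp only [e2, Finset.sum_sub_distrib]
    simp only [Pi.zero_apply, zero_mul, integral_zero, sub_zero]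
    linarith

end

lemma alg {p q π a₀ a y : ℝ} (hπ : 1 < π) (hc : π ^ p < a₀ * π ^ q) (h1 : a₀ / 2 ≤ a) (h2 : a ≤ 2 * a₀) (hy : 0 ≤ y) :
    π / (π ^ p + a₀ * π ^ q) * ((π * y) ^ (p - 1) + a * (π * y) ^ (q - 1)) ≤ 2 * (y ^ (p - 1) + y ^ (q - 1)) ∧
    y ^ q / 4 ≤ ((π * y) ^ p + a * (π * y) ^ q) / (π ^ p + a₀ * π ^ q) ∧
    ((π * y) ^ p + a * (π * y) ^ q) / (π ^ p + a₀ * π ^ q) ≤ 3 * (y ^ p + y ^ q) := by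
  have hπ0 : 0 < π := by linarith
  have P1 : 0 < π ^ p := by positivity
  have P2 : 0 < π ^ q := by positivity
  have ha0 : 0 < a₀ := pos_of_mul_pos_left (P1.trans hc) P2.le
  set Pp := π ^ p + a₀ * π ^ q with hPp
  have hPp0 : 0 < Pp := by positivity
  have m1 : a₀ / 2 * π ^ q ≤ a * π ^ q := mul_le_mul_of_nonneg_right h1 P2.le
  have m2 : a * π ^ q ≤ 2 * a₀ * π ^ q := mul_le_mul_of_nonneg_right h2 P2.le
  have A1 : π ^ p ≤ Pp := by linarith [mul_pos ha0 P2]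
  have A2 : a * π ^ q ≤ 2 * Pp := by linarith
  have A3 : Pp / 4 ≤ a * π ^ q := by linarith
  rw [Real.mul_rpow hπ0.le hy, Real.mul_rpow hπ0.le hy, Real.mul_rpow hπ0.le hy, Real.mul_rpow hπ0.le hy]
  have y1 : 0 ≤ y ^ (p - 1) := by positivity
  have y2 : 0 ≤ y ^ (q - 1) := by positivity
  have y3 : 0 ≤ y ^ p := by positivity
  have y4 : 0 ≤ y ^ q := by positivity
  have e1 : π * π ^ (p - 1) = π ^ p := by rw [Real.rpow_sub_one hπ0.ne']; field_simp
  have e2 : π * π ^ (q - 1) = π ^ q := by rw [Real.rpow_sub_one hπ0.ne']; field_simp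
  refine ⟨?_, ?_, ?_⟩
  · rw [div_mul_eq_mul_div, div_le_iff₀ hPp0]
    calc π * (π ^ (p - 1) * y ^ (p - 1) + a * (π ^ (q - 1) * y ^ (q - 1)))
        = π ^ p * y ^ (p - 1) + (a * π ^ q) * y ^ (q - 1) := by rw [← e1, ← e2]; ring
      _ ≤ Pp * y ^ (p - 1) + (2 * Pp) * y ^ (q - 1) := by gcongr
      _ ≤ _ := by linarith [mul_nonneg hPp0.le y1]
  · rw [le_div_iff₀ hPp0]
    have := mul_le_mul_of_nonneg_right A3 y4
    have := mul_nonneg P1.le y3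
    linarith
  · rw [div_le_iff₀ hPp0]
    have := mul_le_mul_of_nonneg_right A1 y3
    have := mul_le_mul_of_nonneg_right A2 y4
    have := mul_nonneg hPp0.le y3
    have := mul_nonneg hPp0.le y4
    linarith

section
variable {N : ℕ} {p q α L₁ L₂ aH δ : ℝ} {S : Setting n N p q α L₁ L₂ aH} {u : Pt n → Vec N} {Du : Pt n → Mat N n}
  {z₀ : Pt n} {π ρ : ℝ}

def tsc (S : Setting n N p q α L₁ L₂ aH) (z₀ : Pt n) (π ρ : ℝ) : ℝ := π ^ 2 / Hf S.a p q z₀ π * ρ ^ 2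

lemma Hpos (h : PQHyp S Du z₀ π ρ δ) : 0 < Hf S.a p q z₀ π := by
  have h1 := h.hπ; have h2 := S.ha0 z₀
  have : 0 < π ^ p := Real.rpow_pos_of_pos (by linarith) _
  unfold Hf; positivity

lemma tsc_pos (h : PQHyp S Du z₀ π ρ δ) : 0 < tsc S z₀ π ρ := by
  have h1 := h.hπ; have h2 := Hpos h; have h3 := h.hρ.1
  have : 0 < π := by linarith
  unfold tsc; positivity

lemma pre_G (h : PQHyp S Du z₀ π ρ δ) (r : ℝ) :
    Ts z₀ ρ (tsc S z₀ π ρ) ⁻¹' (Gpq S.a p q z₀ π (r * ρ)) = Qc 0 r := by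
  have hρ := h.hρ.1
  have ht := tsc_pos h
  ext z
  have e : π ^ 2 / Hf S.a p q z₀ π * (r * ρ) ^ 2 = r ^ 2 * tsc S z₀ π ρ := by unfold tsc; ring
  rw [mem_Qc]
  simp only [mem_preimage, Gpq, Qrs, e, Ts, mem_prod, mem_ball, dist_eq_norm, mem_Ioo]
  rw [add_sub_cancel_left, norm_smul, Real.norm_eq_abs, abs_of_pos hρ, mul_comm r ρ, mul_lt_mul_iff_right₀ hρ, Prod.fst_zero, sub_zero,
    Prod.snd_zero, sub_zero, abs_lt]
  refine and_congr Iff.rfl (and_congr ?_ ?_)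
  · rw [← mul_lt_mul_iff_right₀ ht (b := -r ^ 2)]
    constructor <;> intro h <;> linarith
  · rw [← mul_lt_mul_iff_right₀ ht (b := z.2)]
    constructor <;> intro h <;> linarith

lemma G_m (S : Setting n N p q α L₁ L₂ aH) (z₀ : Pt n) (π r : ℝ) : MeasurableSet (Gpq S.a p q z₀ π r) :=
  measurableSet_ball.prod measurableSet_Ioo

lemma G_mono (h : PQHyp S Du z₀ π ρ δ) {r s : ℝ} (hr : 0 ≤ r) (hrs : r ≤ s) :
    Gpq S.a p q z₀ π (r * ρ) ⊆ Gpq S.a p q z₀ π (s * ρ) := by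
  have hρ := h.hρ.1
  have h2 := Hpos h
  have h3 : r * ρ ≤ s * ρ := by gcongr
  have h4 : π ^ 2 / Hf S.a p q z₀ π * (r * ρ) ^ 2 ≤ π ^ 2 / Hf S.a p q z₀ π * (s * ρ) ^ 2 := by gcongr
  exact prod_mono (ball_subset_ball h3) (Ioo_subset_Ioo (by linarith) (by linarith))

lemma G_sub (h : PQHyp S Du z₀ π ρ δ) {r : ℝ} (hr : 0 ≤ r) (hrs : r ≤ 16) :
    Gpq S.a p q z₀ π (r * ρ) ⊆ cyl S.Ω S.T := (G_mono h hr hrs).trans h.hsub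

lemma G_vol (h : PQHyp S Du z₀ π ρ δ) {r : ℝ} (hr : 0 < r) :
    volume.real (Gpq S.a p q z₀ π (r * ρ)) = (ρ ^ n * tsc S z₀ π ρ) * (r ^ (n + 2) * Vn n) := by
  have hρ := h.hρ.1
  have ht := tsc_pos h
  have hV := Vn_pos n
  have hH := Hpos h
  have hπ := h.hπ
  unfold Gpq Measure.real
  rw [vol_Qrs _ (by positivity), ENNReal.toReal_ofReal (by positivity)]
  unfold tsc; ring

lemma avg (h : PQHyp S Du z₀ π ρ δ) {r : ℝ} (hr : 0 < r) (hr16 : r ≤ 16) {φ : Pt n → ℝ} (h0 : ∀ z, 0 ≤ φ z)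
    (hi : IntegrableOn φ (cyl S.Ω S.T)) :
    ∫⁻ z in Qc (0 : Pt n) r, ofReal (φ (Ts z₀ ρ (tsc S z₀ π ρ) z)) =
      ofReal (r ^ (n + 2) * Vn n * ⨍ z in Gpq S.a p q z₀ π (r * ρ), φ z) := by
  have hρ := h.hρ.1
  have ht := tsc_pos h
  have hV := Vn_pos n
  have hGm := G_m S z₀ π (r * ρ)
  have hi' := hi.mono_set (G_sub h hr.le hr16)
  rw [← lintegral_indicator (meas_Qc _ _), ← pre_G h r]
  have e1 : ∀ z, (Ts z₀ ρ (tsc S z₀ π ρ) ⁻¹' (Gpq S.a p q z₀ π (r * ρ))).indicator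
      (fun z ↦ ofReal (φ (Ts z₀ ρ (tsc S z₀ π ρ) z))) z =
      (Gpq S.a p q z₀ π (r * ρ)).indicator (fun z ↦ ofReal (φ z)) (Ts z₀ ρ (tsc S z₀ π ρ) z) := fun z ↦ rfl
  simp only [e1]
  rw [Ts_lint z₀ hρ ht, lintegral_indicator hGm, ← ofReal_integral_eq_lintegral_ofReal hi' (ae_of_all _ h0),
    ← ENNReal.ofReal_mul (by positivity), setAverage_eq, G_vol h hr]
  congr 1
  rw [smul_eq_mul]
  field_simp

lemma comp (h : PQHyp S Du z₀ π ρ δ) {z : Pt n} (hz : z ∈ Gpq S.a p q z₀ π (2 * ρ)) :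
    S.a z₀ / 2 ≤ S.a z ∧ S.a z ≤ 2 * S.a z₀ := by
  refine h.hcomp z ?_
  have hρ := h.hρ.1
  have hH := Hpos h
  have hπ := h.hπ
  have h1 : π ^ 2 ≤ Hf S.a p q z₀ π := by
    have a1 : π ^ (2:ℝ) ≤ π ^ p := Real.rpow_le_rpow_of_exponent_le hπ.le S.hp2.le
    rw [Real.rpow_two] at a1
    have a2 := mul_nonneg (S.ha0 z₀) (Real.rpow_nonneg (by linarith : 0 ≤ π) q)
    unfold Hf; linarith
  have h2 : π ^ 2 / Hf S.a p q z₀ π * (2 * ρ) ^ 2 ≤ 1 * (2 * ρ) ^ 2 := by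
    gcongr; exact (div_le_one hH).2 h1
  have h3 : (2 * ρ) ^ 2 ≤ (10 * ρ) ^ 2 := by gcongr; norm_num
  exact prod_mono (ball_subset_ball (by linarith)) (Ioo_subset_Ioo (by linarith) (by linarith)) hz

end

lemma avg_div (G : Set (Pt n)) (φ : Pt n → ℝ) (c : ℝ) : (⨍ z in G, φ z / c) = (⨍ z in G, φ z) / c := by
  rw [setAverage_eq, setAverage_eq, integral_div, smul_eq_mul, smul_eq_mul, mul_div_assoc]

section
variable {N : ℕ} {p q α L₁ L₂ aH δ : ℝ} {S : Setting n N p q α L₁ L₂ aH} {u : Pt n → Vec N} {Du : Pt n → Mat N n}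
  {z₀ : Pt n} {π ρ : ℝ}

lemma HF_int (V : VeryWeakSolution S u Du δ) :
    IntegrableOn (fun z ↦ (HDu S Du z + HFf S z) ^ δ) (cyl S.Ω S.T) := by
  have h1 : ∀ z, 0 ≤ HDu S Du z := fun z ↦ H_0 S z (mn0 _)
  have h2 : ∀ z, 0 ≤ HFf S z := fun z ↦ H_0 S z (mn0 _)
  have m1 : Measurable (HDu S Du) := H_m V.hDuM
  have m2 : Measurable (HFf S) := H_m S.hFM
  refine Integrable.mono' (V.henergy.add (F_int (S := S) V.hδ.1 V.hδ.2)) ((m1.add m2).pow_const δ).aestronglyMeasurable (ae_of_all _ fun z ↦ ?_)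
  rw [Real.norm_eq_abs, abs_of_nonneg (Real.rpow_nonneg (add_nonneg (h1 z) (h2 z)) _)]
  exact addpow V.hδ.1.le V.hδ.2.le (h1 z) (h2 z)

lemma mkNQ (V : VeryWeakSolution S u Du δ) (hqd : q * (1 - δ) ≤ 1 / 2) (h : PQHyp S Du z₀ π ρ δ) :
    ∃ v D P d Pd f, NQ (n := n) N p q δ (L₁ / 4) (2 * (L₂ + 1) + 2 * (N * n)) (16 ^ (n + 2) * Vn n) v D P d Pd f
      (fun z ↦ HDu S Du (Ts z₀ ρ (tsc S z₀ π ρ) z) / Hf S.a p q z₀ π)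
      (fun z ↦ HFf S (Ts z₀ ρ (tsc S z₀ π ρ) z) / Hf S.a p q z₀ π) := by
  have hρ := h.hρ.1
  have hπ := h.hπ
  have hπ0 : 0 < π := by linarith
  have ht := tsc_pos h
  have hH := Hpos h
  have hV := Vn_pos n
  have hp := S.hp2; have hpq := S.hpq
  have hL1 := S.hL₁
  have hL2 : 0 < L₂ := S.hL₁.trans_le S.hL₁₂
  set τ := tsc S z₀ π ρ with hτ
  set Pp := Hf S.a p q z₀ π with hPp
  set T := Ts z₀ ρ τ with hT
  set G := Gpq S.a p q z₀ π (2 * ρ) with hG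
  have hpre : T ⁻¹' G = Qc 0 2 := pre_G h 2
  have hGm : MeasurableSet G := G_m S z₀ π _
  have hGc : G ⊆ cyl S.Ω S.T := G_sub h (by norm_num) (by norm_num)
  have memG : ∀ z, z ∈ Qc (0 : Pt n) 2 ↔ T z ∈ G := fun z ↦ by rw [← hpre]; rfl
  have Tm : Measurable T := (Ts_me z₀ hρ ht).measurable
  have m0 : Measurable (fun z ↦ mnorm (Du z)) := mn_m V.hDuM
  have m1 : Measurable (HDu S Du) := H_m V.hDuM
  have m2 : Measurable (HFf S) := H_m S.hFM
  have m3 : Measurable (fun z ↦ mnorm (S.F z)) := mn_m S.hFM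
  have m4 : Measurable (fun z ↦ mnorm (S.A z (Du z))) := mn_m (A_m V.hDuM)
  have m5 := S.haM
  set Rb : Pt n → ℝ := fun z ↦ mnorm (S.F z) ^ (p - 1) + S.a z * mnorm (S.F z) ^ (q - 1) with hRb
  have Rb0 : ∀ z, 0 ≤ Rb z := fun z ↦ add_nonneg (Real.rpow_nonneg (mn0 _) _)
    (mul_nonneg (S.ha0 z) (Real.rpow_nonneg (mn0 _) _))
  have m6 : Measurable Rb := by fun_prop
  have h1 : ∀ z, 0 ≤ HDu S Du z := fun z ↦ H_0 S z (mn0 _)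
  have h2 : ∀ z, 0 ≤ HFf S z := fun z ↦ H_0 S z (mn0 _)
  set k : ℝ := π / Pp with hk
  have hk0 : 0 < k := by positivity
  have eD : (π * ρ)⁻¹ * ρ = π⁻¹ := by field_simp
  have eP : (π * ρ)⁻¹ * (τ / ρ) = k := by rw [hk, hτ]; unfold tsc; rw [← hPp]; field_simp
  have W : ∀ i, WE (Qc 0 2) (fun z ↦ (π * ρ)⁻¹ * G.indicator (fun z ↦ u z i) (T z))
      (fun j z ↦ π⁻¹ * G.indicator (fun z ↦ Du z i j) (T z))
      (fun j z ↦ k * G.indicator (fun z ↦ S.A z (Du z) i j - rhsF S z i j) (T z)) 0 := by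
    intro i
    have := (we_of V hqd hGm hGc i).scale z₀ hρ ht (π * ρ)⁻¹
    simp only [eD, Pi.zero_apply, mul_zero] at this
    rw [eP, hpre] at this
    exact this

  have alg₉ : ∀ {z : Pt n}, T z ∈ G → ∀ x : ℝ, 0 ≤ x →
      k * (x ^ (p - 1) + S.a (T z) * x ^ (q - 1)) ≤ 2 * ((π⁻¹ * x) ^ (p - 1) + (π⁻¹ * x) ^ (q - 1)) ∧
      (π⁻¹ * x) ^ q / 4 ≤ Hf S.a p q (T z) x / Pp ∧ Hf S.a p q (T z) x / Pp ≤ 3 * ((π⁻¹ * x) ^ p + (π⁻¹ * x) ^ q) := by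
    intro z hz x hx
    have c := comp h hz
    have := alg hπ h.hcase c.1 c.2 (y := π⁻¹ * x) (by positivity)
    rwa [mul_inv_cancel_left₀ hπ0.ne'] at this
  have hgr : ∀ᵐ z, T z ∈ cyl S.Ω S.T → ∀ ξ : Mat N n,
      mnorm (S.A (T z) ξ) ≤ L₂ * (mnorm ξ ^ (p - 1) + S.a (T z) * mnorm ξ ^ (q - 1)) :=
    Ts_ae z₀ hρ ht ((ae_restrict_iff' (cyl_m S)).1 S.hAgrow)
  have hcr : ∀ᵐ z, T z ∈ cyl S.Ω S.T → ∀ ξ : Mat N n,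
      L₁ * (mnorm ξ ^ p + S.a (T z) * mnorm ξ ^ q) ≤ mdot (S.A (T z) ξ) ξ :=
    Ts_ae z₀ hρ ht ((ae_restrict_iff' (cyl_m S)).1 S.hAcoer)
  have hNn : (0:ℝ) ≤ N * n := by positivity
  refine ⟨_, _, _, fun z ↦ π⁻¹ * G.indicator (fun z ↦ mnorm (Du z)) (T z),
    fun z ↦ k * G.indicator (fun z ↦ mnorm (S.A z (Du z)) + Rb z) (T z),
    fun z ↦ π⁻¹ * mnorm (S.F (T z)), ⟨W, ?_, ?_, ?_, ?_, ?_, ?_, ?_, ?_, ?_, ?_, ?_, ?_, ?_, ?_, ?_, ?_, ?_, ?_, ?_, ?_, ?_, ?_⟩⟩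
  · intro i
    have := ((measurable_pi_apply i).comp V.huM).indicator hGm
    exact (this.comp Tm).const_mul _
  · exact ((m0.indicator hGm).comp Tm).const_mul _
  · exact (((m4.add m6).indicator hGm).comp Tm).const_mul _
  · exact (m3.comp Tm).const_mul _
  · exact (m1.comp Tm).div_const _
  · exact (m2.comp Tm).div_const _
  · exact fun z ↦ mul_nonneg (by positivity) (indicator_nonneg (fun _ _ ↦ mn0 _) _)
  · exact fun z ↦ mul_nonneg hk0.le (indicator_nonneg (fun _ _ ↦ add_nonneg (mn0 _) (Rb0 _)) _)
  · exact fun z ↦ mul_nonneg (by positivity) (mn0 _)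
  · exact fun z ↦ div_nonneg (h1 _) hH.le
  · exact fun z ↦ div_nonneg (h2 _) hH.le
  · intro z hz
    rw [memG] at hz
    simp [hz]
  · intro z hz
    rw [memG] at hz
    simp [hz]
  · intro i j
    refine ae_of_all _ fun z ↦ ?_
    rw [abs_mul, abs_of_pos (by positivity)]
    refine mul_le_mul_of_nonneg_left ?_ (by positivity)
    by_cases hz : T z ∈ G
    · simp only [indicator_of_mem hz]; exact mn_entry _ i j
    · simp [hz]
  · intro i j
    refine ae_of_all _ fun z ↦ ?_
    rw [abs_mul, abs_of_pos hk0]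
    refine mul_le_mul_of_nonneg_left ?_ hk0.le
    by_cases hz : T z ∈ G
    · simp only [indicator_of_mem hz]
      exact (abs_sub _ _).trans (add_le_add (mn_entry _ i j) (R_bd S _ i j))
    · simp [hz]
  · intro z hz
    rw [memG] at hz
    simp only [indicator_of_mem hz]
    exact (alg₉ hz _ (mn0 _)).2.1
  · intro z hz
    rw [memG] at hz
    simp only [indicator_of_mem hz]
    exact (alg₉ hz _ (mn0 _)).2.2
  · intro z hz
    rw [memG] at hz
    exact (alg₉ hz _ (mn0 _)).2.1
  · filter_upwards [hgr] with z hz hzQ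
    rw [memG] at hzQ
    simp only [indicator_of_mem hzQ]
    have a1 := (alg₉ hzQ _ (mn0 (Du (T z)))).1
    have a2 := (alg₉ hzQ _ (mn0 (S.F (T z)))).1
    have a3 := mul_le_mul_of_nonneg_left (hz (hGc hzQ) (Du (T z))) hk0.le
    have a4 := mul_le_mul_of_nonneg_left a1 hL2.le
    set X := (π⁻¹ * mnorm (Du (T z))) ^ (p - 1) + (π⁻¹ * mnorm (Du (T z))) ^ (q - 1) with hX
    set Y := (π⁻¹ * mnorm (S.F (T z))) ^ (p - 1) + (π⁻¹ * mnorm (S.F (T z))) ^ (q - 1) with hY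
    have X0 : 0 ≤ X := by have := mn0 (Du (T z)); positivity
    have Y0 : 0 ≤ Y := by have := mn0 (S.F (T z)); positivity
    have a5 := mul_nonneg hL2.le Y0
    have a6 := mul_nonneg hNn X0
    have a7 := mul_nonneg hNn Y0
    simp only [hRb]
    rw [mul_add k]
    linarith
  · filter_upwards [hcr] with z hz hzQ
    rw [memG] at hzQ
    simp only [indicator_of_mem hzQ]
    have a0 := (alg₉ hzQ _ (mn0 (Du (T z)))).2.1
    have a2 := (alg₉ hzQ _ (mn0 (S.F (T z)))).1
    have a3 := hz (hGc hzQ) (Du (T z))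
    set Y := (π⁻¹ * mnorm (S.F (T z))) ^ (p - 1) + (π⁻¹ * mnorm (S.F (T z))) ^ (q - 1) with hY
    have Y0 : 0 ≤ Y := by have := mn0 (S.F (T z)); positivity
    set x := π⁻¹ * mnorm (Du (T z)) with hx
    have x0 : 0 ≤ x := by have := mn0 (Du (T z)); positivity
    have e1 : ∑ i, ∑ j, k * (S.A (T z) (Du (T z)) i j - rhsF S (T z) i j) * (π⁻¹ * Du (T z) i j) =
        Pp⁻¹ * mdot (S.A (T z) (Du (T z))) (Du (T z)) - ∑ i, ∑ j, k * rhsF S (T z) i j * (π⁻¹ * Du (T z) i j) := by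
      unfold mdot
      simp only [Finset.mul_sum, ← Finset.sum_sub_distrib]
      refine Finset.sum_congr rfl fun i _ ↦ Finset.sum_congr rfl fun j _ ↦ ?_
      rw [hk]; field_simp
    have e2 : ∑ i, ∑ j, k * rhsF S (T z) i j * (π⁻¹ * Du (T z) i j) ≤ N * (n * (k * Rb (T z) * x)) := by
      refine (le_abs_self _).trans (sum_bd _ _ fun i ↦ sum_bd _ _ fun j ↦ ?_)
      rw [abs_mul, abs_mul, abs_mul, abs_of_pos hk0, abs_of_pos (inv_pos.2 hπ0)]
      refine mul_le_mul (mul_le_mul_of_nonneg_left (R_bd S _ i j) hk0.le)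
        (mul_le_mul_of_nonneg_left (mn_entry _ i j) (inv_pos.2 hπ0).le) (by positivity) (mul_nonneg hk0.le (Rb0 _))
    rw [e1]
    have e3 := mul_le_mul_of_nonneg_left a3 (inv_pos.2 hH).le
    have e4 : Pp⁻¹ * (L₁ * (mnorm (Du (T z)) ^ p + S.a (T z) * mnorm (Du (T z)) ^ q)) =
        L₁ * (Hf S.a p q (T z) (mnorm (Du (T z))) / Pp) := by unfold Hf; ring
    have e5 := mul_le_mul_of_nonneg_left a0 hL1.le
    have e6 := mul_le_mul_of_nonneg_left (mul_le_mul_of_nonneg_right a2 x0) hNn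
    have e7 := mul_nonneg (mul_nonneg hL2.le Y0) x0
    have e8 := mul_nonneg Y0 x0
    have e9 : (N:ℝ) * (n * (k * Rb (T z) * x)) = N * n * (k * Rb (T z) * x) := by ring
    rw [e9] at e2
    have e10 : (N:ℝ) * n * (k * Rb (T z) * x) ≤ N * n * (2 * Y * x) := e6
    linarith
  · have hi := (HF_int V).div_const (Pp ^ δ)
    have := avg h (r := 16) (by norm_num) le_rfl (φ := fun z ↦ (HDu S Du z + HFf S z) ^ δ / Pp ^ δ)
      (fun z ↦ div_nonneg (Real.rpow_nonneg (add_nonneg (h1 z) (h2 z)) _) (by positivity)) hi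
    rw [avg_div] at this
    calc _ ≤ ∫⁻ z in Qc (0 : Pt n) 16, ofReal ((HDu S Du (T z) + HFf S (T z)) ^ δ / Pp ^ δ) := by
          refine (lintegral_mono_set (?_ : Qc (0 : Pt n) 2 ⊆ Qc 0 16)).trans (lintegral_mono fun z ↦ ?_)
          · exact Qc_mono (by norm_num) (by simp [pd]; norm_num)
          · refine ENNReal.ofReal_le_ofReal ?_
            rw [Real.div_rpow (h1 _) hH.le]
            refine div_le_div_of_nonneg_right (Real.rpow_le_rpow (h1 _) (by linarith [h2 (T z)]) V.hδ.1.le) (by positivity)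
      _ ≤ _ := by
          rw [this]
          refine ENNReal.ofReal_le_ofReal ?_
          exact mul_le_of_le_one_right (by positivity) ((div_le_one (by positivity)).2 h.hup)
  · have hi := (HF_int V).div_const (Pp ^ δ)
    have := avg h (r := 1) (by norm_num) (by norm_num) (φ := fun z ↦ (HDu S Du z + HFf S z) ^ δ / Pp ^ δ)
      (fun z ↦ div_nonneg (Real.rpow_nonneg (add_nonneg (h1 z) (h2 z)) _) (by positivity)) hi
    rw [avg_div, one_mul, one_pow, one_mul] at this
    calc _ ≤ ∫⁻ z in Qc (0 : Pt n) 1, ofReal ((HDu S Du (T z) + HFf S (T z)) ^ δ / Pp ^ δ) := by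
          rw [this]
          refine ENNReal.ofReal_le_ofReal ?_
          exact le_mul_of_one_le_right hV.le ((one_le_div (by positivity)).2 h.hlow)
      _ = _ := by
          refine lintegral_congr fun z ↦ ?_
          rw [← add_div, Real.div_rpow (add_nonneg (h1 _) (h2 _)) hH.le]

theorem dich2 (n N : ℕ) {p q α L₁ L₂ aH : ℝ} (hp : 2 < p) (hpq : p < q) (hL₁ : 0 < L₁) (hL : L₁ ≤ L₂) :
    ∃ κ₀ c₉ : ℝ, 0 < κ₀ ∧ κ₀ ≤ 1 / 2 ∧ 0 < c₉ ∧ ∀ (S : Setting n N p q α L₁ L₂ aH) (u : Pt n → Vec N)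
      (Du : Pt n → Mat N n) (δ : ℝ), q * (1 - δ) ≤ κ₀ → VeryWeakSolution S u Du δ →
      ∀ z₀ π ρ, PQHyp S Du z₀ π ρ δ →
      c₉ * Hf S.a p q z₀ π ^ ((q - 1) / q) ≤ (⨍ z in Gpq S.a p q z₀ π (2 * ρ), HDu S Du z ^ ((q - 1) / q)) ∨
      c₉ * Hf S.a p q z₀ π ^ δ ≤ ⨍ z in Gpq S.a p q z₀ π (2 * ρ), HFf S z ^ δ := by
  have hV := Vn_pos n
  have hNn : (0:ℝ) ≤ N * n := by positivity
  obtain ⟨κ₀, c, hk, hk2, hc, H⟩ := dich n N (m := L₁ / 4) (L := 2 * (L₂ + 1) + 2 * (N * n)) (C := 16 ^ (n + 2) * Vn n)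
    hp hpq (by positivity) (by linarith) (by positivity)
  refine ⟨κ₀, c / (2 ^ (n + 2) * Vn n), hk, hk2, by positivity, ?_⟩
  intro S u Du δ hqd V z₀ π ρ h
  obtain ⟨v, D, P, d, Pd, f, hNQ⟩ := mkNQ V (hqd.trans hk2) h
  have hH := Hpos h
  have h1 : ∀ z, 0 ≤ HDu S Du z := fun z ↦ H_0 S z (mn0 _)
  have h2 : ∀ z, 0 ≤ HFf S z := fun z ↦ H_0 S z (mn0 _)
  have hq0 : 0 < q := by linarith
  have tr : ∀ (t : ℝ) (X : Pt n → ℝ), (∀ z, 0 ≤ X z) → IntegrableOn (fun z ↦ X z ^ t) (cyl S.Ω S.T) →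
      ofReal c ≤ (∫⁻ z in Qc (0 : Pt n) 2, ofReal ((X (Ts z₀ ρ (tsc S z₀ π ρ) z) / Hf S.a p q z₀ π) ^ t)) →
      c / (2 ^ (n + 2) * Vn n) * Hf S.a p q z₀ π ^ t ≤ ⨍ z in Gpq S.a p q z₀ π (2 * ρ), X z ^ t := by
    intro t X hX hi hle
    have e := avg h (r := 2) (by norm_num) (by norm_num) (φ := fun z ↦ X z ^ t / Hf S.a p q z₀ π ^ t)
      (fun z ↦ div_nonneg (Real.rpow_nonneg (hX z) _) (by positivity)) (hi.div_const _)
    simp only [← Real.div_rpow (hX _) hH.le] at e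
    rw [e] at hle
    simp only [Real.div_rpow (hX _) hH.le] at hle
    rw [avg_div] at hle
    have h5 : 0 < 2 ^ (n + 2) * Vn n * ((⨍ z in Gpq S.a p q z₀ π (2 * ρ), X z ^ t) / Hf S.a p q z₀ π ^ t) :=
      ENNReal.ofReal_pos.1 ((ENNReal.ofReal_pos.2 hc).trans_le hle)
    rw [ENNReal.ofReal_le_ofReal_iff h5.le] at hle
    rw [div_mul_eq_mul_div, div_le_iff₀ (by positivity)]
    rw [← mul_div_assoc, le_div_iff₀ (by positivity)] at hle
    linarith
  have hθδ : (q - 1) / q ≤ δ := by rw [div_le_iff₀ hq0]; linarith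
  refine (H δ V.hδ.2 hqd v D P d Pd f _ _ hNQ).imp (tr _ _ h1 ?_) (tr _ _ h2 (F_int V.hδ.1 V.hδ.2))
  exact pw_int (cyl_fin S) (cyl_m S) (div_nonneg (by linarith) hq0.le) hθδ (H_m V.hDuM) h1 V.henergy

end

lemma lev {G U : Set (Pt n)} (hG : MeasurableSet G) (hU : MeasurableSet U) (hGU : G ⊆ U) (hv : volume G ≠ ∞)
    {X : Pt n → ℝ} {t Λ : ℝ} (ht : 0 ≤ t) (hX : Measurable X) (h0 : ∀ z, 0 ≤ X z) (hΛ : 0 ≤ Λ)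
    (hi : IntegrableOn (fun z ↦ X z ^ t) G) :
    ∫ z in G, X z ^ t ≤ (∫ z in G ∩ {z ∈ U | Λ < X z}, X z ^ t) + Λ ^ t * volume.real G := by
  have hE : MeasurableSet {z ∈ U | Λ < X z} := hU.inter (measurableSet_lt measurable_const hX)
  rw [← integral_inter_add_diff hE hi]
  have h1 : ∫ z in G \ {z ∈ U | Λ < X z}, X z ^ t ≤ ∫ z in G \ {z ∈ U | Λ < X z}, Λ ^ t := by
    refine setIntegral_mono_on (hi.mono_set diff_subset)
      (integrableOn_const (ne_top_of_le_ne_top hv (measure_mono diff_subset))) (hG.diff hE) fun z hz ↦ ?_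
    have : X z ≤ Λ := by
      by_contra hc
      exact hz.2 ⟨hGU hz.1, not_le.1 hc⟩
    exact Real.rpow_le_rpow (h0 z) this ht
  rw [setIntegral_const, smul_eq_mul, mul_comm] at h1
  have h2 : volume.real (G \ {z ∈ U | Λ < X z}) ≤ volume.real G := measureReal_mono diff_subset hv
  have h3 := mul_le_mul_of_nonneg_left h2 (Real.rpow_nonneg hΛ t)
  linarith

lemma lev2 {G U : Set (Pt n)} (hG : MeasurableSet G) (hU : MeasurableSet U) (hGU : G ⊆ U) (hv : volume G ≠ ∞)
    (hv0 : 0 < volume.real G)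
    {X : Pt n → ℝ} {t c c₉ Λ : ℝ} (ht : 1 / 2 ≤ t) (hX : Measurable X) (h0 : ∀ z, 0 ≤ X z) (hΛ : 0 < Λ)
    (hc₉ : 0 < c₉) (hc : 4 / c₉ ^ 2 ≤ c) (hc1 : 1 ≤ c)
    (hi : IntegrableOn (fun z ↦ X z ^ t) G) (hle : c₉ * Λ ^ t ≤ ⨍ z in G, X z ^ t) :
    c₉ / 2 * Λ ^ t * volume.real G ≤ ∫ z in G ∩ {z ∈ U | c⁻¹ * Λ < X z}, X z ^ t := by
  have hc0 : 0 < c := by linarith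
  have h1 := lev hG hU hGU hv (by linarith) hX h0 (by positivity : 0 ≤ c⁻¹ * Λ) hi
  rw [setAverage_eq, smul_eq_mul, ← div_eq_inv_mul, le_div_iff₀ hv0] at hle
  have h2 : (c⁻¹ * Λ) ^ t ≤ c₉ / 2 * Λ ^ t := by
    rw [Real.mul_rpow (by positivity) hΛ.le]
    refine mul_le_mul_of_nonneg_right ?_ (by positivity)
    calc c⁻¹ ^ t ≤ c⁻¹ ^ (1 / 2 : ℝ) :=
          Real.rpow_le_rpow_of_exponent_ge (by positivity) (inv_le_one_of_one_le₀ hc1) ht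
      _ ≤ ((c₉ / 2) ^ 2) ^ (1 / 2 : ℝ) := by
          refine Real.rpow_le_rpow (by positivity) ?_ (by norm_num)
          rw [inv_le_comm₀ hc0 (by positivity)]
          calc ((c₉ / 2) ^ 2)⁻¹ = 4 / c₉ ^ 2 := by field_simp; norm_num
            _ ≤ c := hc
      _ = c₉ / 2 := by rw [← Real.sqrt_eq_rpow, Real.sqrt_sq (by positivity)]
  have h3 := mul_le_mul_of_nonneg_right h2 hv0.le
  linarith

end RH

/-- Lemma 4.9: reverse Hölder inequality in the `(p,q)`-intrinsic case. -/
theorem reverse_holder_pq (n N : ℕ) (p q α L₁ L₂ aH : ℝ) :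
    ∃ c δ₁ δ₂ θ₀ : ℝ, 0 < c ∧ δ₁ ∈ Set.Ioo (0 : ℝ) 1 ∧ δ₂ ∈ Set.Ioo δ₁ 1 ∧
      0 < 2 - q * (1 - δ₂) ∧ θ₀ ∈ Set.Ioo (0 : ℝ) δ₂ ∧
      ∀ (S : Setting n N p q α L₁ L₂ aH) (u : Pt n → Vec N) (Du : Pt n → Mat N n) (δ : ℝ),
        δ ∈ Set.Ioo δ₂ 1 → VeryWeakSolution S u Du δ →
        ∀ (z₀ : Pt n) (π ρ : ℝ), PQHyp S Du z₀ π ρ δ →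
          PiBig S u Du z₀ π ρ →
          (Hf S.a p q z₀ π ^ δ
              ≤ c * (⨍ z in Gpq S.a p q z₀ π (2 * ρ), HDu S Du z ^ θ₀) ^ (δ / θ₀)
                + c * (⨍ z in Gpq S.a p q z₀ π (2 * ρ), HFf S z ^ δ))
          ∧ (∫ z in Gpq S.a p q z₀ π (16 * ρ), HDu S Du z ^ δ)
              ≤ c * Hf S.a p q z₀ π ^ (δ - θ₀)
                  * (∫ z in Gpq S.a p q z₀ π (2 * ρ) ∩ PsiSet S Du (c⁻¹ * Hf S.a p q z₀ π),
                      HDu S Du z ^ θ₀)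
                + c * (∫ z in Gpq S.a p q z₀ π (2 * ρ) ∩ PhiSet S (c⁻¹ * Hf S.a p q z₀ π),
                      HFf S z ^ δ) := by
  by_cases hpar : 2 < p ∧ p < q ∧ 0 < L₁ ∧ L₁ ≤ L₂
  swap
  · have hq1 : 0 < 2 * (|q| + 1) := by positivity
    have hx : 1 / (2 * (|q| + 1)) ≤ 1 / 2 := by
      refine one_div_le_one_div_of_le (by norm_num) ?_
      have := abs_nonneg q; linarith
    have hx0 : 0 < 1 / (2 * (|q| + 1)) := by positivity
    refine ⟨1, 1 / 4, 1 - 1 / (2 * (|q| + 1)), 1 / 4, one_pos, ⟨by norm_num, by norm_num⟩, ⟨by linarith, by linarith⟩, ?_,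
      ⟨by norm_num, by linarith⟩, ?_⟩
    · have : q * (1 - (1 - 1 / (2 * (|q| + 1)))) ≤ 1 := by
        rw [sub_sub_cancel, mul_one_div, div_le_one hq1]
        have := abs_nonneg q; have := le_abs_self q; linarith
      linarith
    · intro S
      exact absurd ⟨S.hp2, S.hpq, S.hL₁, S.hL₁₂⟩ hpar
  obtain ⟨hp, hpq, hL, hL'⟩ := hpar
  obtain ⟨κ₀, c₁, hk, hk2, hc₁, H⟩ := RH.dich2 n N (α := α) (aH := aH) hp hpq hL hL'
  have hq0 : 0 < q := by linarith
  set c₉ : ℝ := min c₁ 1 with hc₉d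
  have hc₉ : 0 < c₉ := by positivity
  have hc₉1 : c₉ ≤ 1 := min_le_right _ _
  have hc₉c : c₉ ≤ c₁ := min_le_left _ _
  set E : ℝ := 8 ^ (n + 2) with hE
  have hE1 : 1 ≤ E := one_le_pow₀ (by norm_num)
  set c : ℝ := 4 * E / c₉ ^ 2 with hcd
  set θ : ℝ := (q - 1) / q with hθ
  have hθ2 : 1 / 2 ≤ θ := by rw [hθ, le_div_iff₀ hq0]; linarith
  have hκq : κ₀ / q ≤ 1 / 4 := by rw [div_le_iff₀ hq0]; linarith
  have hκq0 : 0 < κ₀ / q := by positivity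
  have hqk : q * (κ₀ / q) = κ₀ := mul_div_cancel₀ _ hq0.ne'
  have hc0 : 0 < c := by positivity
  have hcc : c * c₉ ^ 2 = 4 * E := by rw [hcd]; field_simp
  have hsq : c₉ ^ 2 ≤ c₉ := by rw [sq]; exact mul_le_of_le_one_left hc₉.le hc₉1
  have hc4 : 4 / c₉ ^ 2 ≤ c := by rw [hcd]; gcongr; linarith
  have hcE : 2 * E ≤ c * c₉ := by
    have := mul_le_mul_of_nonneg_left hsq hc0.le
    linarith
  have hc1 : 1 ≤ c := by
    have := mul_le_of_le_one_right hc0.le hc₉1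
    linarith
  refine ⟨c, 1 / 4, 1 - κ₀ / q, θ, hc0, ⟨by norm_num, by norm_num⟩, ⟨by linarith, by linarith⟩, ?_, ⟨by linarith, ?_⟩, ?_⟩
  · rw [sub_sub_cancel, hqk]; linarith
  · have : θ = 1 - 1 / q := by rw [hθ, sub_div, div_self hq0.ne']
    rw [this]
    have : κ₀ / q < 1 / q := by gcongr; linarith
    linarith
  intro S u Du δ hδ V z₀ π ρ h _
  have hqδ : q * (1 - δ) ≤ κ₀ := by
    have := mul_le_mul_of_nonneg_left (by linarith [hδ.1] : 1 - δ ≤ κ₀ / q) hq0.le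
    linarith
  have hδ1 : δ < 1 := hδ.2
  have hθδ : θ ≤ δ := by rw [hθ, div_le_iff₀ hq0]; linarith
  have hP := RH.Hpos h
  have h1 : ∀ z, 0 ≤ HDu S Du z := fun z ↦ RH.H_0 S z (RH.mn0 _)
  have h2 : ∀ z, 0 ≤ HFf S z := fun z ↦ RH.H_0 S z (RH.mn0 _)
  have m1 : Measurable (HDu S Du) := RH.H_m V.hDuM
  have m2 : Measurable (HFf S) := RH.H_m S.hFM
  have key := H S u Du δ hqδ V z₀ π ρ h
  have hG2 := RH.G_sub h (r := 2) (by norm_num) (by norm_num)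
  have hGm := RH.G_m S z₀ π (2 * ρ)
  have v2 := RH.G_vol h (r := 2) (by norm_num)
  have v16 := RH.G_vol h (r := 16) (by norm_num)
  have ht := RH.tsc_pos h
  have hVn := RH.Vn_pos n
  have hρ := h.hρ.1
  set Pp := Hf S.a p q z₀ π with hPp
  set G := Gpq S.a p q z₀ π (2 * ρ) with hG
  have hvp : 0 < volume.real G := by rw [v2]; positivity
  have hvf : volume G ≠ ∞ := ne_top_of_le_ne_top (RH.cyl_fin S) (measure_mono hG2)
  have hv16 : volume.real (Gpq S.a p q z₀ π (16 * ρ)) = E * volume.real G := by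
    rw [v16, v2, hE, show (16:ℝ) = 8 * 2 by norm_num, mul_pow]; ring
  have i1 : IntegrableOn (fun z ↦ HDu S Du z ^ θ) G :=
    (RH.pw_int (RH.cyl_fin S) (RH.cyl_m S) (by linarith) hθδ m1 h1 V.henergy).mono_set hG2
  have i2 : IntegrableOn (fun z ↦ HFf S z ^ δ) G := (RH.F_int V.hδ.1 V.hδ.2).mono_set hG2
  have pθ : 0 < Pp ^ θ := by positivity
  have pδ : 0 < Pp ^ δ := by positivity
  have key₉ : c₉ * Pp ^ θ ≤ (⨍ z in G, HDu S Du z ^ θ) ∨ c₉ * Pp ^ δ ≤ ⨍ z in G, HFf S z ^ δ :=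
    key.imp (le_trans (by gcongr)) (le_trans (by gcongr))
  have av0 : 0 ≤ ⨍ z in G, HDu S Du z ^ θ := by
    rw [setAverage_eq]; exact mul_nonneg (by positivity) (integral_nonneg fun z ↦ Real.rpow_nonneg (h1 z) _)
  have av1 : 0 ≤ ⨍ z in G, HFf S z ^ δ := by
    rw [setAverage_eq]; exact mul_nonneg (by positivity) (integral_nonneg fun z ↦ Real.rpow_nonneg (h2 z) _)
  constructor
  · rcases key₉ with hk₉ | hk₉
    · have e1 : (c₉ * Pp ^ θ) ^ (δ / θ) ≤ (⨍ z in G, HDu S Du z ^ θ) ^ (δ / θ) :=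
        Real.rpow_le_rpow (by positivity) hk₉ (div_nonneg (by linarith) (by linarith))
      rw [Real.mul_rpow hc₉.le pθ.le, ← Real.rpow_mul hP.le, mul_div_cancel₀ _ (by linarith : θ ≠ 0)] at e1
      have e2 : c₉ ^ 2 ≤ c₉ ^ (δ / θ) := by
        rw [← Real.rpow_two]
        refine Real.rpow_le_rpow_of_exponent_ge hc₉ hc₉1 ?_
        rw [div_le_iff₀ (by linarith)]; linarith
      have e3 := mul_le_mul_of_nonneg_left ((mul_le_mul_of_nonneg_right e2 pδ.le).trans e1) hc0.le
      have e4 : c * (c₉ ^ 2 * Pp ^ δ) = 4 * E * Pp ^ δ := by rw [← hcc]; ring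
      have e5 : 1 * Pp ^ δ ≤ 4 * E * Pp ^ δ := mul_le_mul_of_nonneg_right (by linarith) pδ.le
      have e6 := mul_nonneg hc0.le av1
      linarith
    · have e3 := mul_le_mul_of_nonneg_left hk₉ hc0.le
      have e5 : 1 * Pp ^ δ ≤ c * c₉ * Pp ^ δ := mul_le_mul_of_nonneg_right (by linarith) pδ.le
      have e6 := mul_nonneg hc0.le (Real.rpow_nonneg av0 (δ / θ))
      linarith
  · have hL : ∫ z in Gpq S.a p q z₀ π (16 * ρ), HDu S Du z ^ δ ≤ E * volume.real G * Pp ^ δ := by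
      have hup := h.hup
      have e16 : 0 < E * volume.real G := by positivity
      rw [setAverage_eq, smul_eq_mul, hv16, ← div_eq_inv_mul, div_le_iff₀ e16] at hup
      refine le_trans ?_ (hup.trans (mul_comm _ _).le)
      refine integral_mono (V.henergy.mono_set h.hsub) ((RH.HF_int V).mono_set h.hsub) fun z ↦ ?_
      exact Real.rpow_le_rpow (h1 z) (by linarith [h2 z]) V.hδ.1.le
    have X0 : 0 ≤ ∫ z in G ∩ PsiSet S Du (c⁻¹ * Pp), HDu S Du z ^ θ := integral_nonneg fun z ↦ Real.rpow_nonneg (h1 z) _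
    have Y0 : 0 ≤ ∫ z in G ∩ PhiSet S (c⁻¹ * Pp), HFf S z ^ δ := integral_nonneg fun z ↦ Real.rpow_nonneg (h2 z) _
    have e5 : E * (volume.real G * Pp ^ δ) ≤ c * c₉ / 2 * (volume.real G * Pp ^ δ) :=
      mul_le_mul_of_nonneg_right (by linarith) (by positivity)
    have pd0 : 0 < Pp ^ (δ - θ) := by positivity
    rcases key₉ with hk₉ | hk₉
    · have f1 : c₉ / 2 * Pp ^ θ * volume.real G ≤ ∫ z in G ∩ PsiSet S Du (c⁻¹ * Pp), HDu S Du z ^ θ :=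
        RH.lev2 hGm (RH.cyl_m S) hG2 hvf hvp hθ2 m1 h1 hP hc₉ hc4 hc1 i1 hk₉
      have f2 := mul_le_mul_of_nonneg_left f1 (mul_pos hc0 pd0).le
      have f3 : c * Pp ^ (δ - θ) * (c₉ / 2 * Pp ^ θ * volume.real G) = c * c₉ / 2 * (volume.real G * Pp ^ δ) := by
        have : Pp ^ δ = Pp ^ (δ - θ) * Pp ^ θ := by rw [← Real.rpow_add hP]; ring_nf
        rw [this]; ring
      have f4 := mul_nonneg hc0.le Y0
      linarith
    · have f1 : c₉ / 2 * Pp ^ δ * volume.real G ≤ ∫ z in G ∩ PhiSet S (c⁻¹ * Pp), HFf S z ^ δ :=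
        RH.lev2 hGm (RH.cyl_m S) hG2 hvf hvp (hθ2.trans hθδ) m2 h2 hP hc₉ hc4 hc1 i2 hk₉
      have f2 := mul_le_mul_of_nonneg_left f1 hc0.le
      have f4 := mul_nonneg (mul_pos hc0 pd0).le X0
      linarith
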